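/- For every ε > 0 there exists C > 0 such that for every δ > 0 there exists n₀ ∈ ℕ with the following property: for all n ≥ n₀ and every d with C·log n ≤ d ≤ n−1 and dn even, there exists a probability measure μ on triples (G₁, G₂, G₃) of graphs on [n] such that the first marginal of μ is the law of G(n, (1−ε)d/n), the second marginal is the uniform distribution on 𝒦_d(n), the third marginal is the law of G(n, (1+ε)d/n), and μ({(G₁,G₂,G₃) : G₁ ⊆ G₂ ⊆ G₃}) ≥ 1 − δ. (Theorem 1.1, the sandwich conjecture.) -/

import Mathlib

open scoped Classical ENNReal

noncomputable section

namespace Sandwich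

variable {n : ℕ}

/-- The degree of the vertex `v` in the graph `G`. -/
def deg (G : SimpleGraph (Fin n)) (v : Fin n) : ℕ := Nat.card (G.neighborSet v)

/-- `G` is a `d`-regular graph. -/
def IsRegularGraph (G : SimpleGraph (Fin n)) (d : ℕ) : Prop := ∀ v, deg G v = d

/-- The number of edges of `G`. -/
def edgeCount (G : SimpleGraph (Fin n)) : ℕ := G.edgeSet.ncard

/-- The probability of the event `P` under the probability mass function `μ`. -/
def prEvent {α : Type*} (μ : PMF α) (P : α → Prop) : ℝ≥0∞ := ∑' a, if P a then μ a else 0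

/-- `μ` is the uniform distribution on the set `S`. -/
def IsUniformOn {α : Type*} (μ : PMF α) (S : Set α) : Prop :=
  ∀ a, μ a = if a ∈ S then (S.ncard : ℝ≥0∞)⁻¹ else 0

/-- `P` lists the `k+1` vertices of a `(G₁,G₂)`-alternating path of length `k`: the vertices
are distinct and consecutive vertices are joined by an edge of `G₁` (for steps of even index)
or of `G₂` (for steps of odd index). -/
def IsAltSeq (G₁ G₂ : SimpleGraph (Fin n)) (k : ℕ) (P : Fin (k + 1) → Fin n) : Prop :=
  Function.Injective P ∧
    ∀ i : Fin k, if (i : ℕ) % 2 = 0 then G₁.Adj (P i.castSucc) (P i.succ)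
      else G₂.Adj (P i.castSucc) (P i.succ)

/-- The number of `(G₁,G₂)`-alternating `x,y`-paths of length `k` with no internal vertex
in `Z`. -/
def altPathCount (G₁ G₂ : SimpleGraph (Fin n)) (k : ℕ) (x y : Fin n) (Z : Set (Fin n)) : ℕ :=
  Nat.card {P : Fin (k + 1) → Fin n // IsAltSeq G₁ G₂ k P ∧ P 0 = x ∧ P (Fin.last k) = y ∧
    ∀ i : Fin (k + 1), i ≠ 0 → i ≠ Fin.last k → P i ∉ Z}

/-- The number of `(G₁,G₂)`-alternating paths of length `k` starting at `x`. -/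
def altStartCount (G₁ G₂ : SimpleGraph (Fin n)) (k : ℕ) (x : Fin n) : ℕ :=
  Nat.card {P : Fin (k + 1) → Fin n // IsAltSeq G₁ G₂ k P ∧ P 0 = x}

/-- The external neighbourhood `N_G(U)` of a set of vertices `U`. -/
def nbhd (G : SimpleGraph (Fin n)) (U : Set (Fin n)) : Set (Fin n) :=
  {v | v ∉ U ∧ ∃ u ∈ U, G.Adj u v}

/-- `e_G(U)`, the number of edges of `G` with both endpoints in `U`. -/
def edgesWithin (G : SimpleGraph (Fin n)) (U : Set (Fin n)) : ℕ :=
  {e ∈ G.edgeSet | ∀ v ∈ e, v ∈ U}.ncard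

/-- `e_G(U,V) = |{(u,v) : u ∈ U, v ∈ V, uv ∈ E(G)}|`. -/
def edgesBetween (G : SimpleGraph (Fin n)) (U V : Set (Fin n)) : ℕ :=
  {p : Fin n × Fin n | p.1 ∈ U ∧ p.2 ∈ V ∧ G.Adj p.1 p.2}.ncard

/-- `|E_{≥2,G}(U)|`, the number of edges `xy ∈ E(G)` with `x ∈ U`, `y ∉ U` such that some
`x' ∈ U ∖ {x}` also satisfies `x'y ∈ E(G)`. -/
def E2count (G : SimpleGraph (Fin n)) (U : Set (Fin n)) : ℕ :=
  {e : Sym2 (Fin n) | e ∈ G.edgeSet ∧ ∃ x y, e = s(x, y) ∧ x ∈ U ∧ y ∉ U ∧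
    ∃ x' ∈ U, x' ≠ x ∧ G.Adj x' y}.ncard

/-- `Σ_{u ∈ N_{F∖K}(v)} Σ_{u' ∈ N_K(u)} d_{F∖K}(u')`. -/
def doubleDegSum (F K : SimpleGraph (Fin n)) (v : Fin n) : ℝ :=
  ∑ u : Fin n, if (F \ K).Adj v u then
    ∑ u' : Fin n, if K.Adj u u' then (deg (F \ K) u' : ℝ) else 0
  else 0

/-- `μ` is the law of the binomial random graph `G(n,p)`. -/
def IsGnp (μ : PMF (SimpleGraph (Fin n))) (p : ℝ) : Prop :=
  ∀ G, μ G = ENNReal.ofReal (p ^ edgeCount G * (1 - p) ^ (n.choose 2 - edgeCount G))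

/-- `μ` is the law of `G(n,p)`, where `p` is truncated to `[0,1]` (so that `G(n,p)` is the
empty graph for `p ≤ 0` and the complete graph for `p ≥ 1`). -/
def IsGnpLaw (μ : PMF (SimpleGraph (Fin n))) (p : ℝ) : Prop :=
  IsGnp μ (max 0 (min p 1))

/-- `μ` is the law of `K + E`, where `E` includes each pair not in `E(K)` independently with
probability `p`. -/
def IsAddGnp (μ : PMF (SimpleGraph (Fin n))) (K : SimpleGraph (Fin n)) (p : ℝ) : Prop :=
  ∀ F, μ F = if K ≤ F then
      ENNReal.ofReal (p ^ (edgeCount F - edgeCount K) * (1 - p) ^ (n.choose 2 - edgeCount F))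
    else 0

/-- `ν` is the joint law of `(K, F)` where `K ~ G_d(n)` is a uniformly random `d`-regular graph
and `F = K + E`, `E` including each pair not in `E(K)` independently with probability `p`. -/
def IsRegAddGnp (ν : PMF (SimpleGraph (Fin n) × SimpleGraph (Fin n))) (d : ℕ) (p : ℝ) : Prop :=
  ∀ w, ν w = if IsRegularGraph w.1 d ∧ w.1 ≤ w.2 then
      ({G : SimpleGraph (Fin n) | IsRegularGraph G d}.ncard : ℝ≥0∞)⁻¹ *
        ENNReal.ofReal (p ^ (edgeCount w.2 - edgeCount w.1) *
          (1 - p) ^ (n.choose 2 - edgeCount w.2))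
    else 0

/-- `ν` is the joint law of an independent pair `(K, F)` with `K ~ G_d(n)` and `F ~ G(n,q)`. -/
def IsRegIndepGnp (ν : PMF (SimpleGraph (Fin n) × SimpleGraph (Fin n))) (d : ℕ) (q : ℝ) :
    Prop :=
  ∀ w, ν w = (if IsRegularGraph w.1 d then
      ({G : SimpleGraph (Fin n) | IsRegularGraph G d}.ncard : ℝ≥0∞)⁻¹ else 0) *
      ENNReal.ofReal (q ^ edgeCount w.2 * (1 - q) ^ (n.choose 2 - edgeCount w.2))


/-! ### Binomial random subsets -/

section Bexp

variable {α : Type*} [DecidableEq α]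

/-- The expectation of `g A` where `A` is a `p`-random subset of `X`. -/
def bexp (X : Finset α) (p : ℝ) (g : Finset α → ℝ) : ℝ :=
  ∑ A ∈ X.powerset, p ^ A.card * (1 - p) ^ (X \ A).card * g A

/-- The probability of `P A` where `A` is a `p`-random subset of `X`. -/
def bpr (X : Finset α) (p : ℝ) (P : Finset α → Prop) : ℝ :=
  bexp X p (fun A => if P A then 1 else 0)

lemma bexp_empty (p : ℝ) (g : Finset α → ℝ) : bexp ∅ p g = g ∅ := by
  simp [bexp]

lemma bexp_congr {X : Finset α} {p : ℝ} {f g : Finset α → ℝ} (h : ∀ A ⊆ X, f A = g A) :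
    bexp X p f = bexp X p g :=
  Finset.sum_congr rfl fun A hA => by rw [h A (Finset.mem_powerset.1 hA)]

lemma bexp_insert {a : α} {X : Finset α} (ha : a ∉ X) (p : ℝ) (g : Finset α → ℝ) :
    bexp (insert a X) p g = (1 - p) * bexp X p g + p * bexp X p (fun A => g (insert a A)) := by
  unfold bexp
  rw [Finset.sum_powerset_insert ha, Finset.mul_sum, Finset.mul_sum]
  congr 1
  · refine Finset.sum_congr rfl fun A hA => ?_
    rw [Finset.mem_powerset] at hA
    have h1 : a ∉ A := fun h => ha (hA h)
    rw [Finset.insert_sdiff_of_notMem _ h1, Finset.card_insert_of_notMem (by simp [ha])]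
    ring
  · refine Finset.sum_congr rfl fun A hA => ?_
    rw [Finset.mem_powerset] at hA
    have h1 : a ∉ A := fun h => ha (hA h)
    rw [Finset.card_insert_of_notMem h1]
    have : insert a X \ insert a A = X \ A := by
      ext b; simp only [Finset.mem_sdiff, Finset.mem_insert]
      constructor
      · rintro ⟨h | h, h2⟩ <;> tauto
      · rintro ⟨h, h2⟩
        refine ⟨Or.inr h, ?_⟩
        rintro (h3 | h3)
        · exact ha (h3 ▸ h)
        · exact h2 h3
    rw [this]; ring

lemma bexp_add (X : Finset α) (p : ℝ) (f g : Finset α → ℝ) :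
    bexp X p (fun A => f A + g A) = bexp X p f + bexp X p g := by
  simp [bexp, mul_add, Finset.sum_add_distrib]

lemma bexp_sub (X : Finset α) (p : ℝ) (f g : Finset α → ℝ) :
    bexp X p (fun A => f A - g A) = bexp X p f - bexp X p g := by
  simp [bexp, mul_sub, Finset.sum_sub_distrib]

lemma bexp_const_mul (X : Finset α) (p c : ℝ) (f : Finset α → ℝ) :
    bexp X p (fun A => c * f A) = c * bexp X p f := by
  simp only [bexp, Finset.mul_sum]
  exact Finset.sum_congr rfl fun A _ => by ring

lemma bexp_sum {ι : Type*} (s : Finset ι) (X : Finset α) (p : ℝ) (f : ι → Finset α → ℝ) :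
    bexp X p (fun A => ∑ i ∈ s, f i A) = ∑ i ∈ s, bexp X p (f i) := by
  simp only [bexp, Finset.mul_sum]
  rw [Finset.sum_comm]

lemma bexp_mono {X : Finset α} {p : ℝ} (h0 : 0 ≤ p) (h1 : p ≤ 1) {f g : Finset α → ℝ}
    (h : ∀ A ⊆ X, f A ≤ g A) : bexp X p f ≤ bexp X p g := by
  refine Finset.sum_le_sum fun A hA => ?_
  have : 0 ≤ 1 - p := by linarith
  exact mul_le_mul_of_nonneg_left (h A (Finset.mem_powerset.1 hA)) (by positivity)

lemma bexp_prod (X : Finset α) (p : ℝ) (c : α → ℝ) :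
    bexp X p (fun A => ∏ a ∈ A, c a) = ∏ a ∈ X, (1 - p + p * c a) := by
  induction X using Finset.induction_on with
  | empty => simp [bexp_empty]
  | insert a X ha ih =>
    rw [bexp_insert ha, Finset.prod_insert ha, ← ih]
    rw [bexp_congr (f := fun A => ∏ b ∈ insert a A, c b) (g := fun A => c a * ∏ b ∈ A, c b),
      bexp_const_mul]
    · ring
    · intro A hA
      exact Finset.prod_insert fun h => ha (hA h)

lemma bexp_const (X : Finset α) (p c : ℝ) : bexp X p (fun _ => c) = c := by
  have := bexp_prod X p (fun _ => 1)
  simp only [Finset.prod_const_one, mul_one, sub_add_cancel] at this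
  have h2 := bexp_const_mul X p c (fun _ => 1)
  rw [this] at h2
  simpa using h2

lemma bexp_nonneg {X : Finset α} {p : ℝ} (h0 : 0 ≤ p) (h1 : p ≤ 1) {f : Finset α → ℝ}
    (h : ∀ A ⊆ X, 0 ≤ f A) : 0 ≤ bexp X p f := by
  have := bexp_mono h0 h1 (f := fun _ => 0) (g := f) (X := X) h
  rwa [bexp_const] at this

lemma bexp_exp (X : Finset α) (p : ℝ) (c : α → ℝ) :
    bexp X p (fun A => Real.exp (∑ a ∈ A, c a)) = ∏ a ∈ X, (1 - p + p * Real.exp (c a)) := by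
  rw [← bexp_prod]
  simp [Real.exp_sum]

lemma bexp_exp_le {X : Finset α} {p : ℝ} (h0 : 0 ≤ p) (h1 : p ≤ 1) (c : α → ℝ) :
    bexp X p (fun A => Real.exp (∑ a ∈ A, c a)) ≤
      Real.exp (p * ∑ a ∈ X, (Real.exp (c a) - 1)) := by
  rw [bexp_exp, Finset.mul_sum, Real.exp_sum]
  refine Finset.prod_le_prod (fun a _ => ?_) fun a _ => ?_
  · have := Real.exp_pos (c a); nlinarith
  · have := Real.add_one_le_exp (p * (Real.exp (c a) - 1)); linarith

/-- Conditioning on the part of the random set inside `X`. -/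
lemma bexp_union {X Y : Finset α} (h : Disjoint X Y) (p : ℝ) (g : Finset α → ℝ) :
    bexp (X ∪ Y) p g = bexp X p (fun A => bexp Y p (fun B => g (A ∪ B))) := by
  induction Y using Finset.induction_on generalizing g with
  | empty => simp [bexp_empty]
  | insert a Y ha ih =>
    rw [Finset.disjoint_insert_right] at h
    rw [Finset.union_insert, bexp_insert (by simp [ha, h.1]), ih h.2, ih h.2]
    simp only [bexp_insert ha, Finset.union_insert]
    rw [bexp_add, bexp_const_mul, bexp_const_mul]

lemma bpr_nonneg {X : Finset α} {p : ℝ} (h0 : 0 ≤ p) (h1 : p ≤ 1) (P : Finset α → Prop) :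
    0 ≤ bpr X p P :=
  bexp_nonneg h0 h1 fun A _ => by split_ifs <;> norm_num

lemma bpr_mono {X : Finset α} {p : ℝ} (h0 : 0 ≤ p) (h1 : p ≤ 1) {P Q : Finset α → Prop}
    (h : ∀ A ⊆ X, P A → Q A) : bpr X p P ≤ bpr X p Q :=
  bexp_mono h0 h1 fun A hA => by
    by_cases hP : P A
    · simp [hP, h A hA hP]
    · simp only [hP, if_false]; split_ifs <;> norm_num

lemma bpr_or {X : Finset α} {p : ℝ} (h0 : 0 ≤ p) (h1 : p ≤ 1) (P Q : Finset α → Prop) :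
    bpr X p (fun A => P A ∨ Q A) ≤ bpr X p P + bpr X p Q := by
  unfold bpr
  rw [← bexp_add]
  refine bexp_mono h0 h1 fun A _ => ?_
  by_cases hP : P A <;> by_cases hQ : Q A <;> simp [hP, hQ]

lemma bpr_exists {ι : Type*} (s : Finset ι) {X : Finset α} {p : ℝ} (h0 : 0 ≤ p) (h1 : p ≤ 1)
    (P : ι → Finset α → Prop) :
    bpr X p (fun A => ∃ i ∈ s, P i A) ≤ ∑ i ∈ s, bpr X p (P i) := by
  unfold bpr
  rw [← bexp_sum]
  refine bexp_mono h0 h1 fun A _ => ?_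
  by_cases h : ∃ i ∈ s, P i A
  · obtain ⟨i, hi, hP⟩ := h
    rw [if_pos ⟨i, hi, hP⟩]
    refine le_trans (by simp [hP]) (Finset.single_le_sum (f := fun i => if P i A then (1 : ℝ) else 0)
      (fun j _ => by split_ifs <;> norm_num) hi)
  · rw [if_neg h]
    exact Finset.sum_nonneg fun j _ => by split_ifs <;> norm_num

lemma bpr_exists_le {ι : Type*} [Fintype ι] {X : Finset α} {p b : ℝ} (h0 : 0 ≤ p) (h1 : p ≤ 1)
    (P : ι → Finset α → Prop) (h : ∀ i, bpr X p (P i) ≤ b) :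
    bpr X p (fun A => ∃ i, P i A) ≤ Fintype.card ι * b := by
  have := bpr_exists (Finset.univ : Finset ι) (X := X) h0 h1 P
  simp only [Finset.mem_univ, true_and] at this
  refine this.trans ((Finset.sum_le_sum fun i _ => h i).trans ?_)
  simp

/-- Markov's inequality. -/
lemma bpr_le_bexp {X : Finset α} {p : ℝ} (h0 : 0 ≤ p) (h1 : p ≤ 1) {P : Finset α → Prop}
    {g : Finset α → ℝ} (hg : ∀ A ⊆ X, 0 ≤ g A) (h : ∀ A ⊆ X, P A → 1 ≤ g A) :
    bpr X p P ≤ bexp X p g :=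
  bexp_mono h0 h1 fun A hA => by
    split_ifs with hP
    · exact h A hA hP
    · exact hg A hA

lemma bpr_ge_le {X : Finset α} {p : ℝ} (h0 : 0 ≤ p) (h1 : p ≤ 1) (c : α → ℝ) (b : ℝ) :
    bpr X p (fun A => b ≤ ∑ a ∈ A, c a) ≤
      Real.exp (-b + p * ∑ a ∈ X, (Real.exp (c a) - 1)) := by
  rw [Real.exp_add]
  refine le_trans ?_ (mul_le_mul_of_nonneg_left (bexp_exp_le h0 h1 c) (Real.exp_pos _).le)
  rw [← bexp_const_mul]
  refine bpr_le_bexp h0 h1 (fun A _ => by positivity) fun A _ hA => ?_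
  rw [← Real.exp_add]
  exact Real.one_le_exp (by linarith)

lemma exp_sub_one_le {x : ℝ} (h : |x| ≤ 1) : Real.exp x - 1 ≤ x + x ^ 2 := by
  have := Real.abs_exp_sub_one_sub_id_le h
  have := (abs_le.1 this).2
  linarith

/-- Chernoff-type upper tail bound for a linear statistic. -/
lemma bpr_linear_ge {X : Finset α} {p : ℝ} (h0 : 0 ≤ p) (h1 : p ≤ 1) (c : α → ℝ) (τ t : ℝ)
    (hτ : 0 ≤ τ) (hc : ∀ a ∈ X, |τ * c a| ≤ 1) :
    bpr X p (fun A => p * ∑ a ∈ X, c a + t ≤ ∑ a ∈ A, c a) ≤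
      Real.exp (-(τ * t) + τ ^ 2 * (p * ∑ a ∈ X, c a ^ 2)) := by
  have h := bpr_ge_le (X := X) h0 h1 (fun a => τ * c a) (τ * (p * ∑ a ∈ X, c a + t))
  refine (bpr_mono h0 h1 fun A _ hA => ?_).trans (h.trans (Real.exp_le_exp.2 ?_))
  · rw [← Finset.mul_sum]
    exact mul_le_mul_of_nonneg_left hA hτ
  · have : ∑ a ∈ X, (Real.exp (τ * c a) - 1) ≤ ∑ a ∈ X, (τ * c a + (τ * c a) ^ 2) :=
      Finset.sum_le_sum fun a ha => exp_sub_one_le (hc a ha)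
    have h3 := mul_le_mul_of_nonneg_left this h0
    have h4 : ∑ a ∈ X, (τ * c a + (τ * c a) ^ 2) = τ * ∑ a ∈ X, c a + τ ^ 2 * ∑ a ∈ X, c a ^ 2 := by
      rw [Finset.sum_add_distrib, Finset.mul_sum, Finset.mul_sum]
      simp [mul_pow]
    rw [h4] at h3
    linarith

/-- Chernoff-type lower tail bound for a linear statistic. -/
lemma bpr_linear_le {X : Finset α} {p : ℝ} (h0 : 0 ≤ p) (h1 : p ≤ 1) (c : α → ℝ) (τ t : ℝ)
    (hτ : 0 ≤ τ) (hc : ∀ a ∈ X, |τ * c a| ≤ 1) :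
    bpr X p (fun A => ∑ a ∈ A, c a ≤ p * ∑ a ∈ X, c a - t) ≤
      Real.exp (-(τ * t) + τ ^ 2 * (p * ∑ a ∈ X, c a ^ 2)) := by
  have h := bpr_linear_ge (X := X) h0 h1 (fun a => - c a) τ t hτ
    (fun a ha => by rw [mul_neg, abs_neg]; exact hc a ha)
  simp only [Finset.sum_neg_distrib, neg_sq] at h
  refine (bpr_mono h0 h1 fun A _ hA => ?_).trans h
  linarith

/-- Two-sided tail bound for a linear statistic. -/
lemma bpr_linear_abs {X : Finset α} {p : ℝ} (h0 : 0 ≤ p) (h1 : p ≤ 1) (c : α → ℝ) (τ t : ℝ)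
    (hτ : 0 ≤ τ) (hc : ∀ a ∈ X, |τ * c a| ≤ 1) :
    bpr X p (fun A => t ≤ |∑ a ∈ A, c a - p * ∑ a ∈ X, c a|) ≤
      2 * Real.exp (-(τ * t) + τ ^ 2 * (p * ∑ a ∈ X, c a ^ 2)) := by
  have h2 := bpr_linear_ge (X := X) h0 h1 c τ t hτ hc
  have h3 := bpr_linear_le (X := X) h0 h1 c τ t hτ hc
  refine (bpr_mono h0 h1 fun A _ hA => ?_).trans ((bpr_or h0 h1
    (fun A => p * ∑ a ∈ X, c a + t ≤ ∑ a ∈ A, c a)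
    (fun A => ∑ a ∈ A, c a ≤ p * ∑ a ∈ X, c a - t)).trans (by linarith))
  rcases le_abs.1 hA with h | h
  · exact Or.inl (by linarith)
  · exact Or.inr (by linarith)

end Bexp

/-! ### Approximate stochastic domination of random sets -/

section Dom

variable {α : Type*} [Fintype α] [DecidableEq α]

/-- The laws `μ`, `ν` on finsets have a coupling `(F, H)` with `F ⊆ H` up to probability `δ`. -/
def Dom (δ : ℝ) (μ ν : Finset α → ℝ) : Prop :=
  ∃ J : Finset α → Finset α → ℝ, (∀ F H, 0 ≤ J F H) ∧ (∀ F, ∑ H, J F H = μ F) ∧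
    (∀ H, ∑ F, J F H = ν H) ∧ ∑ F : Finset α, ∑ H : Finset α, (if F ⊆ H then 0 else J F H) ≤ δ

lemma Dom.mono {δ δ' : ℝ} {μ ν : Finset α → ℝ} (h : Dom δ μ ν) (hd : δ ≤ δ') : Dom δ' μ ν := by
  obtain ⟨J, h0, h1, h2, h3⟩ := h
  exact ⟨J, h0, h1, h2, h3.trans hd⟩

lemma Dom.trans {δ₁ δ₂ : ℝ} {μ ν ξ : Finset α → ℝ} (h : Dom δ₁ μ ν) (h' : Dom δ₂ ν ξ) :
    Dom (δ₁ + δ₂) μ ξ := by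
  obtain ⟨J, h0, h1, h2, h3⟩ := h
  obtain ⟨L, g0, g1, g2, g3⟩ := h'
  have hν : ∀ G, 0 ≤ ν G := fun G => by rw [← h2]; exact Finset.sum_nonneg fun F _ => h0 F G
  have hJ : ∀ F G, ν G = 0 → J F G = 0 := fun F G h => by
    rw [← h2] at h
    exact (Finset.sum_eq_zero_iff_of_nonneg fun F _ => h0 F G).1 h F (Finset.mem_univ _)
  have hL : ∀ G H, ν G = 0 → L G H = 0 := fun G H h => by
    rw [← g1] at h
    exact (Finset.sum_eq_zero_iff_of_nonneg fun H _ => g0 G H).1 h H (Finset.mem_univ _)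
  have e1 : ∀ F G, ∑ H, J F G * L G H / ν G = J F G := fun F G => by
    rw [← Finset.sum_div, ← Finset.mul_sum, g1]
    by_cases h : ν G = 0
    · simp [h, hJ F G h]
    · field_simp
  have e2 : ∀ G H, ∑ F, J F G * L G H / ν G = L G H := fun G H => by
    rw [← Finset.sum_div, ← Finset.sum_mul, h2]
    by_cases h : ν G = 0
    · simp [h, hL G H h]
    · field_simp
  refine ⟨fun F H => ∑ G, J F G * L G H / ν G, fun F H => Finset.sum_nonneg fun G _ =>
    div_nonneg (mul_nonneg (h0 _ _) (g0 _ _)) (hν _), fun F => ?_, fun H => ?_, ?_⟩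
  · rw [Finset.sum_comm]; simp_rw [e1]; exact h1 F
  · rw [Finset.sum_comm]; simp_rw [e2]; exact g2 H
  · have key : ∀ F H : Finset α, (if F ⊆ H then 0 else ∑ G, J F G * L G H / ν G) ≤
        ∑ G : Finset α, (if F ⊆ G then 0 else J F G * L G H / ν G) +
        ∑ G : Finset α, (if G ⊆ H then 0 else J F G * L G H / ν G) := by
      intro F H
      rw [← Finset.sum_add_distrib]
      have hn : ∀ G, 0 ≤ J F G * L G H / ν G := fun G =>
        div_nonneg (mul_nonneg (h0 _ _) (g0 _ _)) (hν _)
      split_ifs with hFH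
      · exact Finset.sum_nonneg fun G _ => by
          have := hn G; split_ifs <;> linarith
      · refine Finset.sum_le_sum fun G _ => ?_
        have := hn G
        by_cases h4 : F ⊆ G
        · have h5 : ¬ G ⊆ H := fun h5 => hFH (h4.trans h5)
          simp [h4, h5]
        · rw [if_neg h4]; split_ifs <;> linarith
    refine (Finset.sum_le_sum fun F _ => Finset.sum_le_sum fun H _ => key F H).trans ?_
    simp_rw [Finset.sum_add_distrib]
    refine add_le_add (le_trans (le_of_eq ?_) h3) (le_trans (le_of_eq ?_) g3)
    · refine Finset.sum_congr rfl fun F _ => ?_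
      rw [Finset.sum_comm]
      refine Finset.sum_congr rfl fun G _ => ?_
      split_ifs
      · simp
      · exact e1 F G
    · have : ∀ F, ∑ H : Finset α, ∑ G : Finset α, (if G ⊆ H then 0 else J F G * L G H / ν G) =
          ∑ G : Finset α, ∑ H : Finset α, (if G ⊆ H then 0 else J F G * L G H / ν G) := fun F => Finset.sum_comm
      simp_rw [this]
      rw [Finset.sum_comm]
      refine Finset.sum_congr rfl fun G _ => ?_
      rw [Finset.sum_comm]
      refine Finset.sum_congr rfl fun H _ => ?_
      split_ifs
      · simp
      · exact e2 G H

lemma Dom.mixture {ι : Type*} [Fintype ι] (w e : ι → ℝ) (a b : ι → Finset α → ℝ)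
    (hw : ∀ i, 0 ≤ w i) (h : ∀ i, w i ≠ 0 → Dom (e i) (a i) (b i)) :
    Dom (∑ i, w i * e i) (fun F => ∑ i, w i * a i F) (fun F => ∑ i, w i * b i F) := by
  have h' : ∀ i, ∃ J : Finset α → Finset α → ℝ, w i ≠ 0 → (∀ F H, 0 ≤ J F H) ∧
    (∀ F, ∑ H, J F H = a i F) ∧
    (∀ H, ∑ F, J F H = b i H) ∧ ∑ F : Finset α, ∑ H : Finset α, (if F ⊆ H then 0 else J F H) ≤ e i := by
    intro i
    by_cases hi : w i = 0
    · exact ⟨fun _ _ => 0, fun h => absurd hi h⟩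
    · obtain ⟨J, hJ⟩ := h i hi
      exact ⟨J, fun _ => hJ⟩
  choose J hJ using h'
  refine ⟨fun F H => ∑ i, w i * J i F H, fun F H => Finset.sum_nonneg fun i _ => ?_,
    fun F => ?_, fun H => ?_, ?_⟩
  · by_cases hi : w i = 0
    · simp [hi]
    · exact mul_nonneg (hw i) ((hJ i hi).1 F H)
  · rw [Finset.sum_comm]
    refine Finset.sum_congr rfl fun i _ => ?_
    rw [← Finset.mul_sum]
    by_cases hi : w i = 0
    · simp [hi]
    · rw [(hJ i hi).2.1]
  · rw [Finset.sum_comm]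
    refine Finset.sum_congr rfl fun i _ => ?_
    rw [← Finset.mul_sum]
    by_cases hi : w i = 0
    · simp [hi]
    · rw [(hJ i hi).2.2.1]
  · have : ∀ F H : Finset α, (if F ⊆ H then 0 else ∑ i, w i * J i F H) =
        ∑ i, w i * (if F ⊆ H then 0 else J i F H) := fun F H => by
      split_ifs <;> simp
    simp_rw [this]
    have h2 : ∀ F : Finset α, ∑ H : Finset α, ∑ i, w i * (if F ⊆ H then 0 else J i F H) =
        ∑ i, ∑ H : Finset α, w i * (if F ⊆ H then 0 else J i F H) := fun F => Finset.sum_comm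
    simp_rw [h2]
    rw [Finset.sum_comm]
    refine Finset.sum_le_sum fun i _ => ?_
    simp_rw [← Finset.mul_sum]
    by_cases hi : w i = 0
    · simp [hi]
    · exact mul_le_mul_of_nonneg_left (hJ i hi).2.2.2 (hw i)

lemma Dom.indep {μ ν : Finset α → ℝ} (h0 : ∀ F, 0 ≤ μ F) (h1 : ∀ F, 0 ≤ ν F)
    (hμ : ∑ F, μ F = 1) (hν : ∑ F, ν F = 1) : Dom 1 μ ν := by
  refine ⟨fun F H => μ F * ν H, fun F H => mul_nonneg (h0 F) (h1 H), fun F => ?_, fun H => ?_, ?_⟩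
  · rw [← Finset.mul_sum, hν, mul_one]
  · rw [← Finset.sum_mul, hμ, one_mul]
  · calc ∑ F : Finset α, ∑ H : Finset α, (if F ⊆ H then 0 else μ F * ν H) ≤ ∑ F, ∑ H, μ F * ν H :=
        Finset.sum_le_sum fun F _ => Finset.sum_le_sum fun H _ => by
          have := mul_nonneg (h0 F) (h1 H); split_ifs <;> linarith
      _ = 1 := by simp_rw [← Finset.mul_sum, hν, mul_one, hμ]

lemma Dom.of_subset_support {μ ν : Finset α → ℝ} {F : Finset α} (h0 : ∀ H, 0 ≤ μ H)
    (h1 : ∀ H, 0 ≤ ν H) (hμ : ∑ H, μ H = 1) (hν : ∑ H, ν H = 1)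
    (hF : ∀ H, ¬ H ⊆ F → μ H = 0) :
    Dom (∑ H, if H = F then 0 else max (ν H - μ H) 0) μ ν := by
  set a : Finset α → ℝ := fun H => max (μ H - ν H) 0 with ha
  set b : Finset α → ℝ := fun H => max (ν H - μ H) 0 with hb
  set T : ℝ := ∑ H, a H with hT
  have a0 : ∀ H, 0 ≤ a H := fun H => le_max_right _ _
  have b0 : ∀ H, 0 ≤ b H := fun H => le_max_right _ _
  have ma : ∀ H, min (μ H) (ν H) + a H = μ H := fun H => by
    simp only [ha]; rcases le_total (μ H) (ν H) with h | h <;> simp [h]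
  have mb : ∀ H, min (μ H) (ν H) + b H = ν H := fun H => by
    simp only [hb]; rcases le_total (μ H) (ν H) with h | h <;> simp [h]
  have hTb : ∑ H, b H = T := by
    have e1 : ∑ H, min (μ H) (ν H) + ∑ H, a H = 1 := by
      rw [← Finset.sum_add_distrib]; simp_rw [ma]; exact hμ
    have e2 : ∑ H, min (μ H) (ν H) + ∑ H, b H = 1 := by
      rw [← Finset.sum_add_distrib]; simp_rw [mb]; exact hν
    linarith
  have T0 : 0 ≤ T := Finset.sum_nonneg fun H _ => a0 H
  have ea : ∀ H, a H * T / T = a H := fun H => by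
    by_cases h : T = 0
    · have := (Finset.sum_eq_zero_iff_of_nonneg fun H _ => a0 H).1 h H (Finset.mem_univ _)
      simp [this]
    · field_simp
  have eb : ∀ H, T * b H / T = b H := fun H => by
    by_cases h : T = 0
    · have := (Finset.sum_eq_zero_iff_of_nonneg fun H _ => b0 H).1 (hTb.trans h) H
        (Finset.mem_univ _)
      simp [this]
    · field_simp
  refine ⟨fun A B => (if A = B then min (μ A) (ν A) else 0) + a A * b B / T, fun A B => ?_,
    fun A => ?_, fun B => ?_, ?_⟩
  · have : 0 ≤ a A * b B / T := div_nonneg (mul_nonneg (a0 A) (b0 B)) T0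
    have := le_min (h0 A) (h1 A)
    beta_reduce
    split_ifs <;> linarith
  · rw [Finset.sum_add_distrib, ← Finset.sum_div, ← Finset.mul_sum, hTb, ea]
    simp [ma]
  · rw [Finset.sum_add_distrib, ← Finset.sum_div, ← Finset.sum_mul, eb]
    simp [mb]
  · rw [Finset.sum_comm]
    refine Finset.sum_le_sum fun B _ => ?_
    by_cases hB : B = F
    · rw [if_pos hB]
      refine Finset.sum_nonpos fun A _ => ?_
      beta_reduce
      split_ifs with h1' h2
      · exact le_rfl
      · exact absurd h2.subset h1'
      · have : a A = 0 := by
          simp only [ha]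
          rw [hF A (hB ▸ h1')]
          simp [h1 A]
        simp [this]
    · rw [if_neg hB]
      calc _ ≤ ∑ A, a A * b B / T := Finset.sum_le_sum fun A _ => by
            have : 0 ≤ a A * b B / T := div_nonneg (mul_nonneg (a0 A) (b0 B)) T0
            beta_reduce
            split_ifs with h1' h2
            · exact this
            · exact absurd h2.subset h1'
            · simp
        _ = b B := by rw [← Finset.sum_div, ← Finset.sum_mul, eb]

/-- The law of a `p`-random subset of `F`. -/
def thin (p : ℝ) (F A : Finset α) : ℝ :=
  if A ⊆ F then p ^ A.card * (1 - p) ^ (F \ A).card else 0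

lemma sum_thin_mul (p : ℝ) (F : Finset α) (g : Finset α → ℝ) :
    ∑ A, thin p F A * g A = bexp F p g := by
  unfold thin bexp
  simp_rw [ite_mul, zero_mul]
  rw [← Finset.sum_filter]
  refine Finset.sum_congr ?_ fun _ _ => rfl
  ext A; simp

lemma thin_nonneg {p : ℝ} (h0 : 0 ≤ p) (h1 : p ≤ 1) (F A : Finset α) : 0 ≤ thin p F A := by
  unfold thin
  have : 0 ≤ 1 - p := by linarith
  split_ifs <;> positivity

lemma sum_thin (p : ℝ) (F : Finset α) : ∑ A, thin p F A = 1 := by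
  have := sum_thin_mul p F fun _ => 1
  rw [bexp_const] at this
  simpa using this

lemma sum_interval {G X : Finset α} (h : G ⊆ X) (a b : ℝ) :
    ∑ F : Finset α, (if G ⊆ F ∧ F ⊆ X then a ^ (F \ G).card * b ^ (X \ F).card else 0) =
      (a + b) ^ (X \ G).card := by
  rw [← Finset.sum_pow_mul_eq_add_pow, ← Finset.sum_filter]
  refine Finset.sum_bij' (fun F _ => F \ G) (fun B _ => G ∪ B) ?_ ?_ ?_ ?_ ?_
  · intro F hF
    simp only [Finset.mem_filter, Finset.mem_univ, true_and] at hF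
    exact Finset.mem_powerset.2 (Finset.sdiff_subset_sdiff hF.2 subset_rfl)
  · intro B hB
    rw [Finset.mem_powerset] at hB
    simp only [Finset.mem_filter, Finset.mem_univ, true_and]
    exact ⟨Finset.subset_union_left, Finset.union_subset h (hB.trans Finset.sdiff_subset)⟩
  · intro F hF
    simp only [Finset.mem_filter, Finset.mem_univ, true_and] at hF
    exact Finset.union_sdiff_of_subset hF.1
  · intro B hB
    rw [Finset.mem_powerset] at hB
    rw [Finset.union_sdiff_left, Finset.sdiff_eq_self_iff_disjoint]
    exact (Finset.disjoint_of_subset_left hB Finset.sdiff_disjoint)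
  · intro F hF
    simp only [Finset.mem_filter, Finset.mem_univ, true_and] at hF
    congr 2
    have e1 := Finset.card_sdiff_add_card_eq_card hF.2
    have e2 := Finset.card_sdiff_add_card_eq_card hF.1
    have e3 := Finset.card_sdiff_add_card_eq_card (hF.1.trans hF.2)
    omega

lemma thin_bind (p q : ℝ) (X G : Finset α) :
    ∑ F, thin q X F * thin p F G = thin (q * p) X G := by
  unfold thin
  by_cases h : G ⊆ X
  · rw [if_pos h]
    have h2 := sum_interval h (q * (1 - p)) (1 - q)
    have : q * (1 - p) + (1 - q) = 1 - q * p := by ring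
    rw [this] at h2
    rw [← h2, Finset.mul_sum]
    refine Finset.sum_congr rfl fun F _ => ?_
    by_cases hF : F ⊆ X <;> by_cases hG : G ⊆ F <;> simp only [hF, hG, if_true, if_false,
      and_true, and_false, mul_zero, zero_mul, and_self]
    rw [← Finset.card_sdiff_add_card_eq_card hG, mul_pow q p, mul_pow q (1 - p)]
    ring
  · rw [if_neg h]
    refine Finset.sum_eq_zero fun F _ => ?_
    by_cases hF : F ⊆ X
    · rw [if_neg (fun hG => h (hG.trans hF) : ¬ G ⊆ F), mul_zero]
    · rw [if_neg hF, zero_mul]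

lemma thin_inter {F H : Finset α} (h : F ⊆ H) (p : ℝ) (A : Finset α) :
    ∑ B : Finset α, (if B ∩ F = A then thin p H B else 0) = thin p F A := by
  have e : ∑ B : Finset α, (if B ∩ F = A then thin p H B else 0) =
      bexp H p (fun B => if B ∩ F = A then 1 else 0) := by
    rw [← sum_thin_mul]
    refine Finset.sum_congr rfl fun B _ => by split_ifs <;> simp
  have e2 : H = F ∪ (H \ F) := (Finset.union_sdiff_of_subset h).symm
  rw [e, e2, bexp_union Finset.disjoint_sdiff]
  have e3 : thin p F A = ∑ B, thin p F B * (if B = A then 1 else 0) := by simp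
  rw [e3, sum_thin_mul]
  refine bexp_congr fun B hB => ?_
  rw [← bexp_const (H \ F) p (if B = A then 1 else 0)]
  refine bexp_congr fun C hC => ?_
  have : (B ∪ C) ∩ F = B := by
    rw [Finset.union_inter_distrib_right, Finset.inter_eq_left.2 hB]
    have : C ∩ F = ∅ := by
      rw [← Finset.disjoint_iff_inter_eq_empty]
      exact Finset.disjoint_of_subset_left hC Finset.sdiff_disjoint
    rw [this, Finset.union_empty]
  rw [this]

lemma Dom.thin_of_subset {F H : Finset α} (h : F ⊆ H) {p : ℝ} (h0 : 0 ≤ p) (h1 : p ≤ 1) :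
    Dom 0 (thin p F) (thin p H) := by
  refine ⟨fun A B => if B ∩ F = A then thin p H B else 0, fun A B => ?_, fun A => ?_,
    fun B => ?_, ?_⟩
  · have := thin_nonneg h0 h1 H B
    beta_reduce
    split_ifs <;> linarith
  · exact thin_inter h p A
  · simp
  · refine (Finset.sum_eq_zero fun A _ => Finset.sum_eq_zero fun B _ => ?_).le
    beta_reduce
    split_ifs with h2 h3
    · rfl
    · exact absurd (h3 ▸ Finset.inter_subset_left) h2
    · rfl

/-- Thinning both sides preserves approximate domination. -/
lemma Dom.thinning {δ : ℝ} {μ ν : Finset α → ℝ} (h : Dom δ μ ν) {p : ℝ} (h0 : 0 ≤ p)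
    (h1 : p ≤ 1) :
    Dom δ (fun A => ∑ F, μ F * thin p F A) (fun A => ∑ F, ν F * thin p F A) := by
  obtain ⟨J, j0, j1, j2, j3⟩ := h
  have := Dom.mixture (ι := Finset α × Finset α) (fun i => J i.1 i.2)
    (fun i : Finset α × Finset α => if i.1 ⊆ i.2 then 0 else 1) (fun i => thin p i.1) (fun i => thin p i.2)
    (fun i => j0 _ _) (fun i _ => by
      by_cases hi : i.1 ⊆ i.2
      · simp only [hi, if_true]; exact Dom.thin_of_subset hi h0 h1
      · simp only [hi, if_false]
        exact Dom.indep (thin_nonneg h0 h1 _) (thin_nonneg h0 h1 _) (sum_thin _ _) (sum_thin _ _))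
  have h2 := this.mono (δ' := δ) (by
    rw [Fintype.sum_prod_type]
    refine le_trans (le_of_eq ?_) j3
    refine Finset.sum_congr rfl fun F _ => Finset.sum_congr rfl fun H _ => ?_
    dsimp only
    split_ifs <;> simp)
  convert h2 using 2 with A A
  · rw [Fintype.sum_prod_type]
    refine Finset.sum_congr rfl fun F _ => ?_
    rw [← j1, Finset.sum_mul]
  · rw [Fintype.sum_prod_type_right]
    refine Finset.sum_congr rfl fun F _ => ?_
    rw [← j2, Finset.sum_mul]

/-- The law of a `p`-random subset of the ground set. -/
def gnp (p : ℝ) (A : Finset α) : ℝ := thin p Finset.univ A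

lemma gnp_thin (p q : ℝ) (G : Finset α) : ∑ F, gnp q F * thin p F G = gnp (q * p) G :=
  thin_bind p q Finset.univ G

lemma Dom.gnp_mono {q q' : ℝ} (h0 : 0 ≤ q) (h : q ≤ q') (h1 : q' ≤ 1) :
    Dom 0 (gnp q : Finset α → ℝ) (gnp q') := by
  have hq : q' * (q / q') = q := by
    by_cases hq' : q' = 0
    · have : q = 0 := by linarith
      simp [this]
    · field_simp
  have hr : q / q' ≤ 1 := div_le_one_of_le₀ h (h0.trans h)
  have hr0 : 0 ≤ q / q' := div_nonneg h0 (h0.trans h)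
  refine ⟨fun F H => gnp q' H * thin (q / q') H F, fun F H =>
    mul_nonneg (thin_nonneg (h0.trans h) h1 _ _) (thin_nonneg hr0 hr _ _), fun F => ?_,
    fun H => ?_, ?_⟩
  · rw [gnp_thin, hq]
  · rw [← Finset.mul_sum, sum_thin, mul_one]
  · refine (Finset.sum_eq_zero fun A _ => Finset.sum_eq_zero fun B _ => ?_).le
    beta_reduce
    split_ifs with h2
    · rfl
    · simp [thin, h2]

end Dom

/-! ### Gradual sampling of a random member of a family -/

section Family

variable {α : Type*} [Fintype α] [DecidableEq α]


/-- The uniform law on the family `K`. -/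
def unif (K : Finset (Finset α)) (F : Finset α) : ℝ := if F ∈ K then (K.card : ℝ)⁻¹ else 0

/-- The law of a uniform member of `K` together with an `s`-random subset of its complement. -/
def mixLaw (K : Finset (Finset α)) (s : ℝ) (F : Finset α) : ℝ :=
  (K.card : ℝ)⁻¹ * ∑ A ∈ K, if A ⊆ F then s ^ (F \ A).card * (1 - s) ^ (Finset.univ \ F).card else 0

/-- The number of members of `K` inside `F`. -/
def cnt (K : Finset (Finset α)) (F : Finset α) : ℝ := ((K.filter fun A => A ⊆ F).card : ℝ)

/-- The number of members of `K` inside `F` containing `e`. -/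
def cntMem (K : Finset (Finset α)) (e : α) (F : Finset α) : ℝ :=
  ((K.filter fun A => A ⊆ F ∧ e ∈ A).card : ℝ)

/-- The kernel that keeps a uniform member of `K` inside `F` and each other element of `F`
with probability `1 - β`. -/
def post (K : Finset (Finset α)) (β : ℝ) (F G : Finset α) : ℝ :=
  (cnt K F)⁻¹ * ∑ A ∈ K, if A ⊆ G ∧ G ⊆ F then (1 - β) ^ (G \ A).card * β ^ (F \ G).card else 0

lemma cnt_nonneg (K : Finset (Finset α)) (F : Finset α) : 0 ≤ cnt K F := Nat.cast_nonneg _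

lemma mixLaw_nonneg (K : Finset (Finset α)) {s : ℝ} (h0 : 0 ≤ s) (h1 : s ≤ 1) (F : Finset α) :
    0 ≤ mixLaw K s F := by
  have : 0 ≤ 1 - s := by linarith
  refine mul_nonneg (by positivity) (Finset.sum_nonneg fun A _ => ?_)
  split_ifs <;> positivity

lemma mixLaw_eq {K : Finset (Finset α)} {k : ℕ} (hk : ∀ A ∈ K, A.card = k) (s : ℝ)
    (F : Finset α) :
    mixLaw K s F = (K.card : ℝ)⁻¹ * (cnt K F * (s ^ (F.card - k) * (1 - s) ^ (Finset.univ \ F).card))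
    := by
  unfold mixLaw cnt
  rw [← Finset.sum_filter]
  congr 1
  rw [← nsmul_eq_mul, ← Finset.sum_const]
  refine Finset.sum_congr rfl fun A hA => ?_
  rw [Finset.mem_filter] at hA
  rw [Finset.card_sdiff_of_subset hA.2, hk A hA.1]

lemma sum_mixLaw {K : Finset (Finset α)} (hK : K.Nonempty) (s : ℝ) : ∑ F, mixLaw K s F = 1 := by
  unfold mixLaw
  rw [← Finset.mul_sum, Finset.sum_comm]
  have : ∀ A : Finset α, ∑ F : Finset α,
      (if A ⊆ F then s ^ (F \ A).card * (1 - s) ^ (Finset.univ \ F).card else 0) = 1 := fun A => by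
    have := sum_interval (Finset.subset_univ A) s (1 - s)
    simpa using this
  simp_rw [this]
  have : (K.card : ℝ) ≠ 0 := by exact_mod_cast hK.card_pos.ne'
  simp [this]

lemma mixLaw_post {K : Finset (Finset α)} {k : ℕ} (hk : ∀ A ∈ K, A.card = k) (s β : ℝ)
    (G : Finset α) :
    ∑ F, mixLaw K s F * post K β F G = mixLaw K (s * (1 - β)) G := by
  have e1 : ∀ F, mixLaw K s F * post K β F G = (K.card : ℝ)⁻¹ * ∑ A ∈ K,
      if A ⊆ G ∧ G ⊆ F then (s ^ (F \ A).card * (1 - s) ^ (Finset.univ \ F).card) *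
        ((1 - β) ^ (G \ A).card * β ^ (F \ G).card) else 0 := by
    intro F
    rw [mixLaw_eq hk]
    unfold post
    have e2 : ∑ A ∈ K, (if A ⊆ G ∧ G ⊆ F then (s ^ (F \ A).card * (1 - s) ^ (Finset.univ \ F).card) *
        ((1 - β) ^ (G \ A).card * β ^ (F \ G).card) else 0) =
        (s ^ (F.card - k) * (1 - s) ^ (Finset.univ \ F).card) *
        ∑ A ∈ K, if A ⊆ G ∧ G ⊆ F then ((1 - β) ^ (G \ A).card * β ^ (F \ G).card) else 0 := by
      rw [Finset.mul_sum]
      refine Finset.sum_congr rfl fun A hA => ?_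
      split_ifs with h
      · rw [Finset.card_sdiff_of_subset (h.1.trans h.2), hk A hA]
      · simp
    rw [e2]
    by_cases hZ : cnt K F = 0
    · have : ∑ A ∈ K, (if A ⊆ G ∧ G ⊆ F then ((1 - β) ^ (G \ A).card * β ^ (F \ G).card) else 0) = 0 := by
        refine Finset.sum_eq_zero fun A hA => if_neg fun h => ?_
        have h3 : (K.filter fun A => A ⊆ F) = ∅ := by
          rw [← Finset.card_eq_zero]; unfold cnt at hZ; exact_mod_cast hZ
        exact Finset.notMem_empty A (h3 ▸ Finset.mem_filter.2 ⟨hA, h.1.trans h.2⟩)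
      rw [this]; ring
    · generalize ∑ A ∈ K, (if A ⊆ G ∧ G ⊆ F then ((1 - β) ^ (G \ A).card * β ^ (F \ G).card) else 0) = S
      field_simp
  simp_rw [e1]
  rw [← Finset.mul_sum, Finset.sum_comm]
  unfold mixLaw
  congr 1
  refine Finset.sum_congr rfl fun A hA => ?_
  by_cases hAG : A ⊆ G
  · rw [if_pos hAG]
    have h2 := sum_interval (Finset.subset_univ G) (s * β) (1 - s)
    have e : s * β + (1 - s) = 1 - s * (1 - β) := by ring
    rw [e] at h2
    rw [← h2, Finset.mul_sum]
    refine Finset.sum_congr rfl fun F _ => ?_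
    by_cases hF : G ⊆ F
    · simp only [hAG, hF, and_self, if_true, Finset.subset_univ, mul_pow]
      have e3 := Finset.card_sdiff_add_card_eq_card hF
      have e4 := Finset.card_sdiff_add_card_eq_card hAG
      have e5 := Finset.card_sdiff_add_card_eq_card (hAG.trans hF)
      have : (F \ A).card = (F \ G).card + (G \ A).card := by omega
      rw [this, pow_add]; ring
    · simp [hF]
  · rw [if_neg hAG]
    exact Finset.sum_eq_zero fun F _ => if_neg fun h => hAG h.1

lemma mixLaw_one (K : Finset (Finset α)) (hK : K.Nonempty) : mixLaw K 1 = gnp 1 := by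
  funext F
  have : (K.card : ℝ) ≠ 0 := by exact_mod_cast hK.card_pos.ne'
  unfold mixLaw gnp thin
  by_cases hF : F = Finset.univ
  · subst hF; simp [this]
  · have h2 : (Finset.univ \ F).card ≠ 0 := by
      rw [Ne, Finset.card_eq_zero, Finset.sdiff_eq_empty_iff_subset]
      exact fun h => hF (Finset.univ_subset_iff.1 h)
    simp [h2]

lemma post_nonneg (K : Finset (Finset α)) {β : ℝ} (h0 : 0 ≤ β) (h1 : β ≤ 1) (F G : Finset α) :
    0 ≤ post K β F G := by
  have : 0 ≤ 1 - β := by linarith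
  refine mul_nonneg (inv_nonneg.2 (cnt_nonneg _ _)) (Finset.sum_nonneg fun A _ => ?_)
  split_ifs <;> positivity

lemma sum_post {K : Finset (Finset α)} (β : ℝ) {F : Finset α} (hF : cnt K F ≠ 0) :
    ∑ G, post K β F G = 1 := by
  unfold post
  rw [← Finset.mul_sum, Finset.sum_comm]
  have : ∀ A ∈ K, ∑ G : Finset α,
      (if A ⊆ G ∧ G ⊆ F then (1 - β) ^ (G \ A).card * β ^ (F \ G).card else 0) =
      if A ⊆ F then 1 else 0 := fun A _ => by
    split_ifs with h
    · rw [sum_interval h]; simp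
    · exact Finset.sum_eq_zero fun G _ => if_neg fun h2 => h (h2.1.trans h2.2)
  rw [Finset.sum_congr rfl this, Finset.sum_boole]
  exact inv_mul_cancel₀ hF

lemma pow_one_sub_ge {x : ℝ} (h1 : x ≤ 1) (m : ℕ) : 1 - m * x ≤ (1 - x) ^ m := by
  have := one_add_mul_le_pow (a := -x) (by linarith) m
  have e : 1 + -x = 1 - x := by ring
  rw [e] at this
  linarith

lemma sum_thin_far {F : Finset α} {x : ℝ} (h0 : 0 ≤ x) (h1 : x ≤ 1) :
    ∑ H : Finset α, (if H ⊆ F ∧ 2 ≤ (F \ H).card then thin (1 - x) F H else 0) ≤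
      (F.card : ℝ) ^ 2 * x ^ 2 := by
  have hs := sum_thin (1 - x) F
  have e : ∀ H : Finset α, thin (1 - x) F H =
      (if H ⊆ F ∧ 2 ≤ (F \ H).card then thin (1 - x) F H else 0) +
      ((if H = F then (1 - x) ^ F.card else 0) +
       ∑ a ∈ F, if H = F.erase a then (1 - x) ^ (F.card - 1) * x else 0) := by
    intro H
    by_cases hH : H ⊆ F
    · rcases Nat.lt_or_ge (F \ H).card 2 with h2 | h2
      · rw [if_neg (by omega), zero_add]
        have h3 : (F \ H).card = 0 ∨ (F \ H).card = 1 := by omega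
        rcases h3 with h3 | h3
        · have : H = F := hH.antisymm (Finset.sdiff_eq_empty_iff_subset.1 (Finset.card_eq_zero.1 h3))
          subst this
          rw [if_pos rfl, Finset.sum_eq_zero]
          · simp [thin]
          · intro a ha
            rw [if_neg]
            intro h; exact Finset.notMem_erase a H (h ▸ ha)
        · obtain ⟨a, ha⟩ := Finset.card_eq_one.1 h3
          have haF : a ∈ F ∧ a ∉ H := by
            have : a ∈ F \ H := by rw [ha]; simp
            exact Finset.mem_sdiff.1 this
          have hHe : H = F.erase a := by
            rw [← Finset.sdiff_singleton_eq_erase, ← ha, Finset.sdiff_sdiff_eq_self hH]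
          have hne : H ≠ F := fun h => haF.2 (h ▸ haF.1)
          rw [if_neg hne, zero_add, Finset.sum_eq_single a]
          · rw [if_pos hHe]
            unfold thin
            rw [if_pos hH, h3]
            have := Finset.card_sdiff_add_card_eq_card hH
            have e : F.card - 1 = H.card := by omega
            rw [e]; ring
          · intro b hb hba
            rw [if_neg]
            intro h
            apply hba
            by_contra hne
            have : b ∈ H := hHe ▸ Finset.mem_erase.2 ⟨hne, hb⟩
            rw [h] at this
            exact Finset.notMem_erase b F this
          · intro h; exact absurd haF.1 h
      · rw [if_pos ⟨hH, h2⟩]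
        have hne : H ≠ F := by rintro rfl; simp at h2
        rw [if_neg hne, Finset.sum_eq_zero]
        · ring
        · intro a ha
          rw [if_neg]
          rintro rfl
          have := Finset.card_sdiff_add_card_eq_card hH
          rw [Finset.card_erase_of_mem ha] at this
          omega
    · have hne : H ≠ F := by rintro rfl; exact hH subset_rfl
      rw [if_neg (fun h => hH h.1), if_neg hne, Finset.sum_eq_zero]
      · simp [thin, hH]
      · intro a ha
        rw [if_neg]
        rintro rfl
        exact hH (Finset.erase_subset _ _)
  rw [Finset.sum_congr rfl (fun H _ => e H), Finset.sum_add_distrib, Finset.sum_add_distrib] at hs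
  have e2 : ∑ H : Finset α, ∑ a ∈ F, (if H = F.erase a then (1 - x) ^ (F.card - 1) * x else 0) =
      F.card * ((1 - x) ^ (F.card - 1) * x) := by
    rw [Finset.sum_comm]; simp
  rw [e2] at hs
  simp only [Finset.sum_ite_eq', Finset.mem_univ, if_true] at hs
  rcases Nat.eq_zero_or_pos F.card with h | h
  · rw [h] at hs ⊢; simp at hs ⊢; linarith
  · obtain ⟨m, hm⟩ : ∃ m, F.card = m + 1 := ⟨F.card - 1, by omega⟩
    rw [hm] at hs ⊢
    simp only [Nat.add_sub_cancel] at hs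
    have hb := pow_one_sub_ge h1 m
    have : (1 - m * x) * (1 + m * x) ≤ (1 - x) ^ m * (1 + m * x) :=
      mul_le_mul_of_nonneg_right hb (by positivity)
    rw [pow_succ] at hs
    push_cast at hs ⊢
    nlinarith [sq_nonneg x, mul_nonneg (sq_nonneg x) (Nat.cast_nonneg (α := ℝ) m)]

/-- One step of the gradual sampling: keeping each element of `F` independently dominates the
posterior kernel as long as no element of `F` is too likely to be in the hidden member. -/
lemma one_step {K : Finset (Finset α)} {β r : ℝ}
    (hβ0 : 0 ≤ β) (hβ1 : β ≤ 1) (hr0 : 0 ≤ r) (hr1 : r ≤ 1) {F : Finset α}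
    (hZ : cnt K F ≠ 0) (hF : ∀ e ∈ F, cntMem K e F ≤ r * cnt K F) :
    Dom (2 * (Fintype.card α : ℝ) ^ 2 * β ^ 2) (post K β F) (thin (1 - β * (1 - r)) F) := by
  have hx0 : 0 ≤ β * (1 - r) := mul_nonneg hβ0 (by linarith)
  have hx1 : β * (1 - r) ≤ β := by nlinarith
  have hN : (F.card : ℝ) ≤ Fintype.card α := by exact_mod_cast Finset.card_le_univ F
  set x := β * (1 - r) with hx
  refine (Dom.of_subset_support (F := F) (post_nonneg K hβ0 hβ1 F) (thin_nonneg (by linarith) (by linarith) F)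
    (sum_post β hZ) (sum_thin _ _) ?_).mono ?_
  · intro H hH
    unfold post
    rw [Finset.sum_eq_zero, mul_zero]
    exact fun A _ => if_neg fun h => hH h.2
  have key : ∀ H : Finset α, (if H = F then 0 else max (thin (1 - x) F H - post K β F H) 0) ≤
      (if H ⊆ F ∧ 2 ≤ (F \ H).card then thin (1 - x) F H else 0) +
      ∑ a ∈ F, if H = F.erase a then (Fintype.card α : ℝ) * β ^ 2 else 0 := by
    intro H
    have hs0 : ∀ a ∈ F, (0:ℝ) ≤ if H = F.erase a then (Fintype.card α : ℝ) * β ^ 2 else 0 := fun a _ => by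
      split_ifs <;> positivity
    have hp := post_nonneg K hβ0 hβ1 F H
    have ht := thin_nonneg (p := 1 - x) (by linarith) (by linarith) F H
    have hs := Finset.sum_nonneg hs0
    by_cases hHF : H = F
    · rw [if_pos hHF]
      split_ifs <;> linarith
    rw [if_neg hHF]
    by_cases hH : H ⊆ F
    · by_cases h2 : 2 ≤ (F \ H).card
      · rw [if_pos ⟨hH, h2⟩]
        refine le_trans (max_le (by linarith) ht) (le_add_of_nonneg_right hs)
      · rw [if_neg (by tauto), zero_add]
        have h1 : (F \ H).card = 1 := by
          have : (F \ H).card ≠ 0 := by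
            rw [Ne, Finset.card_eq_zero, Finset.sdiff_eq_empty_iff_subset]
            exact fun h => hHF (hH.antisymm h)
          omega
        obtain ⟨a, ha⟩ := Finset.card_eq_one.1 h1
        have haF : a ∈ F ∧ a ∉ H := by
          have : a ∈ F \ H := by rw [ha]; simp
          exact Finset.mem_sdiff.1 this
        have hHe : H = F.erase a := by
          rw [← Finset.sdiff_singleton_eq_erase, ← ha, Finset.sdiff_sdiff_eq_self hH]
        refine le_trans ?_ (Finset.single_le_sum hs0 haF.1)
        rw [if_pos hHe]
        refine max_le ?_ (by positivity)
        have ht1 : thin (1 - x) F H ≤ x := by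
          unfold thin
          rw [if_pos hH, h1, pow_one]
          have : (1 - x) ^ H.card ≤ 1 := pow_le_one₀ (by linarith) (by linarith)
          nlinarith
        have hp1 : (1 - r) * β * (1 - Fintype.card α * β) ≤ post K β F H := by
          have hcnt : (1 - r) * cnt K F ≤ ((K.filter fun A => A ⊆ H).card : ℝ) := by
            have e : (K.filter fun A => A ⊆ F).card =
                (K.filter fun A => A ⊆ F ∧ a ∈ A).card + (K.filter fun A => A ⊆ H).card := by
              rw [← Finset.card_union_of_disjoint]
              · congr 1
                ext A
                simp only [Finset.mem_filter, Finset.mem_union, hHe, Finset.subset_erase]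
                tauto
              · rw [Finset.disjoint_filter]
                rintro A _ h1 h2
                exact haF.2 (h2 h1.2)
            have e' : cnt K F = cntMem K a F + ((K.filter fun A => A ⊆ H).card : ℝ) := by
              unfold cnt cntMem; exact_mod_cast e
            have := hF a haF.1
            linarith
          have hc : ((K.filter fun A => A ⊆ H).card : ℝ) * (β * (1 - Fintype.card α * β)) ≤
              ∑ A ∈ K, if A ⊆ H ∧ H ⊆ F then (1 - β) ^ (H \ A).card * β ^ (F \ H).card else 0 := by
            rw [← Finset.sum_filter]
            simp only [hH, and_true, h1, pow_one]
            rw [← nsmul_eq_mul, ← Finset.sum_const]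
            refine Finset.sum_le_sum fun A _ => ?_
            have h5 := pow_one_sub_ge hβ1 (H \ A).card
            have h6 : ((H \ A).card : ℝ) ≤ Fintype.card α := by
              exact_mod_cast Finset.card_le_univ _
            have h7 : (1 - Fintype.card α * β) ≤ (1 - β) ^ (H \ A).card :=
              le_trans (by nlinarith) h5
            nlinarith
          have hZ' : 0 < cnt K F := lt_of_le_of_ne (cnt_nonneg _ _) (Ne.symm hZ)
          unfold post
          rw [inv_mul_eq_div, le_div_iff₀ hZ']
          rcases le_total 0 (1 - Fintype.card α * β) with hn | hn
          · have : 0 ≤ β * (1 - Fintype.card α * β) := mul_nonneg hβ0 hn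
            nlinarith
          · refine le_trans ?_ (Finset.sum_nonneg fun A _ => ?_)
            · have : 0 ≤ (1 - r) * β * cnt K F := mul_nonneg (mul_nonneg (by linarith) hβ0) hZ'.le
              nlinarith
            · have : 0 ≤ 1 - β := by linarith
              split_ifs <;> positivity
        have h8 : x * β ≤ β ^ 2 := by nlinarith
        have hNn : (0:ℝ) ≤ Fintype.card α := Nat.cast_nonneg _
        have : (1 - r) * β * (1 - Fintype.card α * β) = x - Fintype.card α * (x * β) := by rw [hx]; ring
        nlinarith
    · rw [if_neg (fun h => hH h.1), zero_add]
      have : thin (1 - x) F H = 0 := if_neg hH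
      rw [this]
      exact le_trans (max_le (by linarith) le_rfl) hs
  refine (Finset.sum_le_sum fun H _ => key H).trans ?_
  rw [Finset.sum_add_distrib]
  have h1 := sum_thin_far (F := F) hx0 (hx1.trans hβ1)
  have e2 : ∑ H : Finset α, ∑ a ∈ F, (if H = F.erase a then (Fintype.card α : ℝ) * β ^ 2 else 0) =
      F.card * ((Fintype.card α : ℝ) * β ^ 2) := by
    rw [Finset.sum_comm]; simp
  rw [e2]
  have h3 : (F.card : ℝ) ^ 2 * x ^ 2 ≤ (Fintype.card α : ℝ) ^ 2 * β ^ 2 := by gcongr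
  have h4 : F.card * ((Fintype.card α : ℝ) * β ^ 2) ≤ Fintype.card α * ((Fintype.card α : ℝ) * β ^ 2) :=
    mul_le_mul_of_nonneg_right hN (by positivity)
  linarith

end Family

section Family

variable {α : Type*} [Fintype α] [DecidableEq α]

lemma cntMem_le_of_odds {K : Finset (Finset α)} {F : Finset α} {e : α} {s κ : ℝ} (hs : 0 < s)
    (hκ0 : 0 ≤ κ) (hκ1 : κ < 1)
    (h : s * cntMem K e F ≤ κ / (1 - κ) * (cnt K F - cntMem K e F)) :
    cntMem K e F ≤ κ / (κ + (1 - κ) * s) * cnt K F := by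
  have h1 : 0 < 1 - κ := by linarith
  have h2 : 0 < κ + (1 - κ) * s := by positivity
  rw [div_mul_eq_mul_div, le_div_iff₀ h1] at h
  rw [div_mul_eq_mul_div, le_div_iff₀ h2]
  linarith

/-- `F` contains an element that is too likely to be in the hidden member of `K`. -/
def BadOdds (K : Finset (Finset α)) (s o : ℝ) (F : Finset α) : Prop :=
  ∃ e ∈ F, o * (cnt K F - cntMem K e F) < s * cntMem K e F

/-- The gradual sampling coupling. -/
theorem dom_of_badOdds {K : Finset (Finset α)} {k : ℕ} (hk : ∀ A ∈ K, A.card = k)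
    (hK : K.Nonempty) {κ sₑ ω β : ℝ} (hκ0 : 0 ≤ κ) (hκ1 : κ < 1) (hs : 0 < sₑ) (hβ0 : 0 ≤ β)
    (hβ1 : β ≤ 1) (R : ℕ) (hR : (1 - β) ^ R = sₑ)
    (hbad : ∀ s, sₑ ≤ s → s ≤ 1 →
      ∑ F, (if BadOdds K s (κ / (1 - κ)) F then mixLaw K s F else 0) ≤ ω) :
    Dom (R * (ω + 2 * (Fintype.card α : ℝ) ^ 2 * β ^ 2)) (unif K) (gnp (κ + (1 - κ) * sₑ)) := by
  have hb1 : 0 ≤ 1 - β := by linarith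
  have hb2 : 1 - β ≤ 1 := by linarith
  have main : ∀ ρ ≤ R, Dom (ρ * (ω + 2 * (Fintype.card α : ℝ) ^ 2 * β ^ 2))
      (mixLaw K ((1 - β) ^ ρ)) (gnp (κ + (1 - κ) * (1 - β) ^ ρ)) := by
    intro ρ
    induction ρ with
    | zero =>
      intro _
      have := Dom.gnp_mono (α := α) (q := 1) (q' := 1) (by norm_num) le_rfl le_rfl
      simpa [mixLaw_one K hK] using this
    | succ ρ ih =>
      intro hρ
      have ih := ih (by omega)
      set s := (1 - β) ^ ρ with hsdef
      have hs1 : s ≤ 1 := pow_le_one₀ hb1 hb2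
      have hse : sₑ ≤ s := by rw [← hR]; exact pow_le_pow_of_le_one hb1 hb2 (by omega)
      have hs0 : 0 < s := hs.trans_le hse
      have hg : 0 < κ + (1 - κ) * s := by
        have : 0 < (1 - κ) * s := mul_pos (by linarith) hs0
        linarith
      set r := κ / (κ + (1 - κ) * s) with hr
      have hr0 : 0 ≤ r := div_nonneg hκ0 hg.le
      have hr1 : r ≤ 1 := by
        rw [hr, div_le_one hg]
        have : 0 < (1 - κ) * s := mul_pos (by linarith) hs0
        linarith
      have hx0 : 0 ≤ 1 - β * (1 - r) := by nlinarith
      have hx1 : 1 - β * (1 - r) ≤ 1 := by nlinarith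
      have h1 := ih.thinning hx0 hx1
      have h2 := Dom.mixture (mixLaw K s)
        (fun F => (if BadOdds K s (κ / (1 - κ)) F then 1 else 0) +
          2 * (Fintype.card α : ℝ) ^ 2 * β ^ 2) (post K β) (thin (1 - β * (1 - r)))
        (mixLaw_nonneg K hs0.le hs1) (fun F hF => by
          have hZ : cnt K F ≠ 0 := fun h => hF (by rw [mixLaw_eq hk, h]; simp)
          by_cases hB : BadOdds K s (κ / (1 - κ)) F
          · refine (Dom.indep (post_nonneg K hβ0 hβ1 F) (thin_nonneg hx0 hx1 F) (sum_post β hZ)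
              (sum_thin _ _)).mono ?_
            rw [if_pos hB]
            have : 0 ≤ 2 * (Fintype.card α : ℝ) ^ 2 * β ^ 2 := by positivity
            linarith
          · refine (one_step hβ0 hβ1 hr0 hr1 hZ fun e he => ?_).mono ?_
            · refine cntMem_le_of_odds hs0 hκ0 hκ1 ?_
              by_contra h
              exact hB ⟨e, he, not_le.1 h⟩
            · rw [if_neg hB]; linarith)
      have e1 : (fun G => ∑ F, mixLaw K s F * post K β F G) = mixLaw K ((1 - β) ^ (ρ + 1)) := by
        funext G
        rw [mixLaw_post hk, pow_succ]
      have e2 : (fun A : Finset α => ∑ F, gnp (κ + (1 - κ) * s) F * thin (1 - β * (1 - r)) F A) =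
          gnp (κ + (1 - κ) * (1 - β) ^ (ρ + 1)) := by
        funext A
        rw [gnp_thin, pow_succ, ← hsdef]
        congr 1
        rw [hr]; field_simp; ring
      rw [e1] at h2
      rw [e2] at h1
      refine (h2.trans h1).mono ?_
      simp_rw [mul_add]
      rw [Finset.sum_add_distrib, ← Finset.sum_mul, sum_mixLaw hK]
      have := hbad s hse hs1
      simp only [mul_ite, mul_one, mul_zero]
      push_cast
      linarith
  have h1 := main R le_rfl
  rw [hR] at h1
  have hs1 : sₑ ≤ 1 := by rw [← hR]; exact pow_le_one₀ hb1 hb2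
  have h0 : Dom 0 (unif K) (mixLaw K sₑ) := by
    have hs2 : 0 ≤ 1 - sₑ := by linarith
    refine ⟨fun A F => if A ∈ K ∧ A ⊆ F then (K.card : ℝ)⁻¹ * (sₑ ^ (F \ A).card *
      (1 - sₑ) ^ (Finset.univ \ F).card) else 0, fun A F => ?_, fun A => ?_, fun F => ?_, ?_⟩
    · beta_reduce
      split_ifs <;> positivity
    · unfold unif
      split_ifs with hA
      · have := sum_interval (Finset.subset_univ A) sₑ (1 - sₑ)
        simp only [Finset.subset_univ, and_true, add_sub_cancel, one_pow] at this
        simp only [hA, true_and]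
        have e : ∀ F : Finset α, (if A ⊆ F then (K.card : ℝ)⁻¹ * (sₑ ^ (F \ A).card *
            (1 - sₑ) ^ (Finset.univ \ F).card) else 0) = (K.card : ℝ)⁻¹ *
            if A ⊆ F then (sₑ ^ (F \ A).card * (1 - sₑ) ^ (Finset.univ \ F).card) else 0 :=
          fun F => by split_ifs <;> simp
        simp_rw [e]
        rw [← Finset.mul_sum, this, mul_one]
      · simp [hA]
    · unfold mixLaw
      rw [Finset.mul_sum, ← Finset.sum_filter_add_sum_filter_not Finset.univ (fun A => A ∈ K)]
      rw [Finset.sum_eq_zero (s := Finset.univ.filter fun A => A ∉ K)]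
      · rw [add_zero]
        refine Finset.sum_congr (by ext; simp) fun A hA => ?_
        by_cases h : A ⊆ F <;> simp [hA, h]
      · intro A hA
        rw [Finset.mem_filter] at hA
        simp [hA.2]
    · refine (Finset.sum_eq_zero fun A _ => Finset.sum_eq_zero fun F _ => ?_).le
      by_cases h : A ⊆ F <;> simp [h]
  simpa using h0.trans h1

/-- If a typical pair (hidden member, added set) lies in `T`, then for most unions `F` the
members of `K` inside `F` that are not typical form a small proportion. -/
lemma mixLaw_atypical {K : Finset (Finset α)} {k : ℕ} (hk : ∀ A ∈ K, A.card = k)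
    {s ω ω' : ℝ} (h0 : 0 ≤ s) (h1 : s ≤ 1) (hω : 0 < ω) (T : Finset α → Finset α → Prop)
    (hT : (K.card : ℝ)⁻¹ * ∑ A ∈ K, bpr Aᶜ s (fun E => ¬ T A E) ≤ ω') :
    ∑ F, (if ω * cnt K F < ((K.filter fun A => A ⊆ F ∧ ¬ T A (F \ A)).card : ℝ)
      then mixLaw K s F else 0) ≤ ω' / ω := by
  have hs2 : 0 ≤ 1 - s := by linarith
  rw [le_div_iff₀ hω]
  refine le_trans ?_ hT
  have e : ∀ A ∈ K, bpr Aᶜ s (fun E => ¬ T A E) = ∑ F : Finset α,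
      if A ⊆ F ∧ ¬ T A (F \ A) then s ^ (F \ A).card * (1 - s) ^ (Finset.univ \ F).card else 0 := by
    intro A _
    unfold bpr bexp
    rw [← Finset.sum_filter_add_sum_filter_not Finset.univ (fun F => A ⊆ F)]
    rw [Finset.sum_eq_zero (s := Finset.univ.filter fun F => ¬ A ⊆ F), add_zero]
    · refine Finset.sum_bij' (fun B _ => A ∪ B) (fun F _ => F \ A) ?_ ?_ ?_ ?_ ?_
      · intro B _; simp
      · intro F _
        rw [Finset.mem_powerset]
        intro x hx
        simp only [Finset.mem_sdiff] at hx
        simp [hx.2]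
      · intro B hB
        rw [Finset.mem_powerset] at hB
        rw [Finset.union_sdiff_left, Finset.sdiff_eq_self_iff_disjoint]
        exact Finset.disjoint_of_subset_left hB disjoint_compl_left
      · intro F hF
        simp only [Finset.mem_filter, Finset.mem_univ, true_and] at hF
        exact Finset.union_sdiff_of_subset hF
      · intro B hB
        rw [Finset.mem_powerset] at hB
        have e1 : (A ∪ B) \ A = B := by
          rw [Finset.union_sdiff_left, Finset.sdiff_eq_self_iff_disjoint]
          exact Finset.disjoint_of_subset_left hB disjoint_compl_left
        have e2 : Finset.univ \ (A ∪ B) = Aᶜ \ B := by ext; simp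
        rw [e1, e2]
        by_cases hT : T A B <;> simp [hT]
    · intro F hF
      simp only [Finset.mem_filter, Finset.mem_univ, true_and] at hF
      simp [hF]
  rw [Finset.sum_congr rfl e, Finset.sum_comm, Finset.sum_mul, Finset.mul_sum]
  refine Finset.sum_le_sum fun F _ => ?_
  have e3 : ∑ A ∈ K, (if A ⊆ F ∧ ¬ T A (F \ A) then s ^ (F \ A).card *
      (1 - s) ^ (Finset.univ \ F).card else 0) =
      ((K.filter fun A => A ⊆ F ∧ ¬ T A (F \ A)).card : ℝ) * (s ^ (F.card - k) *
      (1 - s) ^ (Finset.univ \ F).card) := by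
    rw [← Finset.sum_filter, ← nsmul_eq_mul, ← Finset.sum_const]
    refine Finset.sum_congr rfl fun A hA => ?_
    rw [Finset.mem_filter] at hA
    rw [Finset.card_sdiff_of_subset hA.2.1, hk A hA.1]
  rw [e3]
  split_ifs with h
  · rw [mixLaw_eq hk, mul_assoc]
    refine mul_le_mul_of_nonneg_left ?_ (by positivity)
    have : 0 ≤ s ^ (F.card - k) * (1 - s) ^ (Finset.univ \ F).card := by positivity
    nlinarith
  · rw [zero_mul]; positivity

end Family

section Typical

variable {α : Type*} [Fintype α] [DecidableEq α]

/-- The gradual sampling coupling, with quantitative parameters. -/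
theorem dom_of_typical {K : Finset (Finset α)} {k m : ℕ} (hm : 2 ≤ m)
    (hcard : Fintype.card α ≤ m ^ 2) (hk : ∀ A ∈ K, A.card = k)
    (hK : K.Nonempty) {κ sₑ : ℝ} (hκ0 : 0 ≤ κ) (hκ1 : κ < 1) (hs : 1 / (m : ℝ) ≤ sₑ)
    (hs1 : sₑ ≤ 1) (T : ℝ → Finset α → Finset α → Prop) (ρ : ℝ → ℝ)
    (hT : ∀ s, sₑ ≤ s → s ≤ 1 →
      (K.card : ℝ)⁻¹ * ∑ A ∈ K, bpr Aᶜ s (fun E => ¬ T s A E) ≤ 1 / (m : ℝ) ^ 7)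
    (hodds : ∀ s, sₑ ≤ s → s ≤ 1 → ∀ F, ∀ e ∈ F,
      ((K.filter fun A => A ⊆ F ∧ e ∈ A ∧ T s A (F \ A)).card : ℝ) ≤
        ρ s * ((K.filter fun A => A ⊆ F ∧ e ∉ A).card : ℝ))
    (hρ : ∀ s, sₑ ≤ s → s ≤ 1 → s * (ρ s + 1 / m) ≤ κ / (1 - κ) * (1 - 1 / m)) :
    Dom (1 / (m : ℝ) + 2 * Real.log m ^ 2 / m) (unif K) (gnp (κ + (1 - κ) * sₑ)) := by
  have hm0 : (0 : ℝ) < m := by positivity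
  have hm2 : (2 : ℝ) ≤ m := by exact_mod_cast hm
  have hs0 : 0 < sₑ := lt_of_lt_of_le (by positivity) hs
  set R : ℕ := m ^ 5 with hR
  have hR0 : (0 : ℝ) < (R : ℝ) := by rw [hR]; positivity
  have hRne : R ≠ 0 := by rw [hR]; positivity
  set β : ℝ := 1 - sₑ ^ ((R : ℝ)⁻¹) with hβ
  have hpow : (1 - β) ^ R = sₑ := by
    rw [hβ, sub_sub_cancel, Real.rpow_inv_natCast_pow hs0.le hRne]
  have hβ0 : 0 ≤ β := by
    have : sₑ ^ ((R : ℝ)⁻¹) ≤ 1 := Real.rpow_le_one hs0.le hs1 (by positivity)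
    linarith
  have hβ1 : β ≤ 1 := by
    have : 0 ≤ sₑ ^ ((R : ℝ)⁻¹) := by positivity
    linarith
  have hβR : β ≤ Real.log m / R := by
    have h1 : Real.log sₑ * (R : ℝ)⁻¹ + 1 ≤ sₑ ^ ((R : ℝ)⁻¹) := by
      rw [Real.rpow_def_of_pos hs0]; exact Real.add_one_le_exp _
    have h2 : - Real.log m ≤ Real.log sₑ := by
      rw [← Real.log_inv]
      exact Real.log_le_log (by positivity) (by rwa [← one_div])
    have h3 : - Real.log m * (R : ℝ)⁻¹ ≤ Real.log sₑ * (R : ℝ)⁻¹ :=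
      mul_le_mul_of_nonneg_right h2 (by positivity)
    rw [div_eq_mul_inv]
    linarith
  refine (dom_of_badOdds hk hK hκ0 hκ1 hs0 hβ0 hβ1 R hpow (ω := 1 / (m : ℝ) ^ 7 / (1 / m))
    ?_).mono ?_
  · intro s h1 h2
    refine le_trans (Finset.sum_le_sum fun F _ => ?_)
      (mixLaw_atypical hk (hs0.le.trans h1) h2 (by positivity) (T s) (hT s h1 h2))
    have hnn := mixLaw_nonneg K (hs0.le.trans h1) h2 F
    by_cases hF : 1 / (m : ℝ) * cnt K F < ((K.filter fun A => A ⊆ F ∧ ¬ T s A (F \ A)).card : ℝ)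
    · rw [if_pos hF]; split_ifs <;> linarith
    rw [if_neg hF, if_neg]
    rintro ⟨e, he, hlt⟩
    have h3 := hodds s h1 h2 F e he
    have h4 : (K.filter fun A => A ⊆ F ∧ e ∈ A).card ≤
        (K.filter fun A => A ⊆ F ∧ e ∈ A ∧ T s A (F \ A)).card +
        (K.filter fun A => A ⊆ F ∧ ¬ T s A (F \ A)).card := by
      refine le_trans (Finset.card_le_card ?_) (Finset.card_union_le _ _)
      intro A
      simp only [Finset.mem_filter, Finset.mem_union]
      tauto
    have h5 : (K.filter fun A => A ⊆ F).card = (K.filter fun A => A ⊆ F ∧ e ∈ A).card +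
        (K.filter fun A => A ⊆ F ∧ e ∉ A).card := by
      rw [← Finset.card_union_of_disjoint]
      · congr 1; ext A; simp only [Finset.mem_filter, Finset.mem_union]; tauto
      · rw [Finset.disjoint_filter]; tauto
    have h4' : ((K.filter fun A => A ⊆ F ∧ e ∈ A).card : ℝ) ≤
        ((K.filter fun A => A ⊆ F ∧ e ∈ A ∧ T s A (F \ A)).card : ℝ) +
        ((K.filter fun A => A ⊆ F ∧ ¬ T s A (F \ A)).card : ℝ) := by exact_mod_cast h4
    have h5' : ((K.filter fun A => A ⊆ F).card : ℝ) =
        ((K.filter fun A => A ⊆ F ∧ e ∈ A).card : ℝ) +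
        ((K.filter fun A => A ⊆ F ∧ e ∉ A).card : ℝ) := by exact_mod_cast h5
    unfold cnt cntMem at hlt
    unfold cnt at hF
    rw [not_lt] at hF
    have h6 := hρ s h1 h2
    set X : ℝ := ((K.filter fun A => A ⊆ F ∧ e ∈ A).card : ℝ) with hX
    set Y : ℝ := ((K.filter fun A => A ⊆ F ∧ e ∉ A).card : ℝ) with hY
    have hY0 : 0 ≤ Y := Nat.cast_nonneg _
    rw [h5', add_sub_cancel_left] at hlt
    rw [h5'] at hF
    set w : ℝ := 1 / (m : ℝ) with hw
    have hw1 : w < 1 := by rw [hw, div_lt_one hm0]; linarith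
    have h7 : X * (1 - w) ≤ (ρ s + w) * Y := by nlinarith
    have hs' : 0 ≤ s := hs0.le.trans h1
    have h8 : s * X * (1 - w) ≤ κ / (1 - κ) * Y * (1 - w) :=
      calc s * X * (1 - w) = s * (X * (1 - w)) := by ring
        _ ≤ s * ((ρ s + w) * Y) := mul_le_mul_of_nonneg_left h7 hs'
        _ = s * (ρ s + w) * Y := by ring
        _ ≤ κ / (1 - κ) * (1 - w) * Y := mul_le_mul_of_nonneg_right h6 hY0
        _ = κ / (1 - κ) * Y * (1 - w) := by ring
    have := le_of_mul_le_mul_right h8 (by linarith)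
    linarith
  · have hN : (Fintype.card α : ℝ) ≤ (m : ℝ) ^ 2 := by exact_mod_cast hcard
    have e1 : (R : ℝ) = (m : ℝ) ^ 5 := by rw [hR]; push_cast; ring
    have hl : 0 ≤ Real.log m := Real.log_nonneg (by linarith)
    have h1 : 2 * (Fintype.card α : ℝ) ^ 2 * β ^ 2 ≤
        2 * ((m : ℝ) ^ 2) ^ 2 * (Real.log m / R) ^ 2 := by gcongr
    have h2 : (R : ℝ) * (1 / (m : ℝ) ^ 7 / (1 / m) + 2 * (Fintype.card α : ℝ) ^ 2 * β ^ 2) ≤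
        R * (1 / (m : ℝ) ^ 7 / (1 / m) + 2 * ((m : ℝ) ^ 2) ^ 2 * (Real.log m / R) ^ 2) := by
      gcongr
    refine h2.trans (le_of_eq ?_)
    rw [e1]
    field_simp

end Typical

/-! ### Graphs as edge sets -/

/-- The pairs of distinct vertices. -/
def Edge (n : ℕ) : Type := {e : Sym2 (Fin n) // ¬ e.IsDiag}

instance : Fintype (Edge n) := inferInstanceAs (Fintype {e : Sym2 (Fin n) // ¬ e.IsDiag})

instance : DecidableEq (Edge n) :=
  inferInstanceAs (DecidableEq {e : Sym2 (Fin n) // ¬ e.IsDiag})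

/-- Adjacency in the graph with edge set `A`. -/
def adj (A : Finset (Edge n)) (u v : Fin n) : Prop := ∃ e ∈ A, e.1 = s(u, v)

/-- The neighbours of `v`. -/
def nb (A : Finset (Edge n)) (v : Fin n) : Finset (Fin n) := Finset.univ.filter fun u => adj A v u

/-- The degree of `v`. -/
def dg (A : Finset (Edge n)) (v : Fin n) : ℕ := (nb A v).card

/-- The adjacency matrix. -/
def am (A : Finset (Edge n)) (u v : Fin n) : ℝ := if adj A u v then 1 else 0

/-- The `k`-regular graphs. -/
def regs (n k : ℕ) : Finset (Finset (Edge n)) := Finset.univ.filter fun A => ∀ v, dg A v = k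

lemma mem_regs {k : ℕ} {A : Finset (Edge n)} : A ∈ regs n k ↔ ∀ v, dg A v = k := by
  simp [regs]

lemma adj_symm {A : Finset (Edge n)} {u v : Fin n} (h : adj A u v) : adj A v u := by
  obtain ⟨e, he, h⟩ := h
  exact ⟨e, he, by rw [h, Sym2.eq_swap]⟩

lemma adj_comm {A : Finset (Edge n)} {u v : Fin n} : adj A u v ↔ adj A v u :=
  ⟨adj_symm, adj_symm⟩

lemma adj_ne {A : Finset (Edge n)} {u v : Fin n} (h : adj A u v) : u ≠ v := by
  obtain ⟨e, he, h⟩ := h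
  rintro rfl
  exact e.2 (by rw [h]; simp)

lemma adj_irrefl {A : Finset (Edge n)} {u : Fin n} : ¬ adj A u u := fun h => adj_ne h rfl

/-- The edge joining two distinct vertices. -/
def mkE (u v : Fin n) (h : u ≠ v) : Edge n := ⟨s(u, v), by simpa using h⟩

lemma adj_iff_mem {A : Finset (Edge n)} {u v : Fin n} (h : u ≠ v) :
    adj A u v ↔ mkE u v h ∈ A := by
  constructor
  · rintro ⟨e, he, h2⟩
    have : e = mkE u v h := Subtype.ext h2
    rwa [← this]
  · intro h2
    exact ⟨_, h2, rfl⟩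

lemma Edge.exists_mk (e : Edge n) : ∃ u v, ∃ h : u ≠ v, e = mkE u v h := by
  obtain ⟨e, he⟩ := e
  induction e using Sym2.ind with
  | _ u v => exact ⟨u, v, by simpa using he, rfl⟩

lemma subset_iff_adj {A B : Finset (Edge n)} : A ⊆ B ↔ ∀ u v, adj A u v → adj B u v := by
  constructor
  · rintro h u v ⟨e, he, h2⟩
    exact ⟨e, h he, h2⟩
  · intro h e he
    obtain ⟨u, v, huv, rfl⟩ := e.exists_mk
    exact (adj_iff_mem huv).1 (h u v ((adj_iff_mem huv).2 he))

lemma adj_union {A B : Finset (Edge n)} {u v : Fin n} :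
    adj (A ∪ B) u v ↔ adj A u v ∨ adj B u v := by
  by_cases h : u = v
  · subst h; simp [adj_irrefl]
  · simp [adj_iff_mem h]

lemma adj_sdiff {A B : Finset (Edge n)} {u v : Fin n} :
    adj (A \ B) u v ↔ adj A u v ∧ ¬ adj B u v := by
  by_cases h : u = v
  · subst h; simp [adj_irrefl]
  · simp [adj_iff_mem h]

lemma adj_compl {A : Finset (Edge n)} {u v : Fin n} :
    adj Aᶜ u v ↔ u ≠ v ∧ ¬ adj A u v := by
  by_cases h : u = v
  · subst h; simp [adj_irrefl]
  · simp [adj_iff_mem h, h]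

lemma mem_nb {A : Finset (Edge n)} {u v : Fin n} : u ∈ nb A v ↔ adj A v u := by simp [nb]

lemma am_comm (A : Finset (Edge n)) (u v : Fin n) : am A u v = am A v u := by
  unfold am; simp only [adj_comm]

lemma am_nonneg (A : Finset (Edge n)) (u v : Fin n) : 0 ≤ am A u v := by
  unfold am; split_ifs <;> norm_num

lemma am_le_one (A : Finset (Edge n)) (u v : Fin n) : am A u v ≤ 1 := by
  unfold am; split_ifs <;> norm_num

lemma am_self (A : Finset (Edge n)) (u : Fin n) : am A u u = 0 := by
  simp [am, adj_irrefl]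

lemma am_mono {A B : Finset (Edge n)} (h : A ⊆ B) (u v : Fin n) : am A u v ≤ am B u v := by
  unfold am
  by_cases hA : adj A u v
  · simp [hA, subset_iff_adj.1 h u v hA]
  · simp only [hA, if_false]; split_ifs <;> norm_num

lemma sum_am (A : Finset (Edge n)) (v : Fin n) : ∑ u, am A v u = dg A v := by
  simp [am, dg, nb]

lemma sum_mul_am (A : Finset (Edge n)) (v : Fin n) (f : Fin n → ℝ) :
    ∑ u, am A v u * f u = ∑ u ∈ nb A v, f u := by
  simp [am, nb, Finset.sum_filter]

lemma am_compl (A : Finset (Edge n)) (u v : Fin n) :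
    am Aᶜ u v = 1 - (if u = v then 1 else 0) - am A u v := by
  unfold am
  by_cases h : u = v
  · subst h; simp [adj_irrefl]
  · by_cases hA : adj A u v <;> simp [adj_compl, h, hA]

lemma dg_compl (A : Finset (Edge n)) (v : Fin n) : (dg Aᶜ v : ℝ) = n - 1 - dg A v := by
  rw [← sum_am, ← sum_am]
  simp [am_compl, Finset.sum_sub_distrib]

lemma am_sdiff {A B : Finset (Edge n)} (h : B ⊆ A) (u v : Fin n) :
    am (A \ B) u v = am A u v - am B u v := by
  have := subset_iff_adj.1 h u v
  unfold am
  by_cases hA : adj A u v <;> by_cases hB : adj B u v <;> simp [adj_sdiff, hA, hB]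
  exact absurd (this hB) hA

lemma am_union {A B : Finset (Edge n)} (h : Disjoint A B) (u v : Fin n) :
    am (A ∪ B) u v = am A u v + am B u v := by
  have e : A = (A ∪ B) \ B := by
    rw [Finset.union_sdiff_right, Finset.sdiff_eq_self_of_disjoint h]
  have := am_sdiff (A := A ∪ B) Finset.subset_union_right u v
  rw [← e] at this
  linarith

/-- The symmetrised weight of an edge. -/
def wt (c : Fin n → Fin n → ℝ) (e : Edge n) : ℝ :=
  Sym2.lift ⟨fun u v => c u v + c v u, fun _ _ => add_comm _ _⟩ e.1

lemma wt_mkE (c : Fin n → Fin n → ℝ) (u v : Fin n) (h : u ≠ v) :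
    wt c (mkE u v h) = c u v + c v u := rfl

lemma sum_wt (A : Finset (Edge n)) (c : Fin n → Fin n → ℝ) :
    ∑ e ∈ A, wt c e = ∑ u, ∑ v, c u v * am A u v := by
  have e1 : ∀ u v, am A u v = ∑ e ∈ A, if e.1 = s(u, v) then (1 : ℝ) else 0 := by
    intro u v
    by_cases h : u = v
    · subst h
      rw [am_self, Finset.sum_eq_zero]
      intro e _
      rw [if_neg]
      intro h
      exact e.2 (by rw [h]; simp)
    · have : ∀ e : Edge n, (e.1 = s(u, v)) ↔ e = mkE u v h := fun e =>
        ⟨fun h2 => Subtype.ext h2, fun h2 => by rw [h2]; rfl⟩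
      simp only [this, Finset.sum_ite_eq', am, adj_iff_mem h]
  simp_rw [e1, Finset.mul_sum]
  rw [Finset.sum_congr rfl (fun u _ => Finset.sum_comm), Finset.sum_comm]
  refine Finset.sum_congr rfl fun e _ => ?_
  obtain ⟨a, b, hab, rfl⟩ := e.exists_mk
  rw [wt_mkE]
  have : ∀ u v, c u v * (if (mkE a b hab).1 = s(u, v) then (1 : ℝ) else 0) =
      (if u = a then (if v = b then c a b else 0) else 0) +
      (if u = b then (if v = a then c b a else 0) else 0) := by
    intro u v
    have : ((mkE a b hab).1 = s(u, v)) ↔ (u = a ∧ v = b) ∨ (u = b ∧ v = a) := by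
      simp only [mkE, Sym2.eq_iff]; tauto
    simp only [this]
    clear e1 this
    have hab' := hab.symm
    by_cases h1 : u = a
    · subst h1
      by_cases h2 : v = b
      · subst h2; simp [hab]
      · simp [hab, h2]
    · by_cases h3 : u = b
      · subst h3
        by_cases h4 : v = a
        · subst h4; simp [h1]
        · simp [h1, h4]
      · simp [h1, h3]
  simp_rw [this, Finset.sum_add_distrib]
  simp

lemma card_edge_le : Fintype.card (Edge n) ≤ n ^ 2 := by
  classical
  have h : Function.Surjective (fun p : {p : Fin n × Fin n // p.1 ≠ p.2} => mkE p.1.1 p.1.2 p.2) :=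
    fun e => by
      obtain ⟨a, b, hab, rfl⟩ := e.exists_mk
      exact ⟨⟨(a, b), hab⟩, rfl⟩
  refine (Fintype.card_le_of_surjective _ h).trans ((Fintype.card_subtype_le _).trans ?_)
  simp [sq]

lemma two_mul_card (A : Finset (Edge n)) : 2 * A.card = ∑ v, dg A v := by
  have := sum_wt A (fun _ _ => 1)
  simp only [one_mul, sum_am] at this
  have h2 : ∀ e : Edge n, wt (fun _ _ => 1) e = 2 := fun e => by
    obtain ⟨a, b, hab, rfl⟩ := e.exists_mk
    rw [wt_mkE]; norm_num
  simp only [h2, Finset.sum_const, nsmul_eq_mul] at this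
  have h3 : ((A.card * 2 : ℕ) : ℝ) = ((∑ v, dg A v : ℕ) : ℝ) := by push_cast; exact this
  have := Nat.cast_injective h3
  omega

lemma card_of_mem_regs {k : ℕ} {A : Finset (Edge n)} (h : A ∈ regs n k) : A.card = n * k / 2 := by
  have h1 := two_mul_card A
  simp only [mem_regs.1 h, Finset.sum_const, Finset.card_univ, Fintype.card_fin,
    smul_eq_mul] at h1
  omega

/-- Tail bound for a linear statistic of the adjacency matrix of a random subgraph. -/
lemma bpr_am_abs {X : Finset (Edge n)} {p : ℝ} (h0 : 0 ≤ p) (h1 : p ≤ 1) (c : Fin n → Fin n → ℝ)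
    (τ t : ℝ) (hτ : 0 ≤ τ) (hc : ∀ u v, adj X u v → |τ * (c u v + c v u)| ≤ 1) :
    bpr X p (fun E => t ≤ |∑ u, ∑ v, c u v * am E u v - p * ∑ u, ∑ v, c u v * am X u v|) ≤
      2 * Real.exp (-(τ * t) + τ ^ 2 * (p * ∑ u, ∑ v, (c u v + c v u) ^ 2 / 2 * am X u v)) := by
  have h := bpr_linear_abs (X := X) h0 h1 (wt c) τ t hτ (fun e he => by
    obtain ⟨a, b, hab, rfl⟩ := e.exists_mk
    exact hc a b ((adj_iff_mem hab).2 he))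
  have e : ∀ e : Edge n, wt c e ^ 2 = wt (fun u v => (c u v + c v u) ^ 2 / 2) e := fun e => by
    obtain ⟨a, b, hab, rfl⟩ := e.exists_mk
    simp only [wt_mkE]; ring
  simp only [e, sum_wt] at h
  exact h

/-! ### Switchings along alternating cycles -/

section Switch

variable {l : ℕ}

/-- The set of edges `a i b i`. -/
def pairEdges {ι : Type*} (a b : ι → Fin n) : Finset (Edge n) :=
  Finset.univ.filter fun e => ∃ i, e.1 = s(a i, b i)

lemma adj_pairEdges {ι : Type*} {a b : ι → Fin n} (hab : ∀ i j, a i ≠ b j) {u v : Fin n} :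
    adj (pairEdges a b) u v ↔ ∃ i, (u = a i ∧ v = b i) ∨ (u = b i ∧ v = a i) := by
  constructor
  · rintro ⟨e, he, h⟩
    simp only [pairEdges, Finset.mem_filter, Finset.mem_univ, true_and] at he
    obtain ⟨i, hi⟩ := he
    rw [h, Sym2.eq_iff] at hi
    exact ⟨i, hi⟩
  · rintro ⟨i, ⟨rfl, rfl⟩ | ⟨rfl, rfl⟩⟩
    · exact ⟨mkE _ _ (hab i i), Finset.mem_filter.2 ⟨Finset.mem_univ _, i, rfl⟩, rfl⟩
    · exact ⟨mkE _ _ (hab i i), Finset.mem_filter.2 ⟨Finset.mem_univ _, i, rfl⟩, Sym2.eq_swap⟩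

lemma dg_pairEdges {ι : Type*} {a b : ι → Fin n} (ha : a.Injective) (hb : b.Injective)
    (hab : ∀ i j, a i ≠ b j) (u : Fin n) :
    dg (pairEdges a b) u = if (∃ i, a i = u) ∨ (∃ i, b i = u) then 1 else 0 := by
  split_ifs with h
  · rw [dg, Finset.card_eq_one]
    rcases h with ⟨i, rfl⟩ | ⟨i, rfl⟩
    · refine ⟨b i, ?_⟩
      ext v
      rw [mem_nb, adj_pairEdges hab, Finset.mem_singleton]
      constructor
      · rintro ⟨j, ⟨h1, h2⟩ | ⟨h1, h2⟩⟩
        · rw [ha h1]; exact h2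
        · exact absurd h1 (hab i j)
      · rintro rfl
        exact ⟨i, Or.inl ⟨rfl, rfl⟩⟩
    · refine ⟨a i, ?_⟩
      ext v
      rw [mem_nb, adj_pairEdges hab, Finset.mem_singleton]
      constructor
      · rintro ⟨j, ⟨h1, h2⟩ | ⟨h1, h2⟩⟩
        · exact absurd h1.symm (hab j i)
        · rw [hb h1]; exact h2
      · rintro rfl
        exact ⟨i, Or.inr ⟨rfl, rfl⟩⟩
  · rw [dg, Finset.card_eq_zero, Finset.eq_empty_iff_forall_notMem]
    intro v hv
    rw [mem_nb, adj_pairEdges hab] at hv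
    obtain ⟨i, ⟨h1, -⟩ | ⟨h1, -⟩⟩ := hv
    · exact h (Or.inl ⟨i, h1.symm⟩)
    · exact h (Or.inr ⟨i, h1.symm⟩)

/-- The alternating paths `a 0, b 0, a 1, …, b l` from `x` to `y`, with edges `a i b i` in `A`
and edges `b i a (i+1)` in `B`. -/
def pset (l : ℕ) (A B : Finset (Edge n)) (x y : Fin n) :
    Finset ((Fin (l + 1) → Fin n) × (Fin (l + 1) → Fin n)) :=
  Finset.univ.filter fun P => P.1.Injective ∧ P.2.Injective ∧ (∀ i j, P.1 i ≠ P.2 j) ∧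
    P.1 0 = x ∧ P.2 (Fin.last l) = y ∧ (∀ i, adj A (P.1 i) (P.2 i)) ∧
    ∀ i, i ≠ Fin.last l → adj B (P.2 i) (P.1 (i + 1))

lemma mem_pset {A B : Finset (Edge n)} {x y : Fin n}
    {P : (Fin (l + 1) → Fin n) × (Fin (l + 1) → Fin n)} :
    P ∈ pset l A B x y ↔ P.1.Injective ∧ P.2.Injective ∧ (∀ i j, P.1 i ≠ P.2 j) ∧
    P.1 0 = x ∧ P.2 (Fin.last l) = y ∧ (∀ i, adj A (P.1 i) (P.2 i)) ∧
    ∀ i, i ≠ Fin.last l → adj B (P.2 i) (P.1 (i + 1)) := by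
  simp [pset]

lemma am_switch {K X Y : Finset (Edge n)} (hX : X ⊆ K) (hY : Disjoint K Y) (u v : Fin n) :
    am ((K \ X) ∪ Y) u v = am K u v - am X u v + am Y u v := by
  rw [am_union (hY.mono_left Finset.sdiff_subset), am_sdiff hX]

lemma dg_switch {K X Y : Finset (Edge n)} (hX : X ⊆ K) (hY : Disjoint K Y)
    (h : ∀ v, dg Y v = dg X v) (v : Fin n) : dg ((K \ X) ∪ Y) v = dg K v := by
  have : (dg ((K \ X) ∪ Y) v : ℝ) = dg K v := by
    simp_rw [← sum_am, am_switch hX hY, Finset.sum_add_distrib, Finset.sum_sub_distrib, sum_am,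
      h v]
    ring
  exact_mod_cast this

/-- The edges of the cycle closed by `y x` that are not of the form `a i b i`. -/
def oddEdges (P : (Fin (l + 1) → Fin n) × (Fin (l + 1) → Fin n)) : Finset (Edge n) :=
  pairEdges P.2 fun i => P.1 (i + 1)

set_option maxHeartbeats 1000000 in
theorem switch_count {k : ℕ} {F : Finset (Edge n)} {x y : Fin n} (hxy : x ≠ y)
    (T : Finset (Finset (Edge n)))
    (hT : ∀ K ∈ T, K ∈ regs n k ∧ K ⊆ F ∧ adj K x y) {L U : ℝ} (hU0 : 0 ≤ U)
    (hL : ∀ K ∈ T, L ≤ (pset l (F \ K) K x y).card)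
    (hU : ∀ K ∈ T, ∀ X Y, X ⊆ K → Y ⊆ F \ K → (∀ v, dg X v ≤ 1) → (∀ v, dg Y v = dg X v) →
      ((pset l ((K \ X) ∪ Y) (F \ ((K \ X) ∪ Y)) x y).card : ℝ) ≤ U) :
    L * T.card ≤ U * ((regs n k).filter fun A => A ⊆ F ∧ mkE x y hxy ∉ A).card := by
  set S := (regs n k).filter fun A => A ⊆ F ∧ mkE x y hxy ∉ A with hS
  set sw : (Σ _ : Finset (Edge n), (Fin (l + 1) → Fin n) × (Fin (l + 1) → Fin n)) →
      (Σ _ : Finset (Edge n), (Fin (l + 1) → Fin n) × (Fin (l + 1) → Fin n)) :=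
    fun q => ⟨(q.1 \ oddEdges q.2) ∪ pairEdges q.2.1 q.2.2, q.2⟩ with hsw
  set D := T.sigma fun K => pset l (F \ K) K x y with hD
  have key : ∀ q ∈ D, oddEdges q.2 ⊆ q.1 ∧ pairEdges q.2.1 q.2.2 ⊆ F \ q.1 ∧
      (∀ v, dg (oddEdges q.2) v ≤ 1) ∧
      (∀ v, dg (pairEdges q.2.1 q.2.2) v = dg (oddEdges q.2) v) ∧
      mkE x y hxy ∈ oddEdges q.2 := by
    rintro ⟨K, P⟩ hq
    rw [hD, Finset.mem_sigma] at hq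
    obtain ⟨hK, hP⟩ := hq
    simp only at hK hP ⊢
    obtain ⟨h1, h2, h3, h4, h5, h6, h7⟩ := mem_pset.1 hP
    obtain ⟨-, -, hKxy⟩ := hT K hK
    have h3' : ∀ i j, P.2 i ≠ P.1 (j + 1) := fun i j => (h3 _ _).symm
    have h1' : (fun i => P.1 (i + 1)).Injective := fun i j hij => add_right_cancel (h1 hij)
    have h8 : ∀ i, adj K (P.2 i) (P.1 (i + 1)) := by
      intro i
      by_cases hi : i = Fin.last l
      · rw [hi, h5, Fin.last_add_one, h4]; exact adj_symm hKxy
      · exact h7 i hi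
    have hdX := dg_pairEdges (a := P.2) (b := fun i => P.1 (i + 1)) h2 h1' h3'
    have hdY := dg_pairEdges h1 h2 h3
    refine ⟨?_, ?_, ?_, ?_, ?_⟩
    · rw [subset_iff_adj]
      intro u v huv
      rw [oddEdges, adj_pairEdges h3'] at huv
      obtain ⟨i, ⟨rfl, rfl⟩ | ⟨rfl, rfl⟩⟩ := huv
      · exact h8 i
      · exact adj_symm (h8 i)
    · rw [subset_iff_adj]
      intro u v huv
      rw [adj_pairEdges h3] at huv
      obtain ⟨i, ⟨rfl, rfl⟩ | ⟨rfl, rfl⟩⟩ := huv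
      · exact h6 i
      · exact adj_symm (h6 i)
    · intro v
      rw [oddEdges, hdX]
      split_ifs <;> simp
    · intro v
      rw [oddEdges, hdX, hdY]
      have : (∃ i, P.1 (i + 1) = v) ↔ ∃ i, P.1 i = v :=
        ⟨fun ⟨i, hi⟩ => ⟨i + 1, hi⟩, fun ⟨i, hi⟩ => ⟨i - 1, by rw [sub_add_cancel]; exact hi⟩⟩
      rw [this]
      split_ifs <;> tauto
    · rw [← adj_iff_mem, oddEdges, adj_pairEdges h3']
      exact ⟨Fin.last l, Or.inr ⟨by rw [Fin.last_add_one, h4], h5.symm⟩⟩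
  have hinj : Set.InjOn sw D := by
    rintro ⟨K, P⟩ hq ⟨K', P'⟩ hq' h
    rw [hsw] at h
    simp only [Sigma.mk.injEq, heq_eq_eq] at h
    obtain ⟨h, rfl⟩ := h
    obtain ⟨a1, a2, -, -, -⟩ := key _ hq
    obtain ⟨b1, b2, -, -, -⟩ := key _ hq'
    simp only at a1 a2 b1 b2
    congr 1
    ext e
    have := Finset.ext_iff.1 h e
    have a1 := @a1 e
    have a2 := @a2 e
    have b1 := @b1 e
    have b2 := @b2 e
    simp only [Finset.mem_union, Finset.mem_sdiff] at this a2 b2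
    tauto
  set S' := S.filter fun K' => ∃ q ∈ D, (sw q).1 = K' with hS'
  have himg : ∀ q ∈ D, sw q ∈ S'.sigma fun K' => pset l K' (F \ K') x y := by
    rintro ⟨K, P⟩ hq
    obtain ⟨a1, a2, a3, a4, a5⟩ := key _ hq
    have hq0 := hq
    rw [hD, Finset.mem_sigma] at hq
    obtain ⟨hK, hP⟩ := hq
    simp only at hK hP a1 a2 a3 a4 a5
    obtain ⟨hKr, hKF, hKxy⟩ := hT K hK
    obtain ⟨h1, h2, h3, h4, h5, h6, h7⟩ := mem_pset.1 hP
    have hdis : Disjoint K (pairEdges P.1 P.2) :=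
      Finset.disjoint_of_subset_right a2 Finset.disjoint_sdiff
    have h3' : ∀ i j, P.2 i ≠ P.1 (j + 1) := fun i j => (h3 _ _).symm
    have hsub : (K \ oddEdges P) ∪ pairEdges P.1 P.2 ⊆ F :=
      Finset.union_subset (Finset.sdiff_subset.trans hKF) (a2.trans Finset.sdiff_subset)
    have hoddF : ∀ u v, adj (oddEdges P) u v →
        adj (F \ ((K \ oddEdges P) ∪ pairEdges P.1 P.2)) u v := by
      apply subset_iff_adj.1
      intro e he
      have e1 := a1 he
      have e2 := hKF e1
      have e3 := Finset.disjoint_left.1 hdis e1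
      simp only [Finset.mem_sdiff, Finset.mem_union]
      tauto
    refine Finset.mem_sigma.2 ⟨?_, ?_⟩
    · rw [hS', Finset.mem_filter, hS, Finset.mem_filter]
      refine ⟨⟨?_, hsub, ?_⟩, ⟨K, P⟩, hq0, rfl⟩
      · rw [mem_regs]
        intro v
        exact (dg_switch a1 hdis a4 v).trans (mem_regs.1 hKr v)
      · simp only [hsw, Finset.mem_union, Finset.mem_sdiff, not_or]
        exact ⟨fun h => h.2 a5, Finset.disjoint_left.1 hdis (a1 a5)⟩
    · rw [mem_pset]
      refine ⟨h1, h2, h3, h4, h5, fun i => ?_, fun i hi => ?_⟩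
      · exact adj_union.2 (Or.inr ((adj_pairEdges h3).2 ⟨i, Or.inl ⟨rfl, rfl⟩⟩))
      · exact hoddF _ _ ((adj_pairEdges h3').2 ⟨i, Or.inl ⟨rfl, rfl⟩⟩)
  have hcard := Finset.card_le_card_of_injOn sw himg hinj
  rw [hD, Finset.card_sigma, Finset.card_sigma] at hcard
  have hcard' : ∑ K ∈ T, ((pset l (F \ K) K x y).card : ℝ) ≤
      ∑ K' ∈ S', ((pset l K' (F \ K') x y).card : ℝ) := by exact_mod_cast hcard
  have hUS : ∀ K' ∈ S', ((pset l K' (F \ K') x y).card : ℝ) ≤ U := by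
    intro K' hK'
    rw [hS', Finset.mem_filter] at hK'
    obtain ⟨-, ⟨K, P⟩, hq, rfl⟩ := hK'
    obtain ⟨a1, a2, a3, a4, -⟩ := key _ hq
    exact hU K (Finset.mem_sigma.1 hq).1 _ _ a1 a2 a3 a4
  have h1 : L * T.card ≤ ∑ K ∈ T, ((pset l (F \ K) K x y).card : ℝ) := by
    rw [mul_comm, ← nsmul_eq_mul]
    exact Finset.card_nsmul_le_sum _ _ _ hL
  have h2 : ∑ K' ∈ S', ((pset l K' (F \ K') x y).card : ℝ) ≤ U * S'.card := by
    rw [mul_comm, ← nsmul_eq_mul]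
    exact Finset.sum_le_card_nsmul _ _ _ hUS
  refine h1.trans (hcard'.trans (h2.trans ?_))
  gcongr
  exact Finset.filter_subset _ _

end Switch

/-! ### Regular graphs near a given graph -/

lemma dg_switch_int {G X Y : Finset (Edge n)} (hX : X ⊆ G) (hY : Disjoint G Y) (v : Fin n) :
    (dg ((G \ X) ∪ Y) v : ℤ) = dg G v - dg X v + dg Y v := by
  have : (dg ((G \ X) ∪ Y) v : ℝ) = dg G v - dg X v + dg Y v := by
    simp_rw [← sum_am, am_switch hX hY, Finset.sum_add_distrib, Finset.sum_sub_distrib]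
  exact_mod_cast this

lemma dg_empty (v : Fin n) : dg (∅ : Finset (Edge n)) v = 0 := by
  simp [dg, nb, adj]

lemma dg_singleton {u v : Fin n} (h : u ≠ v) (t : Fin n) :
    (dg {mkE u v h} t : ℤ) = (if t = u then 1 else 0) + (if t = v then 1 else 0) := by
  have e : ∀ a b, adj {mkE u v h} a b ↔ (a = u ∧ b = v) ∨ (a = v ∧ b = u) := by
    intro a b
    have : adj {mkE u v h} a b ↔ (mkE u v h).1 = s(a, b) :=
      ⟨fun ⟨e, he, h2⟩ => Finset.mem_singleton.1 he ▸ h2, fun h2 => ⟨_, Finset.mem_singleton_self _, h2⟩⟩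
    rw [this]
    simp only [mkE, Sym2.eq_iff]
    tauto
  have e2 : nb {mkE u v h} t =
      (if t = u then {v} else ∅) ∪ (if t = v then {u} else ∅) := by
    ext w
    rw [mem_nb, e]
    by_cases h1 : t = u
    · subst h1; simp [h]
    · simp only [h1, false_and, false_or, if_false, Finset.empty_union]
      split_ifs with h2 <;> simp [h2]
  rw [dg, e2]
  by_cases h1 : t = u
  · subst h1; simp [h]
  · simp only [h1, if_false, Finset.empty_union]
    split_ifs <;> simp

lemma dg_le (G : Finset (Edge n)) (v : Fin n) : dg G v ≤ n - 1 := by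
  have : nb G v ⊆ Finset.univ.erase v := fun w hw =>
    Finset.mem_erase.2 ⟨fun h => adj_irrefl (h ▸ mem_nb.1 hw), Finset.mem_univ _⟩
  have h2 := Finset.card_le_card this
  rw [Finset.card_erase_of_mem (Finset.mem_univ _), Finset.card_univ, Fintype.card_fin] at h2
  exact h2

/-- The total deviation of the degrees from `k`. -/
def devi (k : ℕ) (G : Finset (Edge n)) : ℤ :=
  ∑ v, |(dg G v : ℤ) - k| + |∑ v, ((dg G v : ℤ) - k)|

lemma devi_nonneg (k : ℕ) (G : Finset (Edge n)) : 0 ≤ devi k G := by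
  unfold devi; positivity

lemma card_symmDiff_switch (G X Y : Finset (Edge n)) :
    (symmDiff G ((G \ X) ∪ Y)).card ≤ X.card + Y.card := by
  refine (Finset.card_le_card ?_).trans (Finset.card_union_le _ _)
  intro e
  simp only [Finset.mem_symmDiff, Finset.mem_union, Finset.mem_sdiff]
  tauto

lemma exists_devi_lt {k : ℕ} (hk : k < n) (hpar : Even (n * k)) (G : Finset (Edge n))
    (hG : G ∉ regs n k) :
    ∃ G' : Finset (Edge n), (symmDiff G G').card ≤ 2 ∧ devi k G' + 2 ≤ devi k G := by
  set f : Fin n → ℤ := fun v => (dg G v : ℤ) - k with hf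
  set S : ℤ := ∑ v, f v with hS
  have hSe : Even S := by
    have h1 : S = 2 * G.card - n * k := by
      rw [hS, hf, Finset.sum_sub_distrib, ← Nat.cast_sum, ← two_mul_card]
      simp
    rw [h1]
    exact (even_two_mul _).sub (by exact_mod_cast hpar)
  have hdv : devi k G = ∑ v, |f v| + |S| := rfl
  rcases lt_trichotomy S 0 with h0 | h0 | h0
  · obtain ⟨u, -, hu⟩ : ∃ u ∈ Finset.univ, f u < 0 := by
      by_contra! h
      exact absurd (Finset.sum_nonneg h) (not_le.2 h0)
    obtain ⟨v, hv⟩ : ∃ v, v ∉ nb G u ∪ {u} := by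
      by_contra! h
      have h1 : (nb G u ∪ {u}).card = n := by
        rw [Finset.eq_univ_of_forall h]; simp
      have h2 := Finset.card_union_le (nb G u) {u}
      rw [Finset.card_singleton] at h2
      have : (nb G u).card = dg G u := rfl
      simp only [hf] at hu
      omega
    simp only [Finset.mem_union, mem_nb, Finset.mem_singleton, not_or] at hv
    have huv : u ≠ v := Ne.symm hv.2
    have hmem : mkE u v huv ∉ G := fun h => hv.1 ((adj_iff_mem huv).2 h)
    refine ⟨(G \ ∅) ∪ {mkE u v huv}, (card_symmDiff_switch _ _ _).trans (by simp), ?_⟩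
    have hd : ∀ t, (dg ((G \ ∅) ∪ {mkE u v huv}) t : ℤ) - k =
        f t + ((if t = u then 1 else 0) + (if t = v then 1 else 0)) := by
      intro t
      rw [dg_switch_int (Finset.empty_subset _) (Finset.disjoint_singleton_right.2 hmem),
        dg_singleton, dg_empty, hf]
      push_cast; ring
    rw [hdv, devi]
    simp only [hd]
    have h1 : ∑ t, |f t + ((if t = u then 1 else 0) + (if t = v then 1 else 0))| ≤
        ∑ t, (|f t| + ((if t = v then 1 else 0) - (if t = u then 1 else 0))) := by
      refine Finset.sum_le_sum fun t _ => ?_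
      by_cases h1 : t = u
      · subst h1
        simp only [if_true, huv, if_false]
        rw [abs_of_neg hu, abs_of_nonpos (by omega)]; omega
      · simp only [h1, if_false]
        split_ifs
        · refine (abs_add_le _ _).trans (by simp)
        · simp
    rw [Finset.sum_add_distrib, Finset.sum_sub_distrib] at h1
    simp only [Finset.sum_ite_eq', Finset.mem_univ, if_true] at h1
    rw [Finset.sum_add_distrib, Finset.sum_add_distrib]
    simp only [Finset.sum_ite_eq', Finset.mem_univ, if_true]
    rw [← hS, abs_of_neg h0]
    obtain ⟨r, hr⟩ := hSe
    rw [abs_of_nonpos (by omega)]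
    omega
  · have hne : ∃ u, f u ≠ 0 := by
      by_contra! h
      refine hG (mem_regs.2 fun v => ?_)
      have := h v
      simp only [hf] at this
      omega
    obtain ⟨u, hu⟩ : ∃ u, 0 < f u := by
      by_contra! h
      obtain ⟨u, hu⟩ := hne
      exact hu ((Finset.sum_eq_zero_iff_of_nonpos (fun i _ => h i)).1 h0 u (Finset.mem_univ _))
    obtain ⟨v, hv⟩ : ∃ v, f v < 0 := by
      by_contra! h
      obtain ⟨u, hu⟩ := hne
      exact hu ((Finset.sum_eq_zero_iff_of_nonneg (fun i _ => h i)).1 h0 u (Finset.mem_univ _))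
    have huv : u ≠ v := by rintro rfl; omega
    obtain ⟨w, hwu, hwv⟩ : ∃ w ∈ nb G u, w ∉ nb G v ∪ {v} := by
      by_contra! h
      have h1 := Finset.card_le_card (show nb G u ⊆ nb G v ∪ {v} from h)
      have h2 := Finset.card_union_le (nb G v) {v}
      rw [Finset.card_singleton] at h2
      have e1 : (nb G u).card = dg G u := rfl
      have e2 : (nb G v).card = dg G v := rfl
      simp only [hf] at hu hv
      omega
    simp only [Finset.mem_union, mem_nb, Finset.mem_singleton, not_or] at hwu hwv
    have huw : u ≠ w := adj_ne hwu
    have hvw : v ≠ w := Ne.symm hwv.2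
    have hm1 : mkE u w huw ∈ G := (adj_iff_mem huw).1 hwu
    have hm2 : mkE v w hvw ∉ G := fun h => hwv.1 ((adj_iff_mem hvw).2 h)
    refine ⟨(G \ {mkE u w huw}) ∪ {mkE v w hvw},
      (card_symmDiff_switch _ _ _).trans (by simp), ?_⟩
    have hd : ∀ t, (dg ((G \ {mkE u w huw}) ∪ {mkE v w hvw}) t : ℤ) - k =
        f t + ((if t = v then 1 else 0) - (if t = u then 1 else 0)) := by
      intro t
      rw [dg_switch_int (Finset.singleton_subset_iff.2 hm1)
        (Finset.disjoint_singleton_right.2 hm2), dg_singleton, dg_singleton, hf]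
      push_cast; ring
    rw [hdv, devi]
    simp only [hd]
    have h1 : ∑ t, |f t + ((if t = v then 1 else 0) - (if t = u then 1 else 0))| ≤
        ∑ t, (|f t| - ((if t = v then 1 else 0) + (if t = u then 1 else 0))) := by
      refine Finset.sum_le_sum fun t _ => ?_
      by_cases h1 : t = u
      · subst h1
        simp only [if_true, huv, if_false]
        rw [abs_of_pos hu, abs_of_nonneg (by omega)]; omega
      · by_cases h2 : t = v
        · subst h2
          simp only [if_true, h1, if_false]
          rw [abs_of_neg hv, abs_of_nonpos (by omega)]; omega
        · simp [h1, h2]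
    rw [Finset.sum_sub_distrib, Finset.sum_add_distrib] at h1
    simp only [Finset.sum_ite_eq', Finset.mem_univ, if_true] at h1
    have h2 : ∑ t, (f t + ((if t = v then 1 else 0) - (if t = u then 1 else 0))) = 0 := by
      have h3 : ∑ t : Fin n, (((if t = v then 1 else 0) - (if t = u then 1 else 0) : ℤ)) = 0 := by
        rw [Finset.sum_sub_distrib]; simp
      rw [Finset.sum_add_distrib, h3, ← hS, h0, add_zero]
    rw [h2, h0]
    norm_num
    linarith
  · obtain ⟨u, -, hu⟩ : ∃ u ∈ Finset.univ, 0 < f u := by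
      by_contra! h
      exact absurd (Finset.sum_nonpos h) (not_le.2 h0)
    obtain ⟨v, hv⟩ : (nb G u).Nonempty := by
      rw [← Finset.card_pos]
      have : (nb G u).card = dg G u := rfl
      simp only [hf] at hu
      omega
    rw [mem_nb] at hv
    have huv : u ≠ v := adj_ne hv
    have hmem : mkE u v huv ∈ G := (adj_iff_mem huv).1 hv
    refine ⟨(G \ {mkE u v huv}) ∪ ∅, (card_symmDiff_switch _ _ _).trans (by simp), ?_⟩
    have hd : ∀ t, (dg ((G \ {mkE u v huv}) ∪ ∅) t : ℤ) - k =
        f t - ((if t = u then 1 else 0) + (if t = v then 1 else 0)) := by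
      intro t
      rw [dg_switch_int (Finset.singleton_subset_iff.2 hmem) (Finset.disjoint_empty_right _),
        dg_singleton, dg_empty, hf]
      push_cast; ring
    rw [hdv, devi]
    simp only [hd]
    have h1 : ∑ t, |f t - ((if t = u then 1 else 0) + (if t = v then 1 else 0))| ≤
        ∑ t, (|f t| + ((if t = v then 1 else 0) - (if t = u then 1 else 0))) := by
      refine Finset.sum_le_sum fun t _ => ?_
      by_cases h1 : t = u
      · subst h1
        simp only [if_true, huv, if_false]
        rw [abs_of_pos hu, abs_of_nonneg (by omega)]; omega
      · simp only [h1, if_false]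
        split_ifs
        · refine (abs_sub _ _).trans (by simp)
        · simp
    rw [Finset.sum_add_distrib, Finset.sum_sub_distrib] at h1
    simp only [Finset.sum_ite_eq', Finset.mem_univ, if_true] at h1
    rw [Finset.sum_sub_distrib, Finset.sum_add_distrib]
    simp only [Finset.sum_ite_eq', Finset.mem_univ, if_true]
    rw [← hS, abs_of_pos h0]
    obtain ⟨r, hr⟩ := hSe
    rw [abs_of_nonneg (by omega)]
    omega

/-- Every graph is close to a regular graph. -/
theorem exists_regs_near {k : ℕ} (hk : k < n) (hpar : Even (n * k)) (G : Finset (Edge n)) :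
    ∃ K ∈ regs n k, ((symmDiff G K).card : ℤ) ≤ devi k G := by
  suffices h : ∀ N : ℕ, ∀ G : Finset (Edge n), devi k G ≤ N →
      ∃ K ∈ regs n k, ((symmDiff G K).card : ℤ) ≤ devi k G by
    exact h (devi k G).toNat G (Int.self_le_toNat _)
  intro N
  induction N using Nat.strong_induction_on with
  | _ N ih =>
    intro G hG
    by_cases hreg : G ∈ regs n k
    · exact ⟨G, hreg, by simpa using devi_nonneg k G⟩
    obtain ⟨G', h1, h2⟩ := exists_devi_lt hk hpar G hreg
    have h3 := devi_nonneg k G'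
    obtain ⟨K, hK, h4⟩ := ih (N - 2) (by omega) G' (by omega)
    refine ⟨K, hK, ?_⟩
    have h5 : (symmDiff G K).card ≤ (symmDiff G G').card + (symmDiff G' K).card := by
      refine (Finset.card_le_card ?_).trans (Finset.card_union_le _ _)
      exact symmDiff_triangle G G' K
    omega

lemma regs_nonempty {k : ℕ} (hk : k < n) (hpar : Even (n * k)) : (regs n k).Nonempty := by
  obtain ⟨K, hK, -⟩ := exists_regs_near hk hpar ∅
  exact ⟨K, hK⟩

/-! ### Sums over walks -/

section Walks

variable {V : Type*} [Fintype V] [DecidableEq V]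

/-- The total weight of the walks with `L` steps from `x` to `y`, the `t`-th step from `u` to `v`
having weight `A (i + t) u v`. -/
def pw (A : ℕ → V → V → ℝ) : ℕ → ℕ → V → V → ℝ
  | _, 0, x, y => if x = y then 1 else 0
  | i, L + 1, x, y => ∑ z, A i x z * pw A (i + 1) L z y

lemma pw_zero (A : ℕ → V → V → ℝ) (i : ℕ) (x y : V) :
    pw A i 0 x y = if x = y then 1 else 0 := rfl

lemma pw_succ (A : ℕ → V → V → ℝ) (i L : ℕ) (x y : V) :
    pw A i (L + 1) x y = ∑ z, A i x z * pw A (i + 1) L z y := rfl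

lemma pw_one (A : ℕ → V → V → ℝ) (i : ℕ) (x y : V) : pw A i 1 x y = A i x y := by
  simp [pw]

lemma pw_add (A : ℕ → V → V → ℝ) (L L' : ℕ) : ∀ (i : ℕ) (x y : V),
    pw A i (L + L') x y = ∑ z, pw A i L x z * pw A (i + L) L' z y := by
  induction L with
  | zero => intro i x y; simp [pw]
  | succ L ih =>
    intro i x y
    rw [show L + 1 + L' = (L + L') + 1 by ring, pw_succ]
    simp_rw [ih, pw_succ, Finset.sum_mul, Finset.mul_sum]
    rw [Finset.sum_comm]
    refine Finset.sum_congr rfl fun z _ => Finset.sum_congr rfl fun w _ => ?_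
    rw [show i + 1 + L = i + (L + 1) by ring]; ring

lemma pw_succ' (A : ℕ → V → V → ℝ) (i L : ℕ) (x y : V) :
    pw A i (L + 1) x y = ∑ z, pw A i L x z * A (i + L) z y := by
  rw [pw_add]
  simp_rw [pw_one]

lemma pw_congr {A B : ℕ → V → V → ℝ} (L : ℕ) : ∀ {i j : ℕ} (_ : ∀ t < L, A (i + t) = B (j + t)),
    pw A i L = pw B j L := by
  induction L with
  | zero => intro i j _; rfl
  | succ L ih =>
    intro i j h
    funext x y
    rw [pw_succ, pw_succ, ih (i := i + 1) (j := j + 1), show A i = B j by simpa using h 0 (by omega)]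
    intro t ht
    have := h (t + 1) (by omega)
    rwa [add_right_comm, add_right_comm j, add_assoc, add_assoc j]

lemma pw_nonneg {A : ℕ → V → V → ℝ} (hA : ∀ t u v, 0 ≤ A t u v) (L : ℕ) : ∀ (i : ℕ) (x y : V),
    0 ≤ pw A i L x y := by
  induction L with
  | zero => intro i x y; simp only [pw]; split_ifs <;> norm_num
  | succ L ih => intro i x y; exact Finset.sum_nonneg fun z _ => mul_nonneg (hA _ _ _) (ih _ _ _)

/-- The weight of a walk. -/
def pathW (A : ℕ → V → V → ℝ) (i L : ℕ) (P : Fin (L + 1) → V) : ℝ :=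
  ∏ t : Fin L, A (i + t) (P t.castSucc) (P t.succ)

lemma pw_eq_sum (A : ℕ → V → V → ℝ) (L : ℕ) : ∀ (i : ℕ) (x y : V),
    pw A i L x y = ∑ P : Fin (L + 1) → V, if P 0 = x ∧ P (Fin.last L) = y then pathW A i L P
      else 0 := by
  induction L with
  | zero =>
    intro i x y
    rw [← (Equiv.funUnique (Fin 1) V).symm.sum_comp]
    simp only [pw, pathW, Finset.univ_eq_empty, Finset.prod_empty]
    have : ∀ z : V, ((Equiv.funUnique (Fin 1) V).symm z 0 = x ∧
        (Equiv.funUnique (Fin 1) V).symm z (Fin.last 0) = y) ↔ (z = x ∧ z = y) := fun z => Iff.rfl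
    simp only [this]
    by_cases h : x = y
    · subst h; simp
    · rw [if_neg h, Finset.sum_eq_zero]
      intro z _
      rw [if_neg]
      rintro ⟨rfl, h2⟩
      exact h h2
  | succ L ih =>
    intro i x y
    rw [← (Fin.consEquiv fun _ => V).sum_comp, Fintype.sum_prod_type, pw_succ]
    have e : ∀ (a : V) (P : Fin (L + 1) → V),
        (if (Fin.consEquiv fun _ => V) (a, P) 0 = x ∧
          (Fin.consEquiv fun _ => V) (a, P) (Fin.last (L + 1)) = y then
          pathW A i (L + 1) ((Fin.consEquiv fun _ => V) (a, P)) else 0) =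
        if a = x then (if P (Fin.last L) = y then A i x (P 0) * pathW A (i + 1) L P else 0)
          else 0 := by
      intro a P
      have h1 : (Fin.consEquiv fun _ => V) (a, P) = (Fin.cons a P : Fin (L + 2) → V) := rfl
      rw [h1]
      have h2 : (Fin.cons a P : Fin (L + 2) → V) (Fin.last (L + 1)) = P (Fin.last L) := by
        rw [← Fin.succ_last, Fin.cons_succ]
      rw [h2, Fin.cons_zero]
      by_cases h3 : a = x
      · subst h3
        have h4 : pathW A i (L + 1) (Fin.cons a P : Fin (L + 2) → V) =
            A i a (P 0) * pathW A (i + 1) L P := by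
          unfold pathW
          rw [Fin.prod_univ_succ]
          congr 1
          refine Finset.prod_congr rfl fun t _ => ?_
          rw [Fin.cons_succ, ← Fin.succ_castSucc, Fin.cons_succ, Fin.val_succ,
            show i + ((t : ℕ) + 1) = i + 1 + t by ring]
        rw [h4]
        simp
      · simp [h3]
    simp_rw [e]
    have e3 : ∀ P : Fin (L + 1) → V, (∑ a, if a = x then
        (if P (Fin.last L) = y then A i x (P 0) * pathW A (i + 1) L P else 0) else 0) =
        ∑ z, A i x z * (if P 0 = z ∧ P (Fin.last L) = y then pathW A (i + 1) L P else 0) := by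
      intro P
      rw [Finset.sum_ite_eq' Finset.univ x, if_pos (Finset.mem_univ _),
        Finset.sum_eq_single (P 0)]
      · simp
      · intro b _ hb
        rw [if_neg (fun h => hb h.1.symm), mul_zero]
      · simp
    rw [Finset.sum_comm]
    simp_rw [e3, ih]
    rw [Finset.sum_comm]
    simp_rw [Finset.mul_sum]

/-- Walks pinned to `z` at times `i` and `j`. -/
lemma sum_pinned (A : ℕ → V → V → ℝ) {N i j : ℕ} (hij : i < j) (hj : j ≤ N) (x y : V) :
    (∑ P : Fin (N + 1) → V, if P 0 = x ∧ P (Fin.last N) = y ∧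
      P ⟨i, by omega⟩ = P ⟨j, by omega⟩ then pathW A 0 N P else 0) =
      ∑ z, pw A 0 i x z * pw A i (j - i) z z * pw A j (N - j) z y := by
  have key : ∀ z, (∑ P : Fin (N + 1) → V, if P 0 = x ∧ P (Fin.last N) = y ∧
      P ⟨i, by omega⟩ = z ∧ P ⟨j, by omega⟩ = z then pathW A 0 N P else 0) =
      pw A 0 i x z * pw A i (j - i) z z * pw A j (N - j) z y := by
    intro z
    set B : ℕ → V → V → ℝ := fun t u v =>
      A t u v * (if (t = i → u = z) ∧ (t + 1 = j → v = z) then 1 else 0) with hB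
    by_cases hjN : j = N ∧ y ≠ z
    · obtain ⟨rfl, hyz⟩ := hjN
      rw [Nat.sub_self, pw_zero, if_neg hyz.symm, mul_zero]
      refine Finset.sum_eq_zero fun P _ => if_neg ?_
      rintro ⟨-, h1, -, h2⟩
      exact hyz (h1.symm.trans h2)
    have e1 : ∀ P : Fin (N + 1) → V, (if P 0 = x ∧ P (Fin.last N) = y ∧
        P ⟨i, by omega⟩ = z ∧ P ⟨j, by omega⟩ = z then pathW A 0 N P else 0) =
        if P 0 = x ∧ P (Fin.last N) = y then pathW B 0 N P else 0 := by
      intro P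
      by_cases h1 : P 0 = x ∧ P (Fin.last N) = y
      swap
      · rw [if_neg h1, if_neg (fun h => h1 ⟨h.1, h.2.1⟩)]
      rw [if_pos h1]
      have e2 : pathW B 0 N P = pathW A 0 N P * ∏ t : Fin N,
          (if ((0 + t : ℕ) = i → P t.castSucc = z) ∧ ((0 + t : ℕ) + 1 = j → P t.succ = z)
            then 1 else 0) := by
        rw [pathW, pathW, ← Finset.prod_mul_distrib]
      rw [e2]
      by_cases h2 : P ⟨i, by omega⟩ = z ∧ P ⟨j, by omega⟩ = z
      · rw [if_pos ⟨h1.1, h1.2, h2⟩, Finset.prod_eq_one, mul_one]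
        intro t _
        rw [if_pos]
        constructor
        · intro h; rw [← h2.1]; congr 1; ext; simpa using h
        · intro h; rw [← h2.2]; congr 1; ext; simpa using h
      · rw [if_neg (fun h => h2 h.2.2)]
        rw [not_and_or] at h2
        rcases h2 with h2 | h2
        · rw [Finset.prod_eq_zero (Finset.mem_univ (⟨i, by omega⟩ : Fin N)), mul_zero]
          rw [if_neg]
          intro h
          exact h2 (h.1 (by simp))
        · rw [Finset.prod_eq_zero (Finset.mem_univ (⟨j - 1, by omega⟩ : Fin N)), mul_zero]
          rw [if_neg]
          intro h
          refine h2 ?_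
          rw [← h.2 (by simp only []; omega)]
          congr 1; ext; simp only [Fin.val_succ]; omega
    simp_rw [e1]
    rw [← pw_eq_sum]
    have e3 : N = i + ((j - i) + (N - j)) := by omega
    rw [show pw B 0 N x y = pw B 0 (i + ((j - i) + (N - j))) x y by rw [← e3], pw_add]
    simp_rw [pw_add, zero_add, show i + (j - i) = j by omega]
    have a1 : pw B 0 i = pw A 0 i := pw_congr _ fun t ht => by
      funext u v
      simp only [hB, zero_add]
      rw [if_pos ⟨fun h => absurd h (by omega), fun h => absurd h (by omega)⟩, mul_one]
    have a2 : pw B j (N - j) = pw A j (N - j) := pw_congr _ fun t ht => by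
      funext u v
      simp only [hB]
      rw [if_pos ⟨fun h => absurd h (by omega), fun h => absurd h (by omega)⟩, mul_one]
    have a3 : ∀ u v, pw B i (j - i) u v =
        if u = z ∧ v = z then pw A i (j - i) z z else 0 := by
      intro u v
      rw [pw_eq_sum, pw_eq_sum]
      have : ∀ P : Fin (j - i + 1) → V, (if P 0 = u ∧ P (Fin.last _) = v then
          pathW B i (j - i) P else 0) = if u = z ∧ v = z then
            (if P 0 = z ∧ P (Fin.last _) = z then pathW A i (j - i) P else 0) else 0 := by
        intro P
        have e2 : pathW B i (j - i) P = pathW A i (j - i) P * ∏ t : Fin (j - i),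
            (if ((i + t : ℕ) = i → P t.castSucc = z) ∧ ((i + t : ℕ) + 1 = j → P t.succ = z)
              then 1 else 0) := by
          rw [pathW, pathW, ← Finset.prod_mul_distrib]
        by_cases h1 : P 0 = u ∧ P (Fin.last _) = v
        swap
        · rw [if_neg h1]
          split_ifs with h2 h3
          · exact absurd ⟨h3.1.trans h2.1.symm, h3.2.trans h2.2.symm⟩ h1
          · rfl
          · rfl
        rw [if_pos h1, e2]
        obtain ⟨rfl, rfl⟩ := h1
        by_cases h2 : P 0 = z ∧ P (Fin.last _) = z
        · rw [if_pos h2, if_pos h2, Finset.prod_eq_one, mul_one]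
          intro t _
          rw [if_pos]
          constructor
          · intro h; rw [← h2.1]; congr 1; ext; simp only [Fin.val_castSucc]
            simp only [Fin.val_zero]; omega
          · intro h; rw [← h2.2]; congr 1; ext; simp only [Fin.val_succ, Fin.val_last]; omega
        · rw [if_neg h2]
          rw [not_and_or] at h2
          rcases h2 with h2 | h2
          · rw [Finset.prod_eq_zero (Finset.mem_univ (⟨0, by omega⟩ : Fin (j - i))), mul_zero]
            rw [if_neg]
            intro h
            exact h2 (h.1 (by simp))
          · rw [Finset.prod_eq_zero (Finset.mem_univ (⟨j - i - 1, by omega⟩ : Fin (j - i))),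
              mul_zero]
            rw [if_neg]
            intro h
            refine h2 ?_
            rw [← h.2 (by simp only []; omega)]
            congr 1; ext; simp only [Fin.val_succ, Fin.val_last]; omega
      simp_rw [this]
      by_cases h : u = z ∧ v = z
      · simp only [if_pos h]
      · simp only [if_neg h, Finset.sum_const_zero]
    simp_rw [a1, a2, a3]
    rw [Finset.sum_eq_single z]
    · rw [Finset.sum_eq_single z]
      · simp [mul_assoc]
      · intro b _ hb; simp [hb]
      · simp
    · intro b _ hb
      simp [hb]
    · simp
  simp_rw [← key]
  rw [Finset.sum_comm]
  refine Finset.sum_congr rfl fun P _ => ?_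
  by_cases h : P 0 = x ∧ P (Fin.last N) = y ∧ P ⟨i, by omega⟩ = P ⟨j, by omega⟩
  · rw [if_pos h, Finset.sum_eq_single (P ⟨i, by omega⟩)]
    · rw [if_pos ⟨h.1, h.2.1, rfl, h.2.2.symm⟩]
    · intro b _ hb
      rw [if_neg]
      rintro ⟨-, -, h2, -⟩
      exact hb h2.symm
    · simp
  · rw [if_neg h, Finset.sum_eq_zero]
    intro z _
    rw [if_neg]
    rintro ⟨h1, h2, h3, h4⟩
    exact h ⟨h1, h2, h3.trans h4.symm⟩

end Walks

/-! ### Counting alternating paths -/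

section Count

/-- The alternating sequence of adjacency matrices. -/
def alt (A B : Finset (Edge n)) (t : ℕ) : Fin n → Fin n → ℝ := if t % 2 = 0 then am A else am B

lemma alt_nonneg (A B : Finset (Edge n)) (t : ℕ) (u v : Fin n) : 0 ≤ alt A B t u v := by
  unfold alt; split_ifs <;> exact am_nonneg _ _ _

lemma alt_le_one (A B : Finset (Edge n)) (t : ℕ) (u v : Fin n) : alt A B t u v ≤ 1 := by
  unfold alt; split_ifs <;> exact am_le_one _ _ _

lemma am_of_adj {A : Finset (Edge n)} {u v : Fin n} (h : adj A u v) : am A u v = 1 := if_pos h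

lemma am_of_not_adj {A : Finset (Edge n)} {u v : Fin n} (h : ¬ adj A u v) : am A u v = 0 :=
  if_neg h

lemma pset_card_le (l : ℕ) (A B : Finset (Edge n)) (x y : Fin n) :
    ((pset l A B x y).card : ℝ) ≤ pw (alt A B) 0 (2 * l + 1) x y := by
  rw [pw_eq_sum]
  set S : Finset (Fin (2 * l + 1 + 1) → Fin n) := Finset.univ.filter fun P =>
    (P 0 = x ∧ P (Fin.last _) = y) ∧ pathW (alt A B) 0 (2 * l + 1) P = 1 with hS
  have h1 : (S.card : ℝ) ≤ ∑ P : Fin (2 * l + 1 + 1) → Fin n,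
      if P 0 = x ∧ P (Fin.last _) = y then pathW (alt A B) 0 (2 * l + 1) P else 0 := by
    rw [hS, Finset.card_filter]
    push_cast
    refine Finset.sum_le_sum fun P _ => ?_
    by_cases h : P 0 = x ∧ P (Fin.last _) = y
    · simp only [h, true_and, and_self, if_true]
      split_ifs with h2
      · exact h2.ge
      · exact Finset.prod_nonneg fun t _ => alt_nonneg _ _ _ _ _
    · simp only [h, false_and, if_false, le_refl]
  refine le_trans ?_ h1
  norm_cast
  refine Finset.card_le_card_of_injOn (fun Q => fun t : Fin (2 * l + 1 + 1) =>
    if (t : ℕ) % 2 = 0 then Q.1 ⟨t / 2, by omega⟩ else Q.2 ⟨t / 2, by omega⟩) ?_ ?_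
  · intro Q hQ
    obtain ⟨h1, h2, h3, h4, h5, h6, h7⟩ := mem_pset.1 hQ
    rw [hS, Finset.mem_coe, Finset.mem_filter]
    refine ⟨Finset.mem_univ _, ⟨?_, ?_⟩, ?_⟩
    · simp only [Fin.val_zero, Nat.zero_mod, if_true]
      rw [← h4]; rfl
    · simp only [Fin.val_last]
      rw [if_neg (by omega), ← h5]
      exact congrArg Q.2 (Fin.ext (show (2 * l + 1) / 2 = l by omega))
    · refine Finset.prod_eq_one fun t _ => ?_
      simp only [Fin.val_castSucc, Fin.val_succ, zero_add, alt]
      by_cases ht : (t : ℕ) % 2 = 0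
      · rw [if_pos ht, if_pos ht, if_neg (by omega)]
        refine am_of_adj ?_
        have : (⟨((t : ℕ) + 1) / 2, by omega⟩ : Fin (l + 1)) = ⟨(t : ℕ) / 2, by omega⟩ := by
          ext; simp only []; omega
        rw [this]
        exact h6 _
      · rw [if_neg ht, if_neg ht, if_pos (by omega)]
        refine am_of_adj ?_
        have h8 := h7 ⟨(t : ℕ) / 2, by omega⟩ (by
          intro h
          have := congrArg Fin.val h
          simp only [Fin.val_last] at this
          omega)
        have e : (⟨(t : ℕ) / 2, by omega⟩ : Fin (l + 1)) + 1 = ⟨((t : ℕ) + 1) / 2, by omega⟩ := by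
          ext
          rw [Fin.val_add_one_of_lt (by
            rw [Fin.lt_def, Fin.val_last]; show (t : ℕ) / 2 < l; omega)]
          show (t : ℕ) / 2 + 1 = ((t : ℕ) + 1) / 2
          omega
        rw [← e]
        exact h8
  · intro Q _ Q' _ h
    refine Prod.ext (funext fun i => ?_) (funext fun i => ?_)
    · have := congrFun h ⟨2 * i, by omega⟩
      simp only at this
      rw [if_pos (by omega), if_pos (by omega)] at this
      convert this using 2 <;> (ext; simp only []; omega)
    · have := congrFun h ⟨2 * i + 1, by omega⟩
      simp only at this
      rw [if_neg (by omega), if_neg (by omega)] at this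
      convert this using 2 <;> (ext; simp only []; omega)

lemma pset_card_ge (l : ℕ) (A B : Finset (Edge n)) (x y : Fin n) :
    pw (alt A B) 0 (2 * l + 1) x y -
      ∑ j ∈ Finset.range (2 * l + 2), ∑ i ∈ Finset.range j,
        ∑ z, pw (alt A B) 0 i x z * pw (alt A B) i (j - i) z z *
          pw (alt A B) j (2 * l + 1 - j) z y ≤ (pset l A B x y).card := by
  set N := 2 * l + 1 with hN
  set S : Finset (Fin (N + 1) → Fin n) := Finset.univ.filter fun P =>
    P.Injective ∧ (P 0 = x ∧ P (Fin.last _) = y) ∧ pathW (alt A B) 0 N P ≠ 0 with hS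
  have hnn : ∀ P, 0 ≤ pathW (alt A B) 0 N P := fun P =>
    Finset.prod_nonneg fun t _ => alt_nonneg _ _ _ _ _
  have hle : ∀ P, pathW (alt A B) 0 N P ≤ 1 := fun P =>
    Finset.prod_le_one (fun t _ => alt_nonneg _ _ _ _ _) fun t _ => alt_le_one _ _ _ _ _
  have hcard : S.card ≤ (pset l A B x y).card := by
    refine Finset.card_le_card_of_injOn (fun P => (fun i => P ⟨2 * i, by omega⟩,
      fun i => P ⟨2 * i + 1, by omega⟩)) ?_ ?_
    · intro P hP
      rw [hS, Finset.mem_coe, Finset.mem_filter] at hP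
      obtain ⟨-, h1, ⟨h2, h3⟩, h4⟩ := hP
      have hstep : ∀ t : Fin N, alt A B t (P t.castSucc) (P t.succ) ≠ 0 := by
        intro t ht
        refine h4 (Finset.prod_eq_zero (Finset.mem_univ t) ?_)
        rwa [zero_add]
      refine mem_pset.2 ⟨?_, ?_, ?_, ?_, ?_, ?_, ?_⟩
      · intro i i' h
        have := congrArg Fin.val (h1 h)
        simp only at this
        ext; omega
      · intro i i' h
        have := congrArg Fin.val (h1 h)
        simp only at this
        ext; omega
      · intro i i' h
        have := congrArg Fin.val (h1 h)
        simp only at this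
        omega
      · rw [← h2]; rfl
      · rw [← h3]; rfl
      · intro i
        by_contra h
        refine hstep ⟨2 * i, by omega⟩ ?_
        simp only [alt]
        rw [if_pos (by omega)]
        exact am_of_not_adj h
      · intro i hi
        have hi' : (i : ℕ) < l := by
          rcases Nat.lt_or_ge i l with h | h
          · exact h
          · exact absurd (Fin.ext (by rw [Fin.val_last]; omega)) hi
        by_contra h
        refine hstep ⟨2 * i + 1, by omega⟩ ?_
        simp only [alt]
        rw [if_neg (by omega)]
        refine am_of_not_adj fun h5 => h ?_
        have e : (⟨2 * ((i + 1 : Fin (l + 1)) : ℕ), by have := (i + 1).2; omega⟩ : Fin (N + 1)) =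
            (⟨2 * i + 1, by omega⟩ : Fin N).succ := by
          ext
          simp only [Fin.val_succ]
          rw [Fin.val_add_one_of_lt (by rw [Fin.lt_def, Fin.val_last]; exact hi')]
          ring
        simp only [e]
        exact h5
    · intro P _ P' _ h
      simp only [Prod.mk.injEq] at h
      funext t
      by_cases ht : (t : ℕ) % 2 = 0
      · have := congrFun h.1 ⟨t / 2, by omega⟩
        convert this using 2 <;> (ext; simp only []; omega)
      · have := congrFun h.2 ⟨t / 2, by omega⟩
        convert this using 2 <;> (ext; simp only []; omega)
  have hpin : ∑ j ∈ Finset.range (N + 1), ∑ i ∈ Finset.range j,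
        ∑ z, pw (alt A B) 0 i x z * pw (alt A B) i (j - i) z z *
          pw (alt A B) j (N - j) z y =
      ∑ j ∈ Finset.range (N + 1), ∑ i ∈ Finset.range j, ∑ P : Fin (N + 1) → Fin n,
        if P 0 = x ∧ P (Fin.last N) = y ∧ P (Fin.ofNat (N + 1) i) = P (Fin.ofNat (N + 1) j)
          then pathW (alt A B) 0 N P else 0 := by
    refine Finset.sum_congr rfl fun j hj => Finset.sum_congr rfl fun i hi => ?_
    rw [Finset.mem_range] at hi hj
    rw [← sum_pinned _ hi (by omega)]
    refine Finset.sum_congr rfl fun P _ => ?_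
    have e1 : Fin.ofNat (N + 1) i = ⟨i, by omega⟩ := by
      ext; simp only [Fin.ofNat]; exact Nat.mod_eq_of_lt (by omega)
    have e2 : Fin.ofNat (N + 1) j = ⟨j, by omega⟩ := by
      ext; simp only [Fin.ofNat]; exact Nat.mod_eq_of_lt (by omega)
    rw [e1, e2]
  rw [sub_le_iff_le_add]
  refine le_trans ?_ (add_le_add_left (Nat.cast_le.2 hcard) _)
  rw [hpin, pw_eq_sum]
  simp_rw [Finset.sum_comm (t := (Finset.univ : Finset (Fin (N + 1) → Fin n)))]
  rw [hS, Finset.card_filter]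
  push_cast
  rw [← Finset.sum_add_distrib]
  refine Finset.sum_le_sum fun P _ => ?_
  have hnn2 : ∀ j ∈ Finset.range (N + 1), 0 ≤ ∑ i ∈ Finset.range j,
      (if P 0 = x ∧ P (Fin.last N) = y ∧ P (Fin.ofNat (N + 1) i) = P (Fin.ofNat (N + 1) j)
          then pathW (alt A B) 0 N P else 0) := fun j _ => Finset.sum_nonneg fun i _ => by
    split_ifs
    · exact hnn P
    · exact le_rfl
  by_cases h : P 0 = x ∧ P (Fin.last N) = y
  swap
  · rw [if_neg h]
    refine add_nonneg (by split_ifs <;> norm_num) (Finset.sum_nonneg hnn2)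
  rw [if_pos h]
  by_cases hinj : P.Injective
  · by_cases h0 : pathW (alt A B) 0 N P = 0
    · rw [h0]
      refine add_nonneg (by split_ifs <;> norm_num) ?_
      rw [h0] at hnn2
      exact Finset.sum_nonneg hnn2
    · rw [if_pos ⟨hinj, h, h0⟩]
      have := Finset.sum_nonneg hnn2
      linarith [hle P]
  · rw [if_neg (fun h => hinj h.1), zero_add]
    obtain ⟨i, j, hij, hlt⟩ : ∃ i j, P i = P j ∧ i < j := by
      simp only [Function.Injective, not_forall] at hinj
      obtain ⟨i, j, h1, h2⟩ := hinj
      rcases lt_or_gt_of_ne h2 with h3 | h3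
      · exact ⟨i, j, h1, h3⟩
      · exact ⟨j, i, h1.symm, h3⟩
    refine le_trans ?_ (Finset.single_le_sum hnn2 (Finset.mem_range.2 j.2))
    refine le_trans (le_of_eq ?_) (Finset.single_le_sum (fun i _ => ?_)
      (Finset.mem_range.2 (Fin.lt_def.1 hlt)))
    · have e1 : ∀ i : Fin (N + 1), Fin.ofNat (N + 1) i = i := fun i => by
        ext; simp only [Fin.ofNat]; exact Nat.mod_eq_of_lt i.2
      rw [e1, e1, if_pos ⟨h.1, h.2, hij⟩]
    · split_ifs
      · exact hnn P
      · exact le_rfl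

lemma pset_one_card_ge {A B : Finset (Edge n)} {x y : Fin n} (hxy : x ≠ y) (h : ¬ adj A x y) :
    ∑ b, ∑ a, am A x b * am B b a * am A a y ≤ (pset 1 A B x y).card := by
  have e : ∀ b a, am A x b * am B b a * am A a y =
      if adj A x b ∧ adj B b a ∧ adj A a y then 1 else 0 := by
    intro b a
    unfold am
    by_cases h1 : adj A x b <;> by_cases h2 : adj B b a <;> by_cases h3 : adj A a y <;>
      simp [h1, h2, h3]
  simp_rw [e]
  rw [← Fintype.sum_prod_type' (f := fun b a => if adj A x b ∧ adj B b a ∧ adj A a y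
    then (1 : ℝ) else 0), ← Finset.sum_filter, Finset.sum_const, nsmul_eq_mul, mul_one]
  norm_cast
  refine Finset.card_le_card_of_injOn (fun p => (![x, p.2], ![p.1, y])) ?_ ?_
  · rintro ⟨b, a⟩ hp
    simp only [Finset.coe_filter, Finset.mem_univ, true_and, Set.mem_ofPred_eq] at hp
    obtain ⟨h1, h2, h3⟩ := hp
    have n1 : x ≠ a := by rintro rfl; exact h h3
    have n2 : b ≠ y := by rintro rfl; exact h h1
    refine mem_pset.2 ⟨?_, ?_, ?_, rfl, rfl, ?_, ?_⟩
    · intro i j hij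
      fin_cases i <;> fin_cases j <;> simp_all
    · intro i j hij
      fin_cases i <;> fin_cases j <;> simp_all
    · have := adj_ne h1
      have := adj_ne h2
      have := adj_ne h3
      intro i j
      fin_cases i <;> fin_cases j <;> simp_all [eq_comm]
    · intro i; fin_cases i <;> simpa
    · intro i hi
      fin_cases i
      · simpa using h2
      · exact absurd rfl hi
  · rintro ⟨b, a⟩ _ ⟨b', a'⟩ _ hp
    simp only [Prod.mk.injEq] at hp ⊢
    exact ⟨by simpa using congrFun hp.2 0, by simpa using congrFun hp.1 1⟩

lemma pset_two_card_ge {A B : Finset (Edge n)} {x y : Fin n} (hxy : x ≠ y) (h : ¬ adj A x y) :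
    ((Finset.univ.filter fun p : (Fin n × Fin n) × Fin n × Fin n =>
      adj A x p.1.1 ∧ adj A p.1.2 y ∧ p.1.1 ≠ p.1.2 ∧ adj A p.2.1 p.2.2 ∧ adj B p.1.1 p.2.1 ∧
      adj B p.2.2 p.1.2 ∧ p.2.1 ≠ x ∧ p.2.1 ≠ y ∧ p.2.1 ≠ p.1.2 ∧ p.2.2 ≠ x ∧ p.2.2 ≠ y ∧
      p.2.2 ≠ p.1.1).card : ℝ) ≤ (pset 2 A B x y).card := by
  norm_cast
  refine Finset.card_le_card_of_injOn
    (fun p => (![x, p.2.1, p.1.2], ![p.1.1, p.2.2, y])) ?_ ?_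
  · rintro ⟨⟨b, c⟩, a, d⟩ hp
    simp only [Finset.coe_filter, Finset.mem_univ, true_and, Set.mem_ofPred_eq] at hp
    obtain ⟨h1, h2, h3, h4, h5, h6, m1, m2, m3, m4, m5, m6⟩ := hp
    have n1 : x ≠ c := by rintro rfl; exact h h2
    have n2 : b ≠ y := by rintro rfl; exact h h1
    have n3 := adj_ne h1
    have n4 := adj_ne h2
    have n5 := adj_ne h4
    have n6 := adj_ne h5
    have n7 := adj_ne h6
    refine mem_pset.2 ⟨?_, ?_, ?_, rfl, rfl, ?_, ?_⟩
    · intro i j hij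
      fin_cases i <;> fin_cases j <;> simp_all
    · intro i j hij
      fin_cases i <;> fin_cases j <;> simp_all
    · intro i j
      fin_cases i <;> fin_cases j <;> simp_all [eq_comm]
    · intro i; fin_cases i <;> simpa
    · intro i hi
      fin_cases i
      · simpa using h5
      · simpa using h6
      · exact absurd rfl hi
  · rintro ⟨⟨b, c⟩, a, d⟩ _ ⟨⟨b', c'⟩, a', d'⟩ _ hp
    simp only [Prod.mk.injEq] at hp ⊢
    exact ⟨⟨by simpa using congrFun hp.2 0, by simpa using congrFun hp.1 2⟩,
      by simpa using congrFun hp.1 1, by simpa using congrFun hp.2 1⟩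

end Count

/-! ### From switchings to couplings -/

/-- Typical pairs `(K, E)` have bounded odds for all edges. -/
def Good (n k : ℕ) (s r : ℝ) : Prop :=
  ∃ T : Finset (Edge n) → Finset (Edge n) → Prop,
    ((regs n k).card : ℝ)⁻¹ * ∑ A ∈ regs n k, bpr Aᶜ s (fun E => ¬ T A E) ≤ 1 / (n : ℝ) ^ 7 ∧
    ∀ F, ∀ e ∈ F,
      s * (((regs n k).filter fun A => A ⊆ F ∧ e ∈ A ∧ T A (F \ A)).card : ℝ) ≤
        r * (((regs n k).filter fun A => A ⊆ F ∧ e ∉ A).card : ℝ)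

theorem good_of_switch (l : ℕ) {k : ℕ} {s r L U : ℝ} (hs : 0 ≤ s)
    (T : Finset (Edge n) → Finset (Edge n) → Prop)
    (hprob : ((regs n k).card : ℝ)⁻¹ * ∑ A ∈ regs n k, bpr Aᶜ s (fun E => ¬ T A E) ≤
      1 / (n : ℝ) ^ 7)
    (hL0 : 0 < L) (hU0 : 0 ≤ U) (hLU : s * U ≤ r * L)
    (hL : ∀ K ∈ regs n k, ∀ E, Disjoint K E → T K E → ∀ x y, adj K x y →
      L ≤ (pset l E K x y).card)
    (hU : ∀ K ∈ regs n k, ∀ E, Disjoint K E → T K E → ∀ x y, adj K x y → ∀ X Y, X ⊆ K → Y ⊆ E →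
      (∀ v, dg X v ≤ 1) → (∀ v, dg Y v = dg X v) →
      ((pset l ((K \ X) ∪ Y) ((E \ Y) ∪ X) x y).card : ℝ) ≤ U) : Good n k s r := by
  refine ⟨T, hprob, fun F e _ => ?_⟩
  obtain ⟨x, y, hxy, rfl⟩ := e.exists_mk
  set S := (regs n k).filter fun A => A ⊆ F ∧ mkE x y hxy ∈ A ∧ T A (F \ A) with hS
  have hmem : ∀ K ∈ S, K ∈ regs n k ∧ K ⊆ F ∧ adj K x y ∧ T K (F \ K) := by
    intro K hK
    rw [hS, Finset.mem_filter] at hK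
    exact ⟨hK.1, hK.2.1, (adj_iff_mem hxy).2 hK.2.2.1, hK.2.2.2⟩
  have h := switch_count (l := l) (k := k) (F := F) hxy S
    (fun K hK => ⟨(hmem K hK).1, (hmem K hK).2.1, (hmem K hK).2.2.1⟩) hU0 (L := L)
    (fun K hK => hL K (hmem K hK).1 _ Finset.disjoint_sdiff (hmem K hK).2.2.2 _ _
      (hmem K hK).2.2.1)
    (fun K hK X Y hX hY h1 h2 => by
      have e : F \ ((K \ X) ∪ Y) = ((F \ K) \ Y) ∪ X := by
        ext e
        have hKF := @(hmem K hK).2.1 e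
        have hX := @hX e
        have hY := @hY e
        simp only [Finset.mem_union, Finset.mem_sdiff] at hY ⊢
        tauto
      rw [e]
      exact hU K (hmem K hK).1 _ Finset.disjoint_sdiff (hmem K hK).2.2.2 _ _
        (hmem K hK).2.2.1 X Y hX hY h1 h2)
  set a : ℝ := (S.card : ℝ)
  set b : ℝ := (((regs n k).filter fun A => A ⊆ F ∧ mkE x y hxy ∉ A).card : ℝ) with hb
  have hb0 : 0 ≤ b := Nat.cast_nonneg _
  refine le_of_mul_le_mul_left ?_ hL0
  calc L * (s * a) = s * (L * a) := by ring
    _ ≤ s * (U * b) := mul_le_mul_of_nonneg_left h hs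
    _ = (s * U) * b := by ring
    _ ≤ (r * L) * b := mul_le_mul_of_nonneg_right hLU hb0
    _ = L * (r * b) := by ring

lemma average_le {α : Type*} (K : Finset α) (f : α → ℝ) {b : ℝ} (hb : 0 ≤ b)
    (h : ∀ A ∈ K, f A ≤ b) : (K.card : ℝ)⁻¹ * ∑ A ∈ K, f A ≤ b := by
  rcases K.eq_empty_or_nonempty with rfl | hK
  · simpa
  have h0 : (0 : ℝ) < K.card := by exact_mod_cast hK.card_pos
  rw [inv_mul_le_iff₀ h0, ← nsmul_eq_mul]
  exact Finset.sum_le_card_nsmul _ _ _ h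

theorem dom_of_good {k : ℕ} (hn : 2 ≤ n) (hK : (regs n k).Nonempty) {κ sₑ r : ℝ} (hκ0 : 0 ≤ κ)
    (hκ1 : κ < 1) (hs : 1 / (n : ℝ) ≤ sₑ) (hs1 : sₑ ≤ 1)
    (hG : ∀ s, sₑ ≤ s → s ≤ 1 → Good n k s r)
    (hr : r + 1 / n ≤ κ / (1 - κ) * (1 - 1 / n)) :
    Dom (1 / (n : ℝ) + 2 * Real.log n ^ 2 / n) (unif (regs n k)) (gnp (κ + (1 - κ) * sₑ)) := by
  have hn0 : (0 : ℝ) < n := by positivity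
  have hs0 : 0 < sₑ := lt_of_lt_of_le (by positivity) hs
  have hG' : ∀ s : ℝ, ∃ T : Finset (Edge n) → Finset (Edge n) → Prop, sₑ ≤ s → s ≤ 1 →
    ((regs n k).card : ℝ)⁻¹ * ∑ A ∈ regs n k, bpr Aᶜ s (fun E => ¬ T A E) ≤ 1 / (n : ℝ) ^ 7 ∧
    ∀ F, ∀ e ∈ F,
      s * (((regs n k).filter fun A => A ⊆ F ∧ e ∈ A ∧ T A (F \ A)).card : ℝ) ≤
        r * (((regs n k).filter fun A => A ⊆ F ∧ e ∉ A).card : ℝ) := by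
    intro s
    by_cases h : sₑ ≤ s ∧ s ≤ 1
    · obtain ⟨T, hT⟩ := hG s h.1 h.2
      exact ⟨T, fun _ _ => hT⟩
    · exact ⟨fun _ _ => True, fun h1 h2 => absurd ⟨h1, h2⟩ h⟩
  choose T hT using hG'
  refine dom_of_typical (k := n * k / 2) hn card_edge_le (fun A hA => card_of_mem_regs hA) hK hκ0
    hκ1 hs hs1 T (fun s => r / s) (fun s h1 h2 => (hT s h1 h2).1) (fun s h1 h2 F e he => ?_)
    (fun s h1 h2 => ?_)
  · have := (hT s h1 h2).2 F e he
    have h0 : 0 < s := hs0.trans_le h1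
    rw [div_mul_eq_mul_div, le_div_iff₀ h0]
    linarith
  · have h0 : 0 < s := hs0.trans_le h1
    rw [mul_add, mul_div_cancel₀ _ h0.ne']
    refine le_trans ?_ hr
    have : s * (1 / (n : ℝ)) ≤ 1 * (1 / n) := mul_le_mul_of_nonneg_right h2 (by positivity)
    linarith

/-! ### Conditioning on the edges at a vertex -/

lemma bpr_compl {α : Type*} [DecidableEq α] (X : Finset α) (p : ℝ) (P : Finset α → Prop) :
    bpr X p (fun A => ¬ P A) = 1 - bpr X p P := by
  have h := bexp_sub X p (fun _ => 1) (fun A => if P A then 1 else 0)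
  rw [bexp_const] at h
  unfold bpr
  rw [← h]
  exact bexp_congr fun A _ => by by_cases h : P A <;> simp [h]

lemma bpr_union_le {α : Type*} [DecidableEq α] {X Y : Finset α} (h : Disjoint X Y) {p b c : ℝ}
    (h0 : 0 ≤ p) (h1 : p ≤ 1) {P Q : Finset α → Prop} (hb : 0 ≤ b)
    (hP : bpr X p (fun A => ¬ P A) ≤ c)
    (hQ : ∀ A ⊆ X, P A → bpr Y p (fun B => Q (A ∪ B)) ≤ b) : bpr (X ∪ Y) p Q ≤ c + b := by
  unfold bpr
  rw [bexp_union h]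
  calc _ ≤ bexp X p (fun A => (if ¬ P A then 1 else 0) + b) := by
        refine bexp_mono h0 h1 fun A hA => ?_
        by_cases hPA : P A
        · have := hQ A hA hPA
          simpa [hPA, bpr] using this
        · have : bexp Y p (fun B => if Q (A ∪ B) then (1 : ℝ) else 0) ≤ bexp Y p (fun _ => 1) :=
            bexp_mono h0 h1 fun B _ => by split_ifs <;> norm_num
          rw [bexp_const] at this
          simp only [hPA, not_false_eq_true, if_true]
          linarith
    _ ≤ c + b := by
        rw [bexp_add, bexp_const]
        refine add_le_add_left (le_trans (le_of_eq ?_) hP) b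
        exact bexp_congr fun A _ => by by_cases h : P A <;> simp [h]

/-- The edges of `X` at `y`. -/
def star (X : Finset (Edge n)) (y : Fin n) : Finset (Edge n) := X.filter fun e => y ∈ e.1

lemma star_subset (X : Finset (Edge n)) (y : Fin n) : star X y ⊆ X := Finset.filter_subset _ _

lemma star_union (X : Finset (Edge n)) (y : Fin n) : star X y ∪ X \ star X y = X :=
  Finset.union_sdiff_of_subset (star_subset X y)

lemma adj_star {X : Finset (Edge n)} {y u v : Fin n} :
    adj (star X y) u v ↔ adj X u v ∧ (u = y ∨ v = y) := by
  unfold adj star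
  constructor
  · rintro ⟨e, he, h⟩
    rw [Finset.mem_filter, h, Sym2.mem_iff] at he
    exact ⟨⟨e, he.1, h⟩, he.2.imp Eq.symm Eq.symm⟩
  · rintro ⟨⟨e, he, h⟩, h2⟩
    exact ⟨e, Finset.mem_filter.2 ⟨he, by rw [h, Sym2.mem_iff]; exact h2.imp Eq.symm Eq.symm⟩, h⟩

lemma am_star_right (X : Finset (Edge n)) (y u : Fin n) : am (star X y) u y = am X u y := by
  unfold am
  simp [adj_star]

lemma am_sdiff_star (X : Finset (Edge n)) {y u v : Fin n} (hu : u ≠ y) (hv : v ≠ y) :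
    am (X \ star X y) u v = am X u v := by
  unfold am
  simp [adj_sdiff, adj_star, hu, hv]

lemma am_sdiff_star_right (X : Finset (Edge n)) (y u : Fin n) :
    am (X \ star X y) u y = 0 := by
  unfold am
  simp only [adj_sdiff, adj_star, or_true, and_true, and_not_self, if_false]

lemma bpr_am_star {X : Finset (Edge n)} {p : ℝ} (h0 : 0 ≤ p) (h1 : p ≤ 1) (x : Fin n)
    (f : Fin n → ℝ) {M : ℝ} (hf : ∀ v, |f v| ≤ M) (τ t : ℝ) (hτ : 0 ≤ τ) (hτM : τ * M ≤ 1 / 2) :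
    bpr X p (fun E => t ≤ |∑ v, f v * am E x v - p * ∑ v, f v * am X x v|) ≤
      2 * Real.exp (-(τ * t) + 2 * τ ^ 2 * (p * (dg X x * M ^ 2))) := by
  have hM : 0 ≤ M := (abs_nonneg _).trans (hf x)
  set c : Fin n → Fin n → ℝ := fun u v => if u = x then f v else 0 with hc
  have hcM : ∀ u v, |c u v| ≤ M := by
    intro u v
    rw [hc]; beta_reduce
    split_ifs
    · exact hf v
    · simpa
  have hsum : ∀ A : Finset (Edge n), ∑ u, ∑ v, c u v * am A u v = ∑ v, f v * am A x v := by
    intro A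
    rw [Finset.sum_eq_single x]
    · simp [hc]
    · intro u _ hu
      simp [hc, hu]
    · simp
  have h := bpr_am_abs (X := X) h0 h1 c τ t hτ (fun u v _ => by
    rw [abs_mul, abs_of_nonneg hτ]
    have := abs_add_le (c u v) (c v u)
    have := hcM u v
    have := hcM v u
    nlinarith)
  simp only [hsum] at h
  refine h.trans ?_
  gcongr 2 * Real.exp (-(τ * t) + ?_)
  have hvar : ∑ u, ∑ v, (c u v + c v u) ^ 2 / 2 * am X u v ≤ 2 * (dg X x * M ^ 2) := by
    calc _ ≤ ∑ u, ∑ v, (c u v ^ 2 * am X u v + c v u ^ 2 * am X v u) := by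
          refine Finset.sum_le_sum fun u _ => Finset.sum_le_sum fun v _ => ?_
          rw [am_comm X v u]
          have := am_nonneg X u v
          nlinarith [sq_nonneg (c u v - c v u)]
      _ = 2 * ∑ u, ∑ v, c u v ^ 2 * am X u v := by
          simp_rw [Finset.sum_add_distrib]
          rw [Finset.sum_comm (f := fun u v => c v u ^ 2 * am X v u)]
          ring
      _ = 2 * ∑ v, f v ^ 2 * am X x v := by
          rw [Finset.sum_eq_single (f := fun u => ∑ v, c u v ^ 2 * am X u v) x]
          · simp [hc]
          · intro u _ hu
            simp [hc, hu]
          · simp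
      _ ≤ 2 * (dg X x * M ^ 2) := by
          rw [← sum_am, Finset.sum_mul]
          refine mul_le_mul_of_nonneg_left (Finset.sum_le_sum fun v _ => ?_) (by norm_num)
          rw [mul_comm]
          refine mul_le_mul_of_nonneg_left ?_ (am_nonneg _ _ _)
          exact sq_le_sq' (by linarith [(abs_le.1 (hf v)).1]) (abs_le.1 (hf v)).2
  calc τ ^ 2 * (p * ∑ u, ∑ v, (c u v + c v u) ^ 2 / 2 * am X u v)
      ≤ τ ^ 2 * (p * (2 * (dg X x * M ^ 2))) := by gcongr
    _ = _ := by ring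

lemma bpr_dg {X : Finset (Edge n)} {p : ℝ} (h0 : 0 ≤ p) (h1 : p ≤ 1) (x : Fin n)
    (τ t : ℝ) (hτ : 0 ≤ τ) (hτM : τ ≤ 1 / 2) :
    bpr X p (fun E => t ≤ |(dg E x : ℝ) - p * dg X x|) ≤
      2 * Real.exp (-(τ * t) + 2 * τ ^ 2 * (p * dg X x)) := by
  have := bpr_am_star (X := X) h0 h1 x (fun _ => 1) (M := 1) (by simp) τ t hτ (by linarith)
  simpa only [one_mul, sum_am, one_pow, mul_one] using this

lemma pw_three (A : ℕ → Fin n → Fin n → ℝ) (x y : Fin n) :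
    pw A 0 3 x y = ∑ b, ∑ a, A 0 x b * A 1 b a * A 2 a y := by
  rw [pw_succ]
  refine Finset.sum_congr rfl fun b _ => ?_
  rw [pw_succ, Finset.mul_sum]
  refine Finset.sum_congr rfl fun a _ => ?_
  rw [pw_one]
  ring

lemma dg_le_real (hn : 1 ≤ n) (G : Finset (Edge n)) (v : Fin n) : (dg G v : ℝ) ≤ n - 1 := by
  have := dg_le G v
  rw [le_sub_iff_add_le]
  exact_mod_cast (by omega : dg G v + 1 ≤ n)

/-! ### Sparse regular graphs with dense random edges -/

lemma pset_one_card_le {K E : Finset (Edge n)} {k : ℕ} (hK : ∀ v, dg K v = k) (x y : Fin n) :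
    ((pset 1 K E x y).card : ℝ) ≤ (k : ℝ) ^ 2 := by
  refine (pset_card_le 1 K E x y).trans ?_
  rw [show 2 * 1 + 1 = 3 from rfl, pw_three]
  calc _ ≤ ∑ b, ∑ a, am K x b * am K y a := by
        refine Finset.sum_le_sum fun b _ => Finset.sum_le_sum fun a _ => ?_
        have e0 : alt K E 0 x b = am K x b := by simp [alt]
        have e2 : alt K E 2 a y = am K y a := by simp [alt, am_comm K a y]
        rw [e0, e2, mul_right_comm]
        exact mul_le_of_le_one_right (mul_nonneg (am_nonneg _ _ _) (am_nonneg _ _ _))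
          (alt_le_one _ _ _ _ _)
    _ = (k : ℝ) ^ 2 := by
        simp_rw [← Finset.mul_sum, sum_am, ← Finset.sum_mul, sum_am, hK]
        ring

lemma bpr_paths_small {K : Finset (Edge n)} {k : ℕ} (hK : ∀ v, dg K v = k) {s : ℝ} (hk : 1 ≤ k)
    (h0 : 0 < s) (h1 : s ≤ 1) (hks : (k : ℝ) + 2 ≤ s * n / 8) {x y : Fin n} (hxy : x ≠ y) :
    bpr Kᶜ s (fun E => ∑ b, ∑ a, am E x b * am K b a * am E a y < s ^ 2 * n * k / 2) ≤
      4 * Real.exp (-(s ^ 3 * n / 512)) := by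
  have hk0 : (1 : ℝ) ≤ k := by exact_mod_cast hk
  have hn0 : (0 : ℝ) ≤ n := Nat.cast_nonneg n
  have hn1 : 1 ≤ n := Nat.one_le_iff_ne_zero.2 (fun h => by subst h; exact x.elim0)
  have hs3 : s ^ 3 ≤ s := by nlinarith [sq_nonneg s]
  rw [← star_union Kᶜ y, show 4 * Real.exp (-(s ^ 3 * n / 512)) =
    2 * Real.exp (-(s ^ 3 * n / 512)) + 2 * Real.exp (-(s ^ 3 * n / 512)) by ring]
  refine bpr_union_le Finset.disjoint_sdiff h0.le h1
    (P := fun A => 3 / 4 * s * n ≤ dg A y) (by positivity) ?_ ?_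
  · have hd : (dg (star Kᶜ y) y : ℝ) = n - 1 - k := by
      rw [← hK y, ← dg_compl, ← sum_am, ← sum_am]
      exact Finset.sum_congr rfl fun u _ => by rw [am_comm, am_star_right, am_comm]
    have h := bpr_dg (X := star Kᶜ y) h0.le h1 y (1 / 32) (s * n / 8) (by norm_num) (by norm_num)
    refine (bpr_mono h0.le h1 fun A _ hA => ?_).trans (h.trans ?_)
    · rw [hd]
      rw [not_le] at hA
      refine le_trans ?_ (neg_le_abs _)
      nlinarith
    · rw [hd]
      gcongr 2 * Real.exp ?_
      nlinarith
  · intro A hA hPA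
    set f : Fin n → ℝ := fun b => ∑ a, am K b a * am A a y with hf
    have hf0 : ∀ b, 0 ≤ f b := fun b =>
      Finset.sum_nonneg fun a _ => mul_nonneg (am_nonneg _ _ _) (am_nonneg _ _ _)
    have hfk : ∀ b, f b ≤ k := by
      intro b
      calc f b ≤ ∑ a, am K b a := Finset.sum_le_sum fun a _ =>
            mul_le_of_le_one_right (am_nonneg _ _ _) (am_le_one _ _ _)
        _ = k := by rw [sum_am, hK]
    have hfsum : ∑ b, f b = k * dg A y := by
      rw [hf, Finset.sum_comm]
      have : ∀ a, ∑ b, am K b a * am A a y = k * am A y a := by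
        intro a
        rw [← Finset.sum_mul, am_comm A a y, ← hK a, ← sum_am]
        simp_rw [am_comm K _ a]
      simp_rw [this, ← Finset.mul_sum, sum_am]
    have hXsum : 5 / 8 * s * n * k ≤ ∑ b, f b * am (Kᶜ \ star Kᶜ y) x b := by
      have e : ∀ b, f b - k * (am K x b + (if x = b then 1 else 0) + (if y = b then 1 else 0)) ≤
          f b * am (Kᶜ \ star Kᶜ y) x b := by
        intro b
        by_cases hb : b = y
        · subst hb
          have := hfk b
          have := am_nonneg K x b
          simp only [am_sdiff_star_right, if_true, hxy, if_false, mul_zero, add_zero]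
          nlinarith
        · rw [am_sdiff_star _ hxy hb, am_compl]
          simp only [Ne.symm hb, if_false, add_zero]
          have := hfk b
          have := am_nonneg K x b
          split_ifs <;> nlinarith
      refine le_trans ?_ (Finset.sum_le_sum fun b _ => e b)
      rw [Finset.sum_sub_distrib, hfsum, ← Finset.mul_sum, Finset.sum_add_distrib,
        Finset.sum_add_distrib, sum_am, hK, Finset.sum_ite_eq, Finset.sum_ite_eq]
      simp only [Finset.mem_univ, if_true]
      nlinarith
    have h := bpr_am_star (X := Kᶜ \ star Kᶜ y) h0.le h1 x f (M := k)
      (fun v => by rw [abs_of_nonneg (hf0 v)]; exact hfk v) (s / (32 * k)) (s ^ 2 * n * k / 8)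
      (by positivity) (by
        rw [div_mul_eq_mul_div, div_le_iff₀ (by positivity)]
        nlinarith)
    refine (bpr_mono h0.le h1 fun B hB hQ => ?_).trans (h.trans ?_)
    · have hle : ∑ v, f v * am B x v ≤ ∑ b, ∑ a, am (A ∪ B) x b * am K b a * am (A ∪ B) a y := by
        refine Finset.sum_le_sum fun b _ => ?_
        rw [hf]; beta_reduce
        rw [Finset.sum_mul]
        refine Finset.sum_le_sum fun a _ => ?_
        have i1 := am_mono (Finset.subset_union_right : B ⊆ A ∪ B) x b
        have i2 := am_mono (Finset.subset_union_left : A ⊆ A ∪ B) a y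
        calc _ = am B x b * am K b a * am A a y := by ring
          _ ≤ _ := by
            refine mul_le_mul (mul_le_mul_of_nonneg_right i1 (am_nonneg _ _ _)) i2
              (am_nonneg _ _ _) (mul_nonneg (am_nonneg _ _ _) (am_nonneg _ _ _))
      refine le_trans ?_ (neg_le_abs _)
      have := mul_le_mul_of_nonneg_left hXsum h0.le
      nlinarith
    · gcongr 2 * Real.exp ?_
      have hd : (dg (Kᶜ \ star Kᶜ y) x : ℝ) ≤ n := by
        have := dg_le_real hn1 (Kᶜ \ star Kᶜ y) x
        linarith
      have e1 : s / (32 * k) * (s ^ 2 * n * k / 8) = s ^ 3 * n / 256 := by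
        field_simp; norm_num
      have e2 : 2 * (s / (32 * (k : ℝ))) ^ 2 * (s * (dg (Kᶜ \ star Kᶜ y) x * (k : ℝ) ^ 2)) =
          s ^ 3 * dg (Kᶜ \ star Kᶜ y) x / 512 := by
        field_simp; ring
      rw [e1, e2]
      have : s ^ 3 * dg (Kᶜ \ star Kᶜ y) x ≤ s ^ 3 * n := by gcongr
      linarith

theorem good_small {k : ℕ} {s : ℝ} (hn : 1 ≤ n) (hk : 1 ≤ k) (h0 : 0 < s) (h1 : s ≤ 1)
    (hks : (k : ℝ) + 2 ≤ s * n / 8) (hexp : 4 * Real.exp (-(s ^ 3 * n / 512)) ≤ 1 / (n : ℝ) ^ 9) :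
    Good n k s (2 * k / (s * n)) := by
  have hn0 : (0 : ℝ) < n := by exact_mod_cast hn
  have hk0 : (0 : ℝ) < k := by exact_mod_cast hk
  refine good_of_switch 1 h0.le (fun K E => ∀ x y, adj K x y →
    s ^ 2 * n * k / 2 ≤ ∑ b, ∑ a, am E x b * am K b a * am E a y) ?_
    (L := s ^ 2 * n * k / 2) (U := (k : ℝ) ^ 2) (by positivity) (by positivity) ?_ ?_ ?_
  · refine average_le _ _ (by positivity) fun K hK => ?_
    rw [mem_regs] at hK
    calc _ ≤ bpr Kᶜ s (fun E => ∃ p : Fin n × Fin n, p.1 ≠ p.2 ∧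
            ∑ b, ∑ a, am E p.1 b * am K b a * am E a p.2 < s ^ 2 * n * k / 2) := by
          refine bpr_mono h0.le h1 fun E _ h => ?_
          push Not at h
          obtain ⟨x, y, hxy, h⟩ := h
          exact ⟨(x, y), adj_ne hxy, h⟩
      _ ≤ Fintype.card (Fin n × Fin n) * (1 / (n : ℝ) ^ 9) := by
          refine bpr_exists_le h0.le h1 _ fun p => ?_
          by_cases hp : p.1 = p.2
          · simp only [hp, ne_eq, not_true_eq_false, false_and]
            unfold bpr
            simp only [if_false]
            rw [bexp_const]
            positivity
          · refine le_trans (bpr_mono h0.le h1 fun E _ h => h.2) ?_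
            exact (bpr_paths_small hK hk h0 h1 hks hp).trans hexp
      _ = 1 / (n : ℝ) ^ 7 := by
          rw [Fintype.card_prod, Fintype.card_fin]
          push_cast
          field_simp
  · apply le_of_eq
    field_simp
  · intro K hK E hKE hT x y hxy
    refine (hT x y hxy).trans (pset_one_card_ge (adj_ne hxy) fun h => ?_)
    obtain ⟨hne⟩ : Nonempty (x ≠ y) := ⟨adj_ne hxy⟩
    exact Finset.disjoint_left.1 hKE ((adj_iff_mem hne).1 hxy) ((adj_iff_mem hne).1 h)
  · intro K hK E hKE _ x y hxy X Y hX hY _ h2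
    rw [mem_regs] at hK
    refine pset_one_card_le (fun v => ?_) x y
    rw [dg_switch hX (hKE.mono_right hY) h2, hK]

/-! ### Dense regular graphs -/

lemma bpr_dg_rel {X : Finset (Edge n)} {p m e : ℝ} (h0 : 0 ≤ p) (h1 : p ≤ 1)
    (hX : ∀ v, (dg X v : ℝ) = m) (he0 : 0 ≤ e) (he : e ≤ 1) :
    bpr X p (fun E => ∃ v, e * (p * m) < |(dg E v : ℝ) - p * m|) ≤
      n * (2 * Real.exp (-(e ^ 2 * (p * m) / 8))) := by
  have h := bpr_exists_le (ι := Fin n) h0 h1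
    (fun v E => e * (p * m) < |(dg E v : ℝ) - p * m|)
    (b := 2 * Real.exp (-(e ^ 2 * (p * m) / 8))) (fun v => by
      refine (bpr_mono (X := X) h0 h1 fun E _ h => le_of_lt ?_).trans
        ((bpr_dg (X := X) h0 h1 v (e / 4) (e * (p * m)) (by linarith) (by linarith)).trans (le_of_eq ?_))
      · rw [hX]; exact h
      · rw [hX]; ring_nf)
  rwa [Fintype.card_fin] at h

lemma pw_five (A : ℕ → Fin n → Fin n → ℝ) (x y : Fin n) :
    pw A 0 5 x y =
      ∑ b, ∑ a, A 0 x b * A 1 b a * ∑ d, A 2 a d * ∑ c, A 3 d c * A 4 c y := by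
  rw [pw_succ]
  refine Finset.sum_congr rfl fun b _ => ?_
  rw [pw_succ, Finset.mul_sum]
  refine Finset.sum_congr rfl fun a _ => ?_
  rw [pw_succ, ← mul_assoc]
  congr 1
  refine Finset.sum_congr rfl fun d _ => ?_
  rw [pw_succ]
  congr 1
  refine Finset.sum_congr rfl fun c _ => ?_
  rw [pw_one]

lemma pset_two_card_le {K E : Finset (Edge n)} {M : ℝ} (hE : ∀ v, (dg E v : ℝ) ≤ M)
    (x y : Fin n) : ((pset 2 K E x y).card : ℝ) ≤ (n * M) ^ 2 := by
  refine (pset_card_le 2 K E x y).trans ?_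
  have hM : ∑ v, (dg E v : ℝ) ≤ n * M := by
    have := Finset.sum_le_card_nsmul Finset.univ (fun v => (dg E v : ℝ)) M fun v _ => hE v
    simpa using this
  have hA : ∀ t u v, 0 ≤ alt K E t u v := alt_nonneg K E
  have h1 : ∀ t u v, alt K E t u v ≤ 1 := alt_le_one K E
  have e1 : ∀ u v, alt K E 1 u v = am E u v := fun u v => by simp [alt]
  have e3 : ∀ u v, alt K E 3 u v = am E u v := fun u v => by
    simp [alt]
  rw [show 2 * 2 + 1 = 5 from rfl, pw_five]
  calc _ ≤ ∑ b, ∑ a, am E b a * ∑ d, ∑ c, am E d c := by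
        refine Finset.sum_le_sum fun b _ => Finset.sum_le_sum fun a _ => ?_
        rw [e1]
        refine mul_le_mul (mul_le_of_le_one_left (am_nonneg _ _ _) (h1 _ _ _)) ?_
          (Finset.sum_nonneg fun d _ => mul_nonneg (hA _ _ _)
            (Finset.sum_nonneg fun c _ => mul_nonneg (hA _ _ _) (hA _ _ _))) (am_nonneg _ _ _)
        refine Finset.sum_le_sum fun d _ => ?_
        have h3 : ∀ c, alt K E 3 d c * alt K E 4 c y ≤ am E d c := fun c => by
          rw [e3]; exact mul_le_of_le_one_right (am_nonneg _ _ _) (h1 _ _ _)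
        refine (mul_le_of_le_one_left (Finset.sum_nonneg fun c _ =>
          mul_nonneg (hA _ _ _) (hA _ _ _)) (h1 _ _ _)).trans ?_
        exact Finset.sum_le_sum fun c _ => h3 c
    _ = (∑ v, (dg E v : ℝ)) ^ 2 := by
        simp_rw [sum_am, ← Finset.sum_mul, sum_am]
        ring
    _ ≤ (n * M) ^ 2 := by
        have : 0 ≤ ∑ v, (dg E v : ℝ) := Finset.sum_nonneg fun v _ => Nat.cast_nonneg _
        gcongr

lemma pset_two_card_ge' {K E : Finset (Edge n)} {k : ℕ} {M m : ℝ} (hK : ∀ v, dg K v = k)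
    (hM : ∀ v, (dg E v : ℝ) ≤ M) (hm : ∀ v, m ≤ (dg E v : ℝ)) (hm1 : 1 ≤ m)
    (hpos : 0 ≤ n * m - 2 * (n - k + 3) * M) {x y : Fin n} (hxy : x ≠ y) (h : ¬ adj E x y) :
    m * (m - 1) * (n * m - 2 * (n - k + 3) * M) ≤ (pset 2 E K x y).card := by
  refine le_trans ?_ (pset_two_card_ge hxy h)
  have hM0 : 0 ≤ M := (Nat.cast_nonneg _).trans (hM x)
  set W := n * m - 2 * (n - k + 3) * M with hW
  set i : Fin n → Fin n → ℝ := fun u v => if u = v then 1 else 0 with hi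
  have i0 : ∀ u v, 0 ≤ i u v := fun u v => by rw [hi]; beta_reduce; split_ifs <;> norm_num
  have isum : ∀ u, ∑ v, i v u = 1 := fun u => by rw [hi]; simp
  have iself : ∀ u, i u u = 1 := fun u => by rw [hi]; simp
  set β : Fin n → Fin n → ℝ := fun c a => i a x + i a y + i a c with hβ
  have hbad : ∀ b c : Fin n, ∑ a, ∑ d, (β c a + (1 - am K b a)) * am E a d ≤ (n - k + 3) * M := by
    intro b c
    calc _ = ∑ a, (β c a + (1 - am K b a)) * dg E a := by simp_rw [← Finset.mul_sum, sum_am]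
      _ ≤ ∑ a, (β c a + (1 - am K b a)) * M := by
        refine Finset.sum_le_sum fun a _ => mul_le_mul_of_nonneg_left (hM a) ?_
        have := am_le_one K b a
        have := i0 a x
        have := i0 a y
        have := i0 a c
        rw [hβ]; beta_reduce
        linarith
      _ = _ := by
        rw [← Finset.sum_mul, Finset.sum_add_distrib, Finset.sum_sub_distrib, sum_am, hK, hβ]
        simp_rw [Finset.sum_add_distrib, isum]
        simp only [Finset.sum_const, Finset.card_univ, Fintype.card_fin, nsmul_eq_mul, mul_one]
        ring
  have hdeg : ∑ a, ∑ d, am E a d ≥ n * m := by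
    simp_rw [sum_am]
    have := Finset.card_nsmul_le_sum Finset.univ (fun v => (dg E v : ℝ)) m fun v _ => hm v
    simpa using this
  have hbc : ∀ b c : Fin n, W ≤ ∑ a, ∑ d, (am E a d - (β c a + (1 - am K b a)) * am E a d
      - (β b d + (1 - am K c d)) * am E d a) := by
    intro b c
    have h1 := hbad b c
    have h2 := hbad c b
    rw [Finset.sum_comm] at h2
    simp_rw [Finset.sum_sub_distrib]
    rw [hW]
    linarith
  rw [Finset.card_filter]
  push_cast
  rw [Fintype.sum_prod_type]
  simp_rw [Fintype.sum_prod_type]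
  calc m * (m - 1) * W ≤ ∑ b, ∑ c, am E x b * am E y c * (1 - i c b) * W := by
        simp_rw [← Finset.sum_mul]
        refine mul_le_mul_of_nonneg_right ?_ hpos
        have : ∀ b, ∑ c, am E x b * am E y c * (1 - i c b) ≥ am E x b * (m - 1) := by
          intro b
          simp_rw [mul_assoc, ← Finset.mul_sum]
          refine mul_le_mul_of_nonneg_left ?_ (am_nonneg _ _ _)
          have hc : ∀ c, am E y c * (1 - i c b) ≥ am E y c - i c b := by
            intro c
            nlinarith [i0 c b, am_le_one E y c]
          calc _ ≤ ∑ c, (am E y c - i c b) := by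
                rw [Finset.sum_sub_distrib, sum_am, isum]
                linarith [hm y]
            _ ≤ _ := Finset.sum_le_sum fun c _ => hc c
        calc m * (m - 1) ≤ dg E x * (m - 1) := mul_le_mul_of_nonneg_right (hm x) (by linarith)
          _ = ∑ b, am E x b * (m - 1) := by rw [← Finset.sum_mul, sum_am]
          _ ≤ _ := Finset.sum_le_sum fun b _ => this b
    _ ≤ ∑ b, ∑ c, am E x b * am E y c * (1 - i c b) * ∑ a, ∑ d,
          (am E a d - (β c a + (1 - am K b a)) * am E a d
            - (β b d + (1 - am K c d)) * am E d a) := by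
        refine Finset.sum_le_sum fun b _ => Finset.sum_le_sum fun c _ =>
          mul_le_mul_of_nonneg_left (hbc b c) ?_
        refine mul_nonneg (mul_nonneg (am_nonneg _ _ _) (am_nonneg _ _ _)) ?_
        rw [hi]; beta_reduce; split_ifs <;> norm_num
    _ ≤ _ := by
        refine Finset.sum_le_sum fun b _ => Finset.sum_le_sum fun c _ => ?_
        rw [Finset.mul_sum]
        refine Finset.sum_le_sum fun a _ => ?_
        rw [Finset.mul_sum]
        refine Finset.sum_le_sum fun d _ => ?_
        by_cases hxb : adj E x b
        swap
        · rw [am_of_not_adj hxb]; simp [hxb]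
        by_cases hyc : adj E y c
        swap
        · rw [am_of_not_adj hyc]; simp [adj_comm, hyc]
        by_cases hcb : c = b
        · rw [hcb, iself]; simp
        by_cases had : adj E a d
        swap
        · rw [am_comm E d a, am_of_not_adj had]; simp [had]
        rw [am_comm E d a, am_of_adj hxb, am_of_adj hyc, am_of_adj had]
        have icb : i c b = 0 := by rw [hi]; simp [hcb]
        rw [icb]
        have hβ0 : ∀ u v, 0 ≤ β u v := fun u v => by
          rw [hβ]; exact add_nonneg (add_nonneg (i0 _ _) (i0 _ _)) (i0 _ _)
        have hβ1 : ∀ u v, (v = x ∨ v = y ∨ v = u) → 1 ≤ β u v := fun u v h => by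
          have j1 := i0 v x
          have j2 := i0 v y
          have j3 := i0 v u
          rw [hβ]; beta_reduce
          rcases h with rfl | rfl | rfl <;> simp only [iself] at * <;> linarith
        have k1 := am_le_one K b a
        have k2 := am_le_one K c d
        have b1 := hβ0 c a
        have b2 := hβ0 b d
        by_cases ha : a = x ∨ a = y ∨ a = c
        · have := hβ1 c a ha
          refine le_trans (b := 0) (by nlinarith) ?_
          split_ifs <;> norm_num
        by_cases hd : d = x ∨ d = y ∨ d = b
        · have := hβ1 b d hd
          refine le_trans (b := 0) (by nlinarith) ?_
          split_ifs <;> norm_num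
        by_cases hba : adj K b a
        swap
        · rw [am_of_not_adj hba]
          refine le_trans (b := 0) (by nlinarith) ?_
          split_ifs <;> norm_num
        by_cases hdc : adj K d c
        swap
        · rw [am_comm K c d, am_of_not_adj hdc]
          refine le_trans (b := 0) (by nlinarith) ?_
          split_ifs <;> norm_num
        push Not at ha hd
        rw [if_pos ⟨hxb, adj_symm hyc, Ne.symm hcb, had, hba, hdc, ha.1, ha.2.1, ha.2.2, hd.1,
          hd.2.1, hd.2.2⟩]
        nlinarith

theorem good_dense {k : ℕ} {s e : ℝ} (hn : 1 ≤ n) (h0 : 0 < s) (h1 : s ≤ 1) (he0 : 0 < e)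
    (he1 : e ≤ 1 / 20) (hsd : 1 ≤ e * (s * (n - 1 - k))) (hdn : 3 * ((n : ℝ) - k + 3) ≤ e * n)
    (hexp : 2 * Real.exp (-(e ^ 2 * (s * (n - 1 - k)) / 8)) ≤ 1 / (n : ℝ) ^ 8) :
    Good n k s ((1 + 10 * e) * (n / (n - 1 - k))) := by
  have hn0 : (0 : ℝ) < n := by exact_mod_cast hn
  set d : ℝ := n - 1 - k with hd
  have hd0 : 0 < d := by
    by_contra h
    rw [not_lt] at h
    have : e * (s * d) ≤ 0 := by
      rw [← mul_assoc]; exact mul_nonpos_of_nonneg_of_nonpos (by positivity) h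
    linarith
  have hnk : (n : ℝ) - k + 3 = d + 4 := by rw [hd]; ring
  rw [hnk] at hdn
  set D : ℝ := s * d with hD
  have hD0 : 0 < D := by positivity
  have hLL : (1 - 5 * e) * (D ^ 3 * n) ≤
      (1 - e) * D * ((1 - e) * D - 1) * (n * ((1 - e) * D) - 2 * (n - k + 3) * ((1 + e) * D)) := by
    rw [hnk]
    have a1 : (1 - 2 * e) * D ≤ (1 - e) * D - 1 := by linarith
    have a2 : (1 - 2 * e) * D * n ≤ n * ((1 - e) * D) - 2 * (d + 4) * ((1 + e) * D) := by
      have : 2 * (d + 4) * (1 + e) ≤ e * n := by nlinarith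
      nlinarith
    have a3 : 0 ≤ (1 - 2 * e) * D * n := mul_nonneg (mul_nonneg (by linarith) hD0.le) hn0.le
    have a4 : 0 ≤ (1 - e) * D := mul_nonneg (by linarith) hD0.le
    calc (1 - 5 * e) * (D ^ 3 * n) ≤ ((1 - e) * (1 - 2 * e) * (1 - 2 * e)) * (D ^ 3 * n) := by
          refine mul_le_mul_of_nonneg_right ?_ (by positivity)
          nlinarith [sq_nonneg e, mul_nonneg (sq_nonneg e) he0.le]
      _ = (1 - e) * D * ((1 - 2 * e) * D) * ((1 - 2 * e) * D * n) := by ring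
      _ ≤ _ := by
          refine mul_le_mul (mul_le_mul_of_nonneg_left a1 a4) a2 a3 (mul_nonneg a4 ?_)
          exact le_trans (mul_nonneg (by linarith) hD0.le) a1
  refine good_of_switch 2 h0.le (fun _ E => ∀ v, |(dg E v : ℝ) - D| ≤ e * D) ?_
    (L := (1 - 5 * e) * (D ^ 3 * n)) (U := (n * ((1 + e) * D)) ^ 2) ?_ (by positivity) ?_ ?_ ?_
  · refine average_le _ _ (by positivity) fun K hK => ?_
    rw [mem_regs] at hK
    have h := bpr_dg_rel (X := Kᶜ) (m := d) h0.le h1 (fun v => by rw [dg_compl, hK]) he0.le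
      (by linarith)
    refine le_trans (bpr_mono h0.le h1 fun E _ hE => ?_) (h.trans ?_)
    · push Not at hE
      exact hE
    · calc n * (2 * Real.exp (-(e ^ 2 * (s * d) / 8))) ≤ n * (1 / (n : ℝ) ^ 8) := by gcongr
        _ = _ := by field_simp
  · have : 0 < 1 - 5 * e := by linarith
    positivity
  · have h2 : s * (n * ((1 + e) * D)) ^ 2 = (1 + e) ^ 2 * (n ^ 2 * D ^ 2 * s) := by ring
    have h3 : (1 + 10 * e) * (n / d) * ((1 - 5 * e) * (D ^ 3 * n)) =
        (1 + 10 * e) * (1 - 5 * e) * (n ^ 2 * D ^ 2 * s) := by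
      rw [hD]; field_simp
    rw [h2, h3]
    refine mul_le_mul_of_nonneg_right ?_ (by positivity)
    nlinarith
  · intro K hK E hKE hT x y hxy
    rw [mem_regs] at hK
    have hle : ∀ v, (dg E v : ℝ) ≤ (1 + e) * D := fun v => by
      have := (abs_le.1 (hT v)).2; linarith
    have hge : ∀ v, (1 - e) * D ≤ (dg E v : ℝ) := fun v => by
      have := (abs_le.1 (hT v)).1; linarith
    refine hLL.trans (pset_two_card_ge' hK hle hge ?_ ?_ (adj_ne hxy) fun h => ?_)
    · nlinarith
    · rw [hnk]
      have : 2 * (d + 4) * (1 + e) ≤ e * n := by nlinarith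
      nlinarith [mul_nonneg hn0.le hD0.le]
    · exact Finset.disjoint_left.1 hKE ((adj_iff_mem (adj_ne hxy)).1 hxy)
        ((adj_iff_mem (adj_ne hxy)).1 h)
  · intro K hK E hKE hT x y hxy X Y hX hY _ h2
    refine pset_two_card_le (fun v => ?_) x y
    rw [dg_switch hY (hKE.symm.mono_right hX) (fun v => (h2 v).symm)]
    have := (abs_le.1 (hT v)).2
    linarith

/-! ### Cut regularity -/

/-- The number of edges between `A` and `B`. -/
def cutw (E : Finset (Edge n)) (A B : Finset (Fin n)) : ℝ := ∑ u ∈ A, ∑ v ∈ B, am E u v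

lemma bpr_cut {X : Finset (Edge n)} {p η : ℝ} (h0 : 0 ≤ p) (h1 : p ≤ 1) (hη0 : 0 ≤ η)
    (hη1 : η ≤ 1) :
    bpr X p (fun E => ∃ P : Finset (Fin n) × Finset (Fin n),
      η * (n : ℝ) ^ 2 < |cutw E P.1 P.2 - p * cutw X P.1 P.2|) ≤
      4 ^ n * (2 * Real.exp (-(η ^ 2 * (n : ℝ) ^ 2 / 8))) := by
  have h := bpr_exists_le (ι := Finset (Fin n) × Finset (Fin n)) (X := X) h0 h1
    (fun P E => η * (n : ℝ) ^ 2 < |cutw E P.1 P.2 - p * cutw X P.1 P.2|)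
    (b := 2 * Real.exp (-(η ^ 2 * (n : ℝ) ^ 2 / 8))) ?_
  · refine h.trans (le_of_eq ?_)
    rw [Fintype.card_prod, Fintype.card_finset, Fintype.card_fin]
    push_cast
    rw [← mul_pow]
    norm_num
  · rintro ⟨A, B⟩
    set c : Fin n → Fin n → ℝ := fun u v => if u ∈ A then (if v ∈ B then 1 else 0) else 0 with hc
    have hcut : ∀ E : Finset (Edge n), ∑ u, ∑ v, c u v * am E u v = cutw E A B := by
      intro E
      unfold cutw
      rw [← Finset.sum_filter_add_sum_filter_not Finset.univ (fun u => u ∈ A)]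
      rw [Finset.sum_eq_zero (s := Finset.univ.filter fun u => u ∉ A), add_zero,
        Finset.filter_mem_eq_inter, Finset.univ_inter]
      · refine Finset.sum_congr rfl fun u hu => ?_
        simp [hc, hu]
      · intro u hu
        simp only [Finset.mem_filter, Finset.mem_univ, true_and] at hu
        simp [hc, hu]
    have hc0 : ∀ u v, 0 ≤ c u v := fun u v => by rw [hc]; beta_reduce; split_ifs <;> norm_num
    have hc1 : ∀ u v, c u v ≤ 1 := fun u v => by rw [hc]; beta_reduce; split_ifs <;> norm_num
    have hc2 : ∀ u v, 0 ≤ c u v + c v u ∧ c u v + c v u ≤ 2 := fun u v =>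
      ⟨add_nonneg (hc0 _ _) (hc0 _ _), by linarith [hc1 u v, hc1 v u]⟩
    have h := bpr_am_abs (X := X) h0 h1 c (η / 4) (η * (n : ℝ) ^ 2) (by positivity)
      (fun u v _ => by
        rw [abs_of_nonneg (mul_nonneg (by positivity) (hc2 u v).1)]
        have := hc2 u v
        nlinarith)
    simp only [hcut] at h
    refine (bpr_mono h0 h1 fun E _ hE => hE.le).trans (h.trans ?_)
    gcongr 2 * Real.exp ?_
    have hvar : ∑ u, ∑ v, (c u v + c v u) ^ 2 / 2 * am X u v ≤ 2 * (n : ℝ) ^ 2 := by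
      calc _ ≤ ∑ u : Fin n, ∑ v : Fin n, (2 : ℝ) := by
            refine Finset.sum_le_sum fun u _ => Finset.sum_le_sum fun v _ => ?_
            have := hc2 u v
            refine le_trans (mul_le_of_le_one_right (by positivity) (am_le_one _ _ _)) ?_
            nlinarith
        _ = _ := by
            simp only [Finset.sum_const, Finset.card_univ, Fintype.card_fin, nsmul_eq_mul]
            ring
    have hvar0 : 0 ≤ ∑ u, ∑ v, (c u v + c v u) ^ 2 / 2 * am X u v :=
      Finset.sum_nonneg fun u _ => Finset.sum_nonneg fun v _ =>
        mul_nonneg (by positivity) (am_nonneg _ _ _)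
    calc _ ≤ -(η / 4 * (η * (n : ℝ) ^ 2)) + (η / 4) ^ 2 * (2 * (n : ℝ) ^ 2) := by
          refine add_le_add le_rfl (mul_le_mul_of_nonneg_left ?_ (sq_nonneg _))
          exact (mul_le_of_le_one_left hvar0 h1).trans hvar
      _ = _ := by ring

lemma cutw_compl (K : Finset (Edge n)) (A B : Finset (Fin n)) :
    cutw Kᶜ A B = A.card * B.card - (A ∩ B).card - cutw K A B := by
  unfold cutw
  simp_rw [am_compl, Finset.sum_sub_distrib]
  congr 1
  congr 1
  · simp
  · simp only [Finset.sum_ite_eq]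
    rw [← Finset.sum_filter, Finset.filter_mem_eq_inter]
    simp

lemma cutw_univ (A B : Finset (Fin n)) :
    cutw (Finset.univ : Finset (Edge n)) A B = A.card * B.card - (A ∩ B).card := by
  rw [← Finset.compl_empty, cutw_compl]
  simp [cutw, am, adj]

/-- Cut regularity of a graph of density `q`. -/
def CutReg (η q : ℝ) (K : Finset (Edge n)) : Prop :=
  ∀ A B : Finset (Fin n), |cutw K A B - q * (A.card * B.card)| ≤ η * (n : ℝ) ^ 2

lemma weight_symmDiff {α : Type*} [Fintype α] [DecidableEq α] {p ρ : ℝ} (hρ0 : 0 ≤ ρ)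
    (hρp : ρ ≤ p) (hρp' : ρ ≤ 1 - p) (G K : Finset α) :
    p ^ G.card * (1 - p) ^ Gᶜ.card * ρ ^ (symmDiff G K).card ≤
      p ^ K.card * (1 - p) ^ Kᶜ.card := by
  have hp0 : 0 ≤ p := hρ0.trans hρp
  have hp1 : 0 ≤ 1 - p := hρ0.trans hρp'
  have e1 : G.card = (G ∩ K).card + (G \ K).card := (Finset.card_inter_add_card_sdiff G K).symm
  have e2 : K.card = (G ∩ K).card + (K \ G).card := by
    rw [Finset.inter_comm]; exact (Finset.card_inter_add_card_sdiff K G).symm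
  have e3 : Gᶜ.card = (G ∪ K)ᶜ.card + (K \ G).card := by
    rw [← Finset.card_union_of_disjoint]
    · congr 1; ext x; simp only [Finset.mem_compl, Finset.mem_union, Finset.mem_sdiff]; tauto
    · rw [Finset.disjoint_left]; simp only [Finset.mem_compl, Finset.mem_union, Finset.mem_sdiff]
      tauto
  have e4 : Kᶜ.card = (G ∪ K)ᶜ.card + (G \ K).card := by
    rw [← Finset.card_union_of_disjoint]
    · congr 1; ext x; simp only [Finset.mem_compl, Finset.mem_union, Finset.mem_sdiff]; tauto
    · rw [Finset.disjoint_left]; simp only [Finset.mem_compl, Finset.mem_union, Finset.mem_sdiff]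
      tauto
  have e5 : (symmDiff G K).card = (G \ K).card + (K \ G).card := by
    rw [← Finset.card_union_of_disjoint]
    · rfl
    · rw [Finset.disjoint_left]; simp only [Finset.mem_sdiff]; tauto
  rw [e1, e2, e3, e4, e5]
  set a := (G \ K).card
  set b := (K \ G).card
  set i := (G ∩ K).card
  set o := (G ∪ K)ᶜ.card
  calc p ^ (i + a) * (1 - p) ^ (o + b) * ρ ^ (a + b)
      = (p ^ i * (1 - p) ^ o) * ((p ^ a * (1 - p) ^ b) * (ρ ^ a * ρ ^ b)) := by ring
    _ ≤ (p ^ i * (1 - p) ^ o) * (1 * ((1 - p) ^ a * p ^ b)) := by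
        gcongr
        exact mul_le_one₀ (pow_le_one₀ hp0 (by linarith)) (pow_nonneg hp1 _)
          (pow_le_one₀ hp1 (by linarith))
    _ = _ := by ring

lemma sum_inv_sq_pow_le {α : Type*} [Fintype α] [DecidableEq α] {m : ℕ}
    (hm : Fintype.card α ≤ m) : ∑ S : Finset α, ((m : ℝ)⁻¹) ^ S.card ≤ 3 := by
  have h := Finset.sum_pow_mul_eq_add_pow ((m : ℝ)⁻¹) 1 (Finset.univ : Finset α)
  simp only [Finset.powerset_univ, one_pow, mul_one, Finset.card_univ] at h
  rw [h]
  have hm0 : (0 : ℝ) ≤ (m : ℝ)⁻¹ := by positivity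
  calc ((m : ℝ)⁻¹ + 1) ^ Fintype.card α ≤ Real.exp ((m : ℝ)⁻¹) ^ Fintype.card α := by
        gcongr
        exact Real.add_one_le_exp _
    _ = Real.exp (Fintype.card α * (m : ℝ)⁻¹) := (Real.exp_nat_mul _ _).symm
    _ ≤ Real.exp 1 := by
        gcongr
        rw [← div_eq_mul_inv]
        exact div_le_one_of_le₀ (by exact_mod_cast hm) (Nat.cast_nonneg _)
    _ ≤ 3 := Real.exp_one_lt_d9.le.trans (by norm_num)

/-- Rare events for binomial random graphs of suitable density are rare among regular graphs. -/
lemma card_regs_filter_le {k : ℕ} (hk : k < n) (hpar : Even (n * k)) {p ρ : ℝ} (hρ0 : 0 < ρ)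
    (hρp : ρ ≤ p) (hρp' : ρ ≤ 1 - p) (Δ : ℕ)
    (hΔ : bpr (Finset.univ : Finset (Edge n)) p (fun G => (Δ : ℤ) < devi k G) ≤ 1 / 2)
    (P : Finset (Edge n) → Prop) :
    (((regs n k).filter P).card : ℝ) ≤
      (regs n k).card * (6 * ((n : ℝ) ^ 2 / ρ) ^ Δ * bpr Finset.univ p P) := by
  have hn0 : (0 : ℝ) < n := by exact_mod_cast (Nat.zero_le k).trans_lt hk
  have hp0 : 0 < p := hρ0.trans_le hρp
  have hp1 : 0 < 1 - p := hρ0.trans_le hρp'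
  set M := n * k / 2
  set N := Fintype.card (Edge n)
  set w : ℝ := p ^ M * (1 - p) ^ (N - M) with hw
  have hw0 : 0 < w := by positivity
  have hKw : ∀ K ∈ regs n k, p ^ K.card * (1 - p) ^ Kᶜ.card = w := by
    intro K hK
    rw [Finset.card_compl, card_of_mem_regs hK]
  have hup : ((regs n k).filter P).card * w ≤ bpr Finset.univ p P := by
    unfold bpr bexp
    rw [Finset.powerset_univ, ← nsmul_eq_mul, ← Finset.sum_const]
    calc _ ≤ ∑ A ∈ (regs n k).filter P, p ^ A.card * (1 - p) ^ (Finset.univ \ A).card *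
          (if P A then (1 : ℝ) else 0) := by
          refine Finset.sum_le_sum fun A hA => ?_
          rw [Finset.mem_filter] at hA
          rw [if_pos hA.2, ← hKw A hA.1, mul_one, Finset.compl_eq_univ_sdiff]
      _ ≤ _ := by
          refine Finset.sum_le_sum_of_subset_of_nonneg (Finset.subset_univ _) fun A _ _ => ?_
          split_ifs <;> positivity
  have hlo : 1 / 2 ≤ (regs n k).card * w * (3 * ((n : ℝ) ^ 2 / ρ) ^ Δ) := by
    have h1 := bpr_compl (Finset.univ : Finset (Edge n)) p (fun G => (Δ : ℤ) < devi k G)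
    have h2 : 1 / 2 ≤ bpr (Finset.univ : Finset (Edge n)) p (fun G => ¬ (Δ : ℤ) < devi k G) := by
      rw [h1]; linarith
    refine h2.trans ?_
    set x : ℝ := (((n ^ 2 : ℕ) : ℝ))⁻¹ with hx
    have hx0 : 0 < x := by rw [hx]; push_cast; positivity
    have hx1 : x ≤ 1 := by
      rw [hx]
      apply inv_le_one_of_one_le₀
      have : 1 ≤ n := by omega
      exact_mod_cast Nat.one_le_pow _ _ this
    have hρ1 : ρ ≤ 1 := by linarith
    have hkey : ∀ G : Finset (Edge n), p ^ G.card * (1 - p) ^ (Finset.univ \ G).card *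
        (if ¬ (Δ : ℤ) < devi k G then (1 : ℝ) else 0) ≤
        ∑ K ∈ regs n k, w * (((ρ * x) ^ Δ)⁻¹ * x ^ (symmDiff G K).card) := by
      intro G
      have hnn : ∀ K ∈ regs n k, 0 ≤ w * (((ρ * x) ^ Δ)⁻¹ * x ^ (symmDiff G K).card) :=
        fun K _ => by positivity
      split_ifs with hG
      · rw [mul_zero]
        exact Finset.sum_nonneg hnn
      · rw [mul_one]
        obtain ⟨K, hK, hGK⟩ := exists_regs_near hk hpar G
        have hcard : (symmDiff G K).card ≤ Δ := by
          rw [not_lt] at hG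
          exact_mod_cast hGK.trans hG
        refine le_trans ?_ (Finset.single_le_sum hnn hK)
        have h3 := weight_symmDiff hρ0.le hρp hρp' G K
        rw [hKw K hK, ← Finset.compl_eq_univ_sdiff] at *
        rw [← mul_assoc, mul_comm w, mul_assoc, inv_mul_eq_div, le_div_iff₀ (by positivity)]
        calc p ^ G.card * (1 - p) ^ Gᶜ.card * (ρ * x) ^ Δ
            ≤ p ^ G.card * (1 - p) ^ Gᶜ.card * (ρ * x) ^ (symmDiff G K).card := by
              gcongr p ^ G.card * (1 - p) ^ Gᶜ.card * ?_
              exact pow_le_pow_of_le_one (by positivity) (by nlinarith) hcard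
          _ = (p ^ G.card * (1 - p) ^ Gᶜ.card * ρ ^ (symmDiff G K).card) *
              x ^ (symmDiff G K).card := by rw [mul_pow]; ring
          _ ≤ _ := by gcongr
    have hS : ∀ K : Finset (Edge n), ∑ G : Finset (Edge n), x ^ (symmDiff G K).card ≤ 3 := by
      intro K
      have hinv : Function.Involutive fun G : Finset (Edge n) => symmDiff G K :=
        fun G => symmDiff_symmDiff_cancel_right K G
      rw [← hinv.bijective.sum_comp (fun G => x ^ (symmDiff G K).card)]
      simp_rw [symmDiff_symmDiff_cancel_right]
      exact sum_inv_sq_pow_le card_edge_le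
    calc bpr (Finset.univ : Finset (Edge n)) p (fun G => ¬ (Δ : ℤ) < devi k G)
        ≤ ∑ G : Finset (Edge n), ∑ K ∈ regs n k,
            w * (((ρ * x) ^ Δ)⁻¹ * x ^ (symmDiff G K).card) := by
          unfold bpr bexp
          rw [Finset.powerset_univ]
          refine Finset.sum_le_sum fun G _ => le_trans (le_of_eq ?_) (hkey G)
          by_cases h : (Δ : ℤ) < devi k G <;> simp [h]
      _ = ∑ K ∈ regs n k, w * (((ρ * x) ^ Δ)⁻¹ * ∑ G, x ^ (symmDiff G K).card) := by
          rw [Finset.sum_comm]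
          simp_rw [Finset.mul_sum]
      _ ≤ ∑ K ∈ regs n k, w * (((ρ * x) ^ Δ)⁻¹ * 3) := by
          refine Finset.sum_le_sum fun K _ => ?_
          have := hS K
          gcongr
      _ = _ := by
          rw [Finset.sum_const, nsmul_eq_mul, hx]
          have : (ρ * (((n ^ 2 : ℕ) : ℝ))⁻¹)⁻¹ = (n : ℝ) ^ 2 / ρ := by
            push_cast; field_simp
          rw [← inv_pow, this]
          ring
  set a : ℝ := (((regs n k).filter P).card : ℝ)
  set b := bpr Finset.univ p P
  have hb : 0 ≤ b := bpr_nonneg hp0.le (by linarith) _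
  refine le_of_mul_le_mul_right ?_ hw0
  calc a * w ≤ b := hup
    _ = 2 * b * (1 / 2) := by ring
    _ ≤ 2 * b * ((regs n k).card * w * (3 * ((n : ℝ) ^ 2 / ρ) ^ Δ)) := by gcongr
    _ = _ := by ring

/-! ### Graphs of intermediate density -/

lemma sum_path_eq_cutw (A B : Finset (Edge n)) (x y : Fin n) :
    ∑ b, ∑ a, am A x b * am B b a * am A a y = cutw B (nb A x) (nb A y) := by
  unfold cutw
  rw [← sum_mul_am]
  refine Finset.sum_congr rfl fun b _ => ?_
  rw [← sum_mul_am, Finset.mul_sum]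
  refine Finset.sum_congr rfl fun a _ => ?_
  rw [am_comm A a y]
  ring

lemma bpr_devi {k : ℕ} (hn : 2 ≤ n) (hk : k < n) {t : ℝ} (ht0 : 0 ≤ t) (htn : t ≤ 2 * n) {Δ : ℕ}
    (hΔ : 2 * n * t ≤ Δ) :
    bpr (Finset.univ : Finset (Edge n)) (k / (n - 1)) (fun G => (Δ : ℤ) < devi k G) ≤
      n * (2 * Real.exp (-(t ^ 2 / (8 * n)))) := by
  have hn2 : (2 : ℝ) ≤ n := by exact_mod_cast hn
  have hn1 : (0 : ℝ) < n - 1 := by linarith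
  have hk' : (k : ℝ) ≤ n - 1 := by
    have : (k : ℝ) + 1 ≤ n := by exact_mod_cast hk
    linarith
  have h0 : (0 : ℝ) ≤ k / (n - 1) := by positivity
  have h1 : (k : ℝ) / (n - 1) ≤ 1 := (div_le_one hn1).2 hk'
  have hdg : ∀ v : Fin n, (dg (Finset.univ : Finset (Edge n)) v : ℝ) = n - 1 := fun v => by
    rw [← Finset.compl_empty, dg_compl, dg_empty]; simp
  have h := bpr_exists_le (ι := Fin n) (X := (Finset.univ : Finset (Edge n))) h0 h1
    (fun v E => t < |(dg E v : ℝ) - k|) (b := 2 * Real.exp (-(t ^ 2 / (8 * n)))) (fun v => by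
      have h2 := bpr_dg (X := (Finset.univ : Finset (Edge n))) h0 h1 v (t / (4 * n)) t
        (by positivity) (by rw [div_le_iff₀ (by positivity)]; linarith)
      rw [hdg, div_mul_cancel₀ _ hn1.ne'] at h2
      refine (bpr_mono h0 h1 fun E _ hE => hE.le).trans (h2.trans ?_)
      gcongr 2 * Real.exp ?_
      have : 2 * (t / (4 * n)) ^ 2 * k ≤ 2 * (t / (4 * n)) ^ 2 * (n : ℝ) := by
        gcongr
      refine (add_le_add le_rfl this).trans (le_of_eq ?_)
      field_simp
      ring)
  rw [Fintype.card_fin] at h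
  refine (bpr_mono h0 h1 fun G _ hG => ?_).trans h
  by_contra hcon
  push Not at hcon
  refine absurd hG (not_lt.2 ?_)
  have e1 : ((devi k G : ℤ) : ℝ) = ∑ v, |(dg G v : ℝ) - k| + |∑ v, ((dg G v : ℝ) - k)| := by
    unfold devi; push_cast; rfl
  have e2 := Finset.abs_sum_le_sum_abs (fun v => (dg G v : ℝ) - k) Finset.univ
  have e3 : ∑ v, |(dg G v : ℝ) - k| ≤ n * t := by
    have := Finset.sum_le_card_nsmul Finset.univ (fun v => |(dg G v : ℝ) - k|) t fun v _ => hcon v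
    simpa using this
  have : ((devi k G : ℤ) : ℝ) ≤ ((Δ : ℤ) : ℝ) := by
    rw [e1]; push_cast; linarith
  exact_mod_cast this

set_option maxHeartbeats 1600000 in
lemma cutReg_prob {k : ℕ} (hn : 2 ≤ n) (hk : k < n) (hpar : Even (n * k)) {c t η : ℝ} {Δ : ℕ}
    (hc : 0 < c) (hck : c * n ≤ k) (hck' : c * n ≤ n - 1 - k) (ht0 : 0 ≤ t) (htn : t ≤ 2 * n)
    (hΔ : 2 * n * t ≤ Δ) (ht : n * (2 * Real.exp (-(t ^ 2 / (8 * n)))) ≤ 1 / 2) (hη0 : 0 ≤ η)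
    (hη1 : η ≤ 1) (hηn : 4 ≤ η * n) :
    (((regs n k).filter fun K => ¬ CutReg η (k / n) K).card : ℝ) ≤ (regs n k).card *
      (6 * ((n : ℝ) ^ 2 / c) ^ Δ * (4 ^ n * (2 * Real.exp (-((η / 2) ^ 2 * (n : ℝ) ^ 2 / 8))))) := by
  have hn2 : (2 : ℝ) ≤ n := by exact_mod_cast hn
  have hn1 : (0 : ℝ) < n - 1 := by linarith
  have hk' : (k : ℝ) ≤ n - 1 := by
    have : (k : ℝ) + 1 ≤ n := by exact_mod_cast hk
    linarith
  have h0 : (0 : ℝ) ≤ k / (n - 1) := by positivity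
  have h1 : (k : ℝ) / (n - 1) ≤ 1 := (div_le_one hn1).2 hk'
  have hρ1 : c ≤ k / (n - 1) := by
    rw [le_div_iff₀ hn1]; linarith
  have hρ2 : c ≤ 1 - k / (n - 1) := by
    rw [le_sub_iff_add_le, ← le_sub_iff_add_le', div_le_iff₀ hn1]
    linarith
  have key := card_regs_filter_le hk hpar (p := k / (n - 1)) (ρ := c) hc hρ1 hρ2 Δ
    ((bpr_devi hn hk ht0 htn hΔ).trans ht) (fun K => ¬ CutReg η (k / n) K)
  refine le_trans (le_of_eq ?_) (key.trans ?_)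
  · congr!
  · gcongr
    refine (bpr_mono h0 h1 fun G _ hG => ?_).trans
      (bpr_cut (η := η / 2) h0 h1 (by linarith) (by linarith))
    unfold CutReg at hG
    push Not at hG
    obtain ⟨A, B, hAB⟩ := hG
    refine ⟨(A, B), ?_⟩
    by_contra hcon
    rw [not_lt] at hcon
    refine absurd hAB (not_lt.2 ?_)
    rw [cutw_univ] at hcon
    have hA : (A.card : ℝ) ≤ n := by
      have := A.card_le_univ; rw [Fintype.card_fin] at this; exact_mod_cast this
    have hB : (B.card : ℝ) ≤ n := by
      have := B.card_le_univ; rw [Fintype.card_fin] at this; exact_mod_cast this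
    have hI : ((A ∩ B).card : ℝ) ≤ n := by
      have := (A ∩ B).card_le_univ; rw [Fintype.card_fin] at this; exact_mod_cast this
    have hA0 : (0 : ℝ) ≤ A.card := Nat.cast_nonneg _
    have hB0 : (0 : ℝ) ≤ B.card := Nat.cast_nonneg _
    have hI0 : (0 : ℝ) ≤ (A ∩ B).card := Nat.cast_nonneg _
    have hAB2 : (A.card : ℝ) * B.card ≤ n * n := mul_le_mul hA hB hB0 (by linarith)
    have e1 : (k : ℝ) / (n - 1) * (A.card * B.card) - k / n * (A.card * B.card) =
        k / (n - 1) * (A.card * B.card / n) := by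
      field_simp; ring
    have e2 : (k : ℝ) / (n - 1) * (A.card * B.card / n) ≤ n := by
      calc _ ≤ 1 * (A.card * B.card / n : ℝ) := by gcongr
        _ ≤ n := by rw [one_mul, div_le_iff₀ (by linarith)]; exact hAB2
    have e3 : 0 ≤ (k : ℝ) / (n - 1) * (A.card * B.card / n) := by positivity
    have e4 : (k : ℝ) / (n - 1) * (A ∩ B).card ≤ n := (mul_le_of_le_one_left hI0 h1).trans hI
    have e5 : 0 ≤ (k : ℝ) / (n - 1) * (A ∩ B).card := by positivity
    have e6 : 4 * (n : ℝ) ≤ η * n ^ 2 := by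
      rw [pow_two, ← mul_assoc]; exact mul_le_mul_of_nonneg_right hηn (by linarith)
    have e7 : η / 2 * (n : ℝ) ^ 2 = η * n ^ 2 / 2 := by ring
    rw [mul_sub, e7] at hcon
    rw [abs_le] at hcon ⊢
    clear hη0 hη1 hηn ht hΔ htn ht0 hck hck'
    generalize (k : ℝ) / (n - 1) * (A.card * B.card / n) = a1 at *
    generalize (k : ℝ) / (n - 1) * (A.card * B.card) = a2 at *
    generalize (k : ℝ) / n * (A.card * B.card) = a3 at *
    generalize (k : ℝ) / (n - 1) * (A ∩ B).card = a4 at *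
    generalize η * (n : ℝ) ^ 2 = a5 at *
    generalize cutw G A B = a6 at *
    constructor <;> linarith

set_option maxHeartbeats 1600000 in
theorem good_mid {k : ℕ} (hn : 2 ≤ n) (hk : k < n) (hpar : Even (n * k)) {s e c t η : ℝ} {Δ : ℕ}
    (h0 : 0 < s) (h1 : s ≤ 1) (he0 : 0 < e) (he1 : e ≤ 1 / 20)
    (hc : 0 < c) (hck : c * n ≤ k) (hck' : c * n ≤ n - 1 - k) (ht0 : 0 ≤ t) (htn : t ≤ 2 * n)
    (hΔ : 2 * n * t ≤ Δ) (ht : n * (2 * Real.exp (-(t ^ 2 / (8 * n)))) ≤ 1 / 2) (hη0 : 0 < η)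
    (hη1 : η ≤ 1) (hηn : 4 ≤ η * n) (hη : 4 * η ≤ e * s ^ 2 * c ^ 3) (hecn : 2 ≤ e * s * c ^ 3 * n)
    (hp1 : 2 * Real.exp (-(e ^ 2 * (s * (n - 1 - k)) / 8)) ≤ 1 / (3 * (n : ℝ) ^ 8))
    (hp2 : 4 ^ n * (2 * Real.exp (-(η ^ 2 * (n : ℝ) ^ 2 / 8))) ≤ 1 / (3 * (n : ℝ) ^ 7))
    (hp3 : 6 * ((n : ℝ) ^ 2 / c) ^ Δ *
      (4 ^ n * (2 * Real.exp (-((η / 2) ^ 2 * (n : ℝ) ^ 2 / 8)))) ≤ 1 / (3 * (n : ℝ) ^ 7)) :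
    Good n k s ((1 + 10 * e) * (k / (n - k))) := by
  have hn2 : (2 : ℝ) ≤ n := by exact_mod_cast hn
  have hn0 : (0 : ℝ) < n := by linarith
  set q : ℝ := n - k with hq
  have hcn : 0 < c * n := mul_pos hc hn0
  have hk0 : (0 : ℝ) < k := hcn.trans_le hck
  have hqc : c * n ≤ q - 1 := by rw [hq]; linarith
  have hq0 : 0 < q := by linarith
  have hqn : q ≤ n := by rw [hq]; linarith
  have hcq : c * n ≤ q := by linarith
  have hs2 : s ^ 2 ≤ s := by nlinarith
  have hc1 : c ≤ 1 := by
    have : c * n ≤ 1 * n := by linarith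
    exact le_of_mul_le_mul_right this hn0
  set Q : ℝ := k * s ^ 2 * q ^ 2 / n with hQ
  set R : ℝ := s * k ^ 2 * q / n with hR
  have hQ0 : 0 < Q := by positivity
  have hR0 : 0 < R := by positivity
  have hQc : s ^ 2 * c ^ 3 * n ^ 2 ≤ Q := by
    rw [hQ, le_div_iff₀ hn0]
    calc s ^ 2 * c ^ 3 * n ^ 2 * n = (c * n) * s ^ 2 * (c * n) ^ 2 := by ring
      _ ≤ _ := by gcongr
  have hRc : s * c ^ 3 * n ^ 2 ≤ R := by
    rw [hR, le_div_iff₀ hn0]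
    calc s * c ^ 3 * n ^ 2 * n = s * (c * n) ^ 2 * (c * n) := by ring
      _ ≤ _ := by gcongr
  have hn22 : (0 : ℝ) ≤ (n : ℝ) ^ 2 := sq_nonneg _
  have hη2 := mul_le_mul_of_nonneg_right hη hn22
  have hηQ : η * n ^ 2 ≤ e * Q := by
    have := mul_le_mul_of_nonneg_left hQc he0.le
    have i0 : 0 ≤ η * (n : ℝ) ^ 2 := by positivity
    linarith
  have hηR : 2 * (η * n ^ 2) + n ≤ e * R := by
    have i1 : 2 * (η * n ^ 2) ≤ e / 2 * (s ^ 2 * c ^ 3 * n ^ 2) := by linarith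
    have i2 : e / 2 * (s ^ 2 * c ^ 3 * n ^ 2) ≤ e / 2 * (s * c ^ 3 * n ^ 2) := by gcongr
    have i3 : (n : ℝ) ≤ e / 2 * (s * c ^ 3 * n ^ 2) := by
      have := mul_le_mul_of_nonneg_right hecn hn0.le
      linarith
    have i4 := mul_le_mul_of_nonneg_left hRc he0.le
    linarith
  have heq : 1 ≤ e * q := by
    have i1 : e * s * c ^ 3 * n ≤ e * (c * n) := by
      have : s * c ^ 3 ≤ 1 * c := by
        gcongr
        calc c ^ 3 = c ^ 2 * c := by ring
          _ ≤ 1 * c := by gcongr; exact pow_le_one₀ hc.le hc1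
          _ = c := one_mul c
      calc e * s * c ^ 3 * n = (e * n) * (s * c ^ 3) := by ring
        _ ≤ (e * n) * (1 * c) := by gcongr
        _ = _ := by ring
    have i2 := mul_le_mul_of_nonneg_left hcq he0.le
    linarith
  refine good_of_switch 1 h0.le (fun K E => CutReg η (k / n) K ∧
    (∀ v, |(dg E v : ℝ) - s * (q - 1)| ≤ e * (s * (q - 1))) ∧
    ∀ A B, |cutw E A B - s * cutw Kᶜ A B| ≤ η * n ^ 2) ?_
    (L := (1 - 5 * e) * Q) (U := (1 + e) * R) ?_ (by positivity) ?_ ?_ ?_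
  · have hreg : (0 : ℝ) < (regs n k).card := by exact_mod_cast (regs_nonempty hk hpar).card_pos
    have hb : ∀ K ∈ regs n k, bpr Kᶜ s (fun E => ¬ (CutReg η (k / n) K ∧
        (∀ v, |(dg E v : ℝ) - s * (q - 1)| ≤ e * (s * (q - 1))) ∧
        ∀ A B, |cutw E A B - s * cutw Kᶜ A B| ≤ η * n ^ 2)) ≤
        (if ¬ CutReg η (k / n) K then 1 else 0) +
          (n * (1 / (3 * (n : ℝ) ^ 8)) + 1 / (3 * (n : ℝ) ^ 7)) := by
      intro K hK
      rw [mem_regs] at hK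
      by_cases hcut : CutReg η (k / n) K
      · simp only [hcut, true_and, not_true_eq_false, if_false, zero_add]
        have i1 := bpr_dg_rel (X := Kᶜ) (m := q - 1) (e := e) h0.le h1
          (fun v => by rw [dg_compl, hK, hq]; ring) he0.le (by linarith)
        have i2 := bpr_cut (X := Kᶜ) (η := η) h0.le h1 hη0.le hη1
        refine (bpr_mono h0.le h1 fun E _ hE => ?_).trans ((bpr_or h0.le h1 _ _).trans
          (add_le_add (i1.trans ?_) (i2.trans hp2)))
        · rw [not_and_or] at hE
          push Not at hE
          rcases hE with hE | ⟨A, B, hE⟩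
          · exact Or.inl hE
          · exact Or.inr ⟨(A, B), hE⟩
        · have : (q - 1 : ℝ) = n - 1 - k := by rw [hq]; ring
          rw [this]
          gcongr
      · rw [if_pos hcut]
        have : bpr Kᶜ s (fun E => ¬ (CutReg η (k / n) K ∧
            (∀ v, |(dg E v : ℝ) - s * (q - 1)| ≤ e * (s * (q - 1))) ∧
            ∀ A B, |cutw E A B - s * cutw Kᶜ A B| ≤ η * n ^ 2)) ≤ 1 := by
          have := bexp_mono (X := Kᶜ) (f := fun E => if ¬ (CutReg η (k / n) K ∧
            (∀ v, |(dg E v : ℝ) - s * (q - 1)| ≤ e * (s * (q - 1))) ∧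
            ∀ A B, |cutw E A B - s * cutw Kᶜ A B| ≤ η * n ^ 2) then 1 else 0) (g := fun _ => 1)
            h0.le h1 fun E _ => by split_ifs <;> norm_num
          rw [bexp_const] at this
          refine le_trans (le_of_eq ?_) this
          unfold bpr
          exact bexp_congr fun E _ => by split_ifs <;> tauto
        refine this.trans ?_
        have : 0 ≤ n * (1 / (3 * (n : ℝ) ^ 8)) + 1 / (3 * (n : ℝ) ^ 7) := by positivity
        linarith
    rw [inv_mul_le_iff₀ hreg]
    refine (Finset.sum_le_sum hb).trans ?_
    rw [Finset.sum_add_distrib, Finset.sum_const, nsmul_eq_mul]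
    have i3 := (cutReg_prob hn hk hpar hc hck hck' ht0 htn hΔ ht hη0.le hη1 hηn).trans
      (mul_le_mul_of_nonneg_left hp3 hreg.le)
    have i4 : (∑ K ∈ regs n k, if ¬ CutReg η (k / n) K then (1 : ℝ) else 0) =
        (((regs n k).filter fun K => ¬ CutReg η (k / n) K).card : ℝ) := by
      rw [Finset.card_filter]; push_cast
      exact Finset.sum_congr rfl fun K _ => by split_ifs <;> rfl
    rw [i4]
    have i5 : (1 : ℝ) / n ^ 7 = 1 / (3 * (n : ℝ) ^ 7) + (n * (1 / (3 * (n : ℝ) ^ 8)) +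
        1 / (3 * (n : ℝ) ^ 7)) := by field_simp; norm_num
    rw [i5, mul_add]
    linarith
  · have : 0 < 1 - 5 * e := by linarith
    positivity
  · have j1 : s * ((1 + e) * R) = (1 + e) * (s ^ 2 * k ^ 2 * q / n) := by rw [hR]; ring
    have j2 : (1 + 10 * e) * (k / q) * ((1 - 5 * e) * Q) =
        ((1 + 10 * e) * (1 - 5 * e)) * (s ^ 2 * k ^ 2 * q / n) := by rw [hQ]; field_simp
    rw [j1, j2]
    refine mul_le_mul_of_nonneg_right ?_ (by positivity)
    nlinarith
  · rintro K hK E hKE ⟨hT1, hT2, -⟩ x y hxy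
    have hnb : ∀ v, (1 - e) ^ 2 * (s * q) ≤ (nb E v).card := fun v => by
      have := (abs_le.1 (hT2 v)).1
      have e1 : ((nb E v).card : ℝ) = dg E v := rfl
      rw [e1]
      have e2 : (1 - e) * q ≤ q - 1 := by linarith
      have e3 : (1 - e) * ((1 - e) * q * s) ≤ (1 - e) * ((q - 1) * s) := by
        have : 0 ≤ 1 - e := by linarith
        gcongr
      linarith
    refine le_trans ?_ (pset_one_card_ge (adj_ne hxy) fun h =>
      Finset.disjoint_left.1 hKE ((adj_iff_mem (adj_ne hxy)).1 hxy)
        ((adj_iff_mem (adj_ne hxy)).1 h))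
    rw [sum_path_eq_cutw]
    have i1 := (abs_le.1 (hT1 (nb E x) (nb E y))).1
    have i2 : (1 - e) ^ 4 * Q ≤ k / n * ((nb E x).card * (nb E y).card) := by
      calc (1 - e) ^ 4 * Q = k / n * ((1 - e) ^ 2 * (s * q) * ((1 - e) ^ 2 * (s * q))) := by
            rw [hQ]; ring
        _ ≤ _ := by
            have := hnb x
            have := hnb y
            gcongr
    have i3 : 1 - 4 * e ≤ (1 - e) ^ 4 := by
      nlinarith [sq_nonneg e, sq_nonneg (e ^ 2), mul_nonneg (sq_nonneg e) he0.le]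
    have i4 : (1 - 4 * e) * Q ≤ (1 - e) ^ 4 * Q := mul_le_mul_of_nonneg_right i3 hQ0.le
    linarith
  · rintro K hK E hKE ⟨hT1, -, hT3⟩ x y hxy X Y hX hY hX1 hYX
    rw [mem_regs] at hK
    set K' := (K \ X) ∪ Y
    have hK' : ∀ v, ((nb K' v).card : ℝ) = k := fun v => by
      have : (nb K' v).card = dg K' v := rfl
      rw [this, dg_switch hX (hKE.mono_right hY) hYX, hK]
    refine (pset_card_le 1 _ _ x y).trans ?_
    rw [show 2 * 1 + 1 = 3 from rfl, pw_three]
    have a0 : ∀ u v, alt K' ((E \ Y) ∪ X) 0 u v = am K' u v := fun u v => by simp [alt]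
    have a1 : ∀ u v, alt K' ((E \ Y) ∪ X) 1 u v = am ((E \ Y) ∪ X) u v := fun u v => by simp [alt]
    have a2 : ∀ u v, alt K' ((E \ Y) ∪ X) 2 u v = am K' u v := fun u v => by simp [alt]
    simp_rw [a0, a1, a2]
    rw [sum_path_eq_cutw]
    set A := nb K' x
    set B := nb K' y
    have i1 : cutw ((E \ Y) ∪ X) A B ≤ cutw E A B + n := by
      have i2 : cutw ((E \ Y) ∪ X) A B ≤ cutw E A B + cutw X A B := by
        unfold cutw
        rw [← Finset.sum_add_distrib]
        refine Finset.sum_le_sum fun u _ => ?_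
        rw [← Finset.sum_add_distrib]
        refine Finset.sum_le_sum fun v _ => ?_
        rw [am_switch hY (hKE.symm.mono_right hX)]
        linarith [am_nonneg Y u v]
      have i3 : cutw X A B ≤ n := by
        unfold cutw
        calc _ ≤ ∑ u ∈ A, ∑ v, am X u v := Finset.sum_le_sum fun u _ =>
              Finset.sum_le_sum_of_subset_of_nonneg (Finset.subset_univ _)
                fun v _ _ => am_nonneg _ _ _
          _ ≤ ∑ u, ∑ v, am X u v := Finset.sum_le_sum_of_subset_of_nonneg (Finset.subset_univ _)
                fun u _ _ => Finset.sum_nonneg fun v _ => am_nonneg _ _ _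
          _ ≤ ∑ u : Fin n, (1 : ℝ) := Finset.sum_le_sum fun u _ => by
                rw [sum_am]; exact_mod_cast hX1 u
          _ = n := by simp
      linarith
    have i4 := (abs_le.1 (hT3 A B)).2
    have i5 := (abs_le.1 (hT1 A B)).1
    rw [cutw_compl] at i4
    rw [hK', hK'] at i4 i5
    have i6 : (0 : ℝ) ≤ (A ∩ B).card := Nat.cast_nonneg _
    have i7 : s * (k * k - (A ∩ B).card - cutw K A B) ≤ s * (k * k - k / n * (k * k) + η * n ^ 2) :=
      mul_le_mul_of_nonneg_left (by linarith) h0.le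
    have i8 : s * (k * k - k / n * (k * k) + η * n ^ 2) = R + s * (η * n ^ 2) := by
      rw [hR, hq]; field_simp
    have i9 : s * (η * n ^ 2) ≤ 1 * (η * n ^ 2) := by gcongr
    linarith

/-! ### From discrepancy to a bilinear bound -/

section Bilinear

variable {V : Type*}

lemma sum_mul_le_sum_pos (A : Finset V) (x c : V → ℝ) {X : ℝ} (hx0 : ∀ u ∈ A, 0 ≤ x u)
    (hx : ∀ u ∈ A, x u ≤ X) :
    ∑ u ∈ A, x u * c u ≤ X * ∑ u ∈ A.filter (fun u => 0 < c u), c u := by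
  rw [Finset.sum_filter, Finset.mul_sum]
  refine Finset.sum_le_sum fun u hu => ?_
  split_ifs with h
  · exact mul_le_mul_of_nonneg_right (hx u hu) h.le
  · rw [mul_zero]
    exact mul_nonpos_of_nonneg_of_nonpos (hx0 u hu) (not_lt.1 h)

lemma box_le (M : V → V → ℝ) (A B : Finset V) (x y : V → ℝ) {X Y β : ℝ} (hX : 0 ≤ X) (hY : 0 ≤ Y)
    (hx0 : ∀ u ∈ A, 0 ≤ x u) (hx : ∀ u ∈ A, x u ≤ X) (hy0 : ∀ u ∈ B, 0 ≤ y u)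
    (hy : ∀ u ∈ B, y u ≤ Y) (hM : ∀ A' ⊆ A, ∀ B' ⊆ B, ∑ u ∈ A', ∑ v ∈ B', M u v ≤ β) :
    ∑ u ∈ A, ∑ v ∈ B, x u * M u v * y v ≤ X * Y * β := by
  have h1 := sum_mul_le_sum_pos A x (fun u => ∑ v ∈ B, M u v * y v) hx0 hx
  set A' := A.filter fun u => 0 < ∑ v ∈ B, M u v * y v
  have h2 := sum_mul_le_sum_pos B y (fun v => ∑ u ∈ A', M u v) hy0 hy
  set B' := B.filter fun v => 0 < ∑ u ∈ A', M u v
  have h3 := hM A' (Finset.filter_subset _ _) B' (Finset.filter_subset _ _)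
  rw [Finset.sum_comm] at h3
  calc ∑ u ∈ A, ∑ v ∈ B, x u * M u v * y v = ∑ u ∈ A, x u * ∑ v ∈ B, M u v * y v := by
        refine Finset.sum_congr rfl fun u _ => ?_
        rw [Finset.mul_sum]
        exact Finset.sum_congr rfl fun v _ => by ring
    _ ≤ X * ∑ u ∈ A', ∑ v ∈ B, M u v * y v := h1
    _ = X * ∑ v ∈ B, y v * ∑ u ∈ A', M u v := by
        rw [Finset.sum_comm]
        congr 1
        refine Finset.sum_congr rfl fun v _ => ?_
        rw [Finset.mul_sum]
        exact Finset.sum_congr rfl fun u _ => by ring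
    _ ≤ X * (Y * β) := mul_le_mul_of_nonneg_left
        (h2.trans (mul_le_mul_of_nonneg_left h3 hY)) hX
    _ = X * Y * β := by ring

variable [Fintype V]

lemma block_shift (M : V → V → ℝ) {α : ℝ} (hα : 0 ≤ α)
    (hM : ∀ A B : Finset V, ∑ u ∈ A, ∑ v ∈ B, M u v ≤ α * √(A.card * B.card))
    {x y : V → ℝ} (hx : ∀ u, 0 ≤ x u) (hy : ∀ u, 0 ≤ y u) {T : ℕ} (hT : 1 < T) (r : ℤ) :
    ∑ u, ∑ v, (if 0 < x u ∧ 0 < y v ∧ Int.log T (y v) = Int.log T (x u) + r then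
      x u * M u v * y v else 0) ≤ α * T ^ 2 / 2 * (∑ u, x u ^ 2 + ∑ v, y v ^ 2) := by
  have hT0 : (0 : ℝ) < T := by positivity
  set I : Finset ℤ := Finset.univ.image fun u => Int.log T (x u) with hI
  set A : ℤ → Finset V := fun i => Finset.univ.filter fun u => 0 < x u ∧ Int.log T (x u) = i with hA
  set B : ℤ → Finset V := fun i => Finset.univ.filter fun u => 0 < y u ∧ Int.log T (y u) = i with hB
  have h1 : ∑ u, ∑ v, (if 0 < x u ∧ 0 < y v ∧ Int.log T (y v) = Int.log T (x u) + r then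
      x u * M u v * y v else 0) = ∑ i ∈ I, ∑ u ∈ A i, ∑ v ∈ B (i + r), x u * M u v * y v := by
    rw [← Finset.sum_fiberwise_of_maps_to (s := Finset.univ) (t := I)
      (g := fun u => Int.log T (x u)) fun u _ => Finset.mem_image_of_mem _ (Finset.mem_univ u)]
    refine Finset.sum_congr rfl fun i _ => ?_
    rw [hA, Finset.sum_filter, Finset.sum_filter]
    refine Finset.sum_congr rfl fun u _ => ?_
    rw [hB, Finset.sum_filter]
    by_cases h : Int.log T (x u) = i
    · by_cases h' : 0 < x u
      · simp [h, h']
      · simp [h']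
    · simp [h]
  have hAx : ∀ i, ∀ u ∈ A i, (T : ℝ) ^ i ≤ x u ∧ x u ≤ T ^ (i + 1) := fun i u hu => by
    obtain ⟨-, h0, h⟩ := Finset.mem_filter.1 hu
    rw [← h]
    exact ⟨Int.zpow_log_le_self hT h0, (Int.lt_zpow_succ_log_self hT _).le⟩
  have hBy : ∀ i, ∀ u ∈ B i, (T : ℝ) ^ i ≤ y u ∧ y u ≤ T ^ (i + 1) := fun i u hu => by
    obtain ⟨-, h0, h⟩ := Finset.mem_filter.1 hu
    rw [← h]
    exact ⟨Int.zpow_log_le_self hT h0, (Int.lt_zpow_succ_log_self hT _).le⟩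
  have hcard : ∀ (z : V → ℝ) (S : Finset V) (i : ℤ), (∀ u ∈ S, (T : ℝ) ^ i ≤ z u) →
      ((T : ℝ) ^ i) ^ 2 * S.card ≤ ∑ u ∈ S, z u ^ 2 := fun z S i h => by
    rw [mul_comm, ← nsmul_eq_mul]
    refine Finset.card_nsmul_le_sum _ _ _ fun u hu => ?_
    exact pow_le_pow_left₀ (zpow_nonneg hT0.le _) (h u hu) 2
  have h2 : ∀ i ∈ I, ∑ u ∈ A i, ∑ v ∈ B (i + r), x u * M u v * y v ≤
      α * T ^ 2 / 2 * (∑ u ∈ A i, x u ^ 2 + ∑ v ∈ B (i + r), y v ^ 2) := fun i _ => by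
    have := box_le M (A i) (B (i + r)) x y (X := T ^ (i + 1)) (Y := T ^ (i + r + 1))
      (β := α * √((A i).card * (B (i + r)).card)) (zpow_nonneg hT0.le _) (zpow_nonneg hT0.le _)
      (fun u _ => hx u) (fun u hu => (hAx _ u hu).2) (fun u _ => hy u) (fun u hu => (hBy _ u hu).2)
      (fun A' hA' B' hB' => (hM A' B').trans (by gcongr))
    refine this.trans ?_
    have e1 : ∀ j : ℤ, (T : ℝ) ^ (j + 1) = T ^ j * T := fun j => by rw [zpow_add_one₀ hT0.ne']
    rw [e1, e1]
    have i1 := hcard x _ _ fun u hu => (hAx i u hu).1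
    have i2 := hcard y _ _ fun u hu => (hBy (i + r) u hu).1
    have i3 : (T : ℝ) ^ i * T ^ (i + r) * √((A i).card * (B (i + r)).card) ≤
        (((T : ℝ) ^ i) ^ 2 * (A i).card + ((T : ℝ) ^ (i + r)) ^ 2 * (B (i + r)).card) / 2 := by
      rw [Real.sqrt_mul (Nat.cast_nonneg _)]
      have a1 := Real.sq_sqrt (Nat.cast_nonneg (α := ℝ) (A i).card)
      have a2 := Real.sq_sqrt (Nat.cast_nonneg (α := ℝ) (B (i + r)).card)
      nlinarith [sq_nonneg ((T : ℝ) ^ i * √((A i).card) - T ^ (i + r) * √((B (i + r)).card))]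
    calc _ = α * T ^ 2 * ((T : ℝ) ^ i * T ^ (i + r) * √((A i).card * (B (i + r)).card)) := by ring
      _ ≤ α * T ^ 2 * ((∑ u ∈ A i, x u ^ 2 + ∑ v ∈ B (i + r), y v ^ 2) / 2) := by
          refine mul_le_mul_of_nonneg_left ?_ (by positivity)
          linarith
      _ = _ := by ring
  rw [h1]
  refine (Finset.sum_le_sum h2).trans ?_
  rw [← Finset.mul_sum]
  refine mul_le_mul_of_nonneg_left ?_ (by positivity)
  rw [Finset.sum_add_distrib]
  have h3 : ∀ (z : V → ℝ) (f : ℤ → ℤ), Function.Injective f → ∑ i ∈ I, ∑ u ∈ Finset.univ.filter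
      (fun u => 0 < z u ∧ Int.log T (z u) = f i), z u ^ 2 ≤ ∑ u, z u ^ 2 := fun z f hf => by
    simp_rw [Finset.sum_filter]
    rw [Finset.sum_comm]
    refine Finset.sum_le_sum fun u _ => ?_
    by_cases h : ∃ i ∈ I, f i = Int.log T (z u)
    · obtain ⟨i, hi, h⟩ := h
      rw [Finset.sum_eq_single_of_mem i hi fun j _ hj => if_neg fun h' =>
        hj (hf (by rw [h, h'.2]))]
      split_ifs
      · exact le_rfl
      · positivity
    · push Not at h
      rw [Finset.sum_eq_zero fun i hi => if_neg fun h' => h i hi h'.2.symm]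
      positivity
  exact add_le_add (h3 x id Function.injective_id) (h3 y (fun i => i + r) (add_left_injective r))

theorem bilinear_le (M : V → V → ℝ) {α d : ℝ} (hα : 0 ≤ α)
    (hM : ∀ A B : Finset V, ∑ u ∈ A, ∑ v ∈ B, M u v ≤ α * √(A.card * B.card))
    (hd : ∀ u, ∑ v, |M u v| ≤ d) (hd' : ∀ v, ∑ u, |M u v| ≤ d)
    {x y : V → ℝ} (hx : ∀ u, 0 ≤ x u) (hy : ∀ u, 0 ≤ y u) {T : ℕ} (hT : 1 < T) :
    ∑ u, ∑ v, x u * M u v * y v ≤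
      (3 * α * T ^ 2 / 2 + d / T) * (∑ u, x u ^ 2 + ∑ v, y v ^ 2) := by
  have hT0 : (0 : ℝ) < T := by positivity
  set g : ℤ → V → V → ℝ := fun r u v =>
    if 0 < x u ∧ 0 < y v ∧ Int.log T (y v) = Int.log T (x u) + r then x u * M u v * y v else 0
    with hg
  have hpt : ∀ u v, x u * M u v * y v ≤ g (-1) u v + g 0 u v + g 1 u v +
      (|M u v| * (x u ^ 2 / T) + |M u v| * (y v ^ 2 / T)) := fun u v => by
    have hr : 0 ≤ |M u v| * (x u ^ 2 / T) := by positivity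
    have hr' : 0 ≤ |M u v| * (y v ^ 2 / T) := by positivity
    rcases (hx u).eq_or_lt with h0 | h0
    · simp only [hg, ← h0]; simp; positivity
    rcases (hy v).eq_or_lt with h1 | h1
    · simp only [hg, ← h1]; simp; positivity
    have hlow : ∀ a b : ℝ, 0 < a → 0 < b → Int.log T a + 1 < Int.log T b → a ≤ b / T := by
      intro a b ha hb hab
      rw [le_div_iff₀ hT0]
      have i1 := Int.lt_zpow_succ_log_self hT a
      have i2 := Int.zpow_log_le_self hT hb
      have i3 : (T : ℝ) ^ (Int.log T a + 1) * T ≤ T ^ Int.log T b := by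
        rw [← zpow_add_one₀ hT0.ne']
        exact zpow_le_zpow_right₀ (by exact_mod_cast hT.le) (by omega)
      nlinarith
    have habs : x u * M u v * y v ≤ |M u v| * (x u * y v) := by
      have := mul_le_mul_of_nonneg_left (le_abs_self (M u v)) (mul_pos h0 h1).le
      linarith
    rcases lt_or_ge (Int.log T (x u) + 1) (Int.log T (y v)) with h2 | h2
    · have e : g (-1) u v + g 0 u v + g 1 u v = 0 := by
        simp only [hg]
        rw [if_neg (by omega), if_neg (by omega), if_neg (by omega)]; norm_num
      rw [e]
      have := hlow _ _ h0 h1 h2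
      have i1 : x u * y v ≤ y v ^ 2 / T := by
        calc x u * y v ≤ y v / T * y v := by gcongr
          _ = _ := by ring
      have := mul_le_mul_of_nonneg_left i1 (abs_nonneg (M u v))
      linarith
    rcases lt_or_ge (Int.log T (y v) + 1) (Int.log T (x u)) with h3 | h3
    · have e : g (-1) u v + g 0 u v + g 1 u v = 0 := by
        simp only [hg]
        rw [if_neg (by omega), if_neg (by omega), if_neg (by omega)]; norm_num
      rw [e]
      have := hlow _ _ h1 h0 h3
      have i1 : x u * y v ≤ x u ^ 2 / T := by
        calc x u * y v ≤ x u * (x u / T) := by gcongr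
          _ = _ := by ring
      have := mul_le_mul_of_nonneg_left i1 (abs_nonneg (M u v))
      linarith
    have e : g (-1) u v + g 0 u v + g 1 u v = x u * M u v * y v := by
      have h4 : Int.log T (y v) = Int.log T (x u) + -1 ∨ Int.log T (y v) = Int.log T (x u) + 0 ∨
        Int.log T (y v) = Int.log T (x u) + 1 := by omega
      simp only [hg]
      rcases h4 with h4 | h4 | h4
      · rw [if_pos ⟨h0, h1, h4⟩, if_neg (by omega), if_neg (by omega)]; ring
      · rw [if_neg (by omega), if_pos ⟨h0, h1, h4⟩, if_neg (by omega)]; ring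
      · rw [if_neg (by omega), if_neg (by omega), if_pos ⟨h0, h1, h4⟩]; ring
    linarith
  refine (Finset.sum_le_sum fun u _ => Finset.sum_le_sum fun v _ => hpt u v).trans ?_
  simp_rw [Finset.sum_add_distrib]
  have b1 := block_shift M hα hM hx hy hT (-1)
  have b2 := block_shift M hα hM hx hy hT 0
  have b3 := block_shift M hα hM hx hy hT 1
  have c1 : ∑ u, ∑ v, |M u v| * (x u ^ 2 / T) ≤ d / T * ∑ u, x u ^ 2 := by
    rw [Finset.mul_sum]
    refine Finset.sum_le_sum fun u _ => ?_
    rw [← Finset.sum_mul]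
    calc _ ≤ d * (x u ^ 2 / T) := mul_le_mul_of_nonneg_right (hd u) (by positivity)
      _ = _ := by ring
  have c2 : ∑ u, ∑ v, |M u v| * (y v ^ 2 / T) ≤ d / T * ∑ u, y u ^ 2 := by
    rw [Finset.mul_sum, Finset.sum_comm]
    refine Finset.sum_le_sum fun u _ => ?_
    rw [← Finset.sum_mul]
    calc _ ≤ d * (y u ^ 2 / T) := mul_le_mul_of_nonneg_right (hd' u) (by positivity)
      _ = _ := by ring
  simp only [hg]
  linarith

end Bilinear

/-! ### Euclidean norms -/

section Norms

variable {V : Type*} [Fintype V]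

/-- The Euclidean norm. -/
def l2 (x : V → ℝ) : ℝ := √(∑ u, x u ^ 2)

lemma l2_nonneg (x : V → ℝ) : 0 ≤ l2 x := Real.sqrt_nonneg _

lemma l2_sq (x : V → ℝ) : l2 x ^ 2 = ∑ u, x u ^ 2 :=
  Real.sq_sqrt (Finset.sum_nonneg fun _ _ => sq_nonneg _)

lemma l2_le {x : V → ℝ} {b : ℝ} (hb : 0 ≤ b) (h : ∑ u, x u ^ 2 ≤ b ^ 2) : l2 x ≤ b := by
  rw [← Real.sqrt_sq hb]; exact Real.sqrt_le_sqrt h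

lemma sum_mul_le_l2 (x y : V → ℝ) : ∑ u, x u * y u ≤ l2 x * l2 y :=
  Real.sum_mul_le_sqrt_mul_sqrt _ _ _

lemma l2_add_le (x y : V → ℝ) : l2 (fun u => x u + y u) ≤ l2 x + l2 y := by
  refine l2_le (add_nonneg (l2_nonneg _) (l2_nonneg _)) ?_
  have h := sum_mul_le_l2 x y
  have e : ∑ u, (x u + y u) ^ 2 = ∑ u, x u ^ 2 + 2 * ∑ u, x u * y u + ∑ u, y u ^ 2 := by
    rw [Finset.mul_sum, ← Finset.sum_add_distrib, ← Finset.sum_add_distrib]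
    exact Finset.sum_congr rfl fun u _ => by ring
  rw [e, ← l2_sq, ← l2_sq]
  nlinarith

lemma l2_const (c : ℝ) (hc : 0 ≤ c) : l2 (fun _ : V => c) = c * √(Fintype.card V) := by
  unfold l2
  rw [Finset.sum_const, nsmul_eq_mul, Real.sqrt_mul (Nat.cast_nonneg _), Real.sqrt_sq hc,
    Finset.card_univ, mul_comm]

lemma eq_zero_of_l2 {x : V → ℝ} (h : l2 x = 0) (u : V) : x u = 0 := by
  have h2 := l2_sq x
  rw [h, zero_pow two_ne_zero] at h2
  have := (Finset.sum_eq_zero_iff_of_nonneg fun u _ => sq_nonneg (x u)).1 h2.symm u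
    (Finset.mem_univ u)
  exact pow_eq_zero_iff two_ne_zero |>.1 this

lemma bilinear_le_l2 {M : V → V → ℝ} {b : ℝ}
    (h : ∀ x y : V → ℝ, (∀ u, 0 ≤ x u) → (∀ u, 0 ≤ y u) →
      ∑ u, ∑ v, x u * M u v * y v ≤ b * (∑ u, x u ^ 2 + ∑ v, y v ^ 2))
    {x y : V → ℝ} (hx : ∀ u, 0 ≤ x u) (hy : ∀ u, 0 ≤ y u) :
    ∑ u, ∑ v, x u * M u v * y v ≤ 2 * b * (l2 x * l2 y) := by
  rcases (l2_nonneg x).eq_or_lt with h0 | h0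
  · have : ∀ u, x u = 0 := eq_zero_of_l2 h0.symm
    simp [this, ← h0]
  rcases (l2_nonneg y).eq_or_lt with h1 | h1
  · have : ∀ u, y u = 0 := eq_zero_of_l2 h1.symm
    simp [this, ← h1]
  have h2 := h (fun u => l2 y * x u) (fun u => l2 x * y u) (fun u => mul_nonneg h1.le (hx u))
    fun u => mul_nonneg h0.le (hy u)
  simp_rw [mul_pow, ← Finset.mul_sum] at h2
  rw [← l2_sq, ← l2_sq] at h2
  have e : ∑ u, ∑ v, l2 y * x u * M u v * (l2 x * y v) =
      (l2 x * l2 y) * ∑ u, ∑ v, x u * M u v * y v := by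
    rw [Finset.mul_sum]
    refine Finset.sum_congr rfl fun u _ => ?_
    rw [Finset.mul_sum]
    exact Finset.sum_congr rfl fun v _ => by ring
  rw [e] at h2
  refine le_of_mul_le_mul_left (h2.trans (le_of_eq ?_)) (mul_pos h0 h1)
  ring

lemma l2_apply_le {M : V → V → ℝ} {b : ℝ} (hb : 0 ≤ b)
    (h : ∀ x y : V → ℝ, (∀ u, 0 ≤ x u) → (∀ u, 0 ≤ y u) →
      |∑ u, ∑ v, x u * M u v * y v| ≤ b * (l2 x * l2 y))
    {y : V → ℝ} (hy : ∀ u, 0 ≤ y u) : l2 (fun u => ∑ v, M u v * y v) ≤ 2 * b * l2 y := by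
  set z : V → ℝ := fun u => ∑ v, M u v * y v with hz
  rcases (l2_nonneg z).eq_or_lt with h0 | h0
  · rw [← h0]; have := l2_nonneg y; positivity
  have hpart : ∀ p : V → ℝ, (∀ u, 0 ≤ p u) → (∀ u, p u ≤ |z u|) →
      |∑ u, p u * z u| ≤ b * (l2 z * l2 y) := fun p hp hpz => by
    have e : ∑ u, p u * z u = ∑ u, ∑ v, p u * M u v * y v := by
      refine Finset.sum_congr rfl fun u _ => ?_
      rw [hz, Finset.mul_sum]
      exact Finset.sum_congr rfl fun v _ => by ring
    rw [e]
    refine (h p y hp hy).trans ?_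
    have : l2 p ≤ l2 z := Real.sqrt_le_sqrt (Finset.sum_le_sum fun u _ => by
      rw [← sq_abs (z u)]; exact pow_le_pow_left₀ (hp u) (hpz u) 2)
    have := l2_nonneg y
    gcongr
  have h1 := (abs_le.1 (hpart (fun u => max (z u) 0) (fun u => le_max_right _ _)
    fun u => max_le (le_abs_self _) (abs_nonneg _))).2
  have h2 := (abs_le.1 (hpart (fun u => max (-z u) 0) (fun u => le_max_right _ _)
    fun u => max_le (neg_le_abs _) (abs_nonneg _))).1
  have e : l2 z ^ 2 = ∑ u, max (z u) 0 * z u - ∑ u, max (-z u) 0 * z u := by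
    rw [l2_sq, ← Finset.sum_sub_distrib]
    refine Finset.sum_congr rfl fun u _ => ?_
    rcases le_total 0 (z u) with hu | hu
    · rw [max_eq_left hu, max_eq_right (by linarith)]; ring
    · rw [max_eq_right hu, max_eq_left (by linarith)]; ring
  have : l2 z * l2 z ≤ l2 z * (2 * b * l2 y) := by nlinarith
  exact le_of_mul_le_mul_left this h0

lemma l2_stochastic_le {Q : V → V → ℝ} (hQ : ∀ u v, 0 ≤ Q u v) (hs : ∀ u v, Q u v = Q v u)
    (h1 : ∀ u, ∑ v, Q u v = 1) (x : V → ℝ) : l2 (fun v => ∑ u, x u * Q u v) ≤ l2 x := by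
  refine Real.sqrt_le_sqrt ?_
  have h2 : ∀ v, (∑ u, x u * Q u v) ^ 2 ≤ ∑ u, x u ^ 2 * Q u v := fun v => by
    have := Finset.sum_sq_le_sum_mul_sum_of_sq_le_mul (s := Finset.univ)
      (r := fun u => x u * Q u v) (f := fun u => x u ^ 2 * Q u v) (g := fun u => Q u v)
      (fun u _ => mul_nonneg (sq_nonneg _) (hQ u v)) (fun u _ => hQ u v) fun u _ => le_of_eq (by ring)
    have e : ∑ u, Q u v = 1 := by rw [← h1 v]; exact Finset.sum_congr rfl fun u _ => hs u v
    rwa [e, mul_one] at this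
  refine (Finset.sum_le_sum fun v _ => h2 v).trans ?_
  rw [Finset.sum_comm]
  simp_rw [← Finset.mul_sum, h1, mul_one, le_refl]

end Norms

/-! ### Walks alternating between two mixing matrices -/

section Mixing

variable {V : Type*}

/-- The sequence `P, Q, P, Q, …`. -/
def alw (P Q : V → V → ℝ) (t : ℕ) : V → V → ℝ := if t % 2 = 0 then P else Q

lemma alw_even (P Q : V → V → ℝ) {t : ℕ} (h : t % 2 = 0) : alw P Q t = P := if_pos h

lemma alw_odd (P Q : V → V → ℝ) {t : ℕ} (h : t % 2 = 1) : alw P Q t = Q := if_neg (by omega)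

variable [Fintype V] [DecidableEq V]

lemma pw_reverse {A B : ℕ → V → V → ℝ} (L : ℕ) : ∀ {i j : ℕ}
    (_ : ∀ t < L, ∀ u v, A (i + t) u v = B (j + (L - 1 - t)) v u) (x y : V),
    pw A i L x y = pw B j L y x := by
  induction L with
  | zero => intro i j _ x y; simp only [pw_zero]; exact if_congr eq_comm rfl rfl
  | succ L ih =>
    intro i j h x y
    rw [pw_succ, pw_succ']
    refine Finset.sum_congr rfl fun z _ => ?_
    rw [ih (i := i + 1) (j := j) (fun t ht u v => by
      rw [add_assoc, h (1 + t) (by omega)]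
      congr 2; omega) z y]
    have := h 0 (by omega) x z
    rw [add_zero, show L + 1 - 1 - 0 = L by omega] at this
    rw [this, mul_comm]

lemma pw_alw_shift_even (P Q : V → V → ℝ) {i : ℕ} (h : i % 2 = 0) (L : ℕ) :
    pw (alw P Q) i L = pw (alw P Q) 0 L :=
  pw_congr L fun t _ => by unfold alw; congr 1; apply propext; omega

lemma pw_alw_shift_odd (P Q : V → V → ℝ) {i : ℕ} (h : i % 2 = 1) (L : ℕ) :
    pw (alw P Q) i L = pw (alw Q P) 0 L :=
  pw_congr L fun t _ => by
    unfold alw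
    by_cases ht : t % 2 = 0
    · rw [if_neg (by omega), if_pos (by omega)]
    · rw [if_pos (by omega), if_neg (by omega)]

/-- `P` and `Q` are symmetric, nonnegative, approximately stochastic and mix quickly. -/
structure Mixing (P Q : V → V → ℝ) (n δ θ : ℝ) (N : ℕ) : Prop where
  P_nonneg : ∀ u v, 0 ≤ P u v
  Q_nonneg : ∀ u v, 0 ≤ Q u v
  P_symm : ∀ u v, P u v = P v u
  Q_symm : ∀ u v, Q u v = Q v u
  card : (Fintype.card V : ℝ) = n
  n_pos : 0 < n
  δ_pos : 0 ≤ δ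
  δ_le : δ ≤ 1 / 20
  θ_nonneg : 0 ≤ θ
  θ_le : θ ≤ 1
  pow_le : (1 + θ) ^ N ≤ 1 + δ
  le_pow : 1 - δ ≤ (1 - θ) ^ N
  Q_sum : ∀ u, ∑ v, Q u v = 1
  deg_le : ∀ u, ∑ v, P u v ≤ 1 + δ
  le_deg : ∀ u, 1 - δ ≤ ∑ v, P u v
  two_le : ∀ u, ∑ v, P u v * ∑ w, Q v w * ∑ z, P w z ≤ (1 + θ) * ∑ v, P u v
  le_two : ∀ u, (1 - θ) * ∑ v, P u v ≤ ∑ v, P u v * ∑ w, Q v w * ∑ z, P w z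
  bilin : ∃ g, (1 - δ) / n ≤ g ∧ g ≤ (1 + δ) / n ∧
    (∀ x y : V → ℝ, (∀ u, 0 ≤ x u) → (∀ u, 0 ≤ y u) →
      |∑ u, ∑ v, x u * (P u v - g) * y v| ≤ δ * (l2 x * l2 y)) ∧
    ∀ y : V → ℝ, (∀ u, 0 ≤ y u) → l2 (fun u => ∑ v, (P u v - g) * y v) ≤ δ * l2 y

namespace Mixing

variable {P Q : V → V → ℝ} {n δ θ : ℝ} {N : ℕ}

lemma alw_nonneg (h : Mixing P Q n δ θ N) (t : ℕ) (u v : V) : 0 ≤ alw P Q t u v := by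
  unfold alw; split_ifs
  exacts [h.P_nonneg u v, h.Q_nonneg u v]

lemma alw_nonneg' (h : Mixing P Q n δ θ N) (t : ℕ) (u v : V) : 0 ≤ alw Q P t u v := by
  unfold alw; split_ifs
  exacts [h.Q_nonneg u v, h.P_nonneg u v]

lemma sum_pw_bounds (h : Mixing P Q n δ θ N) (L : ℕ) (x : V) :
    (1 - θ) ^ L * ∑ v, P x v ≤ ∑ y, pw (alw P Q) 0 (L + 1) x y ∧
      ∑ y, pw (alw P Q) 0 (L + 1) x y ≤ (1 + θ) ^ L * ∑ v, P x v := by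
  have hP : ∀ x, 0 ≤ ∑ v, P x v := fun x => Finset.sum_nonneg fun v _ => h.P_nonneg x v
  have hstep : ∀ L x, ∑ y, pw (alw P Q) 0 (L + 2) x y =
      ∑ z, P x z * ∑ w, Q z w * ∑ y, pw (alw P Q) 0 L w y := fun L x => by
    simp_rw [pw_succ _ _ (L + 1), pw_succ _ _ L]
    rw [Finset.sum_comm]
    refine Finset.sum_congr rfl fun z _ => ?_
    rw [← Finset.mul_sum, Finset.sum_comm, alw_even P Q (by norm_num)]
    congr 1
    refine Finset.sum_congr rfl fun w _ => ?_
    rw [← Finset.mul_sum, alw_odd P Q (by norm_num), pw_alw_shift_even P Q (by norm_num)]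
  induction L using Nat.strong_induction_on generalizing x with
  | _ L ih =>
    rcases L with _ | _ | L
    · simp [pw_one, alw_even]
    · rw [hstep]
      simp only [pw_zero, Finset.sum_ite_eq, Finset.mem_univ, if_true, mul_one, h.Q_sum]
      have := hP x
      have := h.θ_nonneg
      rw [zero_add, pow_one, pow_one]
      constructor <;> nlinarith
    · rw [show L + 1 + 1 + 1 = (L + 1) + 2 by ring, hstep]
      have hθ := h.θ_nonneg
      have hθ1 : 0 ≤ 1 - θ := by linarith [h.θ_le]
      have pull : ∀ c : ℝ, c * ∑ z, P x z * ∑ w, Q z w * ∑ y, P w y =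
          ∑ z, P x z * ∑ w, Q z w * (c * ∑ y, P w y) := fun c => by
        rw [Finset.mul_sum]
        refine Finset.sum_congr rfl fun z _ => ?_
        rw [mul_left_comm, Finset.mul_sum]
        exact congrArg _ (Finset.sum_congr rfl fun w _ => mul_left_comm _ _ _)
      constructor
      · calc (1 - θ) ^ (L + 1 + 1) * ∑ v, P x v = (1 - θ) ^ L * (1 - θ) * ((1 - θ) * ∑ v, P x v) := by
              ring
          _ ≤ (1 - θ) ^ L * 1 * (∑ v, P x v * ∑ w, Q v w * ∑ z, P w z) :=
              mul_le_mul (mul_le_mul_of_nonneg_left (by linarith) (pow_nonneg hθ1 _)) (h.le_two x)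
                (mul_nonneg hθ1 (hP x)) (by positivity)
          _ = ∑ z, P x z * ∑ w, Q z w * ((1 - θ) ^ L * ∑ y, P w y) := by
              rw [mul_one, pull]
          _ ≤ _ := Finset.sum_le_sum fun z _ => mul_le_mul_of_nonneg_left
              (Finset.sum_le_sum fun w _ => mul_le_mul_of_nonneg_left (ih L (by omega) w).1
                (h.Q_nonneg _ _)) (h.P_nonneg _ _)
      · calc _ ≤ ∑ z, P x z * ∑ w, Q z w * ((1 + θ) ^ L * ∑ y, P w y) :=
              Finset.sum_le_sum fun z _ => mul_le_mul_of_nonneg_left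
              (Finset.sum_le_sum fun w _ => mul_le_mul_of_nonneg_left (ih L (by omega) w).2
                (h.Q_nonneg _ _)) (h.P_nonneg _ _)
          _ = (1 + θ) ^ L * 1 * (∑ v, P x v * ∑ w, Q v w * ∑ z, P w z) := by
              rw [mul_one, pull]
          _ ≤ (1 + θ) ^ L * (1 + θ) * ((1 + θ) * ∑ v, P x v) := by
              refine mul_le_mul (mul_le_mul_of_nonneg_left (by linarith) (by positivity)) (h.two_le x)
                ?_ (by positivity)
              exact Finset.sum_nonneg fun z _ => mul_nonneg (h.P_nonneg _ _)
                (Finset.sum_nonneg fun w _ => mul_nonneg (h.Q_nonneg _ _) (hP w))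
          _ = _ := by ring

lemma sum_pw_P (h : Mixing P Q n δ θ N) {L : ℕ} (hL : L ≤ N) (x : V) :
    1 - 3 * δ ≤ ∑ y, pw (alw P Q) 0 L x y ∧ ∑ y, pw (alw P Q) 0 L x y ≤ 1 + 3 * δ := by
  have hδ := h.δ_pos
  have hδ1 := h.δ_le
  rcases L with _ | L
  · simp only [pw_zero, Finset.sum_ite_eq, Finset.mem_univ, if_true]
    constructor <;> linarith
  · obtain ⟨h1, h2⟩ := h.sum_pw_bounds L x
    have hθ := h.θ_nonneg
    have hθ1 := h.θ_le
    have i1 : (1 + θ) ^ L ≤ 1 + δ := (pow_le_pow_right₀ (by linarith) (by omega)).trans h.pow_le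
    have i2 : 1 - δ ≤ (1 - θ) ^ L :=
      h.le_pow.trans (pow_le_pow_of_le_one (by linarith) (by linarith) (by omega))
    have i3 := h.deg_le x
    have i4 := h.le_deg x
    constructor
    · refine le_trans ?_ h1
      have : (1 - δ) * (1 - δ) ≤ (1 - θ) ^ L * ∑ v, P x v :=
        mul_le_mul i2 i4 (by linarith) (by linarith)
      nlinarith
    · refine h2.trans ?_
      have : (1 + θ) ^ L * ∑ v, P x v ≤ (1 + δ) * (1 + δ) :=
        mul_le_mul i1 i3 (by linarith) (by linarith)
      nlinarith

lemma sum_pw_Q (h : Mixing P Q n δ θ N) {L : ℕ} (hL : L ≤ N) (x : V) :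
    1 - 3 * δ ≤ ∑ y, pw (alw Q P) 0 L x y ∧ ∑ y, pw (alw Q P) 0 L x y ≤ 1 + 3 * δ := by
  have hδ := h.δ_pos
  rcases L with _ | L
  · simp only [pw_zero, Finset.sum_ite_eq, Finset.mem_univ, if_true]
    constructor <;> linarith
  · have e : ∑ y, pw (alw Q P) 0 (L + 1) x y = ∑ z, Q x z * ∑ y, pw (alw P Q) 0 L z y := by
      simp_rw [pw_succ]
      rw [Finset.sum_comm]
      refine Finset.sum_congr rfl fun z _ => ?_
      rw [← Finset.mul_sum, alw_even Q P (by norm_num), pw_alw_shift_odd Q P (by norm_num)]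
    rw [e]
    have hz := fun z => h.sum_pw_P (L := L) (by omega) z
    have e1 : ∀ c : ℝ, ∑ z, Q x z * c = c := fun c => by rw [← Finset.sum_mul, h.Q_sum, one_mul]
    constructor
    · rw [← e1 (1 - 3 * δ)]
      exact Finset.sum_le_sum fun z _ => mul_le_mul_of_nonneg_left (hz z).1 (h.Q_nonneg _ _)
    · rw [← e1 (1 + 3 * δ)]
      exact Finset.sum_le_sum fun z _ => mul_le_mul_of_nonneg_left (hz z).2 (h.Q_nonneg _ _)

lemma sum_pw_le (h : Mixing P Q n δ θ N) (i : ℕ) {L : ℕ} (hL : L ≤ N) (x : V) :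
    ∑ y, pw (alw P Q) i L x y ≤ 2 := by
  have := h.δ_le
  rcases Nat.mod_two_eq_zero_or_one i with hi | hi
  · rw [pw_alw_shift_even P Q hi]; linarith [(h.sum_pw_P hL x).2]
  · rw [pw_alw_shift_odd P Q hi]; linarith [(h.sum_pw_Q hL x).2]

/-- The effect of the two steps `P, Q` on a nonnegative vector. -/
lemma l2_step (h : Mixing P Q n δ θ N) {f : V → ℝ} (hf : ∀ u, 0 ≤ f u)
    (hf1 : ∑ u, f u ≤ 1 + 3 * δ) :
    l2 (fun y => ∑ z, (∑ w, f w * P w z) * Q z y) ≤ (3 / 2) / √n + δ * l2 f := by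
  obtain ⟨g, hg0, hg1, -, hR⟩ := h.bilin
  have hδ := h.δ_pos
  have hδ1 := h.δ_le
  have hn := h.n_pos
  have hg : 0 ≤ g := le_trans (div_nonneg (by linarith) hn.le) hg0
  refine (l2_stochastic_le h.Q_nonneg h.Q_symm h.Q_sum _).trans ?_
  have e : (fun z => ∑ w, f w * P w z) = fun z => g * (∑ w, f w) + ∑ w, (P z w - g) * f w := by
    funext z
    rw [Finset.mul_sum, ← Finset.sum_add_distrib]
    exact Finset.sum_congr rfl fun w _ => by rw [h.P_symm w z]; ring
  rw [e]
  refine (l2_add_le _ _).trans (add_le_add ?_ (hR f hf))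
  have hS : 0 ≤ ∑ w, f w := Finset.sum_nonneg fun w _ => hf w
  rw [l2_const _ (mul_nonneg hg hS), h.card]
  have i1 : g * (∑ w, f w) ≤ (1 + δ) / n * (1 + 3 * δ) :=
    mul_le_mul hg1 hf1 hS (div_nonneg (by linarith) hn.le)
  have i2 : (1 + δ) / n * (1 + 3 * δ) ≤ (3 / 2) / n := by
    rw [div_mul_eq_mul_div]
    gcongr
    nlinarith
  calc _ ≤ (3 / 2) / n * √n := by gcongr; linarith
    _ = _ := by
      rw [div_mul_eq_mul_div, div_eq_div_iff hn.ne' (Real.sqrt_pos.2 hn).ne', mul_assoc,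
        Real.mul_self_sqrt hn.le]

lemma l2_iterate (h : Mixing P Q n δ θ N) (f : ℕ → V → ℝ) (hf : ∀ j u, 0 ≤ f j u) {m : ℕ}
    (hf1 : ∀ j < m, ∑ u, f j u ≤ 1 + 3 * δ) (h0 : l2 (f 0) ≤ 1)
    (hs : ∀ j, f (j + 1) = fun y => ∑ z, (∑ w, f j w * P w z) * Q z y) {m₀ : ℕ} (hm : m₀ ≤ m)
    (hδ : δ ^ m₀ ≤ 1 / √n) : l2 (f m) ≤ 3 / √n := by
  have hsq : 0 < √n := Real.sqrt_pos.2 h.n_pos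
  have key : ∀ j ≤ m, l2 (f j) ≤ 2 / √n + δ ^ j := by
    intro j
    induction j with
    | zero => intro _; rw [pow_zero]; have : 0 ≤ 2 / √n := by positivity
              linarith
    | succ j ih =>
      intro hj
      rw [hs]
      refine (h.l2_step (hf j) (hf1 j (by omega))).trans ?_
      have i1 := mul_le_mul_of_nonneg_left (ih (by omega)) h.δ_pos
      have i2 : δ * (2 / √n) ≤ 1 / 20 * (2 / √n) :=
        mul_le_mul_of_nonneg_right h.δ_le (by positivity)
      have i3 : (3 / 2) / √n + 1 / 20 * (2 / √n) ≤ 2 / √n := by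
        rw [← mul_div_assoc, ← add_div]; gcongr; norm_num
      rw [pow_succ']
      linarith
  have i1 : δ ^ m ≤ δ ^ m₀ := pow_le_pow_of_le_one h.δ_pos (by linarith [h.δ_le]) hm
  have e : 3 / √n = 2 / √n + 1 / √n := by rw [← add_div]; norm_num
  rw [e]
  linarith [key m le_rfl]

lemma l2_pw_P (h : Mixing P Q n δ θ N) {m m₀ : ℕ} (hmN : 2 * m ≤ N) (hm : m₀ ≤ m)
    (hδ : δ ^ m₀ ≤ 1 / √n) (x : V) : l2 (fun y => pw (alw P Q) 0 (2 * m) x y) ≤ 3 / √n := by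
  refine h.l2_iterate (fun j y => pw (alw P Q) 0 (2 * j) x y)
    (fun j u => pw_nonneg h.alw_nonneg _ _ _ _) (fun j hj => (h.sum_pw_P (by omega) x).2) ?_
    (fun j => ?_) hm hδ
  · refine l2_le zero_le_one ?_
    simp [pw_zero]
  · funext y
    show pw (alw P Q) 0 (2 * j + 1 + 1) x y = _
    rw [pw_succ']
    refine Finset.sum_congr rfl fun z _ => ?_
    rw [pw_succ', alw_odd P Q (t := 0 + (2 * j + 1)) (by omega)]
    congr 1
    exact Finset.sum_congr rfl fun w _ => by
      rw [alw_even P Q (t := 0 + 2 * j) (by omega)]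

lemma l2_pw_Q (h : Mixing P Q n δ θ N) {m m₀ : ℕ} (hmN : 2 * m + 1 ≤ N) (hm : m₀ ≤ m)
    (hδ : δ ^ m₀ ≤ 1 / √n) (x : V) : l2 (fun y => pw (alw Q P) 0 (2 * m + 1) x y) ≤ 3 / √n := by
  refine h.l2_iterate (fun j y => pw (alw Q P) 0 (2 * j + 1) x y)
    (fun j u => pw_nonneg h.alw_nonneg' _ _ _ _) (fun j hj => (h.sum_pw_Q (by omega) x).2) ?_
    (fun j => ?_) hm hδ
  · have := l2_stochastic_le h.Q_nonneg h.Q_symm h.Q_sum (fun u => if x = u then 1 else 0)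
    simp only [ite_mul, one_mul, zero_mul, Finset.sum_ite_eq, Finset.mem_univ, if_true] at this
    simp only [mul_zero, zero_add, pw_one, alw_even Q P (t := 0) rfl]
    refine this.trans (l2_le zero_le_one ?_)
    simp
  · funext y
    show pw (alw Q P) 0 (2 * j + 1 + 1 + 1) x y = _
    rw [pw_succ']
    refine Finset.sum_congr rfl fun z _ => ?_
    rw [pw_succ', alw_even Q P (t := 0 + (2 * j + 1 + 1)) (by omega)]
    congr 1
    exact Finset.sum_congr rfl fun w _ => by
      rw [alw_odd Q P (t := 0 + (2 * j + 1)) (by omega)]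

lemma middle (h : Mixing P Q n δ θ N) {f f' : V → ℝ} (hf : ∀ u, 0 ≤ f u) (hf' : ∀ u, 0 ≤ f' u)
    (hf1 : 1 - 3 * δ ≤ ∑ u, f u) (hf2 : ∑ u, f u ≤ 1 + 3 * δ)
    (hf1' : 1 - 3 * δ ≤ ∑ u, f' u) (hf2' : ∑ u, f' u ≤ 1 + 3 * δ)
    (hl : l2 f ≤ 3 / √n) (hl' : l2 f' ≤ 3 / √n) :
    (1 - 17 * δ) / n ≤ ∑ v, (∑ u, f u * P u v) * f' v ∧
      ∑ v, (∑ u, f u * P u v) * f' v ≤ (1 + 17 * δ) / n := by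
  obtain ⟨g, hg0, hg1, hB, -⟩ := h.bilin
  have hδ := h.δ_pos
  have hδ1 := h.δ_le
  have hn := h.n_pos
  have hd0 : 0 ≤ (1 - δ) / n := div_nonneg (by linarith) hn.le
  have hg : 0 ≤ g := le_trans hd0 hg0
  have e : ∑ v, (∑ u, f u * P u v) * f' v =
      g * ((∑ u, f u) * ∑ v, f' v) + ∑ u, ∑ v, f u * (P u v - g) * f' v := by
    simp_rw [Finset.sum_mul]
    rw [Finset.sum_comm, Finset.mul_sum, ← Finset.sum_add_distrib]
    refine Finset.sum_congr rfl fun u _ => ?_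
    rw [Finset.mul_sum, Finset.mul_sum, ← Finset.sum_add_distrib]
    exact Finset.sum_congr rfl fun v _ => by ring
  have hb := abs_le.1 (hB f f' hf hf')
  have hS : 0 ≤ 1 - 3 * δ := by linarith
  have i1 : l2 f * l2 f' ≤ 9 / n := by
    calc _ ≤ 3 / √n * (3 / √n) := mul_le_mul hl hl' (l2_nonneg _) (by positivity)
      _ = _ := by rw [div_mul_div_comm, Real.mul_self_sqrt hn.le]; norm_num
  have i2 : δ * (l2 f * l2 f') ≤ 9 * δ / n := by
    calc _ ≤ δ * (9 / n) := by gcongr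
      _ = _ := by ring
  have i3 : (∑ u, f u) * ∑ v, f' v ≤ (1 + 3 * δ) * (1 + 3 * δ) :=
    mul_le_mul hf2 hf2' (by linarith) (by linarith)
  have i4 : (1 - 3 * δ) * (1 - 3 * δ) ≤ (∑ u, f u) * ∑ v, f' v :=
    mul_le_mul hf1 hf1' (by linarith) (by linarith)
  have i5 : g * ((∑ u, f u) * ∑ v, f' v) ≤ (1 + 8 * δ) / n := by
    calc _ ≤ (1 + δ) / n * ((1 + 3 * δ) * (1 + 3 * δ)) :=
          mul_le_mul hg1 i3 (by nlinarith) (div_nonneg (by linarith) hn.le)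
      _ = ((1 + δ) * ((1 + 3 * δ) * (1 + 3 * δ))) / n := by ring
      _ ≤ _ := by gcongr; nlinarith [mul_nonneg hδ hδ]
  have i6 : (1 - 8 * δ) / n ≤ g * ((∑ u, f u) * ∑ v, f' v) := by
    calc _ ≤ ((1 - δ) * ((1 - 3 * δ) * (1 - 3 * δ))) / n := by
          gcongr; nlinarith [mul_nonneg hδ hδ]
      _ = (1 - δ) / n * ((1 - 3 * δ) * (1 - 3 * δ)) := by ring
      _ ≤ _ := mul_le_mul hg0 i4 (by positivity) hg
  rw [e]
  have j1 : (1 - 17 * δ) / n = (1 - 8 * δ) / n - 9 * δ / n := by ring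
  have j2 : (1 + 17 * δ) / n = (1 + 8 * δ) / n + 9 * δ / n := by ring
  rw [j1, j2]
  constructor <;> linarith

theorem pw_P_bounds (h : Mixing P Q n δ θ N) {a b m₀ : ℕ} (ha : m₀ ≤ a) (hb : m₀ ≤ b)
    (haN : 2 * a ≤ N) (hbN : 2 * b ≤ N) (hδ : δ ^ m₀ ≤ 1 / √n) (x y : V) :
    (1 - 17 * δ) / n ≤ pw (alw P Q) 0 (2 * a + 1 + 2 * b) x y ∧
      pw (alw P Q) 0 (2 * a + 1 + 2 * b) x y ≤ (1 + 17 * δ) / n := by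
  have e : pw (alw P Q) 0 (2 * a + 1 + 2 * b) x y =
      ∑ v, (∑ u, pw (alw P Q) 0 (2 * a) x u * P u v) * pw (alw P Q) 0 (2 * b) y v := by
    rw [pw_add]
    refine Finset.sum_congr rfl fun v _ => ?_
    rw [pw_succ', pw_reverse (A := alw P Q) (B := alw P Q) (2 * b) (i := 0 + (2 * a + 1)) (j := 0)
      (fun t ht u v => ?_) v y]
    · congr 1
      exact Finset.sum_congr rfl fun u _ => by rw [alw_even P Q (t := 0 + 2 * a) (by omega)]
    · rcases Nat.mod_two_eq_zero_or_one t with h' | h'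
      · rw [alw_odd P Q (by omega), alw_odd P Q (by omega), h.Q_symm]
      · rw [alw_even P Q (by omega), alw_even P Q (by omega), h.P_symm]
  rw [e]
  exact h.middle (fun u => pw_nonneg h.alw_nonneg _ _ _ _) (fun u => pw_nonneg h.alw_nonneg _ _ _ _)
    (h.sum_pw_P haN x).1 (h.sum_pw_P haN x).2 (h.sum_pw_P hbN y).1 (h.sum_pw_P hbN y).2
    (h.l2_pw_P haN ha hδ x) (h.l2_pw_P hbN hb hδ y)

theorem pw_Q_bounds (h : Mixing P Q n δ θ N) {a b m₀ : ℕ} (ha : m₀ ≤ a) (hb : m₀ ≤ b)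
    (haN : 2 * a + 1 ≤ N) (hbN : 2 * b + 1 ≤ N) (hδ : δ ^ m₀ ≤ 1 / √n) (x y : V) :
    (1 - 17 * δ) / n ≤ pw (alw Q P) 0 (2 * a + 2 + (2 * b + 1)) x y ∧
      pw (alw Q P) 0 (2 * a + 2 + (2 * b + 1)) x y ≤ (1 + 17 * δ) / n := by
  have e : pw (alw Q P) 0 (2 * a + 2 + (2 * b + 1)) x y =
      ∑ v, (∑ u, pw (alw Q P) 0 (2 * a + 1) x u * P u v) * pw (alw Q P) 0 (2 * b + 1) y v := by
    rw [pw_add]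
    refine Finset.sum_congr rfl fun v _ => ?_
    rw [pw_succ', pw_reverse (A := alw Q P) (B := alw Q P) (2 * b + 1) (i := 0 + (2 * a + 2))
      (j := 0) (fun t ht u v => ?_) v y]
    · congr 1
      exact Finset.sum_congr rfl fun u _ => by rw [alw_odd Q P (t := 0 + (2 * a + 1)) (by omega)]
    · rcases Nat.mod_two_eq_zero_or_one t with h' | h'
      · rw [alw_even Q P (by omega), alw_even Q P (by omega), h.Q_symm]
      · rw [alw_odd Q P (by omega), alw_odd Q P (by omega), h.P_symm]
  rw [e]
  exact h.middle (fun u => pw_nonneg h.alw_nonneg' _ _ _ _)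
    (fun u => pw_nonneg h.alw_nonneg' _ _ _ _)
    (h.sum_pw_Q haN x).1 (h.sum_pw_Q haN x).2 (h.sum_pw_Q hbN y).1 (h.sum_pw_Q hbN y).2
    (h.l2_pw_Q haN ha hδ x) (h.l2_pw_Q hbN hb hδ y)

end Mixing

end Mixing

/-! ### Self-intersecting alternating walks -/

section Pinned

variable {V : Type*} [Fintype V] [DecidableEq V] {P Q : V → V → ℝ} {n δ θ κ ω : ℝ} {N m₀ : ℕ}

lemma sum_mul_mul_le {f g h : V → ℝ} {a b c : ℝ} (hf : ∀ z, 0 ≤ f z) (hg : ∀ z, g z ≤ a)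
    (hh : ∀ z, 0 ≤ h z) (hhb : ∀ z, h z ≤ b) (ha : 0 ≤ a) (hb : 0 ≤ b) (hfc : ∑ z, f z ≤ c) :
    ∑ z, f z * g z * h z ≤ c * a * b := by
  calc ∑ z, f z * g z * h z ≤ ∑ z, f z * (a * b) := Finset.sum_le_sum fun z _ => by
        rw [mul_assoc]
        exact mul_le_mul_of_nonneg_left (mul_le_mul (hg z) (hhb z) (hh z) ha) (hf z)
    _ = (∑ z, f z) * (a * b) := by rw [Finset.sum_mul]
    _ ≤ c * (a * b) := mul_le_mul_of_nonneg_right hfc (mul_nonneg ha hb)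
    _ = _ := by ring

lemma Mixing.sum_pw_le' (h : Mixing P Q n δ θ N) (i : ℕ) {L : ℕ} (hL : L ≤ N) (y : V) :
    ∑ x, pw (alw P Q) i L x y ≤ 2 := by
  have e : ∀ x, pw (alw P Q) i L x y = pw (alw P Q) (i + L + 1) L y x := fun x =>
    pw_reverse L (fun t ht u v => by
      unfold alw
      by_cases h' : (i + t) % 2 = 0
      · rw [if_pos h', if_pos (by omega), h.P_symm]
      · rw [if_neg h', if_neg (by omega), h.Q_symm]) x y
  simp_rw [e]
  exact h.sum_pw_le _ hL _

lemma Mixing.pw_two_le (h : Mixing P Q n δ θ N) (hκ : ∀ u w, ∑ z, P u z * Q z w ≤ κ) (i : ℕ)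
    (u w : V) : pw (alw P Q) i 2 u w ≤ κ := by
  simp only [pw_succ _ _ 1, pw_one]
  rcases Nat.mod_two_eq_zero_or_one i with hi | hi
  · rw [alw_even P Q hi, alw_odd P Q (by omega)]
    exact hκ u w
  · rw [alw_odd P Q hi, alw_even P Q (by omega)]
    refine le_trans (le_of_eq ?_) (hκ w u)
    exact Finset.sum_congr rfl fun z _ => by rw [h.P_symm w z, h.Q_symm u z, mul_comm]

lemma Mixing.pw_le (h : Mixing P Q n δ θ N) (hκ : ∀ u w, ∑ z, P u z * Q z w ≤ κ) (i : ℕ) {L : ℕ}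
    (hL : 2 ≤ L) (hN : L ≤ N) (u w : V) : pw (alw P Q) i L u w ≤ 2 * κ := by
  obtain ⟨L, rfl⟩ := Nat.exists_eq_add_of_le hL
  have hκ0 : 0 ≤ κ := (pw_nonneg h.alw_nonneg 2 i u w).trans (h.pw_two_le hκ i u w)
  rw [pw_add]
  calc _ ≤ ∑ z, κ * pw (alw P Q) (i + 2) L z w := Finset.sum_le_sum fun z _ =>
        mul_le_mul_of_nonneg_right (h.pw_two_le hκ i u z) (pw_nonneg h.alw_nonneg _ _ _ _)
    _ = κ * ∑ z, pw (alw P Q) (i + 2) L z w := by rw [Finset.mul_sum]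
    _ ≤ κ * 2 := mul_le_mul_of_nonneg_left (h.sum_pw_le' _ (by omega) _) hκ0
    _ = _ := mul_comm _ _

lemma Mixing.pw_long_le (h : Mixing P Q n δ θ N) (hδ : δ ^ m₀ ≤ 1 / √n) (i : ℕ) {L : ℕ}
    (hL : 4 * m₀ + 3 ≤ L) (hN : L ≤ N) (u w : V) : pw (alw P Q) i L u w ≤ 4 / n := by
  obtain ⟨L, rfl⟩ := Nat.exists_eq_add_of_le hL
  have hn := h.n_pos
  have hδ1 := h.δ_le
  have h17 : (1 + 17 * δ) / n ≤ 2 / n := by gcongr; linarith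
  have key : ∀ z, pw (alw P Q) i (4 * m₀ + 3) u z ≤ 2 / n := fun z => by
    refine le_trans ?_ h17
    rcases Nat.mod_two_eq_zero_or_one i with hi | hi
    · rw [pw_alw_shift_even P Q hi, show 4 * m₀ + 3 = 2 * m₀ + 1 + 2 * (m₀ + 1) by ring]
      exact (h.pw_P_bounds le_rfl (by omega) (by omega) (by omega) hδ u z).2
    · rw [pw_alw_shift_odd P Q hi, show 4 * m₀ + 3 = 2 * m₀ + 2 + (2 * m₀ + 1) by ring]
      exact (h.pw_Q_bounds le_rfl le_rfl (by omega) (by omega) hδ u z).2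
  rw [pw_add]
  calc _ ≤ ∑ z, 2 / n * pw (alw P Q) (i + (4 * m₀ + 3)) L z w := Finset.sum_le_sum fun z _ =>
        mul_le_mul_of_nonneg_right (key z) (pw_nonneg h.alw_nonneg _ _ _ _)
    _ = 2 / n * ∑ z, pw (alw P Q) (i + (4 * m₀ + 3)) L z w := by rw [Finset.mul_sum]
    _ ≤ 2 / n * 2 := mul_le_mul_of_nonneg_left (h.sum_pw_le' _ (by omega) _) (by positivity)
    _ = _ := by ring

lemma Mixing.pinned_le (h : Mixing P Q n δ θ N) (hδ : δ ^ m₀ ≤ 1 / √n)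
    (hN : 12 * m₀ + 9 ≤ N) (hκ : ∀ u w, ∑ z, P u z * Q z w ≤ κ) (hκn : 1 / n ≤ κ)
    (hP0 : ∀ u, P u u = 0) (hQ0 : ∀ u, Q u u = 0) (hω : ∀ u v, P u v ≤ ω) (hω0 : 0 ≤ ω)
    {x y : V} (hxy : x ≠ y) (hPxy : P x y = 0) {i j : ℕ} (hij : i < j) (hj : j ≤ 12 * m₀ + 9) :
    ∑ z, pw (alw P Q) 0 i x z * pw (alw P Q) i (j - i) z z *
      pw (alw P Q) j (12 * m₀ + 9 - j) z y ≤
      16 * κ / n + if i = 1 then (if j = 12 * m₀ + 8 then 8 * ω / n else 0) else 0 := by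
  have hn := h.n_pos
  have hκ0 : 0 ≤ κ := le_trans (by positivity) hκn
  have hpos : 0 ≤ 16 * κ / n := by positivity
  have hnn := fun i L z w => pw_nonneg h.alw_nonneg L i z w
  have hite : (0 : ℝ) ≤ if i = 1 then (if j = 12 * m₀ + 8 then 8 * ω / n else 0) else 0 := by
    split_ifs <;> positivity
  by_cases h1 : j - i = 1
  · refine le_trans (le_of_eq (Finset.sum_eq_zero fun z _ => ?_)) (add_nonneg hpos hite)
    rw [h1, pw_one]
    have : alw P Q i z z = 0 := by unfold alw; split_ifs; exacts [hP0 z, hQ0 z]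
    rw [this]; ring
  have h2 : ∀ z, pw (alw P Q) i (j - i) z z ≤ 2 * κ := fun z => h.pw_le hκ i (by omega) (by omega) z z
  by_cases hL1 : 4 * m₀ + 3 ≤ 12 * m₀ + 9 - j
  · refine le_add_of_le_of_nonneg ?_ hite
    refine (sum_mul_mul_le (fun z => hnn _ _ _ _) h2 (fun z => hnn _ _ _ _)
      (fun z => h.pw_long_le hδ j hL1 (by omega) z y) (by positivity) (by positivity)
      (h.sum_pw_le 0 (by omega) x)).trans (le_of_eq (by ring))
  by_cases hL2 : 4 * m₀ + 3 ≤ i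
  · refine le_add_of_le_of_nonneg ?_ hite
    refine le_trans (le_of_eq ?_) ((sum_mul_mul_le (fun z => hnn j (12 * m₀ + 9 - j) z y) h2
      (fun z => hnn 0 i x z) (fun z => h.pw_long_le hδ 0 hL2 (by omega) x z) (by positivity)
      (by positivity) (h.sum_pw_le' j (by omega) y)).trans (le_of_eq ?_))
    · exact Finset.sum_congr rfl fun z _ => by ring
    · ring
  have h3 : ∀ z, pw (alw P Q) i (j - i) z z ≤ 4 / n := fun z =>
    h.pw_long_le hδ i (by omega) (by omega) z z
  by_cases hM1 : 2 ≤ 12 * m₀ + 9 - j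
  · refine le_add_of_le_of_nonneg ?_ hite
    refine (sum_mul_mul_le (fun z => hnn _ _ _ _) h3 (fun z => hnn _ _ _ _)
      (fun z => h.pw_le hκ j hM1 (by omega) z y) (by positivity) (by positivity)
      (h.sum_pw_le 0 (by omega) x)).trans (le_of_eq (by ring))
  by_cases hM2 : 2 ≤ i
  · refine le_add_of_le_of_nonneg ?_ hite
    refine le_trans (le_of_eq ?_) ((sum_mul_mul_le (fun z => hnn j (12 * m₀ + 9 - j) z y) h3
      (fun z => hnn 0 i x z) (fun z => h.pw_le hκ 0 hM2 (by omega) x z) (by positivity)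
      (by positivity) (h.sum_pw_le' j (by omega) y)).trans (le_of_eq ?_))
    · exact Finset.sum_congr rfl fun z _ => by ring
    · ring
  have e0 : ∀ a b, alw P Q 0 a b = P a b := fun a b => by rw [alw_even P Q rfl]
  have e8 : ∀ a b, alw P Q (12 * m₀ + 8) a b = P a b := fun a b => by
    rw [alw_even P Q (by omega)]
  have hi : i = 0 ∨ i = 1 := by omega
  have hj' : j = 12 * m₀ + 9 ∨ j = 12 * m₀ + 8 := by omega
  rcases hj' with rfl | rfl
  · refine le_trans (le_of_eq (Finset.sum_eq_zero fun z _ => ?_)) (add_nonneg hpos hite)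
    rw [Nat.sub_self, pw_zero]
    split_ifs with hz
    · subst hz
      rcases hi with rfl | rfl
      · rw [pw_zero, if_neg hxy]; ring
      · rw [pw_one, e0, hPxy]; ring
    · ring
  · rw [show 12 * m₀ + 9 - (12 * m₀ + 8) = 1 by omega]
    rcases hi with rfl | rfl
    · refine le_trans (le_of_eq (Finset.sum_eq_zero fun z _ => ?_)) (add_nonneg hpos hite)
      rw [pw_zero, pw_one, e8]
      split_ifs with hz
      · subst hz; rw [hPxy]; ring
      · ring
    · rw [if_pos rfl, if_pos rfl]
      refine le_add_of_nonneg_of_le hpos ?_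
      refine (sum_mul_mul_le (c := 2) (a := 4 / n) (b := ω) (fun z => hnn _ _ _ _) h3
        (fun z => hnn _ _ _ _) (fun z => ?_) (by positivity) hω0
        (h.sum_pw_le 0 (by omega) x)).trans (le_of_eq (by ring))
      rw [pw_one, e8]; exact hω z y

theorem Mixing.sum_pinned_le (h : Mixing P Q n δ θ N) (hδ : δ ^ m₀ ≤ 1 / √n)
    (hN : 12 * m₀ + 9 ≤ N) (hκ : ∀ u w, ∑ z, P u z * Q z w ≤ κ) (hκn : 1 / n ≤ κ)
    (hP0 : ∀ u, P u u = 0) (hQ0 : ∀ u, Q u u = 0) (hω : ∀ u v, P u v ≤ ω) (hω0 : 0 ≤ ω)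
    {x y : V} (hxy : x ≠ y) (hPxy : P x y = 0) :
    ∑ j ∈ Finset.range (12 * m₀ + 10), ∑ i ∈ Finset.range j,
      ∑ z, pw (alw P Q) 0 i x z * pw (alw P Q) i (j - i) z z *
        pw (alw P Q) j (12 * m₀ + 9 - j) z y ≤
      (12 * m₀ + 10) ^ 2 * (16 * κ / n) + 8 * ω / n := by
  have hn := h.n_pos
  have hκ0 : 0 ≤ κ := le_trans (by positivity) hκn
  have hpos : 0 ≤ 16 * κ / n := by positivity
  have hω' : 0 ≤ 8 * ω / n := by positivity
  calc _ ≤ ∑ j ∈ Finset.range (12 * m₀ + 10), ∑ i ∈ Finset.range j, (16 * κ / n +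
        if i = 1 then (if j = 12 * m₀ + 8 then 8 * ω / n else 0) else 0) :=
        Finset.sum_le_sum fun j hj => Finset.sum_le_sum fun i hi =>
          h.pinned_le hδ hN hκ hκn hP0 hQ0 hω hω0 hxy hPxy (Finset.mem_range.1 hi)
            (by have := Finset.mem_range.1 hj; omega)
    _ ≤ ∑ j ∈ Finset.range (12 * m₀ + 10), ((12 * m₀ + 10) * (16 * κ / n) +
        if j = 12 * m₀ + 8 then 8 * ω / n else 0) := by
        refine Finset.sum_le_sum fun j hj => ?_
        rw [Finset.sum_add_distrib, Finset.sum_const, Finset.card_range, nsmul_eq_mul,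
          Finset.sum_ite_eq']
        have hj' : (j : ℝ) ≤ 12 * m₀ + 10 := by exact_mod_cast (Finset.mem_range.1 hj).le
        refine add_le_add (mul_le_mul_of_nonneg_right hj' hpos) ?_
        split_ifs <;> simp [hω']
    _ = _ := by
        rw [Finset.sum_add_distrib, Finset.sum_const, Finset.card_range, nsmul_eq_mul,
          Finset.sum_ite_eq', if_pos (Finset.mem_range.2 (by omega))]
        push_cast; ring

lemma pw_scale {A B : ℕ → V → V → ℝ} {c : ℕ → ℝ} (h : ∀ t u v, A t u v = c t * B t u v) (L : ℕ) :
    ∀ (i : ℕ) (x y : V), pw A i L x y = (∏ t ∈ Finset.range L, c (i + t)) * pw B i L x y := by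
  induction L with
  | zero => intro i x y; simp [pw_zero]
  | succ L ih =>
    intro i x y
    rw [pw_succ', pw_succ', Finset.prod_range_succ, Finset.mul_sum]
    exact Finset.sum_congr rfl fun z _ => by rw [ih, h]; ring

lemma prod_alternating (a b : ℝ) (l : ℕ) :
    ∏ t ∈ Finset.range (2 * l + 1), (if t % 2 = 0 then a else b) = a ^ (l + 1) * b ^ l := by
  induction l with
  | zero => simp
  | succ l ih =>
    rw [show 2 * (l + 1) + 1 = 2 * l + 1 + 1 + 1 by ring, Finset.prod_range_succ,
      Finset.prod_range_succ, ih, if_neg (by omega), if_pos (by omega)]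
    ring

lemma pinned_scale {A B : ℕ → V → V → ℝ} {c : ℕ → ℝ} (h : ∀ t u v, A t u v = c t * B t u v)
    {N i j : ℕ} (hij : i < j) (hj : j ≤ N) (x y : V) :
    ∑ z, pw A 0 i x z * pw A i (j - i) z z * pw A j (N - j) z y =
      (∏ t ∈ Finset.range N, c t) *
        ∑ z, pw B 0 i x z * pw B i (j - i) z z * pw B j (N - j) z y := by
  have e : ∏ t ∈ Finset.range N, c t = (∏ t ∈ Finset.range i, c (0 + t)) *
      (∏ t ∈ Finset.range (j - i), c (i + t)) * ∏ t ∈ Finset.range (N - j), c (j + t) := by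
    simp_rw [zero_add]
    rw [← Finset.prod_range_add, show i + (j - i) = j by omega, ← Finset.prod_range_add,
      show j + (N - j) = N by omega]
  rw [e, Finset.mul_sum]
  exact Finset.sum_congr rfl fun z _ => by
    rw [pw_scale h i 0, pw_scale h (j - i) i, pw_scale h (N - j) j]; ring

end Pinned

/-! ### Typical pairs of graphs -/

section Typical

/-- `E` is nearly regular of degree `m`, the walks alternating between `E` and `K` expand at the
expected rate, and `E` has no irregular cuts. -/
structure TypPair (E K : Finset (Edge n)) (k : ℕ) (m s δ θ α : ℝ) : Prop where
  deg : ∀ v, |(dg E v : ℝ) - m| ≤ δ * m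
  two : ∀ v, |∑ u, am E v u * ∑ w, am K u w * (dg E w : ℝ) - k * m * dg E v| ≤
    θ * (k * m * dg E v)
  disc : ∀ A B : Finset (Fin n), |cutw E A B - s * (A.card * B.card)| ≤
    α * m * √(A.card * B.card)

lemma cutw_eq (E : Finset (Edge n)) (A B : Finset (Fin n)) :
    cutw E A B = ∑ u ∈ A, ∑ v ∈ B, am E u v := rfl

lemma abs_bilinear_of_disc {E : Finset (Edge n)} {m s α δ : ℝ} (hm : 0 < m) (hs : 0 ≤ s)
    (hα : 0 ≤ α) (hE : ∀ v, (dg E v : ℝ) ≤ 2 * m) (hsn : s * n ≤ 2 * m)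
    (hd : ∀ A B : Finset (Fin n), |cutw E A B - s * (A.card * B.card)| ≤
      α * m * √(A.card * B.card)) {T : ℕ} (hT : 1 < T)
    (hδ : 6 * α * T ^ 2 + 16 / T ≤ δ) :
    (∀ x y : Fin n → ℝ, (∀ u, 0 ≤ x u) → (∀ u, 0 ≤ y u) →
      |∑ u, ∑ v, x u * (am E u v / m - s / m) * y v| ≤ δ / 2 * (l2 x * l2 y)) ∧
    ∀ y : Fin n → ℝ, (∀ u, 0 ≤ y u) →
      l2 (fun u => ∑ v, (am E u v / m - s / m) * y v) ≤ δ * l2 y := by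
  have hT0 : (0 : ℝ) < T := by positivity
  have hb : 0 ≤ 3 * α * T ^ 2 / 2 + 4 / T := by positivity
  have hrow : ∀ u, ∑ v, |am E u v / m - s / m| ≤ 4 := fun u => by
    calc _ ≤ ∑ v, (am E u v / m + s / m) := Finset.sum_le_sum fun v _ => by
          refine (abs_sub _ _).trans (le_of_eq ?_)
          rw [abs_of_nonneg (div_nonneg (am_nonneg _ _ _) hm.le),
            abs_of_nonneg (div_nonneg hs hm.le)]
      _ = (dg E u : ℝ) / m + s * n / m := by
          rw [Finset.sum_add_distrib, ← Finset.sum_div, sum_am, Finset.sum_const,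
            Finset.card_univ, Fintype.card_fin, nsmul_eq_mul]
          ring
      _ ≤ 2 + 2 := add_le_add ((div_le_iff₀ hm).2 (hE u)) ((div_le_iff₀ hm).2 hsn)
      _ = 4 := by norm_num
  have hcol : ∀ v, ∑ u, |am E u v / m - s / m| ≤ 4 := fun v => by
    simp_rw [am_comm E _ v]; exact hrow v
  have hcut : ∀ A B : Finset (Fin n), ∑ u ∈ A, ∑ v ∈ B, (am E u v / m - s / m) =
      (cutw E A B - s * (A.card * B.card)) / m := fun A B => by
    rw [cutw_eq, sub_div, Finset.sum_div]
    have : s * ((A.card : ℝ) * B.card) / m = ∑ u ∈ A, ∑ v ∈ B, s / m := by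
      simp only [Finset.sum_const, nsmul_eq_mul]; ring
    rw [this, ← Finset.sum_sub_distrib]
    refine Finset.sum_congr rfl fun u _ => ?_
    rw [Finset.sum_div, ← Finset.sum_sub_distrib]
  have hcut' : ∀ A B : Finset (Fin n), |∑ u ∈ A, ∑ v ∈ B, (am E u v / m - s / m)| ≤
      α * √(A.card * B.card) := fun A B => by
    rw [hcut, abs_div, abs_of_pos hm, div_le_iff₀ hm]
    refine (hd A B).trans (le_of_eq (by ring))
  have hup := fun (x y : Fin n → ℝ) (hx : ∀ u, 0 ≤ x u) (hy : ∀ u, 0 ≤ y u) =>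
    bilinear_le (fun u v => am E u v / m - s / m) hα
      (fun A B => (le_abs_self _).trans (hcut' A B)) hrow hcol hx hy hT
  have hlo := fun (x y : Fin n → ℝ) (hx : ∀ u, 0 ≤ x u) (hy : ∀ u, 0 ≤ y u) =>
    bilinear_le (fun u v => -(am E u v / m - s / m)) hα
      (fun A B => by
        simp_rw [Finset.sum_neg_distrib]
        exact (neg_le_abs _).trans (hcut' A B))
      (fun u => by simp_rw [abs_neg]; exact hrow u) (fun u => by simp_rw [abs_neg]; exact hcol u)
      hx hy hT
  have hδ4 : 2 * (3 * α * T ^ 2 / 2 + 4 / T) ≤ δ / 2 := by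
    have : 2 * (3 * α * T ^ 2 / 2 + 4 / T) = (6 * α * T ^ 2 + 16 / T) / 2 := by ring
    linarith
  have habs : ∀ x y : Fin n → ℝ, (∀ u, 0 ≤ x u) → (∀ u, 0 ≤ y u) →
      |∑ u, ∑ v, x u * (am E u v / m - s / m) * y v| ≤ δ / 2 * (l2 x * l2 y) := by
    intro x y hx hy
    have h1 := bilinear_le_l2 hup hx hy
    have h2 := bilinear_le_l2 hlo hx hy
    have h3 : 2 * (3 * α * T ^ 2 / 2 + 4 / T) * (l2 x * l2 y) ≤ δ / 2 * (l2 x * l2 y) :=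
      mul_le_mul_of_nonneg_right hδ4 (mul_nonneg (l2_nonneg _) (l2_nonneg _))
    have h4 : ∑ u, ∑ v, x u * -(am E u v / m - s / m) * y v =
        -∑ u, ∑ v, x u * (am E u v / m - s / m) * y v := by
      rw [← Finset.sum_neg_distrib]
      refine Finset.sum_congr rfl fun u _ => ?_
      rw [← Finset.sum_neg_distrib]
      exact Finset.sum_congr rfl fun v _ => by ring
    rw [h4] at h2
    rw [abs_le]
    constructor <;> linarith
  refine ⟨habs, fun y hy => ?_⟩
  have := l2_apply_le (by linarith [hb, hδ4]) habs hy
  linarith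

lemma TypPair.mixing {E K : Finset (Edge n)} {k : ℕ} {m s δ θ α : ℝ} {N T : ℕ}
    (h : TypPair E K k m s δ θ α) (hn : 1 ≤ n) (hK : K ∈ regs n k) (hk : 1 ≤ k) (hm : 0 < m)
    (hs : 0 ≤ s) (hα : 0 ≤ α) (hδ0 : 0 ≤ δ) (hδ : δ ≤ 1 / 20) (hθ0 : 0 ≤ θ) (hθ : θ ≤ 1)
    (hsn : |s * n - m| ≤ δ * m) (hT : 1 < T) (hTδ : 6 * α * T ^ 2 + 16 / T ≤ δ)
    (hN : (1 + θ) ^ N ≤ 1 + δ) (hN' : 1 - δ ≤ (1 - θ) ^ N) :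
    Mixing (fun u v => am E u v / m) (fun u v => am K u v / k) n δ θ N := by
  have hn0 : (0 : ℝ) < n := by exact_mod_cast hn
  have hk0 : (0 : ℝ) < k := by exact_mod_cast hk
  have hdeg := fun v => abs_le.1 (h.deg v)
  have hsn' := abs_le.1 hsn
  have hδm : δ * m ≤ 1 / 20 * m := mul_le_mul_of_nonneg_right hδ hm.le
  obtain ⟨hB1, hB2⟩ := abs_bilinear_of_disc hm hs hα (fun v => by linarith [(hdeg v).2])
    (by linarith [hsn'.2]) h.disc hT hTδ
  have hsum : ∀ u, ∑ v, am E u v / m = dg E u / m := fun u => by rw [← Finset.sum_div, sum_am]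
  have htwo : ∀ u, ∑ v, am E u v / m * ∑ w, am K v w / k * ∑ z, am E w z / m =
      (∑ v, am E u v * ∑ w, am K v w * (dg E w : ℝ)) / (k * m) / m := fun u => by
    simp_rw [hsum]
    rw [Finset.sum_div, Finset.sum_div]
    refine Finset.sum_congr rfl fun v _ => ?_
    rw [div_mul_eq_mul_div, Finset.mul_sum, Finset.mul_sum, Finset.sum_div, Finset.sum_div,
      Finset.sum_div]
    exact Finset.sum_congr rfl fun w _ => by field_simp
  have ht := fun u => abs_le.1 (h.two u)
  refine ⟨fun u v => div_nonneg (am_nonneg _ _ _) hm.le,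
    fun u v => div_nonneg (am_nonneg _ _ _) hk0.le, fun u v => by rw [am_comm],
    fun u v => by rw [am_comm], by rw [Fintype.card_fin], hn0, hδ0, hδ, hθ0, hθ, hN, hN',
    fun u => ?_, fun u => ?_, fun u => ?_, fun u => ?_, fun u => ?_, s / m, ?_, ?_, ?_, hB2⟩
  · rw [← Finset.sum_div, sum_am, mem_regs.1 hK u, div_self hk0.ne']
  · rw [hsum, div_le_iff₀ hm]; linarith [(hdeg u).2]
  · rw [hsum, le_div_iff₀ hm]; linarith [(hdeg u).1]
  · rw [htwo, hsum, ← mul_div_assoc]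
    refine div_le_div_of_nonneg_right ?_ hm.le
    rw [div_le_iff₀ (by positivity)]
    linarith [(ht u).2]
  · rw [htwo, hsum, ← mul_div_assoc]
    refine div_le_div_of_nonneg_right ?_ hm.le
    rw [le_div_iff₀ (by positivity)]
    linarith [(ht u).1]
  · rw [div_le_div_iff₀ hn0 hm]; linarith [hsn'.1]
  · rw [div_le_div_iff₀ hm hn0]; linarith [hsn'.2]
  · intro x y hx hy
    refine (hB1 x y hx hy).trans ?_
    exact mul_le_mul_of_nonneg_right (by linarith) (mul_nonneg (l2_nonneg _) (l2_nonneg _))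

lemma card_le_of_mixing {E K : Finset (Edge n)} {k m₀ N : ℕ} {m δ θ : ℝ}
    (hk : 1 ≤ k) (hm : 0 < m)
    (h : Mixing (fun u v => am E u v / m) (fun u v => am K u v / k) n δ θ N)
    (hδ : δ ^ m₀ ≤ 1 / √n) (hN : 12 * m₀ + 9 ≤ N) (x y : Fin n) :
    ((pset (6 * m₀ + 4) K E x y).card : ℝ) ≤
      k ^ (6 * m₀ + 5) * m ^ (6 * m₀ + 4) * ((1 + 17 * δ) / n) := by
  have hk0 : (0 : ℝ) < k := by exact_mod_cast hk
  refine (pset_card_le _ _ _ _ _).trans ?_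
  rw [pw_scale (B := alw (fun u v => am K u v / k) (fun u v => am E u v / m))
    (c := fun t => if t % 2 = 0 then (k : ℝ) else m) (fun t u v => ?_)]
  · simp_rw [zero_add]
    rw [prod_alternating]
    refine mul_le_mul_of_nonneg_left ?_ (by positivity)
    have := (h.pw_Q_bounds (a := 3 * m₀ + 1) (b := 3 * m₀ + 2) (by omega) (by omega) (by omega)
      (by omega) hδ x y).2
    rwa [show 2 * (3 * m₀ + 1) + 2 + (2 * (3 * m₀ + 2) + 1) = 2 * (6 * m₀ + 4) + 1 by ring] at this
  · unfold alt alw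
    split_ifs
    · exact (mul_div_cancel₀ _ hk0.ne').symm
    · exact (mul_div_cancel₀ _ hm.ne').symm

lemma le_card_of_mixing {E K : Finset (Edge n)} {k m₀ N : ℕ} {m δ θ κ : ℝ}
    (hk : 1 ≤ k) (hm : 0 < m)
    (h : Mixing (fun u v => am E u v / m) (fun u v => am K u v / k) n δ θ N)
    (hδ : δ ^ m₀ ≤ 1 / √n) (hN : 12 * m₀ + 9 ≤ N)
    (hκ : ∀ u w, ∑ z, am E u z * am K z w ≤ κ * (k * m)) (hκn : 1 / n ≤ κ) {x y : Fin n}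
    (hxy : x ≠ y) (hE : ¬ adj E x y) :
    m ^ (6 * m₀ + 5) * k ^ (6 * m₀ + 4) *
      ((1 - 17 * δ) / n - ((12 * m₀ + 10) ^ 2 * (16 * κ / n) + 8 * (1 / m) / n)) ≤
      (pset (6 * m₀ + 4) E K x y).card := by
  have hk0 : (0 : ℝ) < k := by exact_mod_cast hk
  have hc : ∀ t u v, alt E K t u v = (fun t => if t % 2 = 0 then m else (k : ℝ)) t *
      alw (fun u v => am E u v / m) (fun u v => am K u v / k) t u v := fun t u v => by
    unfold alt alw
    beta_reduce
    split_ifs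
    · exact (mul_div_cancel₀ _ hm.ne').symm
    · exact (mul_div_cancel₀ _ hk0.ne').symm
  refine le_trans ?_ (pset_card_ge _ _ _ _ _)
  rw [pw_scale hc]
  have e : ∑ j ∈ Finset.range (2 * (6 * m₀ + 4) + 2), ∑ i ∈ Finset.range j,
      ∑ z, pw (alt E K) 0 i x z * pw (alt E K) i (j - i) z z *
        pw (alt E K) j (2 * (6 * m₀ + 4) + 1 - j) z y =
      m ^ (6 * m₀ + 5) * k ^ (6 * m₀ + 4) *
        ∑ j ∈ Finset.range (2 * (6 * m₀ + 4) + 2), ∑ i ∈ Finset.range j,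
          ∑ z, pw (alw (fun u v => am E u v / m) (fun u v => am K u v / k)) 0 i x z *
            pw (alw (fun u v => am E u v / m) (fun u v => am K u v / k)) i (j - i) z z *
            pw (alw (fun u v => am E u v / m) (fun u v => am K u v / k)) j
              (2 * (6 * m₀ + 4) + 1 - j) z y := by
    rw [Finset.mul_sum]
    refine Finset.sum_congr rfl fun j hj => ?_
    rw [Finset.mul_sum]
    refine Finset.sum_congr rfl fun i hi => ?_
    have := Finset.mem_range.1 hj
    rw [pinned_scale hc (Finset.mem_range.1 hi) (by omega), prod_alternating]
  rw [e]
  simp_rw [zero_add]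
  rw [prod_alternating, ← mul_sub]
  refine mul_le_mul_of_nonneg_left ?_ (by positivity)
  have h1 := (h.pw_P_bounds (a := 3 * m₀ + 2) (b := 3 * m₀ + 2) (by omega) (by omega) (by omega)
    (by omega) hδ x y).1
  rw [show 2 * (3 * m₀ + 2) + 1 + 2 * (3 * m₀ + 2) = 2 * (6 * m₀ + 4) + 1 by ring] at h1
  have h2 := h.sum_pinned_le hδ hN (κ := κ) (ω := 1 / m) (fun u w => ?_) hκn
    (fun u => by rw [am_self, zero_div]) (fun u => by rw [am_self, zero_div])
    (fun u v => div_le_div_of_nonneg_right (am_le_one _ _ _) hm.le) (by positivity) hxy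
    (by rw [am_of_not_adj hE, zero_div])
  · rw [show 2 * (6 * m₀ + 4) + 2 = 12 * m₀ + 10 by ring]
    simp_rw [show 2 * (6 * m₀ + 4) + 1 = 12 * m₀ + 9 by ring] at h1 ⊢
    linarith
  · have : ∑ z, am E u z / m * (am K z w / k) = (∑ z, am E u z * am K z w) / (k * m) := by
      rw [Finset.sum_div]
      exact Finset.sum_congr rfl fun z _ => by rw [div_mul_div_comm, mul_comm (k : ℝ)]
    rw [this, div_le_iff₀ (by positivity)]
    exact hκ u w

lemma cutw_matching_le {X : Finset (Edge n)} (hX : ∀ v, dg X v ≤ 1) (A B : Finset (Fin n)) :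
    cutw X A B ≤ √(A.card * B.card) := by
  have key : ∀ A B : Finset (Fin n), cutw X A B ≤ A.card := fun A B => by
    calc cutw X A B ≤ ∑ u ∈ A, ∑ v, am X u v := Finset.sum_le_sum fun u _ =>
          Finset.sum_le_univ_sum_of_nonneg fun v => am_nonneg _ _ _
      _ ≤ ∑ u ∈ A, (1 : ℝ) := Finset.sum_le_sum fun u _ => by
          rw [sum_am]; exact_mod_cast hX u
      _ = _ := by simp
  have h1 := key A B
  have h2 : cutw X A B ≤ B.card := by
    rw [cutw_eq, Finset.sum_comm]
    simp_rw [am_comm X]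
    exact key B A
  have h0 : 0 ≤ cutw X A B := Finset.sum_nonneg fun u _ => Finset.sum_nonneg fun v _ =>
    am_nonneg _ _ _
  apply Real.le_sqrt_of_sq_le
  rw [sq]
  exact mul_le_mul h1 h2 h0 (by positivity)

lemma abs_sum_am_sub_le {X Y : Finset (Edge n)} (hX : ∀ v, dg X v ≤ 1)
    (hY : ∀ v, dg Y v = dg X v) (u : Fin n) (f : Fin n → ℝ) {M : ℝ} (hM : ∀ v, |f v| ≤ M) :
    |∑ v, (am X u v - am Y u v) * f v| ≤ 2 * M := by
  have hM0 : 0 ≤ M := (abs_nonneg _).trans (hM u)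
  calc _ ≤ ∑ v, |(am X u v - am Y u v) * f v| := Finset.abs_sum_le_sum_abs _ _
    _ ≤ ∑ v, (am X u v + am Y u v) * M := Finset.sum_le_sum fun v _ => by
        rw [abs_mul]
        refine mul_le_mul ((abs_sub _ _).trans (le_of_eq ?_)) (hM v) (abs_nonneg _)
          (add_nonneg (am_nonneg _ _ _) (am_nonneg _ _ _))
        rw [abs_of_nonneg (am_nonneg _ _ _), abs_of_nonneg (am_nonneg _ _ _)]
    _ = ((dg X u : ℝ) + dg Y u) * M := by
        rw [← Finset.sum_mul, Finset.sum_add_distrib, sum_am, sum_am]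
    _ ≤ 2 * M := by
        refine mul_le_mul_of_nonneg_right ?_ hM0
        rw [hY]
        have : (dg X u : ℝ) ≤ 1 := by exact_mod_cast hX u
        linarith

lemma TypPair.switch {E K X Y : Finset (Edge n)} {k : ℕ} {m s δ θ α : ℝ}
    (h : TypPair E K k m s δ θ α) (hK : K ∈ regs n k) (hk : 1 ≤ k) (hm : 0 < m)
    (hδ : δ ≤ 1 / 2) (hKE : Disjoint K E) (hXK : X ⊆ K) (hYE : Y ⊆ E)
    (hX : ∀ v, dg X v ≤ 1) (hY : ∀ v, dg Y v = dg X v) :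
    TypPair ((E \ Y) ∪ X) ((K \ X) ∪ Y) k m s δ (θ + 8 / m + 4 / k) (α + 1 / m) := by
  have hk0 : (0 : ℝ) < k := by exact_mod_cast hk
  have hdK : Disjoint K Y := Finset.disjoint_of_subset_right hYE hKE
  have hdE : Disjoint E X := (Finset.disjoint_of_subset_left hXK hKE).symm
  have hdeg : ∀ v, dg ((E \ Y) ∪ X) v = dg E v := dg_switch hYE hdE (fun v => (hY v).symm)
  have hdegK : ∀ v, dg ((K \ X) ∪ Y) v = dg K v := dg_switch hXK hdK hY
  have hδm : δ * m ≤ 1 / 2 * m := mul_le_mul_of_nonneg_right hδ hm.le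
  have hDle : ∀ v, (dg E v : ℝ) ≤ 2 * m := fun v => by linarith [(abs_le.1 (h.deg v)).2]
  have hDge : ∀ v, m / 2 ≤ (dg E v : ℝ) := fun v => by linarith [(abs_le.1 (h.deg v)).1]
  have hDabs : ∀ v, |(dg E v : ℝ)| ≤ 2 * m := fun v => by rw [Nat.abs_cast]; exact hDle v
  refine ⟨fun v => by rw [hdeg]; exact h.deg v, fun v => ?_, fun A B => ?_⟩
  · simp_rw [hdeg]
    have e : ∑ u, am ((E \ Y) ∪ X) v u * ∑ w, am ((K \ X) ∪ Y) u w * (dg E w : ℝ) =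
        ∑ u, am E v u * ∑ w, am K u w * (dg E w : ℝ) +
        ∑ u, (am X v u - am Y v u) * ∑ w, am ((K \ X) ∪ Y) u w * (dg E w : ℝ) -
        ∑ u, am E v u * ∑ w, (am X u w - am Y u w) * (dg E w : ℝ) := by
      rw [← Finset.sum_add_distrib, ← Finset.sum_sub_distrib]
      refine Finset.sum_congr rfl fun u _ => ?_
      have : ∑ w, (am X u w - am Y u w) * (dg E w : ℝ) = ∑ w, am K u w * (dg E w : ℝ) -
          ∑ w, am ((K \ X) ∪ Y) u w * (dg E w : ℝ) := by
        rw [← Finset.sum_sub_distrib]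
        exact Finset.sum_congr rfl fun w _ => by rw [am_switch hXK hdK]; ring
      rw [this, am_switch hYE hdE]
      ring
    have b1 : |∑ u, (am X v u - am Y v u) * ∑ w, am ((K \ X) ∪ Y) u w * (dg E w : ℝ)| ≤
        2 * (k * (2 * m)) := by
      refine abs_sum_am_sub_le hX hY v _ fun u => ?_
      rw [abs_of_nonneg (Finset.sum_nonneg fun w _ => mul_nonneg (am_nonneg _ _ _)
        (Nat.cast_nonneg _))]
      calc _ ≤ ∑ w, am ((K \ X) ∪ Y) u w * (2 * m) := Finset.sum_le_sum fun w _ =>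
            mul_le_mul_of_nonneg_left (hDle w) (am_nonneg _ _ _)
        _ = _ := by rw [← Finset.sum_mul, sum_am, hdegK, mem_regs.1 hK]
    have b2 : |∑ u, am E v u * ∑ w, (am X u w - am Y u w) * (dg E w : ℝ)| ≤
        dg E v * (2 * (2 * m)) := by
      refine (Finset.abs_sum_le_sum_abs _ _).trans ?_
      rw [← sum_am, Finset.sum_mul]
      refine Finset.sum_le_sum fun u _ => ?_
      rw [abs_mul, abs_of_nonneg (am_nonneg _ _ _)]
      exact mul_le_mul_of_nonneg_left (abs_sum_am_sub_le hX hY u _ hDabs) (am_nonneg _ _ _)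
    have b3 := h.two v
    have e1 : (θ + 8 / m + 4 / k) * (k * m * (dg E v : ℝ)) =
        θ * (k * m * (dg E v : ℝ)) + 8 * k * dg E v + 4 * m * dg E v := by
      field_simp
    have b4 : 2 * (k * (2 * m)) ≤ 8 * k * (dg E v : ℝ) := by
      have := mul_le_mul_of_nonneg_left (hDge v) (by positivity : (0 : ℝ) ≤ 8 * k)
      linarith
    rw [e, e1]
    have t1 := abs_le.1 b1
    have t2 := abs_le.1 b2
    have t3 := abs_le.1 b3
    rw [abs_le]
    constructor <;> linarith [t1.1, t1.2, t2.1, t2.2, t3.1, t3.2]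
  · have e : cutw ((E \ Y) ∪ X) A B = cutw E A B + (cutw X A B - cutw Y A B) := by
      simp only [cutw_eq]
      rw [← Finset.sum_sub_distrib, ← Finset.sum_add_distrib]
      refine Finset.sum_congr rfl fun u _ => ?_
      rw [← Finset.sum_sub_distrib, ← Finset.sum_add_distrib]
      exact Finset.sum_congr rfl fun v _ => by rw [am_switch hYE hdE]; ring
    have hc0 : ∀ Z : Finset (Edge n), 0 ≤ cutw Z A B := fun Z =>
      Finset.sum_nonneg fun u _ => Finset.sum_nonneg fun v _ => am_nonneg _ _ _
    have h1 := cutw_matching_le hX A B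
    have h2 := cutw_matching_le (fun v => (hY v).le.trans (hX v)) A B
    have h3 := abs_le.1 (h.disc A B)
    have e1 : (α + 1 / m) * m * √(A.card * B.card) =
        α * m * √(A.card * B.card) + √(A.card * B.card) := by field_simp
    rw [e, e1, abs_le]
    have := hc0 X
    have := hc0 Y
    constructor <;> linarith [h3.1, h3.2]

end Typical

/-! ### Typicality of random pairs -/

section TypProb

/-- Switchings apply to typical pairs with small codegrees. -/
theorem good_of_typ {k m₀ T : ℕ} {m s δ θ α κ : ℝ} (hn : 2 ≤ n) (hk : 1 ≤ k) (hkn : k + 1 < n)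
    (hs : 0 < s) (hm : m = s * (n - 1 - k)) (hδ0 : 0 < δ) (hδ : δ ≤ 1 / 40) (hθ0 : 0 ≤ θ)
    (hα : 0 ≤ α) (hsk : s * (k + 1) ≤ δ * m) (hT : 1 < T)
    (hθ : θ + 8 / m + 4 / k ≤ 1)
    (hTδ : 6 * (α + 1 / m) * T ^ 2 + 16 / T ≤ δ)
    (hN : (1 + (θ + 8 / m + 4 / k)) ^ (12 * m₀ + 9) ≤ 1 + δ)
    (hN' : 1 - δ ≤ (1 - (θ + 8 / m + 4 / k)) ^ (12 * m₀ + 9))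
    (hδn : δ ^ m₀ ≤ 1 / √n) (hκn : 1 / n ≤ κ)
    (hsmall : (12 * m₀ + 10) ^ 2 * (16 * κ) + 8 / m ≤ δ)
    (hprob : ∀ K ∈ regs n k, bpr Kᶜ s (fun E => ¬ (TypPair E K k m s δ θ α ∧
      ∀ u w, ∑ z, am E u z * am K z w ≤ κ * (k * m))) ≤ 1 / (n : ℝ) ^ 7) :
    Good n k s (k / (n - 1 - k) * ((1 + 17 * δ) / (1 - 18 * δ))) := by
  have hn0 : (0 : ℝ) < n := by positivity
  have hk0 : (0 : ℝ) < k := by exact_mod_cast hk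
  have hnk : (0 : ℝ) < n - 1 - k := by
    have : (k : ℝ) + 1 < n := by exact_mod_cast hkn
    linarith
  have hm0 : 0 < m := hm ▸ mul_pos hs hnk
  have hsn : |s * n - m| ≤ δ * m := by
    have e : s * n - m = s * (k + 1) := by rw [hm]; ring
    rw [e, abs_of_nonneg (by positivity)]; exact hsk
  have hmix := fun (E K : Finset (Edge n)) (h : TypPair E K k m s δ (θ + 8 / m + 4 / k) (α + 1 / m))
      (hK : K ∈ regs n k) =>
    h.mixing (N := 12 * m₀ + 9) (by omega) hK hk hm0 hs.le (by positivity) hδ0.le (by linarith)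
      (by positivity) hθ hsn hT hTδ hN hN'
  have hweak : ∀ E K : Finset (Edge n), TypPair E K k m s δ θ α →
      TypPair E K k m s δ (θ + 8 / m + 4 / k) (α + 1 / m) := fun E K h => by
    refine ⟨h.deg, fun v => (h.two v).trans ?_, fun A B => (h.disc A B).trans ?_⟩
    · refine mul_le_mul_of_nonneg_right ?_ (by positivity)
      have : 0 ≤ 8 / m + 4 / k := by positivity
      linarith
    · refine mul_le_mul_of_nonneg_right (mul_le_mul_of_nonneg_right ?_ hm0.le) (by positivity)
      have : 0 ≤ 1 / m := by positivity
      linarith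
  refine good_of_switch (6 * m₀ + 4)
    (L := m ^ (6 * m₀ + 5) * k ^ (6 * m₀ + 4) * ((1 - 18 * δ) / n))
    (U := k ^ (6 * m₀ + 5) * m ^ (6 * m₀ + 4) * ((1 + 17 * δ) / n)) hs.le
    (fun K E => TypPair E K k m s δ θ α ∧ ∀ u w, ∑ z, am E u z * am K z w ≤ κ * (k * m))
    (average_le _ _ (by positivity) hprob) ?_ (by positivity) (le_of_eq ?_) ?_ ?_
  · have : 0 < 1 - 18 * δ := by linarith
    positivity
  · have : 1 - 18 * δ ≠ 0 := by linarith
    rw [show 6 * m₀ + 5 = 6 * m₀ + 4 + 1 by rfl, pow_succ m (6 * m₀ + 4),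
      pow_succ (k : ℝ) (6 * m₀ + 4)]
    generalize m ^ (6 * m₀ + 4) = a
    generalize (k : ℝ) ^ (6 * m₀ + 4) = b
    generalize 1 - 18 * δ = c at this
    have hq := hnk.ne'
    rw [hm]
    field_simp
  · intro K hK E hKE hT' x y hxy
    refine le_trans ?_ (le_card_of_mixing hk hm0 (hmix E K (hweak E K hT'.1) hK) hδn le_rfl
      hT'.2 hκn (adj_ne hxy) fun hE => ?_)
    · refine mul_le_mul_of_nonneg_left ?_ (by positivity)
      have e : (1 - 17 * δ) / n - ((12 * m₀ + 10) ^ 2 * (16 * κ / n) + 8 * (1 / m) / n) =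
          (1 - 17 * δ - ((12 * m₀ + 10) ^ 2 * (16 * κ) + 8 / m)) / n := by ring
      rw [e]
      exact div_le_div_of_nonneg_right (by linarith) hn0.le
    · have hne := adj_ne hxy
      rw [adj_iff_mem hne] at hxy hE
      exact Finset.disjoint_left.1 hKE hxy hE
  · intro K hK E hKE hT' x y hxy X Y hX hY hX1 hYX
    refine card_le_of_mixing hk hm0 (hmix _ _ (hT'.1.switch hK hk hm0 (by linarith) hKE hX hY
      hX1 hYX) (mem_regs.2 fun v => ?_)) hδn le_rfl x y
    rw [dg_switch hX (Finset.disjoint_of_subset_right hY hKE) hYX, mem_regs.1 hK]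

lemma bpr_star_ge {X : Finset (Edge n)} {p : ℝ} (h0 : 0 ≤ p) (h1 : p ≤ 1) (x : Fin n)
    {f : Fin n → ℝ} (hf0 : ∀ v, 0 ≤ f v) (hf1 : ∀ v, f v ≤ 1) {τ b : ℝ} (hτ : 0 ≤ τ) :
    bpr X p (fun E => b ≤ ∑ v, am E x v * f v) ≤
      Real.exp (-(τ * b) + p * ((Real.exp τ - 1) * ∑ v, am X x v * f v)) := by
  set c : Fin n → Fin n → ℝ := fun u v => if u = x then f v else 0
  have hs : ∀ A : Finset (Edge n), ∑ e ∈ A, wt c e = ∑ v, am A x v * f v := fun A => by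
    rw [sum_wt, Finset.sum_eq_single x]
    · exact Finset.sum_congr rfl fun v _ => by simp only [c, if_true]; ring
    · intro u _ hu
      exact Finset.sum_eq_zero fun v _ => by simp only [c, if_neg hu, zero_mul]
    · exact fun h => absurd (Finset.mem_univ _) h
  have hw : ∀ e : Edge n, 0 ≤ wt c e ∧ wt c e ≤ 1 := fun e => by
    obtain ⟨u, v, huv, rfl⟩ := e.exists_mk
    rw [wt_mkE]
    simp only [c]
    by_cases hu : u = x
    · rw [if_pos hu, if_neg (fun hv => huv (hu.trans hv.symm)), add_zero]
      exact ⟨hf0 _, hf1 _⟩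
    · rw [if_neg hu, zero_add]
      split_ifs
      exacts [⟨hf0 _, hf1 _⟩, ⟨le_rfl, zero_le_one⟩]
  have hconv : ∀ w : ℝ, 0 ≤ w → w ≤ 1 → Real.exp (τ * w) - 1 ≤ (Real.exp τ - 1) * w := by
    intro w hw0 hw1
    have := convexOn_exp.2 (Set.mem_univ 0) (Set.mem_univ τ) (by linarith : (0 : ℝ) ≤ 1 - w) hw0
      (by ring)
    simp only [smul_eq_mul, mul_zero, zero_add, Real.exp_zero, mul_one] at this
    rw [mul_comm τ]
    linarith
  have key := bpr_ge_le (X := X) h0 h1 (fun e => τ * wt c e) (τ * b)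
  refine le_trans (bpr_mono (X := X) h0 h1 fun A _ h => ?_) (key.trans ?_)
  · rw [← Finset.mul_sum, hs]
    exact mul_le_mul_of_nonneg_left h hτ
  · refine Real.exp_le_exp.2 (add_le_add le_rfl (mul_le_mul_of_nonneg_left ?_ h0))
    rw [← hs, Finset.mul_sum]
    exact Finset.sum_le_sum fun e _ => hconv _ (hw e).1 (hw e).2

end TypProb

section TypProbBounds

variable {K : Finset (Edge n)} {k : ℕ}

lemma dg_compl_regs (hK : K ∈ regs n k) (v : Fin n) : (dg Kᶜ v : ℝ) = n - 1 - k := by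
  rw [dg_compl, mem_regs.1 hK]

lemma sum_am_mul_regs_le (hK : K ∈ regs n k) (X : Finset (Edge n)) (u w : Fin n) :
    ∑ z, am X u z * am K z w ≤ k := by
  calc _ ≤ ∑ z, am K w z := Finset.sum_le_sum fun z _ => by
        rw [am_comm K]; exact mul_le_of_le_one_left (am_nonneg _ _ _) (am_le_one _ _ _)
    _ = k := by rw [sum_am, mem_regs.1 hK]

lemma bpr_codeg (hK : K ∈ regs n k) (X : Finset (Edge n)) {s b τ : ℝ} (h0 : 0 ≤ s) (h1 : s ≤ 1)
    (hτ : 0 ≤ τ) (u w : Fin n) :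
    bpr X s (fun E => b ≤ ∑ z, am E u z * am K z w) ≤
      Real.exp (-(τ * b) + s * ((Real.exp τ - 1) * k)) := by
  refine (bpr_star_ge (X := X) h0 h1 u (fun v => am_nonneg K v w) (fun v => am_le_one K v w)
    hτ).trans (Real.exp_le_exp.2 ?_)
  have : 0 ≤ Real.exp τ - 1 := by linarith [Real.add_one_le_exp τ]
  have := mul_le_mul_of_nonneg_left
    (mul_le_mul_of_nonneg_left (sum_am_mul_regs_le hK X u w) this) h0
  linarith

lemma cutw_comm (E : Finset (Edge n)) (A B : Finset (Fin n)) : cutw E A B = cutw E B A := by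
  rw [cutw_eq, cutw_eq, Finset.sum_comm]
  simp_rw [am_comm E]

lemma cutw_nonneg (E : Finset (Edge n)) (A B : Finset (Fin n)) : 0 ≤ cutw E A B := by
  rw [cutw_eq]
  exact Finset.sum_nonneg fun u _ => Finset.sum_nonneg fun v _ => am_nonneg _ _ _

lemma cutw_le_left {E : Finset (Edge n)} {M : ℝ} (hE : ∀ v, (dg E v : ℝ) ≤ M)
    (A B : Finset (Fin n)) : cutw E A B ≤ M * A.card := by
  rw [cutw_eq]
  calc _ ≤ ∑ u ∈ A, M := Finset.sum_le_sum fun u _ => by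
        refine le_trans ?_ (hE u)
        rw [← sum_am]
        exact Finset.sum_le_univ_sum_of_nonneg fun v => am_nonneg _ _ _
    _ = M * A.card := by rw [Finset.sum_const, nsmul_eq_mul, mul_comm]

lemma cutw_le_right {E : Finset (Edge n)} {M : ℝ} (hE : ∀ v, (dg E v : ℝ) ≤ M)
    (A B : Finset (Fin n)) : cutw E A B ≤ M * B.card := by
  rw [cutw_comm]; exact cutw_le_left hE B A

lemma le_sqrt_mul_of_le {x a b : ℝ} (hx : 0 ≤ x) (ha : x ≤ a) (hb : x ≤ b) : x ≤ √(a * b) :=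
  Real.le_sqrt_of_sq_le (by nlinarith)

lemma cutw_le_sqrt {E : Finset (Edge n)} {M : ℝ} (hM : 0 ≤ M) (hE : ∀ v, (dg E v : ℝ) ≤ M)
    (A B : Finset (Fin n)) : cutw E A B ≤ M * √(A.card * B.card) := by
  rcases le_total (A.card : ℝ) B.card with h | h
  · exact (cutw_le_left hE A B).trans
      (mul_le_mul_of_nonneg_left (le_sqrt_mul_of_le (by positivity) le_rfl h) hM)
  · exact (cutw_le_right hE A B).trans
      (mul_le_mul_of_nonneg_left (le_sqrt_mul_of_le (by positivity) h le_rfl) hM)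

lemma bpr_cutw {X : Finset (Edge n)} {s m α : ℝ} (h0 : 0 ≤ s) (h1 : s ≤ 1) (hm : 0 ≤ m)
    (hX : ∀ v, s * dg X v ≤ m) (hα0 : 0 ≤ α) (hα1 : α ≤ 1) (A B : Finset (Fin n)) :
    bpr X s (fun E => α / 2 * m * √(A.card * B.card) ≤ |cutw E A B - s * cutw X A B|) ≤
      2 * Real.exp (-(α ^ 2 / 32 * m * √(A.card * B.card))) := by
  set c : Fin n → Fin n → ℝ := fun u v => if u ∈ A ∧ v ∈ B then 1 else 0 with hc
  have hcut : ∀ E : Finset (Edge n), ∑ u, ∑ v, c u v * am E u v = cutw E A B := by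
    intro E
    rw [cutw_eq, ← Finset.sum_subset (Finset.subset_univ A)]
    · refine Finset.sum_congr rfl fun u hu => ?_
      rw [← Finset.sum_subset (Finset.subset_univ B)]
      · exact Finset.sum_congr rfl fun v hv => by simp [hc, hu, hv]
      · intro v _ hv; simp [hc, hv]
    · intro u _ hu; simp [hc, hu]
  have hc01 : ∀ u v, 0 ≤ c u v ∧ c u v ≤ 1 := fun u v => by
    simp only [hc]; split_ifs <;> norm_num
  have h := bpr_am_abs (X := X) h0 h1 c (α / 8) (α / 2 * m * √(A.card * B.card)) (by linarith)
    (fun u v _ => by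
      have := hc01 u v
      have := hc01 v u
      rw [abs_le]
      constructor <;> nlinarith)
  simp_rw [hcut] at h
  refine h.trans (mul_le_mul_of_nonneg_left (Real.exp_le_exp.2 ?_) (by norm_num))
  have hv : s * ∑ u, ∑ v, (c u v + c v u) ^ 2 / 2 * am X u v ≤
      2 * (m * √(A.card * B.card)) := by
    have e1 : ∑ u, ∑ v, (c u v + c v u) ^ 2 / 2 * am X u v ≤
        ∑ u, ∑ v, (c u v * am X u v + c v u * am X u v) :=
      Finset.sum_le_sum fun u _ => Finset.sum_le_sum fun v _ => by
        rw [← add_mul]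
        refine mul_le_mul_of_nonneg_right ?_ (am_nonneg _ _ _)
        have := hc01 u v
        have := hc01 v u
        nlinarith
    have e2 : ∑ u, ∑ v, c v u * am X u v = cutw X A B := by
      rw [Finset.sum_comm, ← hcut X]
      exact Finset.sum_congr rfl fun u _ => Finset.sum_congr rfl fun v _ => by rw [am_comm]
    simp_rw [Finset.sum_add_distrib] at e1
    rw [hcut, e2] at e1
    have e3 : s * cutw X A B ≤ m * √(A.card * B.card) := by
      rcases h0.eq_or_lt with h | h
      · rw [← h, zero_mul]; positivity
      · have := cutw_le_sqrt (E := X) (M := m / s) (by positivity) (fun v => by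
          rw [le_div_iff₀ h, mul_comm]; exact hX v) A B
        calc _ ≤ s * (m / s * √(A.card * B.card)) := mul_le_mul_of_nonneg_left this h0
          _ = _ := by field_simp
    have := mul_le_mul_of_nonneg_left e1 h0
    linarith
  have := mul_le_mul_of_nonneg_left hv (sq_nonneg (α / 8))
  refine (add_le_add le_rfl this).trans (le_of_eq ?_)
  ring

lemma bpr_disc (hn : 1 ≤ n) (hK : K ∈ regs n k) {s m α : ℝ} (h0 : 0 ≤ s) (h1 : s ≤ 1)
    (hm0 : 0 < m) (hm : m = s * (n - 1 - k)) (hα0 : 0 < α) (hα1 : α ≤ 1)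
    (hsk : s * (k + 1) ≤ α / 2 * m)
    (hp : Real.exp (-(α ^ 3 * m / 128)) ≤ 1 / (n : ℝ) ^ 10) :
    bpr Kᶜ s (fun E => (∀ v, (dg E v : ℝ) ≤ 2 * m) ∧
      ∃ P : Finset (Fin n) × Finset (Fin n),
        α * m * √(P.1.card * P.2.card) < |cutw E P.1 P.2 - s * (P.1.card * P.2.card)|) ≤
      18 / (n : ℝ) ^ 18 := by
  have hn0 : (0 : ℝ) < n := by exact_mod_cast hn
  have hsn : s * n ≤ 2 * m := by
    have : s * n = m + s * (k + 1) := by rw [hm]; ring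
    nlinarith
  set b : Finset (Fin n) × Finset (Fin n) → ℝ := fun P =>
    2 / (n : ℝ) ^ 18 * (((n : ℝ)⁻¹) ^ P.1.card * ((n : ℝ)⁻¹) ^ P.2.card) with hb
  have hsum : ∑ P, b P ≤ 18 / (n : ℝ) ^ 18 := by
    have h3 := sum_inv_sq_pow_le (α := Fin n) (m := n) (by simp)
    have h3' : 0 ≤ ∑ S : Finset (Fin n), ((n : ℝ)⁻¹) ^ S.card := by positivity
    rw [hb, ← Finset.mul_sum, Fintype.sum_prod_type]
    simp only []
    rw [← Finset.sum_mul_sum]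
    calc _ ≤ 2 / (n : ℝ) ^ 18 * (3 * 3) :=
          mul_le_mul_of_nonneg_left (mul_le_mul h3 h3 h3' (by norm_num)) (by positivity)
      _ = _ := by ring
  refine le_trans ?_ hsum
  refine (bpr_mono (X := Kᶜ) h0 h1 fun E _ h => ?_).trans (le_trans (bpr_exists (X := Kᶜ)
    (Finset.univ : Finset (Finset (Fin n) × Finset (Fin n))) h0 h1 fun P E =>
      (∀ v, (dg E v : ℝ) ≤ 2 * m) ∧
      α * m * √(P.1.card * P.2.card) < |cutw E P.1 P.2 - s * (P.1.card * P.2.card)|)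
      (Finset.sum_le_sum fun P _ => ?_))
  · obtain ⟨h, P, hP⟩ := h
    exact ⟨P, Finset.mem_univ _, h, hP⟩
  obtain ⟨A, B⟩ := P
  dsimp only [hb]
  have ha0 : (0 : ℝ) ≤ A.card := by positivity
  have hb0 : (0 : ℝ) ≤ B.card := by positivity
  have haN : (A.card : ℝ) ≤ n := by exact_mod_cast card_finset_fin_le A
  have hbN : (B.card : ℝ) ≤ n := by exact_mod_cast card_finset_fin_le B
  have hbpos : 0 ≤ 2 / (n : ℝ) ^ 18 * (((n : ℝ)⁻¹) ^ A.card * ((n : ℝ)⁻¹) ^ B.card) := by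
    positivity
  have hfalse : ∀ Q : Finset (Edge n) → Prop, (∀ E, ¬ Q E) → bpr Kᶜ s Q ≤
      2 / (n : ℝ) ^ 18 * (((n : ℝ)⁻¹) ^ A.card * ((n : ℝ)⁻¹) ^ B.card) := fun Q hQ => by
    refine le_trans (bpr_le_bexp (X := Kᶜ) (g := fun _ => 0) h0 h1 (fun _ _ => le_rfl)
      fun E _ h => absurd h (hQ E)) ?_
    rw [bexp_const]; exact hbpos
  -- very different sizes are controlled by the degrees
  have hdet : ∀ x y : ℝ, 0 ≤ x → 0 ≤ y → x ≤ α ^ 2 / 4 * y → 2 * m * x ≤ α * m * √(x * y) := by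
    intro x y hx hy hxy
    have : 2 / α * x ≤ √(x * y) := by
      refine Real.le_sqrt_of_sq_le ?_
      have e : (2 / α * x) ^ 2 = x * (4 / α ^ 2 * x) := by field_simp; ring
      rw [e]
      refine mul_le_mul_of_nonneg_left ?_ hx
      calc _ ≤ 4 / α ^ 2 * (α ^ 2 / 4 * y) := mul_le_mul_of_nonneg_left hxy (by positivity)
        _ = y := by field_simp
    calc 2 * m * x = α * m * (2 / α * x) := by field_simp
      _ ≤ _ := mul_le_mul_of_nonneg_left this (by positivity)
  by_cases hA : (A.card : ℝ) ≤ α ^ 2 / 4 * B.card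
  · refine hfalse _ fun E ⟨hd, h⟩ => absurd h (not_lt.2 ?_)
    refine le_trans ?_ (hdet _ _ ha0 hb0 hA)
    have e1 := cutw_le_left hd A B
    have e2 : s * (A.card * B.card) ≤ 2 * m * A.card := by
      calc s * (A.card * B.card) ≤ s * (A.card * n) := by gcongr
        _ = s * n * A.card := by ring
        _ ≤ _ := mul_le_mul_of_nonneg_right hsn ha0
    have e3 := cutw_nonneg E A B
    have e4 : 0 ≤ s * (A.card * B.card : ℝ) := by positivity
    rw [abs_le]; constructor <;> linarith
  by_cases hB : (B.card : ℝ) ≤ α ^ 2 / 4 * A.card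
  · refine hfalse _ fun E ⟨hd, h⟩ => absurd h (not_lt.2 ?_)
    rw [mul_comm (A.card : ℝ)]
    refine le_trans ?_ (hdet _ _ hb0 ha0 hB)
    have e1 := cutw_le_right hd A B
    have e2 : s * (B.card * A.card) ≤ 2 * m * B.card := by
      calc s * (B.card * A.card) ≤ s * (B.card * n) := by gcongr
        _ = s * n * B.card := by ring
        _ ≤ _ := mul_le_mul_of_nonneg_right hsn hb0
    have e3 := cutw_nonneg E A B
    have e4 : 0 ≤ s * (B.card * A.card : ℝ) := by positivity
    rw [abs_le]; constructor <;> linarith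
  push Not at hA hB
  have hApos : (0 : ℝ) < A.card := lt_of_le_of_lt (by positivity) hA
  have hBpos : (0 : ℝ) < B.card := lt_of_le_of_lt (by positivity) hB
  have hA1 : 1 ≤ A.card := by exact_mod_cast hApos
  have hB1 : 1 ≤ B.card := by exact_mod_cast hBpos
  have hsq : α / 4 * (A.card + B.card) ≤ √(A.card * B.card) := by
    have key : ∀ x y : ℝ, 0 ≤ x → x ≤ y → α ^ 2 / 4 * y ≤ x → α / 4 * (x + y) ≤ √(x * y) := by
      intro x y hx hxy h
      refine Real.le_sqrt_of_sq_le ?_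
      have hy : 0 ≤ y := hx.trans hxy
      calc (α / 4 * (x + y)) ^ 2 ≤ (α / 4 * (y + y)) ^ 2 := by gcongr
        _ = α ^ 2 / 4 * y * y := by ring
        _ ≤ x * y := mul_le_mul_of_nonneg_right h hy
    rcases le_total (A.card : ℝ) B.card with h | h
    · exact key _ _ ha0 h hA.le
    · rw [mul_comm (A.card : ℝ), add_comm]
      exact key _ _ hb0 h hB.le
  refine (bpr_mono (X := Kᶜ) h0 h1 fun E _ h => ?_).trans
    ((bpr_cutw (X := Kᶜ) h0 h1 hm0.le (fun v => by rw [dg_compl_regs hK, hm]) hα0.le hα1 A B).trans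
      ?_)
  · have h := h.2
    rw [cutw_compl]
    have e1 : cutw K A B ≤ k * √(A.card * B.card) :=
      cutw_le_sqrt (by positivity) (fun v => by rw [mem_regs.1 hK]) A B
    have e2 : ((A ∩ B).card : ℝ) ≤ √(A.card * B.card) :=
      le_sqrt_mul_of_le (by positivity) (by exact_mod_cast Finset.card_le_card Finset.inter_subset_left)
        (by exact_mod_cast Finset.card_le_card Finset.inter_subset_right)
    have e3 : s * ((A ∩ B).card + cutw K A B) ≤ α / 2 * m * √(A.card * B.card) := by
      calc _ ≤ s * ((k + 1) * √(A.card * B.card)) :=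
            mul_le_mul_of_nonneg_left (by linarith) h0
        _ = s * (k + 1) * √(A.card * B.card) := by ring
        _ ≤ _ := mul_le_mul_of_nonneg_right hsk (Real.sqrt_nonneg _)
    have e4 : 0 ≤ s * ((A ∩ B).card + cutw K A B) :=
      mul_nonneg h0 (add_nonneg (by positivity) (cutw_nonneg _ _ _))
    have e5 : cutw E A B - s * (A.card * B.card - (A ∩ B).card - cutw K A B) =
        (cutw E A B - s * (A.card * B.card)) + s * ((A ∩ B).card + cutw K A B) := by ring
    rw [e5]
    have e6 := abs_sub_abs_le_abs_sub (cutw E A B - s * (A.card * B.card))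
      (-(s * ((A ∩ B).card + cutw K A B)))
    rw [sub_neg_eq_add, abs_neg, abs_of_nonneg e4] at e6
    linarith
  · have e1 : Real.exp (-(α ^ 2 / 32 * m * √(A.card * B.card))) ≤
        Real.exp (-(α ^ 3 * m / 128)) ^ A.card * Real.exp (-(α ^ 3 * m / 128)) ^ B.card := by
      rw [← pow_add, ← Real.exp_nat_mul]
      refine Real.exp_le_exp.2 ?_
      have := mul_le_mul_of_nonneg_left hsq (by positivity : 0 ≤ α ^ 2 / 32 * m)
      push_cast
      linarith
    have e2 : ∀ a : ℕ, 1 ≤ a → Real.exp (-(α ^ 3 * m / 128)) ^ a ≤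
        1 / (n : ℝ) ^ 9 * ((n : ℝ)⁻¹) ^ a := by
      intro a ha
      have hn1 : ((n : ℝ)⁻¹) ≤ 1 := inv_le_one_of_one_le₀ (by exact_mod_cast hn)
      calc _ ≤ (1 / (n : ℝ) ^ 10) ^ a := pow_le_pow_left₀ (Real.exp_pos _).le hp a
        _ = (((n : ℝ)⁻¹) ^ 9) ^ a * ((n : ℝ)⁻¹) ^ a := by
            rw [← mul_pow]; congr 1; rw [← pow_succ, inv_pow, one_div]
        _ ≤ ((n : ℝ)⁻¹) ^ 9 * ((n : ℝ)⁻¹) ^ a := by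
            refine mul_le_mul_of_nonneg_right ?_ (by positivity)
            exact pow_le_of_le_one (by positivity) (pow_le_one₀ (by positivity) hn1) (by omega)
        _ = _ := by rw [inv_pow, one_div]
    have e3 := mul_le_mul (e2 _ hA1) (e2 _ hB1) (by positivity) (by positivity)
    have e4 := mul_le_mul_of_nonneg_left (e1.trans e3) (by norm_num : (0 : ℝ) ≤ 2)
    refine e4.trans (le_of_eq ?_)
    ring

lemma dg_star_self (X : Finset (Edge n)) (v : Fin n) : dg (star X v) v = dg X v := by
  have : (dg (star X v) v : ℝ) = dg X v := by
    rw [← sum_am, ← sum_am]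
    exact Finset.sum_congr rfl fun u _ => by rw [am_comm, am_star_right, am_comm]
  exact_mod_cast this

lemma dg_le_one_of_subset_star {A X : Finset (Edge n)} {v w : Fin n} (hA : A ⊆ star X v)
    (hw : w ≠ v) : (dg A w : ℝ) ≤ 1 := by
  rw [← sum_am, Finset.sum_eq_single v]
  · exact am_le_one _ _ _
  · intro u _ hu
    have h := am_mono hA w u
    have h0 : am (star X v) w u = 0 := by
      unfold am
      rw [if_neg]
      rw [adj_star]; tauto
    exact le_antisymm (h.trans h0.le) (am_nonneg _ _ _)
  · exact fun h => absurd (Finset.mem_univ _) h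

lemma bpr_two_given (hK : K ∈ regs n k) {s m σ θ : ℝ} (h0 : 0 ≤ s) (h1 : s ≤ 1)
    (hk : 1 ≤ k) (hm0 : 0 < m) (hm : m = s * (n - 1 - k)) (hσ : 0 < σ) (hθ0 : 0 ≤ θ) (hθ1 : θ ≤ 1)
    (hθm : 2 ≤ θ * m) (v : Fin n) {A : Finset (Edge n)} (hA : A ⊆ star Kᶜ v)
    (hAσ : ∀ w, ∑ u, am A v u * am K u w ≤ σ) (hAd : m / 2 ≤ dg A v) :
    bpr (Kᶜ \ star Kᶜ v) s (fun B => θ * (k * m * dg (A ∪ B) v) <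
      |∑ u, am (A ∪ B) v u * ∑ w, am K u w * (dg (A ∪ B) w : ℝ) - k * m * dg (A ∪ B) v|) ≤
      2 * Real.exp (-(θ ^ 2 * (k * m) * m / (64 * σ))) := by
  set Y := Kᶜ \ star Kᶜ v with hY
  set μ : Fin n → ℝ := fun w => ∑ u, am A v u * am K u w with hμ
  set a : ℝ := ((dg A v : ℕ) : ℝ) with ha
  have ha0 : 0 ≤ a := Nat.cast_nonneg _
  have hk0 : (0 : ℝ) < k := by exact_mod_cast hk
  have hμ0 : ∀ w, 0 ≤ μ w := fun w =>
    Finset.sum_nonneg fun u _ => mul_nonneg (am_nonneg _ _ _) (am_nonneg _ _ _)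
  have hμsum : ∑ w, μ w = k * a := by
    simp only [hμ]
    rw [Finset.sum_comm]
    simp_rw [← Finset.mul_sum, sum_am, mem_regs.1 hK]
    rw [← Finset.sum_mul, sum_am, mul_comm]
  have hμv : μ v = 0 := Finset.sum_eq_zero fun u _ => by
    have h := am_mono (hA.trans (star_subset _ _)) v u
    rw [am_compl] at h
    rw [am_comm K u v]
    have h1 := am_nonneg A v u
    have h2 := am_nonneg K v u
    unfold am at *
    split_ifs at * <;> simp_all <;> linarith
  have hdA : ∀ w, μ w * (dg A w : ℝ) ≤ μ w := fun w => by
    by_cases hw : w = v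
    · rw [hw, hμv, zero_mul]
    · exact mul_le_of_le_one_right (hμ0 w) (dg_le_one_of_subset_star hA hw)
  have hdS : ∀ w, μ w * (dg (star Kᶜ v) w : ℝ) ≤ μ w := fun w => by
    by_cases hw : w = v
    · rw [hw, hμv, zero_mul]
    · exact mul_le_of_le_one_right (hμ0 w) (dg_le_one_of_subset_star (Finset.Subset.refl _) hw)
  have hdY : ∀ w, (dg Y w : ℝ) = (n - 1 - k) - dg (star Kᶜ v) w := fun w => by
    rw [← dg_compl_regs hK w, ← sum_am, ← sum_am, ← sum_am, ← Finset.sum_sub_distrib]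
    exact Finset.sum_congr rfl fun u _ => am_sdiff (star_subset _ _) _ _
  have hmeanhi : s * ∑ w, μ w * (dg Y w : ℝ) ≤ k * m * a := by
    rw [Finset.mul_sum]
    calc _ ≤ ∑ w, μ w * m := Finset.sum_le_sum fun w _ => by
          rw [hdY, hm]
          have h := mul_nonneg h0 (mul_nonneg (hμ0 w) (Nat.cast_nonneg (α := ℝ)
            (dg (star Kᶜ v) w)))
          linarith
      _ = _ := by rw [← Finset.sum_mul, hμsum]; ring
  have hmeanlo : k * m * a - k * a ≤ s * ∑ w, μ w * (dg Y w : ℝ) := by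
    rw [Finset.mul_sum]
    calc _ = ∑ w, (μ w * m - μ w) := by
          rw [Finset.sum_sub_distrib, ← Finset.sum_mul, hμsum]; ring
      _ ≤ _ := Finset.sum_le_sum fun w _ => by
          rw [hdY, hm]
          have h := mul_le_mul_of_nonneg_left (hdS w) h0
          have h' := mul_le_mul_of_nonneg_right h1 (hμ0 w)
          linarith
  have hsplit : ∀ B ⊆ Y, dg (A ∪ B) v = dg A v ∧
      ∑ u, am (A ∪ B) v u * ∑ w, am K u w * (dg (A ∪ B) w : ℝ) =
        ∑ w, μ w * (dg A w : ℝ) + ∑ w, ∑ z, μ w * am B w z := by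
    intro B hB
    have hdis : Disjoint A B := Finset.disjoint_of_subset_left hA
      (Finset.disjoint_of_subset_right hB Finset.disjoint_sdiff)
    have hBv : ∀ u, am B v u = 0 := fun u => by
      refine le_antisymm ?_ (am_nonneg _ _ _)
      rw [am_comm, ← am_sdiff_star_right Kᶜ v u]
      exact am_mono hB u v
    have hAB : ∀ u, am (A ∪ B) v u = am A v u := fun u => by rw [am_union hdis, hBv, add_zero]
    constructor
    · have : (dg (A ∪ B) v : ℝ) = dg A v := by
        rw [← sum_am, ← sum_am]
        exact Finset.sum_congr rfl fun u _ => hAB u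
      exact_mod_cast this
    · have hd : ∀ w, (dg (A ∪ B) w : ℝ) = dg A w + dg B w := fun w => by
        rw [← sum_am, ← sum_am, ← sum_am, ← Finset.sum_add_distrib]
        exact Finset.sum_congr rfl fun u _ => am_union hdis _ _
      simp_rw [hAB, Finset.mul_sum]
      rw [Finset.sum_comm, ← Finset.sum_add_distrib]
      refine Finset.sum_congr rfl fun w _ => ?_
      rw [← Finset.mul_sum, sum_am, ← mul_add, ← hd, hμ, Finset.sum_mul]
      exact Finset.sum_congr rfl fun u _ => by ring
  have hτ0 : 0 ≤ θ / (8 * σ) := by positivity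
  have hdev := bpr_am_abs (X := Y) h0 h1 (fun w _ => μ w) (θ / (8 * σ)) (θ / 2 * (k * m * a)) hτ0
    (fun u w _ => by
      have h1 := hAσ u
      have h2 := hAσ w
      rw [abs_of_nonneg (mul_nonneg hτ0 (add_nonneg (hμ0 u) (hμ0 w)))]
      calc _ ≤ θ / (8 * σ) * (σ + σ) := mul_le_mul_of_nonneg_left (add_le_add h1 h2) hτ0
        _ = θ / 4 := by field_simp; ring
        _ ≤ 1 := by linarith)
  have hvar : s * ∑ u, ∑ w, (μ u + μ w) ^ 2 / 2 * am Y u w ≤ 2 * σ * (k * m * a) := by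
    have e1 : ∑ u, ∑ w, (μ u + μ w) ^ 2 / 2 * am Y u w ≤
        ∑ u, ∑ w, (μ u ^ 2 * am Y u w + μ w ^ 2 * am Y u w) :=
      Finset.sum_le_sum fun u _ => Finset.sum_le_sum fun w _ => by
        rw [← add_mul]
        refine mul_le_mul_of_nonneg_right ?_ (am_nonneg _ _ _)
        nlinarith [sq_nonneg (μ u - μ w)]
    have e2 : ∑ u, ∑ w, μ w ^ 2 * am Y u w = ∑ u, ∑ w, μ u ^ 2 * am Y u w := by
      rw [Finset.sum_comm]
      exact Finset.sum_congr rfl fun u _ => Finset.sum_congr rfl fun w _ => by rw [am_comm]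
    have e3 : ∑ u, ∑ w, μ u ^ 2 * am Y u w ≤ σ * ∑ w, μ w * (dg Y w : ℝ) := by
      simp_rw [← Finset.mul_sum, sum_am]
      rw [Finset.mul_sum]
      refine Finset.sum_le_sum fun w _ => ?_
      rw [sq, mul_assoc]
      exact mul_le_mul_of_nonneg_right (hAσ w) (mul_nonneg (hμ0 w) (Nat.cast_nonneg _))
    simp_rw [Finset.sum_add_distrib] at e1
    rw [e2] at e1
    have e4 := mul_le_mul_of_nonneg_left (e1.trans (add_le_add e3 e3)) h0
    have e5 := mul_le_mul_of_nonneg_left hmeanhi hσ.le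
    linarith
  refine (bpr_mono (X := Y) h0 h1 fun B hB h => ?_).trans (hdev.trans ?_)
  · obtain ⟨e1, e2⟩ := hsplit B hB
    rw [e1, e2] at h
    have hsumY : ∑ u, ∑ w, μ u * am Y u w = ∑ w, μ w * (dg Y w : ℝ) := by
      simp_rw [← Finset.mul_sum, sum_am]
    show _ ≤ |∑ u, ∑ w, μ u * am B u w - s * ∑ u, ∑ w, μ u * am Y u w|
    rw [hsumY]
    have hA1 : ∑ w, μ w * (dg A w : ℝ) ≤ k * a :=
      (Finset.sum_le_sum fun w _ => hdA w).trans hμsum.le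
    have hA0 : 0 ≤ ∑ w, μ w * (dg A w : ℝ) :=
      Finset.sum_nonneg fun w _ => mul_nonneg (hμ0 w) (Nat.cast_nonneg _)
    have hka : k * a ≤ θ / 2 * (k * m * a) := by
      have := mul_le_mul_of_nonneg_left hθm (by positivity : 0 ≤ k * a / 2)
      linarith
    rw [← ha] at h
    generalize ∑ u, ∑ w, μ u * am B u w = Z at *
    generalize s * ∑ w, μ w * (dg Y w : ℝ) = M at *
    generalize ∑ w, μ w * (dg A w : ℝ) = V at *
    rcases lt_abs.1 h with h | h
    · exact (le_abs_self _).trans' (by linarith)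
    · exact (neg_le_abs _).trans' (by linarith)
  · refine mul_le_mul_of_nonneg_left (Real.exp_le_exp.2 ?_) (by norm_num)
    have h1 := mul_le_mul_of_nonneg_left hvar (sq_nonneg (θ / (8 * σ)))
    refine (add_le_add le_rfl h1).trans ?_
    have e : -(θ / (8 * σ) * (θ / 2 * (k * m * a))) + (θ / (8 * σ)) ^ 2 * (2 * σ * (k * m * a)) =
        -(θ ^ 2 * (k * m) * a / (32 * σ)) := by field_simp; ring
    rw [e, neg_le_neg_iff]
    have e2 : θ ^ 2 * (k * m) * m / (64 * σ) = θ ^ 2 * (k * m) * (m / 2) / (32 * σ) := by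
      field_simp; ring
    rw [e2]
    gcongr

lemma bpr_two (hK : K ∈ regs n k) {s m σ θ b₁ b₂ b₃ : ℝ} (h0 : 0 ≤ s) (h1 : s ≤ 1)
    (hk : 1 ≤ k) (hm0 : 0 < m) (hm : m = s * (n - 1 - k)) (hσ : 0 < σ) (hθ0 : 0 ≤ θ) (hθ1 : θ ≤ 1)
    (hθm : 2 ≤ θ * m) (hb₁ : ∀ w (X : Finset (Edge n)), ∀ v,
      bpr X s (fun E => σ ≤ ∑ u, am E v u * am K u w) ≤ b₁)
    (hb₂ : 2 * Real.exp (-(m / 32)) ≤ b₂)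
    (hb₃ : 2 * Real.exp (-(θ ^ 2 * (k * m) * m / (64 * σ))) ≤ b₃) (v : Fin n) :
    bpr Kᶜ s (fun E => θ * (k * m * dg E v) <
      |∑ u, am E v u * ∑ w, am K u w * (dg E w : ℝ) - k * m * dg E v|) ≤
      n * b₁ + b₂ + b₃ := by
  have h := bpr_union_le (X := star Kᶜ v) (Y := Kᶜ \ star Kᶜ v) Finset.disjoint_sdiff h0 h1
    (c := n * b₁ + b₂) (b := b₃)
    (P := fun A => (∀ w, ∑ u, am A v u * am K u w ≤ σ) ∧ m / 2 ≤ dg A v)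
    (Q := fun E => θ * (k * m * dg E v) <
      |∑ u, am E v u * ∑ w, am K u w * (dg E w : ℝ) - k * m * dg E v|)
    (le_trans (by positivity) hb₃) ?_ ?_
  · rwa [star_union] at h
  · refine (bpr_mono (X := star Kᶜ v) h0 h1 (Q := fun A =>
      (∃ w, σ ≤ ∑ u, am A v u * am K u w) ∨
        m / 2 ≤ |(dg A v : ℝ) - s * dg (star Kᶜ v) v|) fun A _ hA => ?_).trans
      ((bpr_or (X := star Kᶜ v) h0 h1 _ _).trans (add_le_add ?_ ?_))
    · rcases not_and_or.1 hA with h | h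
      · push Not at h
        obtain ⟨w, hw⟩ := h
        exact Or.inl ⟨w, hw.le⟩
      · right
        rw [dg_star_self, dg_compl_regs hK, ← hm]
        push Not at h
        exact (neg_le_abs _).trans' (by linarith)
    · have := bpr_exists_le (ι := Fin n) (X := star Kᶜ v) h0 h1
        (fun w A => σ ≤ ∑ u, am A v u * am K u w) (fun w => hb₁ w _ v)
      rwa [Fintype.card_fin] at this
    · refine (bpr_dg (X := star Kᶜ v) h0 h1 v (1 / 8) (m / 2) (by norm_num) (by norm_num)).trans
        (le_trans (le_of_eq ?_) hb₂)
      rw [dg_star_self, dg_compl_regs hK, ← hm]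
      ring_nf
  · intro A hA hP
    exact (bpr_two_given hK h0 h1 hk hm0 hm hσ hθ0 hθ1 hθm v hA hP.1 hP.2).trans hb₃

theorem bpr_not_typ (hn : 4 ≤ n) (hK : K ∈ regs n k) {s m κ δ θ α τ : ℝ} (h0 : 0 ≤ s) (h1 : s ≤ 1)
    (hk : 1 ≤ k) (hm0 : 0 < m) (hm : m = s * (n - 1 - k)) (hκ : 0 < κ) (hθ0 : 0 ≤ θ) (hθ1 : θ ≤ 1)
    (hθm : 2 ≤ θ * m) (hα0 : 0 < α) (hα1 : α ≤ 1) (hδ0 : 0 ≤ δ) (hδ1 : δ ≤ 1)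
    (hsk : s * (k + 1) ≤ α / 2 * m) (hτ : 0 ≤ τ)
    (hp1 : 2 * Real.exp (-(δ ^ 2 * m / 8)) ≤ 1 / (n : ℝ) ^ 10)
    (hp2 : 2 * Real.exp (-(m / 32)) ≤ 1 / (n : ℝ) ^ 10)
    (hp3 : 2 * Real.exp (-(θ ^ 2 * m / (64 * κ))) ≤ 1 / (n : ℝ) ^ 10)
    (hp4 : Real.exp (-(τ * (κ * (k * m))) + s * ((Real.exp τ - 1) * k)) ≤ 1 / (n : ℝ) ^ 10)
    (hp5 : Real.exp (-(α ^ 3 * m / 128)) ≤ 1 / (n : ℝ) ^ 10) :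
    bpr Kᶜ s (fun E => ¬ (TypPair E K k m s δ θ α ∧
      ∀ u w, ∑ z, am E u z * am K z w ≤ κ * (k * m))) ≤ 1 / (n : ℝ) ^ 7 := by
  have hn0 : (0 : ℝ) < n := by positivity
  have hn4 : (4 : ℝ) ≤ n := by exact_mod_cast hn
  have hk0 : (0 : ℝ) < k := by exact_mod_cast hk
  have hσ : 0 < κ * (k * m) := by positivity
  have hcod : ∀ w (X : Finset (Edge n)), ∀ v,
      bpr X s (fun E => κ * (k * m) ≤ ∑ u, am E v u * am K u w) ≤ 1 / (n : ℝ) ^ 10 :=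
    fun w X v => (bpr_codeg hK X h0 h1 hτ v w).trans hp4
  have hA := bpr_dg_rel (X := Kᶜ) h0 h1 (dg_compl_regs hK) hδ0 hδ1
  rw [← hm] at hA
  have hB := bpr_exists_le (ι := Fin n × Fin n) (X := Kᶜ) h0 h1
    (fun P E => κ * (k * m) ≤ ∑ u, am E P.1 u * am K u P.2) fun P => hcod P.2 _ P.1
  have hC := bpr_exists_le (ι := Fin n) (X := Kᶜ) h0 h1
    (fun v E => θ * (k * m * dg E v) <
      |∑ u, am E v u * ∑ w, am K u w * (dg E w : ℝ) - k * m * dg E v|)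
    fun v => bpr_two hK h0 h1 hk hm0 hm hσ hθ0 hθ1 hθm hcod hp2 (b₃ := 1 / (n : ℝ) ^ 10)
      (by
        refine le_trans (le_of_eq ?_) hp3
        congr 3
        field_simp) v
  have hD := bpr_disc (by omega) hK h0 h1 hm0 hm hα0 hα1 hsk hp5
  rw [Fintype.card_prod, Fintype.card_fin] at hB
  rw [Fintype.card_fin] at hC
  refine (bpr_mono (X := Kᶜ) h0 h1 fun E _ h => ?_).trans
    ((bpr_or (X := Kᶜ) h0 h1 _ _).trans (add_le_add hA
      ((bpr_or (X := Kᶜ) h0 h1 _ _).trans (add_le_add hB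
        ((bpr_or (X := Kᶜ) h0 h1 _ _).trans (add_le_add hC hD)))))) |>.trans ?_
  · by_contra hno
    push Not at hno
    obtain ⟨n1, n2, n3, n4⟩ := hno
    refine h ⟨⟨n1, n3, fun A B => n4 (fun v => ?_) (A, B)⟩, fun u w => (n2 (u, w)).le⟩
    have := (abs_le.1 (n1 v)).2
    nlinarith
  · have e1 : (n : ℝ) * (2 * Real.exp (-(δ ^ 2 * m / 8))) ≤ n * (1 / (n : ℝ) ^ 10) :=
      mul_le_mul_of_nonneg_left hp1 hn0.le
    refine (add_le_add e1 le_rfl).trans ?_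
    push_cast
    have e2 : n * (1 / (n : ℝ) ^ 10) + (n * n * (1 / (n : ℝ) ^ 10) +
        (n * (n * (1 / (n : ℝ) ^ 10) + 1 / (n : ℝ) ^ 10 + 1 / (n : ℝ) ^ 10) + 18 / (n : ℝ) ^ 18)) =
        (3 * n ^ 9 + 2 * n ^ 10 + 18) / (n : ℝ) ^ 18 := by field_simp; ring
    rw [e2, div_le_div_iff₀ (by positivity) (by positivity)]
    have p9 : (18 : ℝ) ≤ n ^ 9 := by
      calc (18 : ℝ) ≤ 4 ^ 9 := by norm_num
        _ ≤ n ^ 9 := by gcongr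
    have p10 : 4 * (n : ℝ) ^ 9 ≤ n ^ 10 := by
      rw [pow_succ (n : ℝ) 9, mul_comm]; gcongr
    have p11 : 4 * (n : ℝ) ^ 10 ≤ n ^ 11 := by
      rw [pow_succ (n : ℝ) 10, mul_comm]; gcongr
    have : 3 * (n : ℝ) ^ 9 + 2 * n ^ 10 + 18 ≤ n ^ 11 := by linarith
    calc _ ≤ (n : ℝ) ^ 11 * n ^ 7 := by gcongr
      _ = _ := by ring

end TypProbBounds

section GoodHard

lemma Good.mono {k : ℕ} {s r r' : ℝ} (h : Good n k s r) (hr : r ≤ r') : Good n k s r' := by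
  obtain ⟨T, h1, h2⟩ := h
  exact ⟨T, h1, fun F e he => (h2 F e he).trans
    (mul_le_mul_of_nonneg_right hr (Nat.cast_nonneg _))⟩

lemma exp_neg_le_inv_pow {ℓ x : ℝ} {j : ℕ} (hn : 1 ≤ n) (hℓ : ℓ = Real.log n) (hx : j * ℓ ≤ x) :
    Real.exp (-x) ≤ 1 / (n : ℝ) ^ j := by
  have hn0 : (0 : ℝ) < n := by exact_mod_cast hn
  have : (n : ℝ) ^ j = Real.exp (j * ℓ) := by rw [Real.exp_nat_mul, hℓ, Real.exp_log hn0]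
  rw [this, one_div, ← Real.exp_neg]
  exact Real.exp_le_exp.2 (by linarith)

lemma two_mul_exp_neg_le {ℓ x : ℝ} {j : ℕ} (hn : 1 ≤ n) (hℓ : ℓ = Real.log n) (hℓ1 : 1 ≤ ℓ)
    (hx : (j + 1) * ℓ ≤ x) : 2 * Real.exp (-x) ≤ 1 / (n : ℝ) ^ j := by
  refine le_trans ?_ (exp_neg_le_inv_pow hn hℓ (x := x - 1) (by nlinarith))
  have e : Real.exp (-(x - 1)) = Real.exp 1 * Real.exp (-x) := by rw [← Real.exp_add]; ring_nf
  rw [e]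
  exact mul_le_mul_of_nonneg_right (by linarith [Real.add_one_le_exp 1]) (Real.exp_pos _).le

set_option maxHeartbeats 1000000 in
lemma good_hard_aux {k T : ℕ} {s m ℓ M δ α κ₀ : ℝ} (hn : 4 ≤ n) (hℓ : ℓ = Real.log n)
    (hℓ1 : 1 ≤ ℓ) (hk1 : 1 ≤ k) (hs0 : 0 < s) (hs1 : s ≤ 1) (hm : m = s * (n - 1 - k))
    (hδ0 : 0 < δ) (hδ : δ ≤ 1 / 40) (hα0 : 0 < α) (hα1 : α ≤ 1) (hκ0 : 0 < κ₀) (hκ1 : κ₀ ≤ 1)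
    (hT : 64 ≤ δ * T) (hTα : 24 * α * T ^ 2 ≤ δ) (hκδ : 36992 * κ₀ ≤ δ)
    (hkδ : k + 1 ≤ δ * (n - 1 - k)) (hkα : k + 1 ≤ α / 2 * (n - 1 - k))
    (hmM : M * ℓ ≤ m) (hkM : M * ℓ ≤ k) (c1 : 1632 ≤ δ * M) (c2 : 352 ≤ M) (c3 : 88 ≤ δ ^ 2 * M)
    (c4 : 704 * κ₀ * 204 ^ 2 ≤ δ ^ 2 * M) (c5 : 1280 ≤ α ^ 3 * M) (c6 : 40 ≤ κ₀ * M)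
    (c7 : 24 * (T : ℝ) ^ 2 ≤ δ * M) (hlarge : 8 * ℓ ≤ κ₀ * √n) :
    Good n k s (k / (n - 1 - k) * ((1 + 17 * δ) / (1 - 18 * δ))) := by
  have hn0 : (0 : ℝ) < n := by positivity
  have hℓ0 : 0 < ℓ := by linarith
  have hk0 : (0 : ℝ) < k := by exact_mod_cast hk1
  have hnk : (0 : ℝ) < n - 1 - k := by
    by_contra h
    push Not at h
    nlinarith only [hkδ, h, hδ0, hk0]
  have hkn : k + 1 < n := by
    have : (k : ℝ) + 1 < n := by linarith
    exact_mod_cast this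
  have hm0 : 0 < m := hm ▸ mul_pos hs0 hnk
  have hM0 : 0 < M := by linarith
  have hMm : M ≤ m := by nlinarith only [hmM, hM0, hℓ1]
  have scale : ∀ {a b : ℝ}, 0 ≤ b → a ≤ b * M → a * ℓ ≤ b * m := fun {a b} hb h => by
    calc a * ℓ ≤ b * M * ℓ := mul_le_mul_of_nonneg_right h hℓ0.le
      _ = b * (M * ℓ) := by ring
      _ ≤ b * m := mul_le_mul_of_nonneg_left hmM hb
  have h8m : 8 / m ≤ δ / (204 * ℓ) := by
    rw [div_le_div_iff₀ hm0 (by positivity)]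
    have := scale hδ0.le c1
    linarith
  have h4k : 4 / (k : ℝ) ≤ δ / (204 * ℓ) := by
    rw [div_le_div_iff₀ hk0 (by positivity)]
    have h1 : 1632 * ℓ ≤ δ * M * ℓ := mul_le_mul_of_nonneg_right c1 hℓ0.le
    have h2 : δ * (M * ℓ) ≤ δ * k := mul_le_mul_of_nonneg_left hkM hδ0.le
    linarith
  set θ : ℝ := δ / (204 * ℓ) with hθ
  have hθ0 : 0 < θ := by positivity
  have hθℓ : θ * ℓ = δ / 204 := by rw [hθ]; field_simp
  have hθδ : θ ≤ δ / 204 := by nlinarith only [hθℓ, hθ0, hℓ1]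
  set m₀ : ℕ := ⌈ℓ⌉₊ with hm₀
  have hm₀1 : ℓ ≤ m₀ := Nat.le_ceil _
  have hm₀2 : (m₀ : ℝ) ≤ ℓ + 1 := (Nat.ceil_lt_add_one hℓ0.le).le
  have hφ0 : 0 ≤ θ + 8 / m + 4 / k := by positivity
  have hφN : ((12 * m₀ + 9 : ℕ) : ℝ) * (θ + 8 / m + 4 / k) ≤ δ / 2 := by
    push_cast
    calc (12 * (m₀ : ℝ) + 9) * (θ + 8 / m + 4 / k) ≤ (34 * ℓ) * (3 * θ) :=
          mul_le_mul (by linarith) (by linarith) hφ0 (by positivity)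
      _ = 102 * (θ * ℓ) := by ring
      _ = δ / 2 := by rw [hθℓ]; ring
  have hsqrt : 0 < √(n : ℝ) := Real.sqrt_pos.2 hn0
  have hsq : √(n : ℝ) * √n = n := Real.mul_self_sqrt hn0.le
  have hT0 : (0 : ℝ) < T := by
    by_contra h
    push Not at h
    nlinarith only [h, hT, hδ0]
  have hmn : s * n ≤ 2 * m := by
    have := mul_le_mul_of_nonneg_left hkδ hs0.le
    have h2 : s * (δ * (n - 1 - k)) ≤ s * (1 * (n - 1 - k)) := by gcongr; linarith
    rw [hm]
    linarith
  refine good_of_typ (m₀ := m₀) (T := T) (θ := θ) (α := α) (κ := κ₀ / ℓ ^ 2) (by omega) hk1 hkn hs0 hm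
    hδ0 hδ hθ0.le hα0.le ?_ ?_ ?_ ?_ ?_ ?_ ?_ ?_ ?_ ?_
  · rw [hm]
    have := mul_le_mul_of_nonneg_left hkδ hs0.le
    linarith
  · have : (1 : ℝ) < T := by nlinarith only [hT, hδ, hT0]
    exact_mod_cast this
  · linarith
  · have e1 : 16 / (T : ℝ) ≤ δ / 4 := by
      rw [div_le_div_iff₀ hT0 (by norm_num)]; linarith
    have e2 : 1 / m * (T : ℝ) ^ 2 ≤ δ / 24 := by
      rw [one_div, inv_mul_le_iff₀ hm0]
      have := mul_le_mul_of_nonneg_left hMm hδ0.le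
      linarith
    rw [mul_add, add_mul]
    linarith
  · have h1 : 1 + (θ + 8 / m + 4 / k) ≤ Real.exp (θ + 8 / m + 4 / k) := by
      linarith [Real.add_one_le_exp (θ + 8 / m + 4 / k)]
    refine (pow_le_pow_left₀ (by positivity) h1 _).trans ?_
    rw [← Real.exp_nat_mul]
    refine (Real.exp_le_exp.2 hφN).trans ?_
    have := exp_sub_one_le (x := δ / 2) (by rw [abs_of_nonneg (by positivity)]; linarith)
    nlinarith only [this, hδ, hδ0]
  · have h1 := one_add_mul_le_pow (a := -(θ + 8 / m + 4 / k)) (by linarith) (12 * m₀ + 9)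
    rw [← sub_eq_add_neg] at h1
    refine le_trans ?_ h1
    linarith
  · calc δ ^ m₀ ≤ (Real.exp (-1)) ^ m₀ := by
          refine pow_le_pow_left₀ hδ0.le ?_ _
          have : (0 : ℝ) < Real.exp 1 := Real.exp_pos 1
          rw [Real.exp_neg, ← one_div, le_div_iff₀ this]
          nlinarith only [Real.exp_one_lt_d9, hδ, hδ0, this]
      _ = Real.exp (-m₀) := by rw [← Real.exp_nat_mul]; ring_nf
      _ ≤ Real.exp (-(ℓ / 2)) := Real.exp_le_exp.2 (by linarith)
      _ = 1 / √n := by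
          rw [Real.exp_neg, ← one_div]
          congr 1
          rw [hℓ, Real.sqrt_eq_rpow, Real.rpow_def_of_pos hn0]
          ring_nf
  · rw [div_le_div_iff₀ hn0 (by positivity), one_mul]
    have h1 := mul_le_mul hlarge hlarge (by positivity) (by positivity)
    have h2 : κ₀ * √n * (κ₀ * √n) ≤ κ₀ * n := by
      calc _ = κ₀ * (κ₀ * (√(n : ℝ) * √n)) := by ring
        _ ≤ κ₀ * (1 * n) := by rw [hsq]; gcongr
        _ = _ := by ring
    nlinarith only [h1, h2]
  · have e1 : (12 * (m₀ : ℝ) + 10) ^ 2 ≤ (34 * ℓ) ^ 2 :=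
      pow_le_pow_left₀ (by positivity) (by linarith) 2
    have e2 : (12 * (m₀ : ℝ) + 10) ^ 2 * (16 * (κ₀ / ℓ ^ 2)) ≤ δ / 2 := by
      calc _ ≤ (34 * ℓ) ^ 2 * (16 * (κ₀ / ℓ ^ 2)) :=
            mul_le_mul_of_nonneg_right e1 (by positivity)
        _ = 18496 * κ₀ := by field_simp; norm_num
        _ ≤ δ / 2 := by linarith
    linarith
  · intro K hK
    refine bpr_not_typ hn hK hs0.le hs1 hk1 hm0 hm (by positivity) hθ0.le (by linarith) ?_ hα0 hα1
      hδ0.le (by linarith) ?_ (τ := ℓ / 2) (by linarith) ?_ ?_ ?_ ?_ ?_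
    · rw [div_le_iff₀ hm0] at h8m; linarith
    · rw [hm]
      have := mul_le_mul_of_nonneg_left hkα hs0.le
      linarith
    · refine two_mul_exp_neg_le (by omega) hℓ hℓ1 ?_
      have := scale (by positivity) c3
      push_cast
      linarith
    · refine two_mul_exp_neg_le (by omega) hℓ hℓ1 ?_
      have := scale (b := 1) (by norm_num) (by linarith : (352 : ℝ) ≤ 1 * M)
      push_cast
      linarith
    · refine two_mul_exp_neg_le (by omega) hℓ hℓ1 ?_
      have h1 := scale (by positivity) c4
      rw [le_div_iff₀ (by positivity)]
      have e : θ ^ 2 * m = δ ^ 2 * m / (204 ^ 2 * ℓ ^ 2) := by rw [hθ]; field_simp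
      rw [e, le_div_iff₀ (by positivity)]
      push_cast
      have e2 : (10 + 1) * ℓ * (64 * (κ₀ / ℓ ^ 2)) * (204 ^ 2 * ℓ ^ 2) =
          704 * κ₀ * 204 ^ 2 * ℓ := by field_simp; norm_num
      rw [e2]; exact h1
    · rw [show -(ℓ / 2 * (κ₀ / ℓ ^ 2 * (k * m))) + s * ((Real.exp (ℓ / 2) - 1) * k) =
        -(ℓ / 2 * (κ₀ / ℓ ^ 2 * (k * m)) - s * ((Real.exp (ℓ / 2) - 1) * k)) by ring]
      refine exp_neg_le_inv_pow (by omega) hℓ ?_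
      have e0 : Real.exp (ℓ / 2) = √n := by
        rw [hℓ, Real.sqrt_eq_rpow, Real.rpow_def_of_pos hn0]
        ring_nf
      have e1 : ℓ / 2 * (κ₀ / ℓ ^ 2 * (k * m)) = κ₀ * k * m / (2 * ℓ) := by field_simp
      have e2 : s * ((√n - 1) * k) ≤ κ₀ * k * m / (4 * ℓ) := by
        rw [le_div_iff₀ (by positivity)]
        calc s * ((√n - 1) * k) * (4 * ℓ) ≤ s * (√n * k) * (4 * ℓ) := by
              gcongr; linarith
          _ = (8 * ℓ) * (s * √n * k / 2) := by ring
          _ ≤ (κ₀ * √n) * (s * √n * k / 2) := mul_le_mul_of_nonneg_right hlarge (by positivity)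
          _ = κ₀ * k * (s * (√(n : ℝ) * √n) / 2) := by ring
          _ ≤ κ₀ * k * m := by
              rw [hsq]
              exact mul_le_mul_of_nonneg_left (by linarith) (by positivity)
      have e3 : 10 * ℓ ≤ κ₀ * k * m / (4 * ℓ) := by
        rw [le_div_iff₀ (by positivity)]
        have h1 : M * ℓ * (M * ℓ) ≤ k * m := mul_le_mul hkM hmM (by positivity) hk0.le
        have h2 : 40 * 1 ≤ κ₀ * M * M := mul_le_mul c6 (by linarith) (by norm_num) (by positivity)
        calc 10 * ℓ * (4 * ℓ) = 40 * 1 * ℓ ^ 2 := by ring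
          _ ≤ κ₀ * M * M * ℓ ^ 2 := mul_le_mul_of_nonneg_right h2 (by positivity)
          _ = κ₀ * (M * ℓ * (M * ℓ)) := by ring
          _ ≤ κ₀ * (k * m) := mul_le_mul_of_nonneg_left h1 hκ0.le
          _ = _ := by ring
      have e4 : κ₀ * k * m / (2 * ℓ) = 2 * (κ₀ * k * m / (4 * ℓ)) := by field_simp; norm_num
      rw [e0, e1, e4]
      push_cast
      linarith
    · refine exp_neg_le_inv_pow (by omega) hℓ ?_
      have := scale (by positivity) c5
      push_cast
      linarith

set_option maxHeartbeats 1000000 in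
/-- For `c * log n ≪ k ≪ n` all relevant densities are good. -/
theorem good_hard {η ζ : ℝ} (hη : 0 < η) (hζ : 0 < ζ) :
    ∃ C > 0, ∃ c > 0, ∃ n₀ : ℕ, ∀ n ≥ n₀, ∀ k : ℕ, C * Real.log n ≤ k → (k : ℝ) ≤ c * n →
      ∀ s : ℝ, ζ * k / n ≤ s → s ≤ 1 → Good n k s ((1 + η) * (k / n)) := by
  set δ : ℝ := min (1 / 40) (η / 67) with hδ
  have hδ0 : 0 < δ := by positivity
  have hδ1 : δ ≤ 1 / 40 := min_le_left _ _
  have hδη : 67 * δ ≤ η := by linarith [min_le_right (1 / 40) (η / 67)]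
  obtain ⟨T, hT⟩ := exists_nat_ge (64 / δ)
  rw [div_le_iff₀ hδ0] at hT
  have hT0 : (0 : ℝ) < T := by
    by_contra h
    push Not at h
    nlinarith only [h, hT, hδ0]
  set α : ℝ := δ / (24 * T ^ 2) with hα
  have hα0 : 0 < α := by positivity
  have hTα : 24 * α * T ^ 2 = δ := by rw [hα]; field_simp
  have hα1 : α ≤ δ := by
    rw [hα]
    have : (1 : ℝ) ≤ T := by nlinarith only [hT, hδ1, hT0]
    exact div_le_self hδ0.le (by nlinarith only [this])
  set κ₀ : ℝ := δ / 36992 with hκ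
  have hκ0 : 0 < κ₀ := by positivity
  set M : ℝ := 1632 / δ + 352 + 88 / δ ^ 2 + 704 * κ₀ * 204 ^ 2 / δ ^ 2 + 1280 / α ^ 3 + 40 / κ₀ +
    24 * (T : ℝ) ^ 2 / δ with hM
  have hMpos : 0 < M := by positivity
  have hMle : ∀ {a b : ℝ}, 0 < b → a / b ≤ M → a ≤ b * M := fun {a b} hb h => by
    rw [div_le_iff₀ hb] at h; linarith
  have p1 : 0 < 1632 / δ := by positivity
  have p3 : 0 < 88 / δ ^ 2 := by positivity
  have p4 : 0 < 704 * κ₀ * 204 ^ 2 / δ ^ 2 := by positivity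
  have p5 : 0 < 1280 / α ^ 3 := by positivity
  have p6 : 0 < 40 / κ₀ := by positivity
  have p7 : 0 < 24 * (T : ℝ) ^ 2 / δ := by positivity
  have hlog : ∃ n₀ : ℕ, ∀ n ≥ n₀, 8 * Real.log n ≤ κ₀ * √n := by
    have h := (isLittleO_log_rpow_atTop (r := 1 / 2) (by norm_num)).bound
      (by positivity : 0 < κ₀ / 8)
    obtain ⟨x, hx⟩ := Filter.eventually_atTop.1 h
    refine ⟨max ⌈x⌉₊ 1, fun n hn => ?_⟩
    have h1 : x ≤ n := (Nat.le_ceil x).trans (by exact_mod_cast (le_max_left _ _).trans hn)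
    have h2 : (1 : ℝ) ≤ n := by exact_mod_cast (le_max_right _ _).trans hn
    have h3 := hx n h1
    rw [Real.norm_of_nonneg (Real.log_nonneg h2), Real.norm_of_nonneg (by positivity),
      ← Real.sqrt_eq_rpow] at h3
    linarith
  obtain ⟨n₁, hn₁⟩ := hlog
  set c : ℝ := α / 8 with hc
  refine ⟨(1 + 2 / ζ) * M, by positivity, c, by positivity, max (max n₁ 4) ⌈1 / c⌉₊,
    fun n hn k hk hkc s hs hs1 => ?_⟩
  have hn4 : 4 ≤ n := (le_max_right _ _).trans ((le_max_left _ _).trans hn)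
  have hn4' : (4 : ℝ) ≤ n := by exact_mod_cast hn4
  have hn0 : (0 : ℝ) < n := by linarith
  have hnc : 1 ≤ c * n := by
    have h : 1 / c ≤ n := (Nat.le_ceil _).trans (by exact_mod_cast (le_max_right _ _).trans hn)
    rw [div_le_iff₀ (by positivity)] at h
    linarith
  have hℓ1 : 1 ≤ Real.log n := by
    rw [Real.le_log_iff_exp_le hn0]
    linarith [Real.exp_one_lt_d9]
  set ℓ := Real.log n with hℓ
  have hkM : M * ℓ ≤ k := by
    refine le_trans ?_ hk
    have : 0 ≤ 2 / ζ * M * ℓ := by positivity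
    linarith
  have hk0 : (0 : ℝ) < k := lt_of_lt_of_le (by positivity) hkM
  have hs0 : 0 < s := lt_of_lt_of_le (by positivity) hs
  have hcα : 8 * c = α := by rw [hc]; ring
  have hcn : c * n ≤ 1 / 320 * n := mul_le_mul_of_nonneg_right (by linarith) hn0.le
  have hhalf : (n : ℝ) / 2 ≤ n - 1 - k := by linarith
  have hkα : k + 1 ≤ α / 2 * (n - 1 - k) := by
    have := mul_le_mul_of_nonneg_left hhalf hα0.le
    have h3 : α * n = 8 * (c * n) := by rw [← hcα]; ring
    linarith
  have hnk : (0 : ℝ) < n - 1 - k := by linarith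
  have hkδ : k + 1 ≤ δ * (n - 1 - k) := by
    have := mul_le_mul_of_nonneg_right hα1 hnk.le
    have h0 : 0 ≤ α * (n - 1 - k) := by positivity
    linarith
  have hmM : M * ℓ ≤ s * (n - 1 - k) := by
    calc M * ℓ = ζ / 2 * (2 / ζ * M * ℓ) := by field_simp
      _ ≤ ζ / 2 * k := by
          refine mul_le_mul_of_nonneg_left (le_trans ?_ hk) (by positivity)
          have : 0 ≤ M * ℓ := by positivity
          linarith
      _ = ζ * k / n * (n / 2) := by field_simp
      _ ≤ s * (n - 1 - k) := mul_le_mul hs hhalf (by positivity) hs0.le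
  have key := good_hard_aux (n := n) (k := k) (T := T) (s := s) (M := M) (δ := δ) (α := α) (κ₀ := κ₀)
    hn4 hℓ hℓ1 (by exact_mod_cast hk0) hs0 hs1 rfl hδ0 hδ1 hα0 (by linarith) hκ0 (by linarith)
    (by linarith) hTα.le (by linarith) hkδ hkα hmM hkM (hMle hδ0 (by linarith)) (by linarith)
    (hMle (by positivity) (by linarith)) (hMle (by positivity) (by linarith))
    (hMle (by positivity) (by linarith)) (hMle hκ0 (by linarith)) (hMle hδ0 (by linarith))
    (hn₁ n ((le_max_left _ _).trans ((le_max_left _ _).trans hn)))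
  refine key.mono ?_
  have h18 : 0 < 1 - 18 * δ := by linarith
  have e1 : (1 + 17 * δ) / (1 - 18 * δ) ≤ 1 + 64 * δ := by
    rw [div_le_iff₀ h18]; nlinarith only [hδ0, hδ1]
  have e2 : (k : ℝ) / (n - 1 - k) ≤ (1 + δ) * (k / n) := by
    rw [div_le_iff₀ hnk]
    have : (n : ℝ) ≤ (1 + δ) * (n - 1 - k) := by linarith
    calc (k : ℝ) = k / n * n := by field_simp
      _ ≤ k / n * ((1 + δ) * (n - 1 - k)) := mul_le_mul_of_nonneg_left this (by positivity)
      _ = _ := by ring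
  calc _ ≤ (1 + δ) * (k / n) * (1 + 64 * δ) :=
        mul_le_mul e2 e1 (div_nonneg (by linarith) h18.le) (by positivity)
    _ = (1 + δ) * (1 + 64 * δ) * (k / n) := by ring
    _ ≤ (1 + η) * (k / n) := mul_le_mul_of_nonneg_right (by nlinarith only [hδ0, hδ1, hδη])
        (by positivity)

end GoodHard

section Regimes

lemma eventually_log_pow_le (K : ℝ) (hK : 0 < K) :
    ∀ᶠ n : ℕ in Filter.atTop, K * Real.log n ^ 3 ≤ n ∧ 1 ≤ Real.log n ∧ K ≤ n := by
  have h := (Real.isLittleO_pow_log_id_atTop (n := 3)).bound (by positivity : 0 < 1 / K)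
  have h' := tendsto_natCast_atTop_atTop (R := ℝ) |>.eventually h
  filter_upwards [h', Filter.eventually_ge_atTop 3, Filter.eventually_ge_atTop ⌈K⌉₊] with n hn h3 hKn
  have h3' : (3 : ℝ) ≤ n := by exact_mod_cast h3
  have hl : 1 ≤ Real.log n := by
    rw [Real.le_log_iff_exp_le (by linarith)]
    linarith [Real.exp_one_lt_d9]
  refine ⟨?_, hl, (Nat.le_ceil K).trans (by exact_mod_cast hKn)⟩
  rw [Real.norm_of_nonneg (by positivity), id, Real.norm_of_nonneg (by linarith)] at hn
  calc _ ≤ K * (1 / K * n) := mul_le_mul_of_nonneg_left hn hK.le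
    _ = n := by field_simp

set_option maxHeartbeats 1000000 in
/-- Linear degrees on both sides. -/
theorem good_mid_eventually {e s₀ c : ℝ} (he0 : 0 < e) (he : e ≤ 1 / 20) (hs₀ : 0 < s₀)
    (hs₁ : s₀ ≤ 1) (hc0 : 0 < c) (hc1 : c ≤ 1) :
    ∀ᶠ n : ℕ in Filter.atTop, ∀ k : ℕ, c * n ≤ k → c * n ≤ n - 1 - k → Even (n * k) →
      ∀ s : ℝ, s₀ ≤ s → s ≤ 1 → Good n k s ((1 + 10 * e) * (k / (n - k))) := by
  set η : ℝ := e * s₀ ^ 2 * c ^ 3 / 4 with hη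
  have hη0 : 0 < η := by positivity
  have hη1 : η ≤ 1 := by
    have h1 : e * s₀ ^ 2 * c ^ 3 ≤ 1 * 1 * 1 := by
      gcongr
      · linarith
      · exact pow_le_one₀ hs₀.le hs₁
      · exact pow_le_one₀ hc0.le hc1
    rw [hη]; linarith
  set ϑ : ℝ := η ^ 2 / 384 with hϑ
  have hϑ0 : 0 < ϑ := by positivity
  have hϑ1 : ϑ ≤ 1 := by
    have := pow_le_one₀ hη0.le hη1 (n := 2)
    rw [hϑ]; linarith
  set K : ℝ := 18 + 4 / η + 24 / ϑ ^ 2 + 2 / (e * s₀ * c ^ 3) + 80 / (e ^ 2 * s₀ * c) + 896 / η ^ 2 +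
    1 / c with hK
  have q1 : 0 < 4 / η := by positivity
  have q2 : 0 < 24 / ϑ ^ 2 := by positivity
  have q3 : 0 < 2 / (e * s₀ * c ^ 3) := by positivity
  have q4 : 0 < 80 / (e ^ 2 * s₀ * c) := by positivity
  have q5 : 0 < 896 / η ^ 2 := by positivity
  have q6 : 0 < 1 / c := by positivity
  have hKle : ∀ {a b : ℝ}, 0 < b → a / b ≤ K → a ≤ b * K := fun {a b} hb h => by
    rw [div_le_iff₀ hb] at h; linarith
  filter_upwards [eventually_log_pow_le K (by positivity)] with n hn k hck hck' hpar s hs hs1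
  obtain ⟨hℓ3, hℓ1, hKn⟩ := hn
  have hn18 : (18 : ℝ) ≤ n := by linarith
  have hn0 : (0 : ℝ) < n := by linarith
  have hn1 : 1 ≤ n := by exact_mod_cast (by linarith : (1 : ℝ) ≤ n)
  have hs0 : 0 < s := by linarith
  set ℓ := Real.log n with hℓ
  have hℓ0 : 0 < ℓ := by linarith
  have hℓK : K * ℓ ≤ n := by
    refine le_trans (mul_le_mul_of_nonneg_left ?_ (by positivity)) hℓ3
    exact le_self_pow₀ hℓ1 (by norm_num)
  have hℓn : ℓ ≤ n := by
    refine le_trans ?_ hℓK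
    exact le_mul_of_one_le_left hℓ0.le (by linarith)
  have up : ∀ {a b x y : ℝ}, 0 < b → a / b ≤ K → 0 ≤ x → K * x ≤ y → a * x ≤ b * y :=
    fun {a b x y} hb h hx hy => by
      calc a * x ≤ b * K * x := mul_le_mul_of_nonneg_right (hKle hb h) hx
        _ = b * (K * x) := by ring
        _ ≤ b * y := mul_le_mul_of_nonneg_left hy hb.le
  have hKn1 : K * 1 ≤ n := by linarith
  have hk : k < n := by
    have : (k : ℝ) < n := by
      have : 0 < c * n := by positivity
      linarith
    exact_mod_cast this
  set t : ℝ := ϑ * n / ℓ with ht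
  have htn : t ≤ n := by
    rw [ht, div_le_iff₀ hℓ0]
    have h1 := mul_le_mul_of_nonneg_right hϑ1 hn0.le
    have h2 := mul_le_mul_of_nonneg_left hℓ1 hn0.le
    linarith
  have ht0 : 0 < t := by positivity
  have h896 : 896 * n ≤ η ^ 2 * (n : ℝ) ^ 2 := by
    have := up (a := 896) (b := η ^ 2) (by positivity) (by linarith) hn0.le
      (y := (n : ℝ) * n) (mul_le_mul_of_nonneg_right hKn hn0.le)
    linarith
  have four : (4 : ℝ) ^ n ≤ Real.exp (2 * n) := by
    have h4 : (4 : ℝ) ≤ Real.exp 2 := by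
      have e1 := Real.add_one_le_exp (1 : ℝ)
      have e2 : Real.exp 2 = Real.exp 1 * Real.exp 1 := by rw [← Real.exp_add]; norm_num
      rw [e2]
      nlinarith only [e1]
    calc (4 : ℝ) ^ n ≤ Real.exp 2 ^ n := pow_le_pow_left₀ (by norm_num) h4 n
      _ = _ := by rw [← Real.exp_nat_mul]; ring_nf
  have inv3 : ∀ j : ℕ, 1 / (n : ℝ) ^ (j + 1) ≤ 1 / (18 * (n : ℝ) ^ j) := fun j => by
    refine one_div_le_one_div_of_le (by positivity) ?_
    rw [pow_succ, mul_comm]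
    exact mul_le_mul_of_nonneg_left hn18 (by positivity)
  have inv3' : ∀ j : ℕ, 1 / (18 * (n : ℝ) ^ j) ≤ 1 / (3 * (n : ℝ) ^ j) := fun j =>
    one_div_le_one_div_of_le (by positivity) (by gcongr; norm_num)
  refine good_mid (t := t) (η := η) (Δ := ⌈2 * n * t⌉₊) (c := c) (by exact_mod_cast (by linarith : (2 : ℝ) ≤ n))
    hk hpar hs0 hs1 he0 he hc0 hck hck' ht0.le (by linarith) (Nat.le_ceil _) ?_ hη0 hη1 ?_ ?_ ?_
    ?_ ?_ ?_
  · have h1 := two_mul_exp_neg_le (n := n) (ℓ := ℓ) (x := t ^ 2 / (8 * n)) (j := 2) hn1 hℓ hℓ1 (by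
      rw [le_div_iff₀ (by positivity), ht, div_pow, le_div_iff₀ (by positivity)]
      have := up (a := 24) (b := ϑ ^ 2) (by positivity) (by linarith) (by positivity) hℓ3
      have := mul_le_mul_of_nonneg_right this hn0.le
      push_cast
      linarith)
    calc _ ≤ n * (1 / (n : ℝ) ^ 2) := mul_le_mul_of_nonneg_left h1 hn0.le
      _ = 1 / n := by field_simp
      _ ≤ 1 / 2 := one_div_le_one_div_of_le (by norm_num) (by linarith)
  · have := up (a := 4) (b := η) hη0 (by linarith) zero_le_one hKn1
    linarith
  · rw [hη]
    have : e * s₀ ^ 2 * c ^ 3 ≤ e * s ^ 2 * c ^ 3 := by gcongr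
    linarith
  · have h1 := up (a := 2) (b := e * s₀ * c ^ 3) (by positivity) (by linarith) zero_le_one hKn1
    have : e * s₀ * c ^ 3 * n ≤ e * s * c ^ 3 * n := by gcongr
    linarith
  · refine (two_mul_exp_neg_le (j := 9) hn1 hℓ hℓ1 ?_).trans ((inv3 8).trans (inv3' 8))
    have h1 := up (a := 80) (b := e ^ 2 * s₀ * c) (by positivity) (by linarith) hℓ0.le hℓK
    have h2 : e ^ 2 * s₀ * (c * n) ≤ e ^ 2 * s * (n - 1 - k) := by gcongr
    push_cast
    linarith
  · have h1 := two_mul_exp_neg_le (n := n) (ℓ := ℓ) (j := 8)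
      (x := η ^ 2 * (n : ℝ) ^ 2 / 8 - 2 * n) hn1 hℓ hℓ1 (by push_cast; linarith)
    refine le_trans ?_ (h1.trans ((inv3 7).trans (inv3' 7)))
    calc _ ≤ Real.exp (2 * n) * (2 * Real.exp (-(η ^ 2 * (n : ℝ) ^ 2 / 8))) := by gcongr
      _ = 2 * (Real.exp (2 * n) * Real.exp (-(η ^ 2 * (n : ℝ) ^ 2 / 8))) := by ring
      _ = _ := by
        rw [← Real.exp_add]
        congr 2
        ring
  · have hΔ : ((⌈2 * n * t⌉₊ : ℕ) : ℝ) ≤ 2 * n * t + 1 := (Nat.ceil_lt_add_one (by positivity)).le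
    have hbase : (n : ℝ) ^ 2 / c ≤ Real.exp (3 * ℓ) := by
      have e1 : Real.exp (3 * ℓ) = (n : ℝ) ^ 3 := by
        rw [show 3 * ℓ = ((3 : ℕ) : ℝ) * ℓ by norm_num, Real.exp_nat_mul, hℓ, Real.exp_log hn0]
      rw [e1, div_le_iff₀ hc0]
      have h1 := up (a := 1) (b := c) hc0 (by linarith) zero_le_one hKn1
      have h2 := mul_le_mul_of_nonneg_left h1 (sq_nonneg (n : ℝ))
      linarith
    have hpow : ((n : ℝ) ^ 2 / c) ^ ⌈2 * n * t⌉₊ ≤ Real.exp (η ^ 2 * n ^ 2 / 64 + 3 * ℓ) := by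
      refine (pow_le_pow_left₀ (by positivity) hbase _).trans ?_
      rw [← Real.exp_nat_mul]
      refine Real.exp_le_exp.2 ?_
      calc _ ≤ (2 * n * t + 1) * (3 * ℓ) := mul_le_mul_of_nonneg_right hΔ (by positivity)
        _ = 6 * n * (t * ℓ) + 3 * ℓ := by ring
        _ = _ := by rw [ht, div_mul_cancel₀ _ hℓ0.ne', hϑ]; ring
    have h1 := two_mul_exp_neg_le (n := n) (ℓ := ℓ) (j := 8)
      (x := η ^ 2 * (n : ℝ) ^ 2 / 32 - 2 * n - (η ^ 2 * (n : ℝ) ^ 2 / 64 + 3 * ℓ)) hn1 hℓ hℓ1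
      (by push_cast; linarith)
    have h2 := mul_le_mul_of_nonneg_left (h1.trans (inv3 7)) (by norm_num : (0 : ℝ) ≤ 6)
    refine le_trans ?_ (h2.trans (le_of_eq ?_))
    · calc _ ≤ 6 * Real.exp (η ^ 2 * n ^ 2 / 64 + 3 * ℓ) *
            (Real.exp (2 * n) * (2 * Real.exp (-((η / 2) ^ 2 * (n : ℝ) ^ 2 / 8)))) := by gcongr
        _ = _ := by
          rw [show ∀ a b c : ℝ, 6 * a * (b * (2 * c)) = 6 * (2 * (a * b * c)) by intros; ring,
            ← Real.exp_add, ← Real.exp_add]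
          congr 3
          ring
    · field_simp; norm_num

/-- Small linear degrees and constant density. -/
theorem good_small_eventually {s₀ c : ℝ} (hs₀ : 0 < s₀) (hc : c ≤ s₀ / 16) (hc0 : 0 < c) :
    ∀ᶠ n : ℕ in Filter.atTop, ∀ k : ℕ, 1 ≤ k → (k : ℝ) ≤ c * n →
      ∀ s : ℝ, s₀ ≤ s → s ≤ 1 → Good n k s (2 * c / s₀) := by
  set K : ℝ := 32 / s₀ + 512 * 11 / s₀ ^ 3 + 2 with hK
  have q1 : 0 < 32 / s₀ := by positivity
  have q2 : 0 < 512 * 11 / s₀ ^ 3 := by positivity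
  filter_upwards [eventually_log_pow_le K (by positivity)] with n hn k hk hkc s hs hs1
  obtain ⟨hℓ3, hℓ1, hKn⟩ := hn
  have hn2 : (2 : ℝ) ≤ n := by linarith
  have hn0 : (0 : ℝ) < n := by linarith
  have hn1 : 1 ≤ n := by exact_mod_cast (by linarith : (1 : ℝ) ≤ n)
  have hs0 : 0 < s := by linarith
  set ℓ := Real.log n with hℓ
  have hℓK : K * ℓ ≤ n :=
    le_trans (mul_le_mul_of_nonneg_left (le_self_pow₀ hℓ1 (by norm_num)) (by positivity)) hℓ3
  refine (good_small hn1 hk hs0 hs1 ?_ ?_).mono ?_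
  · have h1 : 32 ≤ n * s₀ := by
      have : 32 / s₀ ≤ n := by linarith
      rwa [div_le_iff₀ hs₀] at this
    have h2 : c * n ≤ s₀ / 16 * n := mul_le_mul_of_nonneg_right hc hn0.le
    have h3 : s₀ * n ≤ s * n := mul_le_mul_of_nonneg_right hs hn0.le
    linarith
  · have h1 := two_mul_exp_neg_le (n := n) (ℓ := ℓ) (j := 10) (x := s ^ 3 * n / 512) hn1 hℓ hℓ1 (by
      have h2 : 512 * 11 / s₀ ^ 3 * ℓ ≤ n :=
        le_trans (mul_le_mul_of_nonneg_right (by linarith) (by linarith)) hℓK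
      rw [div_mul_eq_mul_div, div_le_iff₀ (by positivity)] at h2
      have h3 : s₀ ^ 3 * n ≤ s ^ 3 * n := by gcongr
      push_cast
      linarith)
    have h2 : 2 * (1 / (n : ℝ) ^ 10) ≤ 1 / (n : ℝ) ^ 9 := by
      rw [mul_one_div, div_le_div_iff₀ (by positivity) (by positivity), pow_succ (n : ℝ) 9, one_mul,
        mul_comm]
      exact mul_le_mul_of_nonneg_left hn2 (by positivity)
    linarith
  · rw [div_le_div_iff₀ (by positivity) hs₀]
    calc 2 * (k : ℝ) * s₀ ≤ 2 * (c * n) * s := by gcongr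
      _ = 2 * c * (s * n) := by ring

/-- Almost complete regular graphs. -/
theorem good_dense_eventually {e s₀ : ℝ} (he0 : 0 < e) (he : e ≤ 1 / 20) (hs₀ : 0 < s₀) :
    ∃ C > 0, ∀ᶠ n : ℕ in Filter.atTop, ∀ k : ℕ, C * Real.log n ≤ n - 1 - k →
      (n : ℝ) - 1 - k ≤ e / 6 * n →
      ∀ s : ℝ, s₀ ≤ s → s ≤ 1 → Good n k s ((1 + 10 * e) * (n / (n - 1 - k))) := by
  refine ⟨72 / (e ^ 2 * s₀) + 1 / (e * s₀), by positivity, ?_⟩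
  have q1 : 0 < 72 / (e ^ 2 * s₀) := by positivity
  have q2 : 0 < 1 / (e * s₀) := by positivity
  filter_upwards [eventually_log_pow_le (24 / e + 1) (by positivity)] with n hn k hk hkc s hs hs1
  obtain ⟨hℓ3, hℓ1, hKn⟩ := hn
  have q3 : 0 < 24 / e := by positivity
  have hn0 : (0 : ℝ) < n := by linarith
  have hn1 : 1 ≤ n := by exact_mod_cast (by linarith : (1 : ℝ) ≤ n)
  have hs0 : 0 < s := by linarith
  set ℓ := Real.log n with hℓ
  have hd0 : (0 : ℝ) ≤ n - 1 - k := le_trans (by positivity) hk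
  rw [add_mul] at hk
  have hd1 : 72 / (e ^ 2 * s₀) * ℓ ≤ n - 1 - k := by
    have : 0 ≤ 1 / (e * s₀) * ℓ := by positivity
    linarith
  have hd2 : 1 / (e * s₀) * ℓ ≤ n - 1 - k := by
    have : 0 ≤ 72 / (e ^ 2 * s₀) * ℓ := by positivity
    linarith
  rw [div_mul_eq_mul_div, div_le_iff₀ (by positivity)] at hd1 hd2
  refine good_dense hn1 hs0 hs1 he0 he ?_ ?_ ?_
  · have : e * (s₀ * (n - 1 - k)) ≤ e * (s * (n - 1 - k)) := by gcongr
    linarith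
  · have : 24 / e ≤ n := by linarith
    rw [div_le_iff₀ he0] at this
    linarith
  · refine two_mul_exp_neg_le (n := n) (ℓ := ℓ) (j := 8) hn1 hℓ hℓ1 ?_
    have : e ^ 2 * (s₀ * (n - 1 - k)) ≤ e ^ 2 * (s * (n - 1 - k)) := by gcongr
    push_cast
    linarith

end Regimes

section Domination

lemma Dom.of_forall_subset {α : Type*} [Fintype α] [DecidableEq α] {μ ν : Finset α → ℝ}
    (h0 : ∀ F, 0 ≤ μ F) (h1 : ∀ F, 0 ≤ ν F) (hμ : ∑ F, μ F = 1) (hν : ∑ F, ν F = 1)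
    (h : ∀ F H, μ F ≠ 0 → ν H ≠ 0 → F ⊆ H) : Dom 0 μ ν := by
  refine ⟨fun F H => μ F * ν H, fun F H => mul_nonneg (h0 F) (h1 H), fun F => ?_, fun H => ?_, ?_⟩
  · rw [← Finset.mul_sum, hν, mul_one]
  · rw [← Finset.sum_mul, hμ, one_mul]
  · refine Finset.sum_nonpos fun F _ => Finset.sum_nonpos fun H _ => ?_
    split_ifs with hFH
    · exact le_rfl
    · by_contra hne
      push Not at hne
      exact hFH (h F H (left_ne_zero_of_mul hne.ne') (right_ne_zero_of_mul hne.ne'))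

lemma unif_nonneg {α : Type*} [Fintype α] [DecidableEq α] (K : Finset (Finset α)) (F : Finset α) :
    0 ≤ unif K F := by
  unfold unif
  split_ifs <;> positivity

lemma sum_unif {α : Type*} [Fintype α] [DecidableEq α] {K : Finset (Finset α)} (hK : K.Nonempty) :
    ∑ F, unif K F = 1 := by
  have : (K.card : ℝ) ≠ 0 := by exact_mod_cast hK.card_pos.ne'
  simp [unif, this]

lemma gnp_nonneg {α : Type*} [Fintype α] [DecidableEq α] {q : ℝ} (h0 : 0 ≤ q) (h1 : q ≤ 1)
    (F : Finset α) : 0 ≤ gnp q F := thin_nonneg h0 h1 _ _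

lemma sum_gnp {α : Type*} [Fintype α] [DecidableEq α] (q : ℝ) :
    ∑ F : Finset α, gnp q F = 1 := sum_thin _ _

/-- The error term of the couplings. -/
def err (n : ℕ) : ℝ := 1 / (n : ℝ) + 2 * Real.log n ^ 2 / n

lemma err_nonneg (n : ℕ) : 0 ≤ err n := by unfold err; positivity

/-- Domination of a random regular graph from the odds bound. -/
theorem dom_reg {k : ℕ} (hn : 2 ≤ n) (hK : (regs n k).Nonempty) {sₑ r q : ℝ} (hr0 : 0 ≤ r)
    (hs : 1 / (n : ℝ) ≤ sₑ) (hs1 : sₑ ≤ 1) (hG : ∀ s, sₑ ≤ s → s ≤ 1 → Good n k s r)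
    (hq1 : q ≤ 1) (hq : (1 - q) * ((1 + r) * n) ≤ (1 - sₑ) * (n - 1)) :
    Dom (err n) (unif (regs n k)) (gnp q) := by
  have hn2 : (2 : ℝ) ≤ n := by exact_mod_cast hn
  have hn0 : (0 : ℝ) < n := by linarith
  have hn1 : (0 : ℝ) < n - 1 := by linarith
  have hD : 0 < (1 + r) * n := by positivity
  set w : ℝ := (n - 1) / ((1 + r) * n) with hw
  have hw0 : 0 < w := by positivity
  have hw1 : w ≤ 1 := by
    rw [hw, div_le_one hD]
    have : 0 ≤ r * n := by positivity
    linarith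
  have hs0 : 0 ≤ sₑ := le_trans (by positivity) hs
  have h := dom_of_good hn hK (κ := 1 - w) (by linarith) (by linarith) hs hs1 hG (by
    rw [sub_sub_cancel, sub_div, div_self hw0.ne', hw, one_div_div]
    refine le_of_eq ?_
    field_simp
    ring)
  have hle : (1 - w) + (1 - (1 - w)) * sₑ ≤ q := by
    have : 1 - q ≤ (1 - sₑ) * w := by
      rw [hw, mul_div_assoc', le_div_iff₀ hD]
      exact hq
    linarith
  have h2 := h.trans (Dom.gnp_mono (add_nonneg (by linarith)
    (mul_nonneg (by linarith) hs0)) hle hq1)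
  exact h2.mono (by rw [add_zero]; rfl)

set_option maxHeartbeats 1000000 in
/-- A random regular graph is dominated by a slightly denser binomial random graph. -/
theorem dom_upper {ε : ℝ} (hε : 0 < ε) (hε1 : ε ≤ 1 / 2) :
    ∃ C > 0, ∀ᶠ n : ℕ in Filter.atTop, ∀ d : ℕ, C * Real.log n ≤ d → d + 1 ≤ n → Even (n * d) →
      Dom (err n) (unif (regs n d)) (gnp (min ((1 + ε) * d / n) 1)) := by
  obtain ⟨C, hC, c₀, hc₀, n₀, hard⟩ := good_hard (η := ε / 4) (ζ := ε / 4) (by linarith) (by linarith)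
  set c : ℝ := min c₀ (ε / 3) with hc
  have hc0 : 0 < c := lt_min hc₀ (by linarith)
  have hcε : c ≤ ε / 3 := min_le_right _ _
  have hc1 : c ≤ 1 := by linarith
  set s₀ : ℝ := ε * c / 4 with hs₀
  have hs₀0 : 0 < s₀ := by positivity
  have hs₀1 : s₀ ≤ 1 := by
    have : ε * c ≤ 1 * 1 := by gcongr; linarith
    rw [hs₀]; linarith
  have mid := good_mid_eventually (e := ε / 40) (by linarith) (by linarith) hs₀0 hs₀1 hc0 hc1
  refine ⟨C + 4 / ε, by positivity, ?_⟩
  have q1 : 0 < 4 / ε := by positivity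
  have q2 : 0 < 1 / s₀ := by positivity
  filter_upwards [eventually_log_pow_le (4 / ε + 1 / s₀ + 2) (by positivity), mid,
    Filter.eventually_ge_atTop n₀] with n hn hmid hn₀ d hd hdn hpar
  obtain ⟨-, hℓ1, hKn⟩ := hn
  have hn2 : (2 : ℝ) ≤ n := by linarith
  have hn0 : (0 : ℝ) < n := by linarith
  have hn2' : 2 ≤ n := by exact_mod_cast hn2
  have hne := regs_nonempty (n := n) (k := d) (by omega) hpar
  have hnε : 4 ≤ n * ε := by
    have : 4 / ε ≤ n := by linarith
    rwa [div_le_iff₀ hε] at this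
  have hns : 1 ≤ n * s₀ := by
    have : 1 / s₀ ≤ n := by linarith
    rwa [div_le_iff₀ hs₀0] at this
  have hℓ0 : 0 < Real.log n := by linarith
  rw [add_mul] at hd
  have hdC : C * Real.log n ≤ d := by
    have : 0 < 4 / ε * Real.log n := by positivity
    linarith
  have hdε : 4 ≤ d * ε := by
    have h1 : 4 / ε * 1 ≤ 4 / ε * Real.log n := by gcongr
    have h2 : 0 < C * Real.log n := by positivity
    have : 4 / ε ≤ d := by linarith
    rwa [div_le_iff₀ hε] at this
  have hd0 : (0 : ℝ) ≤ d := Nat.cast_nonneg d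
  rcases le_or_gt 1 ((1 + ε) * d / n) with hbig | hsmall
  · rw [min_eq_right hbig]
    refine (Dom.of_forall_subset (unif_nonneg _) (gnp_nonneg zero_le_one le_rfl) (sum_unif hne)
      (sum_gnp 1) fun F H _ hH => ?_).mono (err_nonneg n)
    suffices h : H = Finset.univ by rw [h]; exact Finset.subset_univ _
    by_contra hcon
    apply hH
    have : (Finset.univ \ H).card ≠ 0 := by
      rw [Finset.card_ne_zero, Finset.sdiff_nonempty]
      exact fun h => hcon (Finset.univ_subset_iff.1 h)
    simp [gnp, thin, this]
  rw [min_eq_left hsmall.le]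
  have hsm : (1 + ε) * d < n := by rwa [div_lt_one hn0] at hsmall
  rcases le_total (d : ℝ) (c * n) with hdc | hdc
  · have hdc' : (d : ℝ) ≤ c₀ * n := hdc.trans (by gcongr; exact min_le_left _ _)
    refine dom_reg hn2' hne (sₑ := ε / 4 * d / n) (r := (1 + ε / 4) * (d / n)) (by positivity)
      ?_ ?_ (hard n hn₀ d hdC hdc') hsmall.le ?_
    · gcongr
      linarith
    · rw [div_le_one hn0]
      nlinarith only [hsm, hd0, hε, hε1]
    · set x : ℝ := d / n with hx
      have hxn : (d : ℝ) = x * n := by rw [hx]; field_simp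
      have hx0 : 0 ≤ x := by positivity
      rw [mul_div_assoc, mul_div_assoc, ← hx]
      rw [hxn] at hdε
      have e1 : 0 ≤ (1 + ε) * (1 + ε / 4) * x ^ 2 * n := by positivity
      have e2 : 0 ≤ ε / 4 * x := by positivity
      nlinarith only [e1, e2, hdε]
  · have hdlt : (d : ℝ) < n := by
      have : 0 ≤ ε * d := by positivity
      linarith
    have hnd : (0 : ℝ) < n - d := by linarith
    refine dom_reg hn2' hne (sₑ := s₀) (r := (1 + 10 * (ε / 40)) * (d / (n - d))) (by positivity)
      ?_ hs₀1 (hmid d hdc ?_ hpar) hsmall.le ?_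
    · rw [div_le_iff₀ hn0]; linarith
    · have h1 : c * n ≤ ε / 3 * n := by gcongr
      have h2 : ε * d ≤ ε * n := by gcongr
      have h3 : ε * (ε * d) ≤ 1 / 2 * (ε * n) := by gcongr
      nlinarith only [h1, h2, h3, hsm, hnε, hε, hε1, hn0]
    · have e : (1 - (1 + ε) * d / n) * ((1 + (1 + 10 * (ε / 40)) * (d / (n - d))) * n) =
          (n - (1 + ε) * d) * (n + ε / 4 * d) / (n - d) := by
        field_simp
        ring
      rw [e, div_le_iff₀ hnd]
      have h1 : s₀ * n ≤ ε / 4 * d := by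
        calc s₀ * n = ε / 4 * (c * n) := by rw [hs₀]; ring
          _ ≤ _ := by gcongr
      have h2 : 0 ≤ (1 + ε) * (ε / 4) * (d : ℝ) ^ 2 := by positivity
      have h3 : s₀ * n * n ≤ ε / 4 * d * n := by gcongr
      have h4 : 1 * (n : ℝ) ≤ n * s₀ * n := by gcongr
      have h5 : 0 ≤ s₀ * (n - d) := by positivity
      have h6 : 0 ≤ s₀ * n * d := by positivity
      nlinarith only [h1, h2, h3, h4, h5, h6, hd0, hn0]

set_option maxHeartbeats 1000000 in
/-- The complement of a random `d`-regular graph is dominated by a binomial random graph. -/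
theorem dom_lower {ε : ℝ} (hε : 0 < ε) (hε1 : ε ≤ 1 / 2) :
    ∃ C > 0, ∀ᶠ n : ℕ in Filter.atTop, ∀ d k : ℕ, d + k + 1 = n → C * Real.log n ≤ d →
      Even (n * k) → Dom (err n) (unif (regs n k)) (gnp (1 - (1 - ε) * d / n)) := by
  obtain ⟨C, hC, dense⟩ := good_dense_eventually (e := ε / 40) (s₀ := ε / 4) (by linarith)
    (by linarith) (by linarith)
  have small := good_small_eventually (s₀ := ε / 4) (c := ε ^ 2 / 32) (by linarith)
    (by nlinarith only [hε, hε1]) (by positivity)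
  set c : ℝ := min (ε ^ 2 / 32) (ε / 40 / 6) with hc
  have hc0 : 0 < c := lt_min (by positivity) (by positivity)
  have hc1 : c ≤ 1 := (min_le_right _ _).trans (by linarith)
  have mid := good_mid_eventually (e := ε / 40) (s₀ := ε / 4) (by linarith) (by linarith)
    (by linarith) (by linarith) hc0 hc1
  refine ⟨C, hC, ?_⟩
  have q1 : 0 < 4 / ε := by positivity
  filter_upwards [eventually_log_pow_le (4 / ε + 2) (by positivity), small, mid, dense]
    with n hn hsm hmid hdense d k hdk hd hpar
  obtain ⟨-, hℓ1, hKn⟩ := hn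
  have hn2 : (2 : ℝ) ≤ n := by linarith
  have hn0 : (0 : ℝ) < n := by linarith
  have hn2' : 2 ≤ n := by exact_mod_cast hn2
  have hne := regs_nonempty (n := n) (k := k) (by omega) hpar
  have hnε : 4 ≤ n * ε := by
    have : 4 / ε ≤ n := by linarith
    rwa [div_le_iff₀ hε] at this
  have hℓ0 : 0 < Real.log n := by linarith
  have hdk' : (d : ℝ) + k + 1 = n := by exact_mod_cast hdk
  have hd0 : (0 : ℝ) < d := lt_of_lt_of_le (by positivity) hd
  have hk0 : (0 : ℝ) ≤ k := Nat.cast_nonneg k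
  have hq0 : 0 ≤ (1 - ε) * d / n := div_nonneg (mul_nonneg (by linarith) hd0.le) hn0.le
  have hqn : (1 - ε) * d / n ≤ 1 := by
    rw [div_le_one hn0]
    have : 0 < ε * d := by positivity
    linarith
  have hs1n : 1 / (n : ℝ) ≤ ε / 4 := by rw [div_le_iff₀ hn0]; linarith
  have key : ∀ r : ℝ, 0 ≤ r → (∀ s, ε / 4 ≤ s → s ≤ 1 → Good n k s r) →
      (1 - ε) * (d * (1 + r)) ≤ (1 - ε / 4) * (n - 1) →
      Dom (err n) (unif (regs n k)) (gnp (1 - (1 - ε) * d / n)) := fun r hr hG h => by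
    refine dom_reg hn2' hne hr hs1n (by linarith) hG (by linarith) (le_trans (le_of_eq ?_) h)
    field_simp
    ring
  have hfac : (1 - ε) * (1 + ε / 4) ≤ 1 - ε / 4 := by nlinarith only [hε, sq_nonneg ε]
  have hmul : ∀ y : ℝ, y ≤ (1 + ε / 4) * (n - 1) → (1 - ε) * y ≤ (1 - ε / 4) * (n - 1) :=
    fun y hy => by
      calc _ ≤ (1 - ε) * ((1 + ε / 4) * (n - 1)) := mul_le_mul_of_nonneg_left hy (by linarith)
        _ = (1 - ε) * (1 + ε / 4) * (n - 1) := by ring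
        _ ≤ _ := mul_le_mul_of_nonneg_right hfac (by linarith)
  rcases Nat.eq_zero_or_pos k with rfl | hkpos
  · refine (Dom.of_forall_subset (unif_nonneg _) (gnp_nonneg (by linarith) (by linarith))
      (sum_unif hne) (sum_gnp _) fun F H hF _ => ?_).mono (err_nonneg n)
    have hF' : F ∈ regs n 0 := by
      by_contra hcon
      exact hF (by simp [unif, hcon])
    have h0 := card_of_mem_regs hF'
    simp only [mul_zero, Nat.zero_div, Finset.card_eq_zero] at h0
    rw [h0]
    exact Finset.empty_subset _
  rcases le_total (k : ℝ) (ε ^ 2 / 32 * n) with hkc | hkc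
  · refine key (2 * (ε ^ 2 / 32) / (ε / 4)) (by positivity) (hsm k hkpos hkc) (hmul _ ?_)
    rw [show 2 * (ε ^ 2 / 32) / (ε / 4) = ε / 4 by field_simp; norm_num, mul_comm]
    exact mul_le_mul_of_nonneg_left (by linarith) (by linarith)
  rcases le_total (d : ℝ) (ε / 40 / 6 * n) with hdc | hdc
  · have e : (n : ℝ) - 1 - k = d := by linarith
    have hG := hdense k (by rwa [e]) (by rwa [e])
    rw [e] at hG
    refine key ((1 + 10 * (ε / 40)) * (n / d)) (by positivity) hG ?_
    have e2 : d * (1 + (1 + 10 * (ε / 40)) * (n / d)) = d + (1 + ε / 4) * n := by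
      field_simp
      ring
    rw [e2]
    have h1 : (1 - ε) * (d + (1 + ε / 4) * n) ≤ (1 - ε) * ((1 + ε / 4 + ε / 240) * n) :=
      mul_le_mul_of_nonneg_left (by linarith) (by linarith)
    have h2 : 0 ≤ ε ^ 2 * n := by positivity
    nlinarith only [h1, h2, hnε, hε]
  · have hcn : c * n ≤ k := le_trans (by gcongr; exact min_le_left _ _) hkc
    have hcn' : c * n ≤ n - 1 - k := by
      have : c * n ≤ ε / 40 / 6 * n := by gcongr; exact min_le_right _ _
      linarith
    have hnk : (n : ℝ) - k = d + 1 := by linarith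
    have hG := hmid k hcn hcn' hpar
    rw [hnk] at hG
    refine key ((1 + 10 * (ε / 40)) * (k / (d + 1))) (by positivity) hG (hmul _ ?_)
    have h1 : (d : ℝ) / (d + 1) ≤ 1 := by rw [div_le_one (by positivity)]; linarith
    calc (d : ℝ) * (1 + (1 + 10 * (ε / 40)) * (k / (d + 1)))
        = d + (1 + ε / 4) * k * (d / (d + 1)) := by ring
      _ ≤ d + (1 + ε / 4) * k * 1 := by gcongr
      _ ≤ (1 + ε / 4) * (n - 1) := by
        have : 0 ≤ ε / 4 * d := by positivity
        rw [show (n : ℝ) - 1 = d + k by linarith]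
        linarith

end Domination

section Assembly

lemma Dom.compl {α : Type*} [Fintype α] [DecidableEq α] {δ : ℝ} {μ ν : Finset α → ℝ}
    (h : Dom δ μ ν) : Dom δ (fun F => ν Fᶜ) (fun F => μ Fᶜ) := by
  obtain ⟨J, h0, h1, h2, h3⟩ := h
  have sc : ∀ f : Finset α → ℝ, ∑ F, f Fᶜ = ∑ F, f F := fun f =>
    Equiv.sum_comp (Function.Involutive.toPerm _ (compl_involutive (α := Finset α))) f
  refine ⟨fun F H => J Hᶜ Fᶜ, fun F H => h0 _ _, fun F => ?_, fun H => ?_, ?_⟩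
  · exact (sc fun H => J H Fᶜ).trans (h2 _)
  · exact (sc fun F => J Hᶜ F).trans (h1 _)
  · refine le_trans (le_of_eq ?_) h3
    rw [Finset.sum_comm, ← sc]
    refine Finset.sum_congr rfl fun F _ => ?_
    rw [← sc]
    refine Finset.sum_congr rfl fun H _ => ?_
    simp only [Finset.compl_subset_compl, compl_compl]

lemma gnp_one_sub_compl {α : Type*} [Fintype α] [DecidableEq α] (p : ℝ) (A : Finset α) :
    gnp (1 - p) Aᶜ = gnp p A := by
  simp only [gnp, thin, Finset.subset_univ, if_true, ← Finset.compl_eq_univ_sdiff, compl_compl,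
    sub_sub_cancel]
  ring

lemma unif_compl {d k : ℕ} (h : d + k + 1 = n) (A : Finset (Edge n)) :
    unif (regs n k) Aᶜ = unif (regs n d) A := by
  have hR : (d : ℝ) + k + 1 = n := by exact_mod_cast h
  have hmem : ∀ B : Finset (Edge n), Bᶜ ∈ regs n k ↔ B ∈ regs n d := fun B => by
    rw [mem_regs, mem_regs]
    refine forall_congr' fun v => ?_
    have hc := dg_compl B v
    rw [← Nat.cast_inj (R := ℝ), ← Nat.cast_inj (R := ℝ), hc]
    constructor <;> intro h' <;> linarith
  have hcard : (regs n k).card = (regs n d).card := by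
    refine Finset.card_bij' (fun B _ => Bᶜ) (fun B _ => Bᶜ) (fun B hB => ?_)
      (fun B hB => (hmem B).2 hB) (fun B _ => compl_compl B) (fun B _ => compl_compl B)
    rw [← hmem, compl_compl]
    exact hB
  unfold unif
  rw [hcard]
  by_cases hA : A ∈ regs n d
  · rw [if_pos hA, if_pos ((hmem A).2 hA)]
  · rw [if_neg hA, if_neg (mt (hmem A).1 hA)]

lemma glue_aux {α : Type*} [Fintype α] {ν : α → ℝ} {J : α → α → ℝ}
    (h0 : ∀ F H, 0 ≤ J F H) (h : ∀ F, ∑ H, J F H = ν F) (F H : α) :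
    ν F / ν F * J F H = J F H := by
  by_cases hF : ν F = 0
  · have := (Finset.sum_eq_zero_iff_of_nonneg fun H _ => h0 F H).1 ((h F).trans hF) H
      (Finset.mem_univ _)
    rw [this, mul_zero]
  · rw [div_self hF, one_mul]

/-- Two couplings with a common marginal can be realised on triples. -/
lemma Dom.glue {α : Type*} [Fintype α] [DecidableEq α] {δ₁ δ₂ : ℝ} {μ ν ξ : Finset α → ℝ}
    (h : Dom δ₁ μ ν) (h' : Dom δ₂ ν ξ) :
    ∃ T : Finset α × Finset α × Finset α → ℝ, (∀ t, 0 ≤ T t) ∧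
      (∀ F, ∑ t, (if F = t.1 then T t else 0) = μ F) ∧
      (∀ F, ∑ t, (if F = t.2.1 then T t else 0) = ν F) ∧
      (∀ F, ∑ t, (if F = t.2.2 then T t else 0) = ξ F) ∧
      ∑ t, (if t.1 ⊆ t.2.1 ∧ t.2.1 ⊆ t.2.2 then 0 else T t) ≤ δ₁ + δ₂ := by
  obtain ⟨J, a0, a1, a2, a3⟩ := h
  obtain ⟨L, b0, b1, b2, b3⟩ := h'
  have hν : ∀ G, 0 ≤ ν G := fun G => by rw [← b1]; exact Finset.sum_nonneg fun H _ => b0 G H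
  set T : Finset α × Finset α × Finset α → ℝ := fun t => J t.1 t.2.1 * L t.2.1 t.2.2 / ν t.2.1
    with hT
  have hT0 : ∀ t, 0 ≤ T t := fun t => div_nonneg (mul_nonneg (a0 _ _) (b0 _ _)) (hν _)
  have s3 : ∀ F G, ∑ H, T (F, G, H) = J F G := fun F G => by
    show ∑ H, J F G * L G H / ν G = J F G
    rw [← Finset.sum_div, ← Finset.mul_sum, b1, mul_div_assoc, mul_comm]
    exact glue_aux (J := fun G F => J F G) (fun _ _ => a0 _ _) a2 G F
  have s1 : ∀ G H, ∑ F, T (F, G, H) = L G H := fun G H => by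
    show ∑ F, J F G * L G H / ν G = L G H
    rw [← Finset.sum_div, ← Finset.sum_mul, a2, mul_div_right_comm]
    exact glue_aux b0 b1 G H
  refine ⟨T, hT0, fun F => ?_, fun G => ?_, fun H => ?_, ?_⟩
  · simp only [Fintype.sum_prod_type]
    rw [Finset.sum_eq_single F (fun b _ hb => by simp [hb.symm]) (by simp)]
    simp only [if_true, s3, a1]
  · simp only [Fintype.sum_prod_type]
    have : ∀ F : Finset α, ∑ G' : Finset α, ∑ H : Finset α, (if G = G' then T (F, G', H) else 0) =
        J F G := fun F => by
      rw [Finset.sum_eq_single G (fun b _ hb => by simp [hb.symm]) (by simp)]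
      simp only [if_true, s3]
    simp only [this, a2]
  · simp only [Fintype.sum_prod_type, Finset.sum_ite_eq, Finset.mem_univ, if_true]
    rw [Finset.sum_comm]
    simp only [s1, b2]
  · have hsplit : ∀ t : Finset α × Finset α × Finset α,
        (if t.1 ⊆ t.2.1 ∧ t.2.1 ⊆ t.2.2 then 0 else T t) ≤
          (if t.1 ⊆ t.2.1 then 0 else T t) + (if t.2.1 ⊆ t.2.2 then 0 else T t) := fun t => by
      have := hT0 t
      by_cases h1 : t.1 ⊆ t.2.1 <;> by_cases h2 : t.2.1 ⊆ t.2.2 <;> simp [h1, h2, this]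
    refine (Finset.sum_le_sum fun t _ => hsplit t).trans ?_
    rw [Finset.sum_add_distrib]
    refine add_le_add (le_trans (le_of_eq ?_) a3) (le_trans (le_of_eq ?_) b3)
    · simp only [Fintype.sum_prod_type]
      refine Finset.sum_congr rfl fun F _ => Finset.sum_congr rfl fun G _ => ?_
      by_cases hFG : F ⊆ G
      · simp [hFG]
      · simp only [hFG, if_false, s3]
    · simp only [Fintype.sum_prod_type]
      rw [Finset.sum_comm]
      refine Finset.sum_congr rfl fun G _ => ?_
      rw [Finset.sum_comm]
      refine Finset.sum_congr rfl fun H _ => ?_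
      by_cases hGH : G ⊆ H
      · simp [hGH]
      · simp only [hGH, if_false, s1]

/-- The graph with a given edge set. -/
def toGraph (A : Finset (Edge n)) : SimpleGraph (Fin n) where
  Adj := adj A
  symm := ⟨fun _ _ h => adj_symm h⟩
  loopless := ⟨fun _ h => adj_irrefl h⟩

lemma toGraph_le {A B : Finset (Edge n)} : toGraph A ≤ toGraph B ↔ A ⊆ B := by
  rw [subset_iff_adj]
  exact ⟨fun h u v huv => h huv, fun h u v huv => h u v huv⟩

lemma toGraph_injective : Function.Injective (toGraph (n := n)) := fun _ _ h =>
  Finset.Subset.antisymm (toGraph_le.1 h.le) (toGraph_le.1 h.ge)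

lemma toGraph_surjective : Function.Surjective (toGraph (n := n)) := fun G => by
  refine ⟨Finset.univ.filter fun e => e.1 ∈ G.edgeSet, ?_⟩
  ext u v
  show adj _ u v ↔ _
  by_cases h : u = v
  · subst h
    simp [adj_irrefl]
  · rw [adj_iff_mem h, Finset.mem_filter]
    exact ⟨fun h => h.2, fun h => ⟨Finset.mem_univ _, h⟩⟩

lemma deg_toGraph (A : Finset (Edge n)) (v : Fin n) : deg (toGraph A) v = dg A v := by
  have : (toGraph A).neighborSet v = (nb A v : Set (Fin n)) := by
    ext u
    rw [Finset.mem_coe, mem_nb]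
    rfl
  rw [deg, this, dg, Nat.card_coe_set_eq, Set.ncard_coe_finset]

lemma isRegularGraph_toGraph {A : Finset (Edge n)} {d : ℕ} :
    IsRegularGraph (toGraph A) d ↔ A ∈ regs n d := by
  simp only [IsRegularGraph, deg_toGraph, mem_regs]

lemma edgeCount_toGraph (A : Finset (Edge n)) : edgeCount (toGraph A) = A.card := by
  have : (toGraph A).edgeSet = (fun e : Edge n => e.1) '' (A : Set (Edge n)) := by
    ext e
    induction e using Sym2.ind with
    | _ u v =>
      rw [SimpleGraph.mem_edgeSet]
      exact Iff.rfl
  have hinj : Function.Injective fun e : Edge n => e.1 := fun _ _ h => Subtype.ext h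
  rw [edgeCount, this]
  exact (Set.ncard_image_of_injective _ hinj).trans (Set.ncard_coe_finset A)

lemma card_edge : Fintype.card (Edge n) = n.choose 2 := by
  have := Sym2.card_subtype_not_diag (α := Fin n)
  rw [Fintype.card_fin] at this
  rw [← this]
  exact Fintype.card_congr (Equiv.refl _)

lemma isGnp_of_forall {μ : PMF (SimpleGraph (Fin n))} {p : ℝ}
    (h : ∀ A : Finset (Edge n), μ (toGraph A) = ENNReal.ofReal (gnp p A)) : IsGnp μ p := fun G => by
  obtain ⟨A, rfl⟩ := toGraph_surjective G
  rw [h, edgeCount_toGraph, gnp, thin, if_pos (Finset.subset_univ _), ← card_edge,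
    ← Finset.compl_eq_univ_sdiff, Finset.card_compl]

lemma isUniformOn_of_forall {μ : PMF (SimpleGraph (Fin n))} {d : ℕ}
    (hne : (regs n d).Nonempty)
    (h : ∀ A : Finset (Edge n), μ (toGraph A) = ENNReal.ofReal (unif (regs n d) A)) :
    IsUniformOn μ {G | IsRegularGraph G d} := fun G => by
  have hS : {G : SimpleGraph (Fin n) | IsRegularGraph G d} = toGraph '' (regs n d : Set _) := by
    ext G
    obtain ⟨A, rfl⟩ := toGraph_surjective G
    rw [toGraph_injective.mem_set_image, Finset.mem_coe, ← isRegularGraph_toGraph]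
    exact Iff.rfl
  rw [hS, Set.ncard_image_of_injective _ toGraph_injective, Set.ncard_coe_finset]
  obtain ⟨A, rfl⟩ := toGraph_surjective G
  rw [h, toGraph_injective.mem_set_image, Finset.mem_coe, unif]
  by_cases hA : A ∈ regs n d
  · have : (0 : ℝ) < (regs n d).card := by exact_mod_cast hne.card_pos
    rw [if_pos hA, if_pos hA, ENNReal.ofReal_inv_of_pos this, ENNReal.ofReal_natCast]
  · rw [if_neg hA, if_neg hA, ENNReal.ofReal_zero]

/-- A coupling of three graph laws from two couplings of laws on edge sets. -/
theorem exists_coupling {d : ℕ} (hne : (regs n d).Nonempty) {p q δ₁ δ₂ : ℝ}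
    (h : Dom δ₁ (gnp p) (unif (regs n d))) (h' : Dom δ₂ (unif (regs n d)) (gnp q)) :
    ∃ μ : PMF (SimpleGraph (Fin n) × SimpleGraph (Fin n) × SimpleGraph (Fin n)),
      IsGnp (μ.map fun t => t.1) p ∧
      IsUniformOn (μ.map fun t => t.2.1) {G | IsRegularGraph G d} ∧
      IsGnp (μ.map fun t => t.2.2) q ∧
      ENNReal.ofReal (1 - (δ₁ + δ₂)) ≤ prEvent μ (fun t => t.1 ≤ t.2.1 ∧ t.2.1 ≤ t.2.2) := by
  obtain ⟨T, hT0, hT1, hT2, hT3, hT4⟩ := h.glue h'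
  have htot : ∑ t, T t = 1 := by
    rw [← sum_unif hne]
    simp only [← hT2]
    rw [Finset.sum_comm]
    simp
  let P : PMF (Finset (Edge n) × Finset (Edge n) × Finset (Edge n)) :=
    PMF.ofFintype (fun t => ENNReal.ofReal (T t)) (by
      rw [← ENNReal.ofReal_sum_of_nonneg fun t _ => hT0 t, htot, ENNReal.ofReal_one])
  have hP : ∀ t, P t = ENNReal.ofReal (T t) := fun t => rfl
  have hmap : ∀ f : Finset (Edge n) × Finset (Edge n) × Finset (Edge n) → Finset (Edge n),
      ∀ A, P.map (fun t => toGraph (f t)) (toGraph A) =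
        ENNReal.ofReal (∑ t, if A = f t then T t else 0) := fun f A => by
    rw [PMF.map_apply, tsum_fintype, ENNReal.ofReal_sum_of_nonneg fun t _ => by
      split_ifs
      exacts [hT0 t, le_rfl]]
    refine Finset.sum_congr rfl fun t _ => ?_
    rw [hP]
    by_cases hA : A = f t
    · simp [hA]
    · simp [hA, toGraph_injective.eq_iff]
  refine ⟨P.map fun t => (toGraph t.1, toGraph t.2.1, toGraph t.2.2), ?_, ?_, ?_, ?_⟩
  · rw [PMF.map_comp]
    exact isGnp_of_forall fun A => (hmap (fun t => t.1) A).trans (by rw [hT1])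
  · rw [PMF.map_comp]
    exact isUniformOn_of_forall hne fun A => (hmap (fun t => t.2.1) A).trans (by rw [hT2])
  · rw [PMF.map_comp]
    exact isGnp_of_forall fun A => (hmap (fun t => t.2.2) A).trans (by rw [hT3])
  · set Q : PMF (SimpleGraph (Fin n) × SimpleGraph (Fin n) × SimpleGraph (Fin n)) :=
      P.map fun t => (toGraph t.1, toGraph t.2.1, toGraph t.2.2)
    have e1 : prEvent Q (fun t => t.1 ≤ t.2.1 ∧ t.2.1 ≤ t.2.2) =
        Q.toOuterMeasure {t | t.1 ≤ t.2.1 ∧ t.2.1 ≤ t.2.2} := by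
      rw [PMF.toOuterMeasure_apply, prEvent]
      refine tsum_congr fun t => ?_
      by_cases ht : t ∈ {t : SimpleGraph (Fin n) × SimpleGraph (Fin n) × SimpleGraph (Fin n) |
          t.1 ≤ t.2.1 ∧ t.2.1 ≤ t.2.2}
      · exact (if_pos ht).trans (Set.indicator_of_mem ht _).symm
      · exact (if_neg ht).trans (Set.indicator_of_notMem ht _).symm
    rw [e1, PMF.toOuterMeasure_map_apply, PMF.toOuterMeasure_apply_fintype]
    have e2 : ∀ t, Set.indicator ((fun t : Finset (Edge n) × Finset (Edge n) × Finset (Edge n) =>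
        (toGraph t.1, toGraph t.2.1, toGraph t.2.2)) ⁻¹'
          {t | t.1 ≤ t.2.1 ∧ t.2.1 ≤ t.2.2}) P t =
        ENNReal.ofReal (T t - if t.1 ⊆ t.2.1 ∧ t.2.1 ⊆ t.2.2 then 0 else T t) := fun t => by
      simp only [Set.indicator_apply, Set.mem_preimage, Set.mem_ofPred_eq, toGraph_le, hP]
      by_cases ht : t.1 ⊆ t.2.1 ∧ t.2.1 ⊆ t.2.2
      · simp [ht]
      · simp only [ht, if_false, sub_self, ENNReal.ofReal_zero]
    simp only [e2]
    rw [← ENNReal.ofReal_sum_of_nonneg fun t _ => by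
      split_ifs
      · simpa using hT0 t
      · simp]
    refine ENNReal.ofReal_le_ofReal ?_
    rw [Finset.sum_sub_distrib, htot]
    linarith

lemma eventually_err_le {δ : ℝ} (hδ : 0 < δ) : ∀ᶠ n : ℕ in Filter.atTop, err n ≤ δ := by
  filter_upwards [eventually_log_pow_le (3 / δ) (by positivity)] with n hn
  obtain ⟨h1, hℓ, hK⟩ := hn
  have hn0 : (0 : ℝ) < n := lt_of_lt_of_le (by positivity) hK
  rw [div_mul_eq_mul_div, div_le_iff₀ hδ] at h1
  have h2 : (1 : ℝ) ≤ Real.log n ^ 3 := one_le_pow₀ hℓ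
  have h3 : Real.log n ^ 2 ≤ Real.log n ^ 3 := pow_le_pow_right₀ hℓ (by norm_num)
  rw [err, ← add_div, div_le_iff₀ hn0]
  linarith

end Assembly

/-- **Theorem 1.1 (the sandwich conjecture).** For every `ε > 0` there is `C > 0` such that
for every `δ > 0`, for all sufficiently large `n` and every `d` with `C·log n ≤ d ≤ n−1` and
`dn` even, there is a coupling `μ` of `(G₁, G₂, G₃)` whose marginals are `G(n,(1−ε)d/n)`,
the uniform distribution on `𝒦_d(n)`, and `G(n,(1+ε)d/n)`, with
`μ(G₁ ⊆ G₂ ⊆ G₃) ≥ 1 − δ`. -/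
theorem sandwich_conjecture :
    ∀ ε : ℝ, 0 < ε →
      ∃ C : ℝ, 0 < C ∧
        ∀ δ : ℝ, 0 < δ →
          ∃ n₀ : ℕ, ∀ n : ℕ, n₀ ≤ n →
            ∀ d : ℕ, C * Real.log n ≤ (d : ℝ) → d ≤ n - 1 → Even (d * n) →
              ∃ μ : PMF (SimpleGraph (Fin n) × SimpleGraph (Fin n) × SimpleGraph (Fin n)),
                IsGnpLaw (μ.map fun t => t.1) ((1 - ε) * d / n) ∧
                IsUniformOn (μ.map fun t => t.2.1) {G | IsRegularGraph G d} ∧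
                IsGnpLaw (μ.map fun t => t.2.2) ((1 + ε) * d / n) ∧
                ENNReal.ofReal (1 - δ) ≤
                  prEvent μ (fun t => t.1 ≤ t.2.1 ∧ t.2.1 ≤ t.2.2) := by
  intro ε hε
  set ε' : ℝ := min ε (1 / 2) with hε'
  have hε'0 : 0 < ε' := lt_min hε (by norm_num)
  have hε'1 : ε' ≤ 1 / 2 := min_le_right _ _
  have hε'ε : ε' ≤ ε := min_le_left _ _
  obtain ⟨C₁, hC₁, upper⟩ := dom_upper hε'0 hε'1
  obtain ⟨C₂, hC₂, lower⟩ := dom_lower hε'0 hε'1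
  refine ⟨C₁ + C₂, by positivity, fun δ hδ => ?_⟩
  have hall := (upper.and lower).and ((eventually_err_le (half_pos hδ)).and
    (Filter.eventually_ge_atTop 1))
  obtain ⟨n₀, hn₀⟩ := Filter.eventually_atTop.1 hall
  refine ⟨n₀, fun n hn d hd hdn hpar => ?_⟩
  obtain ⟨⟨hup, hlow⟩, herr, hn1⟩ := hn₀ n hn
  have hn0 : (0 : ℝ) < n := by exact_mod_cast hn1
  have hℓ : 0 ≤ Real.log n := Real.log_natCast_nonneg n
  rw [add_mul] at hd
  have hd1 : C₁ * Real.log n ≤ d := by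
    have := mul_nonneg hC₂.le hℓ
    linarith
  have hd2 : C₂ * Real.log n ≤ d := by
    have := mul_nonneg hC₁.le hℓ
    linarith
  have hdk : d + (n - 1 - d) + 1 = n := by omega
  have hpar' : Even (n * d) := by rwa [mul_comm]
  have hpark : Even (n * (n - 1 - d)) := by
    have h1 : n * (n - 1 - d) + n * d = n * (n - 1) := by
      rw [← mul_add]
      congr 1
      omega
    have h2 : Even (n * (n - 1)) := Nat.even_mul_pred_self n
    rw [← h1, Nat.even_add] at h2
    exact h2.2 hpar'
  have hdn' : (d : ℝ) ≤ n := by exact_mod_cast (by omega : d ≤ n)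
  have hx0 : 0 ≤ (d : ℝ) / n := by positivity
  have hx1 : (d : ℝ) / n ≤ 1 := (div_le_one hn0).2 hdn'
  have U := hup d hd1 (by omega) hpar'
  have L := (hlow d _ hdk hd2 hpark).compl
  simp only [gnp_one_sub_compl, unif_compl hdk] at L
  simp only [mul_div_assoc] at U L ⊢
  have U' := U.trans (Dom.gnp_mono (q' := max 0 (min ((1 + ε) * (d / n)) 1))
    (le_min (by positivity) zero_le_one)
    (le_max_of_le_right (min_le_min_right _ (by gcongr)))
    (max_le zero_le_one (min_le_right _ _)))
  have L' := (Dom.gnp_mono (q := max 0 (min ((1 - ε) * (d / n)) 1)) (le_max_left _ _)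
    (max_le (mul_nonneg (by linarith) hx0) ((min_le_left _ _).trans (by gcongr)))
    (mul_le_one₀ (by linarith) hx0 hx1)).trans L
  obtain ⟨μ, h1, h2, h3, h4⟩ :=
    exists_coupling (regs_nonempty (n := n) (k := d) (by omega) hpar') L' U'
  exact ⟨μ, h1, h2, h3, (ENNReal.ofReal_le_ofReal (by linarith)).trans h4⟩

end Sandwich
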